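/- Let S be an excellent regular strictly henselian local scheme with closed point s, U ⊆ S a dense open subscheme, and X → S a semistable morphism smooth over U. If X/S is not aligned at s, then for every non-degenerate trait φ: T → S through s there exists a Cartier divisor D on X_T := X ×_S T, trivial over the generic point of T, such that no Cartier divisor E on X that is trivial over U has φ*E linearly equivalent to D. -/

import Mathlib

/-!
Common infrastructure for formalizing "Néron models of jacobians over base schemes of
dimension greater than 1" (semistable morphisms, strata, dual graphs, alignment,
specialisation maps, Cartier/Weil divisors, Picard data, Néron models).

Notes on design choices (Mathlib has no algebraic spaces, no Picard functor, no strict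
henselisation and no excellent rings):
* Algebraic spaces are replaced by schemes throughout.
* The label of a point of a semistable morphism over a strictly henselian local base is
  taken in the local ring itself (which agrees with the strict henselisation there), and
  alignment over a general base is defined via base change to arbitrary strictly
  henselian Noetherian local test rings (which is equivalent to the definition via
  geometric points, since the strict henselisations are among such test rings).
* Excellence of the base is beyond current Mathlib and is omitted from hypotheses.
-/

open AlgebraicGeometry CategoryTheory CategoryTheory.Limits

universe u

noncomputable section

namespace NeronSemistable

/-! ### Local properties of morphisms of schemes -/

/-- `f` is smooth at the point `x` if it is smooth on an open neighbourhood of `x`. -/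
def SmoothAtPt {X S : Scheme.{u}} (f : X ⟶ S) (x : X) : Prop :=
  ∃ U : X.Opens, x ∈ U ∧ IsSmooth (U.ι ≫ f)

/-- `f` is étale at the point `x` if it is étale on an open neighbourhood of `x`. -/
def EtaleAtPt {X S : Scheme.{u}} (f : X ⟶ S) (x : X) : Prop :=
  ∃ U : X.Opens, x ∈ U ∧ IsEtale (U.ι ≫ f)

/-- `f` is flat at `x` if the induced map of stalks is flat. -/
def FlatAtPt {X S : Scheme.{u}} (f : X ⟶ S) (x : X) : Prop :=
  letI := (f.stalkMap x).hom.toAlgebra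
  Module.Flat (S.presheaf.stalk (f.base x)) (X.presheaf.stalk x)

/-- A morphism of schemes is flat if it is flat at every point. -/
def SchemeFlat {X S : Scheme.{u}} (f : X ⟶ S) : Prop := ∀ x : X, FlatAtPt f x

/-- The non-smooth locus of a morphism, as a set of points. -/
def NonSmoothLocus {X S : Scheme.{u}} (f : X ⟶ S) : Set X := {x | ¬ SmoothAtPt f x}

/-! ### Fibres -/

/-- The scheme-theoretic fibre `X_s` of `f : X ⟶ S` over `s ∈ S`. -/
def fiberScheme {X S : Scheme.{u}} (f : X ⟶ S) (s : S) : Scheme.{u} :=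
  pullback f (S.fromSpecResidueField s)

/-- The projection from the fibre `X_s` to `X`. -/
def fiberι {X S : Scheme.{u}} (f : X ⟶ S) (s : S) : fiberScheme f s ⟶ X :=
  pullback.fst f (S.fromSpecResidueField s)

/-- The structure morphism of the fibre `X_s` to the spectrum of the residue field. -/
def fiberRes {X S : Scheme.{u}} (f : X ⟶ S) (s : S) :
    fiberScheme f s ⟶ Spec (S.residueField s) :=
  pullback.snd f (S.fromSpecResidueField s)

/-- `f : X ⟶ S` has geometrically connected fibres. -/
def GeomConnFibers {X S : Scheme.{u}} (f : X ⟶ S) : Prop :=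
  ∀ (K : Type u) [Field K] [IsAlgClosed K] (g : Spec (CommRingCat.of K) ⟶ S),
    ConnectedSpace ↑(pullback f g)

/-- A subset `T` of a scheme `Z` over (the spectrum of) a field object `k` is geometrically
irreducible if its preimage in `Z ×_k K` is irreducible for every field extension `K` of `k`. -/
def GeomIrreducibleOver (k : CommRingCat.{u}) {Z : Scheme.{u}} (g : Z ⟶ Spec k)
    (T : Set Z) : Prop :=
  ∀ (K : Type u) [Field K] (ψ : k ⟶ CommRingCat.of K),
    IsIrreducible ((pullback.fst g (Spec.map ψ)).base ⁻¹' T)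

/-! ### Standard local models `Spec R[x₁,…,xₙ]/(x₁⋯x_l − b)` and semistable morphisms -/

open MvPolynomial in
/-- The ring `R[x₁,…,xₙ]/(x₁⋯x_l − b)`. -/
abbrev stdRing (R : Type u) [CommRing R] (n l : ℕ) (b : R) : Type u :=
  MvPolynomial (Fin n) R ⧸
    Ideal.span {(∏ i : Fin n, if (i : ℕ) < l then X i else 1) - C b}

/-- The standard local model as a scheme. -/
def stdScheme (R : Type u) [CommRing R] (n l : ℕ) (b : R) : Scheme.{u} :=
  Spec (CommRingCat.of (stdRing R n l b))

/-- The structure morphism of the standard local model. -/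
def stdSpec (R : CommRingCat.{u}) (n l : ℕ) (b : R) : stdScheme ↥R n l b ⟶ Spec R :=
  Spec.map (CommRingCat.ofHom (algebraMap ↥R (stdRing ↥R n l b)))

open MvPolynomial in
/-- The class of the coordinate `x_i` in the standard model. -/
def stdCoord (R : Type u) [CommRing R] (n l : ℕ) (b : R) (i : Fin n) : stdRing R n l b :=
  Ideal.Quotient.mk _ (X i)

/-- The data of a commutative diagram exhibiting `f` étale-locally at `x` as a standard
semistable model `Spec R[x₁,…,xₙ]/(x₁⋯x_l − b)`, as in the definition of a semistable
morphism. -/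
structure ChartData {X S : Scheme.{u}} (f : X ⟶ S) (x : X) where
  R : CommRingCat.{u}
  n : ℕ
  l : ℕ
  hln : l ≤ n
  b : ↥R
  etS : Spec R ⟶ S
  etS_etale : IsEtale etS
  s' : ↑(Spec R)
  hs' : etS.base s' = f.base x
  U : Scheme.{u}
  U_conn : ConnectedSpace ↑U
  gX : U ⟶ X
  gX_etale : IsEtale gX
  x' : ↑U
  hx' : gX.base x' = x
  gT : U ⟶ stdScheme ↥R n l b
  gT_etale : IsEtale gT
  comm : gT ≫ stdSpec R n l b ≫ etS = gX ≫ f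

/-- A morphism is semistable if it is proper with geometrically connected fibres and admits
standard semistable charts étale-locally at every point. -/
def IsSemistable {X S : Scheme.{u}} (f : X ⟶ S) : Prop :=
  IsProper f ∧ GeomConnFibers f ∧ ∀ x : X, Nonempty (ChartData f x)

/-! ### Local rings: regularity, strict henselianity -/

/-- The closed point of `Spec R` for a local ring `R` (with the local-ring witness passed
explicitly). -/
def closedPt (R : CommRingCat.{u}) (h : IsLocalRing ↥R) : ↑(Spec R) :=
  (@IsLocalRing.closedPoint ↥R _ h : PrimeSpectrum ↥R)

/-- A commutative ring is strictly henselian local if it is a henselian local ring with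
separably closed residue field. -/
structure StrictlyHenselianLocal (A : Type u) [CommRing A] : Prop where
  toIsLocalRing : IsLocalRing A
  henselian : HenselianLocalRing A
  sepClosedResidue : @IsSepClosed (@IsLocalRing.ResidueField A _ toIsLocalRing)
      (@IsLocalRing.ResidueField.field A _ toIsLocalRing)

/-- A Noetherian local ring is regular if its maximal ideal is generated by
`dim R` many elements. -/
def IsRegularLocal (A : Type u) [CommRing A] : Prop :=
  IsNoetherianRing A ∧ ∃ (h : IsLocalRing A) (s : Finset A),
    Ideal.span (s : Set A) = @IsLocalRing.maximalIdeal A _ h ∧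
    (s.card : WithBot (WithTop ℕ)) = ringKrullDim A

/-- A scheme is regular if all its local rings are regular (and it is locally Noetherian). -/
def IsRegularScheme (X : Scheme.{u}) : Prop :=
  IsLocallyNoetherian X ∧ ∀ x : X, IsRegularLocal ↥(X.presheaf.stalk x)

/-! ### Labels of points of semistable morphisms over a local base -/

/-- Over an affine base `Spec R`, the point `x` (of the non-smooth locus of its fibre) has
label `(b)`, `b ∈ R`, if there is a local chart
`U ⟶ Spec R[x₁,…,xₙ]/(x₁⋯x_l − b)` at `x` (with the coordinates `x₁,…,x_l` contained in
the prime ideal of the image of `x`).  Over a strictly henselian local ring this agrees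
with the usual label in the strict henselisation. -/
def HasLabel {R : CommRingCat.{u}} {X : Scheme.{u}} (f : X ⟶ Spec R) (x : X) (b : ↥R) :
    Prop :=
  ∃ (n l : ℕ), l ≤ n ∧
    ∃ (U : Scheme.{u}) (gX : U ⟶ X) (x' : ↑U) (gT : U ⟶ stdScheme ↥R n l b),
      IsEtale gX ∧ IsEtale gT ∧ gX.base x' = x ∧
      gT ≫ stdSpec R n l b = gX ≫ f ∧
      ∀ i : Fin n, (i : ℕ) < l → stdCoord ↥R n l b i ∈ (gT.base x').asIdeal

/-! ### Reduced closed subschemes and strata of fibres -/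

/-- A realisation of the closed subset `C ⊆ X` as a reduced closed subscheme of `X`
(such a realisation always exists and is unique up to unique isomorphism). -/
structure ReducedClosedSubscheme (X : Scheme.{u}) (C : Set X) where
  Z : Scheme.{u}
  ι : Z ⟶ X
  isClosedImmersion : IsClosedImmersion ι
  reduced : IsReduced Z
  range : Set.range ι.base = C

/-- `Sing` is the sequence of iterated non-smooth loci of a scheme `Z` over a field object
`k`: `Sing 0 = Z`, and `Sing (r+1)` is the non-smooth locus over `k` of `Sing r` endowed
with its reduced induced closed subscheme structure. -/
def IsSingSeq {k : CommRingCat.{u}} {Z : Scheme.{u}} (g : Z ⟶ Spec k)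
    (Sing : ℕ → Set Z) : Prop :=
  Sing 0 = Set.univ ∧
  ∀ r : ℕ, ∃ W : ReducedClosedSubscheme Z (Sing r),
    Sing (r + 1) = W.ι.base '' {z | ¬ SmoothAtPt (W.ι ≫ g) z}

/-- `T` is an `r`-stratum of the scheme `Z` over the field object `k`: an irreducible
component of the smooth locus of the `r`-th iterated non-smooth locus of `Z` over `k`. -/
def IsStratum {k : CommRingCat.{u}} {Z : Scheme.{u}} (g : Z ⟶ Spec k) (r : ℕ)
    (T : Set Z) : Prop :=
  ∃ Sing : ℕ → Set Z, IsSingSeq g Sing ∧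
    ∃ W : ReducedClosedSubscheme Z (Sing r),
      ∃ T' ∈ irreducibleComponents {z : W.Z // SmoothAtPt (W.ι ≫ g) z},
        T = W.ι.base '' (Subtype.val '' T')

/-! ### Dual graphs, cycles and alignment over a local base -/

/-- The (1-)stratum `T` of the closed fibre of `f` has label `b` (i.e. some — equivalently,
by constancy of labels, any — point of it has label `b`). -/
def StratumHasLabel {R : CommRingCat.{u}} {X : Scheme.{u}} (f : X ⟶ Spec R)
    (s : ↑(Spec R)) (T : Set (fiberScheme f s)) (b : ↥R) : Prop :=
  ∃ z ∈ T, HasLabel f ((fiberι f s).base z) b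

/-- A cycle in the dual graph of the fibre of `f : X ⟶ Spec R` over the point `s`:
a cyclic sequence of pairwise distinct vertices (irreducible components of the fibre)
joined by pairwise distinct edges (1-strata, each contained in exactly the two
neighbouring components). -/
structure GraphCycle {R : CommRingCat.{u}} {X : Scheme.{u}} (f : X ⟶ Spec R)
    (s : ↑(Spec R)) where
  N : ℕ
  hN : 0 < N
  v : Fin N → Set (fiberScheme f s)
  hv : ∀ i, v i ∈ irreducibleComponents ↑(fiberScheme f s)
  v_inj : Function.Injective v
  T : Fin N → Set (fiberScheme f s)
  hT : ∀ i, IsStratum (fiberRes f s) 1 (T i)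
  T_inj : Function.Injective T
  incident : ∀ i : Fin N,
    {c ∈ irreducibleComponents ↑(fiberScheme f s) | T i ⊆ c} =
      {v i, v (⟨((i : ℕ) + 1) % N, Nat.mod_lt _ hN⟩ : Fin N)}

/-- `f : X ⟶ Spec R` (for `R` local) is aligned at the closed point: for any cycle in the
dual graph of the closed fibre, the labels of any two of its edges admit equal positive
powers (as ideals of `R`). -/
def AlignedOver {R : CommRingCat.{u}} (hR : IsLocalRing ↥R) {X : Scheme.{u}}
    (f : X ⟶ Spec R) : Prop :=
  ∀ (c : GraphCycle f (closedPt R hR)) (i j : Fin c.N) (bi bj : ↥R),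
    StratumHasLabel f (closedPt R hR) (c.T i) bi →
    StratumHasLabel f (closedPt R hR) (c.T j) bj →
    ∃ n m : ℕ, 0 < n ∧ 0 < m ∧ Ideal.span {bi} ^ n = Ideal.span {bj} ^ m

/-- `f : X ⟶ S` is aligned (at every geometric point): the base change of `f` to any
Noetherian strictly henselian local test ring over `S` is aligned at the closed point.
(Taking the test ring to be a strict henselisation of a local ring of `S` recovers the
notion of alignment at a geometric point of `S`.) -/
def IsAligned {X S : Scheme.{u}} (f : X ⟶ S) : Prop :=
  ∀ (A : CommRingCat.{u}), IsNoetherianRing ↥A →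
    ∀ (h : StrictlyHenselianLocal ↥A) (g : Spec A ⟶ S),
      AlignedOver h.toIsLocalRing (pullback.snd f g)

/-! ### The specialisation relation on irreducible components of fibres -/

/-- The irreducible component `Z` of the fibre `X_s` specialises (under `sp_{s→η}`) to the
irreducible component `Y` of `X_η`, i.e. `Z` is contained in the fibre over `s` of the
closure of `Y` in `X`. -/
def spRel {X S : Scheme.{u}} (f : X ⟶ S) (s η : S)
    (Z : Set (fiberScheme f s)) (Y : Set (fiberScheme f η)) : Prop :=
  (fiberι f s).base '' Z ⊆ closure ((fiberι f η).base '' Y)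

/-- `C` is a connected component of the subset `A` of a topological space. -/
def IsConnCompOf {α : Type u} [TopologicalSpace α] (A C : Set α) : Prop :=
  ∃ x : ↥A, C = Subtype.val '' connectedComponent x
/-! ### Orders of vanishing, Weil divisors and Cartier divisors -/

/-- `a` has order (length of `A/(a)` as an `A`-module, computed as the Krull dimension of
the lattice of submodules) equal to `m`. -/
def elemOrd (A : Type u) [CommRing A] (a : A) (m : ℕ) : Prop :=
  Order.krullDim (Submodule A (A ⧸ Ideal.span {a})) = (m : ℕ∞)

/-- The order of vanishing of `a ∈ R` at the point `p` of `Spec R` is `k`. -/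
def IsLocOrd {R : Type u} [CommRing R] (a : R) (p : PrimeSpectrum R) (k : ℕ) : Prop :=
  elemOrd (Localization (@Ideal.primeCompl R _ p.asIdeal p.2))
    (algebraMap R (Localization (@Ideal.primeCompl R _ p.asIdeal p.2)) a) k

/-- `z` is a divisorial point of `X`: its local ring has Krull dimension 1, i.e. the
closure of `z` is a prime divisor on `X`. -/
def IsDivisorialPt (X : Scheme.{u}) (z : X) : Prop :=
  ringKrullDim ↥(X.presheaf.stalk z) = 1

/-- The order of vanishing at `z ∈ V` of the section `h ∈ Γ(X, V)` is `m`. -/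
def germOrd {X : Scheme.{u}} (V : X.Opens) (h : Γ(X, V)) (z : X) (hz : z ∈ V)
    (m : ℕ) : Prop :=
  elemOrd ↥(X.presheaf.stalk z) (X.presheaf.germ V z hz h) m

/-- A Weil divisor on `X` is recorded as a coefficient function on points of `X`; only its
values at divisorial points are relevant. `CutsOn D V h₁ h₂` says that on the open set `V`
the divisor `D` is cut out by the pair of nonzerodivisors `(h₁, h₂)` (i.e. `D` equals
`div h₁ − div h₂` on `V`). -/
def CutsOn {X : Scheme.{u}} (D : X → ℤ) (V : X.Opens) (h₁ h₂ : Γ(X, V)) : Prop :=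
  h₁ ∈ nonZeroDivisors Γ(X, V) ∧ h₂ ∈ nonZeroDivisors Γ(X, V) ∧
  ∀ z (hz : z ∈ V), IsDivisorialPt X z →
    ∀ m₁ m₂ : ℕ, germOrd V h₁ z hz m₁ → germOrd V h₂ z hz m₂ →
      D z = (m₁ : ℤ) - (m₂ : ℤ)

/-- The Weil divisor `D` is a Cartier divisor: it is cut out locally by ratios of
nonzerodivisor sections. -/
def IsCartierDiv {X : Scheme.{u}} (D : X → ℤ) : Prop :=
  ∀ x : X, ∃ V : X.Opens, x ∈ V ∧ ∃ h₁ h₂ : Γ(X, V), CutsOn D V h₁ h₂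

/-- `D'` is the pullback along `p : W ⟶ X` of the Cartier divisor `D` on `X`: at every
divisorial point of `W`, the coefficient of `D'` is computed by pulling back local
equations of `D`. -/
def IsDivPullback {W X : Scheme.{u}} (p : W ⟶ X) (D : X → ℤ) (D' : W → ℤ) : Prop :=
  ∀ w : W, IsDivisorialPt W w →
    ∀ (V : X.Opens) (hw : p.base w ∈ V) (h₁ h₂ : Γ(X, V)), CutsOn D V h₁ h₂ →
      ∀ m₁ m₂ : ℕ, germOrd (p ⁻¹ᵁ V) (p.app V h₁) w hw m₁ →
        germOrd (p ⁻¹ᵁ V) (p.app V h₂) w hw m₂ →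
          D' w = (m₁ : ℤ) - (m₂ : ℤ)

/-- Two Weil divisors on `X` are linearly equivalent if their difference is the divisor of
a global ratio of nonzerodivisor sections. -/
def LinEquivDiv {X : Scheme.{u}} (D D' : X → ℤ) : Prop :=
  ∃ h₁ h₂ : Γ(X, ⊤), h₁ ∈ nonZeroDivisors Γ(X, ⊤) ∧ h₂ ∈ nonZeroDivisors Γ(X, ⊤) ∧
    ∀ z : X, IsDivisorialPt X z →
      ∀ m₁ m₂ : ℕ, germOrd ⊤ h₁ z trivial m₁ → germOrd ⊤ h₂ z trivial m₂ →
        D z - D' z = (m₁ : ℤ) - (m₂ : ℤ)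

/-! ### Group schemes over a base (group objects via generalized points) -/

/-- A group scheme over `S`: a scheme `G/S` together with multiplication, unit and
inverse morphisms satisfying the group axioms (expressed on generalized points). -/
structure GroupSchemeOver (S : Scheme.{u}) where
  G : Scheme.{u}
  π : G ⟶ S
  e : S ⟶ G
  e_sec : e ≫ π = 𝟙 S
  mul : pullback π π ⟶ G
  mul_over : mul ≫ π = pullback.fst π π ≫ π
  inv : G ⟶ G
  inv_over : inv ≫ π = π
  mul_assoc' : ∀ {T : Scheme.{u}} (a b c : T ⟶ G) (hab : a ≫ π = b ≫ π)
    (hbc : b ≫ π = c ≫ π)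
    (h₁ : (pullback.lift a b hab ≫ mul) ≫ π = c ≫ π)
    (h₂ : a ≫ π = (pullback.lift b c hbc ≫ mul) ≫ π),
    pullback.lift (pullback.lift a b hab ≫ mul) c h₁ ≫ mul =
      pullback.lift a (pullback.lift b c hbc ≫ mul) h₂ ≫ mul
  one_mul' : ∀ {T : Scheme.{u}} (a : T ⟶ G) (h : (a ≫ π ≫ e) ≫ π = a ≫ π),
    pullback.lift (a ≫ π ≫ e) a h ≫ mul = a
  mul_one' : ∀ {T : Scheme.{u}} (a : T ⟶ G) (h : a ≫ π = (a ≫ π ≫ e) ≫ π),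
    pullback.lift a (a ≫ π ≫ e) h ≫ mul = a
  inv_mul' : ∀ {T : Scheme.{u}} (a : T ⟶ G) (h : (a ≫ inv) ≫ π = a ≫ π),
    pullback.lift (a ≫ inv) a h ≫ mul = a ≫ π ≫ e
/-! ### Line bundles via Čech gluing data, and the relative Picard scheme -/

/-- A line bundle on a scheme `Y`, presented by Čech gluing data: an open cover together
with unit transition functions satisfying the cocycle condition. -/
structure GluingData (Y : Scheme.{u}) where
  I : Type u
  U : I → Y.Opens
  covers : iSup U = ⊤
  t : ∀ i j : I, Γ(Y, U i ⊓ U j)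
  t_isUnit : ∀ i j, IsUnit (t i j)
  cocycle : ∀ i j k : I,
    (Y.presheaf.map (homOfLE (inf_le_left : (U i ⊓ U j) ⊓ U k ≤ U i ⊓ U j)).op) (t i j) *
    (Y.presheaf.map (homOfLE (le_inf (inf_le_left.trans inf_le_right)
      (inf_le_right : (U i ⊓ U j) ⊓ U k ≤ U k))).op) (t j k) =
    (Y.presheaf.map (homOfLE (le_inf (inf_le_left.trans inf_le_left)
      (inf_le_right : (U i ⊓ U j) ⊓ U k ≤ U k))).op) (t i k)

/-- The trivial line bundle. -/
def trivialGluing (Y : Scheme.{u}) : GluingData Y where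
  I := PUnit
  U := fun _ => ⊤
  covers := by simp
  t := fun _ _ => 1
  t_isUnit := fun _ _ => isUnit_one
  cocycle := by intro i j k; simp

/-- `D'` is the pullback of the gluing data `D` along `φ : Z ⟶ Y`. -/
def IsPullbackGluing {Z Y : Scheme.{u}} (φ : Z ⟶ Y) (D : GluingData Y)
    (D' : GluingData Z) : Prop :=
  ∃ eqv : D.I ≃ D'.I,
    (∀ i, D'.U (eqv i) = φ ⁻¹ᵁ D.U i) ∧
    ∀ (i j : D.I) (hle : D'.U (eqv i) ⊓ D'.U (eqv j) ≤ φ ⁻¹ᵁ (D.U i ⊓ D.U j)),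
      D'.t (eqv i) (eqv j) =
        (Z.presheaf.map (homOfLE hle).op) ((φ.app (D.U i ⊓ D.U j)) (D.t i j))

/-- Two gluing data on `Y` present isomorphic line bundles: on a common refinement their
transition functions differ by a coboundary. -/
def GluingIso {Y : Scheme.{u}} (D₁ D₂ : GluingData Y) : Prop :=
  ∃ (K : Type u) (W : K → Y.Opens) (_ : iSup W = ⊤)
    (r₁ : K → D₁.I) (r₂ : K → D₂.I)
    (_ : ∀ k, W k ≤ D₁.U (r₁ k)) (_ : ∀ k, W k ≤ D₂.U (r₂ k))
    (s : ∀ k, Γ(Y, W k)),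
    (∀ k, IsUnit (s k)) ∧
    ∀ (k k' : K) (hle₁ : W k ⊓ W k' ≤ D₁.U (r₁ k) ⊓ D₁.U (r₁ k'))
      (hle₂ : W k ⊓ W k' ≤ D₂.U (r₂ k) ⊓ D₂.U (r₂ k')),
      (Y.presheaf.map (homOfLE hle₁).op) (D₁.t (r₁ k) (r₁ k')) *
        (Y.presheaf.map (homOfLE (inf_le_right : W k ⊓ W k' ≤ W k')).op) (s k') =
      (Y.presheaf.map (homOfLE (inf_le_left : W k ⊓ W k' ≤ W k)).op) (s k) *
        (Y.presheaf.map (homOfLE hle₂).op) (D₂.t (r₂ k) (r₂ k'))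

/-- `D₃` is (isomorphic to) the tensor product of the line bundles presented by `D₁` and
`D₂`: on a common refinement, its transition functions are the products of those of `D₁`
and `D₂`, up to a coboundary. -/
def TensorIso {Y : Scheme.{u}} (D₁ D₂ D₃ : GluingData Y) : Prop :=
  ∃ (K : Type u) (W : K → Y.Opens) (_ : iSup W = ⊤)
    (r₁ : K → D₁.I) (r₂ : K → D₂.I) (r₃ : K → D₃.I)
    (_ : ∀ k, W k ≤ D₁.U (r₁ k)) (_ : ∀ k, W k ≤ D₂.U (r₂ k))
    (_ : ∀ k, W k ≤ D₃.U (r₃ k)) (s : ∀ k, Γ(Y, W k)),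
    (∀ k, IsUnit (s k)) ∧
    ∀ (k k' : K) (hle₁ : W k ⊓ W k' ≤ D₁.U (r₁ k) ⊓ D₁.U (r₁ k'))
      (hle₂ : W k ⊓ W k' ≤ D₂.U (r₂ k) ⊓ D₂.U (r₂ k'))
      (hle₃ : W k ⊓ W k' ≤ D₃.U (r₃ k) ⊓ D₃.U (r₃ k')),
      (Y.presheaf.map (homOfLE hle₃).op) (D₃.t (r₃ k) (r₃ k')) *
        (Y.presheaf.map (homOfLE (inf_le_right : W k ⊓ W k' ≤ W k')).op) (s k') =
      (Y.presheaf.map (homOfLE (inf_le_left : W k ⊓ W k' ≤ W k)).op) (s k) *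
        ((Y.presheaf.map (homOfLE hle₁).op) (D₁.t (r₁ k) (r₁ k')) *
          (Y.presheaf.map (homOfLE hle₂).op) (D₂.t (r₂ k) (r₂ k')))

/-- An fppf cover: faithfully flat and locally of finite presentation. -/
def IsFppfCover {T' T : Scheme.{u}} (c : T' ⟶ T) : Prop :=
  SchemeFlat c ∧ LocallyOfFinitePresentation c ∧ Function.Surjective c.base

/-- For `g : T ⟶ S` and `c : T' ⟶ T`, the induced morphism `X ×_S T' ⟶ X ×_S T`. -/
def inducedMap {X S T T' : Scheme.{u}} (f : X ⟶ S) (g : T ⟶ S) (c : T' ⟶ T) :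
    pullback f (c ≫ g) ⟶ pullback f g :=
  pullback.map f (c ≫ g) f g (𝟙 X) c (𝟙 S) (by simp) (by simp)

/-- Data exhibiting a group scheme `P/S` as (a scheme representing) the relative Picard
functor `Pic_{X/S}`, i.e. the fppf sheafification of `T ↦ Pic(X ×_S T)`:
a natural assignment `toPic` from line bundles on `X ×_S T` to `T`-points of `P`, which is
compatible with pullback, isomorphism and tensor products, sends the trivial bundle to the
unit section, and is fppf-locally bijective. -/
structure PicardData {X S : Scheme.{u}} (f : X ⟶ S) extends GroupSchemeOver S where
  lfp : LocallyOfFinitePresentation π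
  toPic : ∀ {T : Scheme.{u}} (g : T ⟶ S), GluingData (pullback f g) → (T ⟶ G)
  toPic_over : ∀ {T : Scheme.{u}} (g : T ⟶ S) (D : GluingData (pullback f g)),
    toPic g D ≫ π = g
  toPic_trivial : ∀ {T : Scheme.{u}} (g : T ⟶ S),
    toPic g (trivialGluing _) = g ≫ e
  toPic_pullback : ∀ {T T' : Scheme.{u}} (g : T ⟶ S) (c : T' ⟶ T)
    (D : GluingData (pullback f g)) (D' : GluingData (pullback f (c ≫ g))),
    IsPullbackGluing (inducedMap f g c) D D' → toPic (c ≫ g) D' = c ≫ toPic g D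
  toPic_iso : ∀ {T : Scheme.{u}} (g : T ⟶ S) (D₁ D₂ : GluingData (pullback f g)),
    GluingIso D₁ D₂ → toPic g D₁ = toPic g D₂
  toPic_mul : ∀ {T : Scheme.{u}} (g : T ⟶ S) (D₁ D₂ D₃ : GluingData (pullback f g))
    (_ : TensorIso D₁ D₂ D₃)
    (h : toPic g D₁ ≫ π = toPic g D₂ ≫ π),
    pullback.lift (toPic g D₁) (toPic g D₂) h ≫ mul = toPic g D₃
  locally_surjective : ∀ {T : Scheme.{u}} (g : T ⟶ S) (h : T ⟶ G), h ≫ π = g →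
    ∃ (T' : Scheme.{u}) (c : T' ⟶ T), IsFppfCover c ∧
      ∃ D' : GluingData (pullback f (c ≫ g)), toPic (c ≫ g) D' = c ≫ h
  locally_injective : ∀ {T : Scheme.{u}} (g : T ⟶ S)
    (D₁ D₂ : GluingData (pullback f g)), toPic g D₁ = toPic g D₂ →
    ∃ (T' : Scheme.{u}) (c : T' ⟶ T), IsFppfCover c ∧
      ∃ (D₁' D₂' : GluingData (pullback f (c ≫ g))) (E : GluingData T')
        (E' E₂ : GluingData (pullback f (c ≫ g))),
        IsPullbackGluing (inducedMap f g c) D₁ D₁' ∧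
        IsPullbackGluing (inducedMap f g c) D₂ D₂' ∧
        IsPullbackGluing (pullback.snd f (c ≫ g)) E E' ∧
        TensorIso D₁' E' E₂ ∧ GluingIso E₂ D₂'

/-! ### `Pic⁰`, scheme-theoretic closures and Néron models -/

/-- The fibrewise identity component of a group scheme `P/S` over the open set `U ⊆ S`:
the set of points lying over `U` and belonging to the connected component of the unit
section inside their fibre. -/
def pic0Set {S : Scheme.{u}} (P : GroupSchemeOver S) (U : S.Opens) : Set P.G :=
  {p | P.π.base p ∈ U ∧
    p ∈ connectedComponentIn (P.π.base ⁻¹' {P.π.base p}) (P.e.base (P.π.base p))}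

/-- `(Z, ι)` is the scheme-theoretic closure (scheme-theoretic image) of `g : A ⟶ P`:
the smallest closed subscheme of `P` through which `g` factors. -/
structure IsSchClosure {A P : Scheme.{u}} (g : A ⟶ P) (Z : Scheme.{u}) (ι : Z ⟶ P) :
    Prop where
  isClosedImmersion : IsClosedImmersion ι
  factors : ∃ g' : A ⟶ Z, g' ≫ ι = g
  smallest : ∀ (W : Scheme.{u}) (κ : W ⟶ P), IsClosedImmersion κ →
    (∃ w : A ⟶ W, w ≫ κ = g) → ∃ ρ : Z ⟶ W, ρ ≫ κ = ι

/-- A Néron model over `S` of a smooth "abelian" scheme `A` over the dense open `U ⊆ S`: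
a smooth separated scheme `N/S` with an isomorphism `N ×_S U ≅ A` over `U`, satisfying
the Néron mapping property.  (The paper allows `N` to be an algebraic space; algebraic
spaces are not available in Mathlib, so schemes are used.) -/
structure NeronModelData {S : Scheme.{u}} (U : S.Opens) {A : Scheme.{u}}
    (aU : A ⟶ U.toScheme) where
  N : Scheme.{u}
  ν : N ⟶ S
  smooth : IsSmooth ν
  separated : IsSeparated ν
  isoU : (ν ⁻¹ᵁ U).toScheme ≅ A
  isoU_over : isoU.hom ≫ aU = ν ∣_ U
  mapping : ∀ (T : Scheme.{u}) (t : T ⟶ S), IsSmooth t →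
    ∀ (φU : (t ⁻¹ᵁ U).toScheme ⟶ A), φU ≫ aU = t ∣_ U →
      ∃! φ : T ⟶ N, φ ≫ ν = t ∧
        (t ⁻¹ᵁ U).ι ≫ φ = φU ≫ isoU.inv ≫ (ν ⁻¹ᵁ U).ι

/-! ### Projective morphisms -/

attribute [local instance] MvPolynomial.gradedAlgebra

/-- Projective `n`-space (over `Spec (ULift ℤ)`). -/
def projSpace (n : ℕ) : Scheme.{u} :=
  Proj (MvPolynomial.homogeneousSubmodule (Fin (n + 1)) (ULift.{u} ℤ))

/-- Relative projective `n`-space over `S`. -/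
def projSpaceOver (S : Scheme.{u}) (n : ℕ) : Scheme.{u} :=
  pullback (terminal.from (projSpace.{u} n)) (terminal.from S)

/-- A morphism is projective if it factors as a closed immersion into some relative
projective space over the base. -/
def IsProjectiveMorphism {X S : Scheme.{u}} (f : X ⟶ S) : Prop :=
  ∃ (n : ℕ) (ι : X ⟶ projSpaceOver S n),
    IsClosedImmersion ι ∧ ι ≫ pullback.snd _ _ = f
end NeronSemistable
end

noncomputable section
namespace NeronSemistable

set_option linter.unusedSectionVars false

lemma krull_closed {A : Type*} [CommRing A] [IsLocalRing A] [IsNoetherianRing A] {I J : Ideal A}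
    (hJ : J ≠ ⊤) {a : A} (h : ∀ N : ℕ, a ∈ I ⊔ J ^ N) : a ∈ I := by
  have := Ideal.iInf_pow_smul_eq_bot_of_isLocalRing (R := A) (M := A ⧸ I) J hJ
  rw [← Ideal.Quotient.eq_zero_iff_mem, ← Submodule.mem_bot A, ← this, Submodule.mem_iInf]
  intro N
  obtain ⟨i, hi, j, hj, rfl⟩ := Submodule.mem_sup.mp (h N)
  rw [map_add, Ideal.Quotient.eq_zero_iff_mem.mpr hi, zero_add]
  have : Ideal.Quotient.mk I j = j • (1 : A ⧸ I) := by
    rw [Algebra.smul_def, mul_one]; rfl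
  rw [this]
  exact Submodule.smul_mem_smul hj trivial

section RegularNormal

open IsLocalRing

variable {R : Type*} [CommRing R] [IsLocalRing R] {d : ℕ} (x : Fin d → R)

/-- elements of powers of the span of `x` are values of forms -/
lemma exists_form (hx : Ideal.span (Set.range x) = maximalIdeal R) (n : ℕ) :
    ∀ a ∈ (maximalIdeal R) ^ n,
    ∃ F : MvPolynomial (Fin d) R, F.IsHomogeneous n ∧ MvPolynomial.aeval x F = a := by
  induction n with
  | zero =>
    intro a _
    exact ⟨MvPolynomial.C a, MvPolynomial.isHomogeneous_C _ _, by simp⟩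
  | succ n ih =>
    intro a ha
    rw [pow_succ] at ha
    refine Submodule.mul_induction_on ha ?_ ?_
    · intro p hp q hq
      obtain ⟨F, hF, rfl⟩ := ih p hp
      rw [← hx, Ideal.mem_span_range_iff_exists_fun] at hq
      obtain ⟨c, rfl⟩ := hq
      refine ⟨F * ∑ i, MvPolynomial.C (c i) * MvPolynomial.X i, hF.mul ?_, by simp⟩
      refine MvPolynomial.IsHomogeneous.sum _ _ _ fun i _ => ?_
      simpa using (MvPolynomial.isHomogeneous_C _ (c i)).mul (MvPolynomial.isHomogeneous_X R i)
    · rintro p q ⟨F, hF, rfl⟩ ⟨G, hG, rfl⟩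
      exact ⟨F + G, hF.add hG, by simp⟩

lemma form_mem (hx : Ideal.span (Set.range x) = maximalIdeal R) {n : ℕ}
    {F : MvPolynomial (Fin d) R} (hF : F.IsHomogeneous n) :
    MvPolynomial.aeval x F ∈ (maximalIdeal R) ^ n := by
  rw [MvPolynomial.aeval_eq_eval₂Hom, MvPolynomial.coe_eval₂Hom, MvPolynomial.eval₂_eq]
  refine Ideal.sum_mem _ fun m hm => Ideal.mul_mem_left _ _ ?_
  have h := hF (MvPolynomial.mem_support_iff.mp hm)
  have : n = ∑ i, m i := by
    rw [← h, Finsupp.weight_apply, Finsupp.sum_fintype _ _ (by simp)]; simp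
  have h2 : ∏ i ∈ m.support, x i ^ m i = ∏ i, x i ^ m i :=
    Finset.prod_subset (Finset.subset_univ _) (by
      intro i _ hi; simp at hi; simp [hi])
  rw [h2, this, ← Finset.prod_pow_eq_pow_sum]
  refine Ideal.prod_mem_prod fun i _ => Ideal.pow_mem_pow ?_ _
  rw [← hx]; exact Ideal.subset_span ⟨i, rfl⟩

lemma sup_pow_le_aux {A : Type*} [CommRing A] (J K : Ideal A) (n : ℕ) :
    (J ⊔ K) ^ n ≤ J ⊔ K ^ n := by
  induction n with
  | zero => simp
  | succ n ih =>
    rw [pow_succ, pow_succ]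
    refine (Ideal.mul_mono_left ih).trans ?_
    rw [Ideal.sup_mul, Ideal.mul_sup (K ^ n)]
    have h1 : J * (J ⊔ K) ≤ J ⊔ K ^ n * K := le_trans Ideal.mul_le_left le_sup_left
    have h2 : K ^ n * J ≤ J ⊔ K ^ n * K := le_trans Ideal.mul_le_right le_sup_left
    exact sup_le h1 (sup_le h2 le_sup_right)

/-- homogeneous evaluation at scalar multiples -/
lemma form_eval_smul {A : Type*} [CommRing A] {n : ℕ} {F : MvPolynomial (Fin d) R}
    [Algebra R A] (hF : F.IsHomogeneous n) (c : A) (y : Fin d → A) :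
    MvPolynomial.aeval (fun i => c * y i) F = c ^ n * MvPolynomial.aeval y F := by
  simp only [MvPolynomial.aeval_eq_eval₂Hom, MvPolynomial.coe_eval₂Hom, MvPolynomial.eval₂_eq]
  rw [Finset.mul_sum]
  refine Finset.sum_congr rfl fun m hm => ?_
  have h := hF (MvPolynomial.mem_support_iff.mp hm)
  have : n = ∑ i ∈ m.support, m i := by
    rw [← h, Finsupp.weight_apply, Finsupp.sum]; simp
  simp only [mul_pow, Finset.prod_mul_distrib, Finset.prod_pow_eq_pow_sum, ← this]
  ring

/-- analytic independence of regular parameters -/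
lemma form_map_eq_zero [IsNoetherianRing R] [Infinite (ResidueField R)]
    (hx : Ideal.span (Set.range x) = maximalIdeal R) (hd : ringKrullDim R = d) {n : ℕ}
    {F : MvPolynomial (Fin d) R} (hF : F.IsHomogeneous n)
    (h : MvPolynomial.aeval x F ∈ (maximalIdeal R) ^ (n + 1)) :
    MvPolynomial.map (residue R) F = 0 := by
  by_contra hne
  have hFk : (MvPolynomial.map (residue R) F).IsHomogeneous n := hF.map _
  obtain ⟨a, ha⟩ : ∃ a : Fin d → ResidueField R,
      MvPolynomial.eval a (MvPolynomial.map (residue R) F) ≠ 0 := by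
    by_contra hcon
    push Not at hcon
    exact hne (MvPolynomial.funext (by simpa using hcon))
  choose a' ha' using fun i => residue_surjective (a i)
  have hFa : IsUnit (MvPolynomial.aeval a' F) := by
    rw [← IsLocalRing.notMem_maximalIdeal, ← residue_eq_zero_iff]
    convert ha
    rw [MvPolynomial.eval_map, MvPolynomial.aeval_eq_eval₂Hom, MvPolynomial.coe_eval₂Hom,
      MvPolynomial.hom_eval₂]
    congr 1
    funext i; exact ha' i
  obtain ⟨i0, hi0⟩ : ∃ i0, IsUnit (a' i0) := by
    by_contra hcon
    push Not at hcon
    have hm : ∀ i, a i = 0 := fun i => by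
      rw [← ha', residue_eq_zero_iff]; exact hcon i
    have ha0 : a = 0 := funext hm
    rcases Nat.eq_zero_or_pos n with rfl | hn
    · obtain ⟨c, rfl⟩ : ∃ c, F = MvPolynomial.C c :=
        ⟨_, (MvPolynomial.totalDegree_eq_zero_iff_eq_C.mp (by
          simpa using hF.totalDegree_le))⟩
      simp only [MvPolynomial.aeval_C, zero_add, pow_one] at h
      apply hne
      simp only [MvPolynomial.map_C, MvPolynomial.C_eq_zero]
      rw [residue_eq_zero_iff]; exact h
    · apply ha
      rw [ha0, MvPolynomial.eval_zero]
      rw [MvPolynomial.constantCoeff_eq]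
      by_contra h0
      have := hFk h0
      simp at this; omega
  let y : Fin d → R := fun i => a' i0 * x i - a' i * x i0
  let J : Ideal R := Ideal.span (y '' {i | i ≠ i0})
  have hyJ : ∀ i, y i ∈ J := by
    intro i
    by_cases hi : i = i0
    · subst hi; simp [y, mul_comm]
    · exact Ideal.subset_span ⟨i, hi, rfl⟩
  have hmJ : maximalIdeal R ≤ J ⊔ Ideal.span {x i0} := by
    rw [← hx, Ideal.span_le]
    rintro _ ⟨i, rfl⟩
    have h1 : a' i0 * x i ∈ J ⊔ Ideal.span {x i0} := by
      have : a' i0 * x i = y i + a' i * x i0 := by simp [y]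
      rw [this]
      exact Ideal.add_mem _ (Ideal.mem_sup_left (hyJ i))
        (Ideal.mul_mem_left _ _ (Ideal.mem_sup_right (Ideal.mem_span_singleton_self _)))
    exact (Ideal.unit_mul_mem_iff_mem _ hi0).mp h1
  have hJm : J ≤ maximalIdeal R := by
    rw [Ideal.span_le]
    rintro _ ⟨i, -, rfl⟩
    have hxm : ∀ i, x i ∈ maximalIdeal R := fun i => by
      rw [← hx]; exact Ideal.subset_span ⟨i, rfl⟩
    exact Ideal.sub_mem _ (Ideal.mul_mem_left _ _ (hxm i)) (Ideal.mul_mem_left _ _ (hxm i0))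
  have hpow : x i0 ^ n ∈ J := by
    let π := Ideal.Quotient.mk J
    have e1 : π (a' i0 ^ n * MvPolynomial.aeval x F)
        = π (x i0 ^ n * MvPolynomial.aeval a' F) := by
      rw [← form_eval_smul hF, ← form_eval_smul hF]
      have key : ∀ z : Fin d → R, π (MvPolynomial.aeval z F) =
          MvPolynomial.aeval (fun i => π (z i)) F := by
        intro z
        simp only [MvPolynomial.aeval_eq_eval₂Hom, MvPolynomial.coe_eval₂Hom]
        rw [MvPolynomial.hom_eval₂]; rfl
      rw [key, key]
      congr 2
      funext i
      rw [Ideal.Quotient.eq]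
      simpa [y, mul_comm] using hyJ i
    have h2 : MvPolynomial.aeval x F ∈ J ⊔ Ideal.span {x i0 ^ (n+1)} := by
      have h3 : (maximalIdeal R) ^ (n+1) ≤ J ⊔ Ideal.span {x i0 ^ (n+1)} := by
        refine (Ideal.pow_right_mono hmJ _).trans ?_
        rw [← Ideal.span_singleton_pow]; exact sup_pow_le_aux _ _ _
      exact h3 h
    obtain ⟨j, hj, w, hw, hjw⟩ := Submodule.mem_sup.mp h2
    obtain ⟨r, rfl⟩ := Ideal.mem_span_singleton'.mp hw
    rw [← hjw, Ideal.Quotient.eq] at e1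
    obtain ⟨v, hv⟩ := hFa
    have h4 : x i0 ^ n * (a' i0 ^ n * r * x i0 - MvPolynomial.aeval a' F) ∈ J := by
      have := Ideal.sub_mem _ e1 (Ideal.mul_mem_left J (a' i0 ^ n) hj)
      convert this using 1; ring
    have hu : IsUnit (a' i0 ^ n * r * x i0 - MvPolynomial.aeval a' F) := by
      rw [← IsLocalRing.notMem_maximalIdeal]
      intro hmem
      have hxm : x i0 ∈ maximalIdeal R := by rw [← hx]; exact Ideal.subset_span ⟨i0, rfl⟩
      have := Ideal.sub_mem _ (Ideal.mul_mem_left _ (a' i0 ^ n * r) hxm) hmem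
      rw [sub_sub_cancel] at this
      exact (IsLocalRing.notMem_maximalIdeal.mpr (hv ▸ v.isUnit)) this
    rw [mul_comm] at h4
    exact (Ideal.unit_mul_mem_iff_mem _ hu).mp h4
  have hmin : maximalIdeal R ∈ J.minimalPrimes := by
    refine ⟨⟨inferInstance, hJm⟩, ?_⟩
    rintro q ⟨hq, hJq⟩ _
    refine hmJ.trans (sup_le hJq ?_)
    rw [Ideal.span_le, Set.singleton_subset_iff]
    exact hq.mem_of_pow_mem _ (hJq hpow)
  classical
  have hcard : (maximalIdeal R).height ≤ ((Finset.univ.erase i0).image y).card := by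
    refine Ideal.height_le_card_of_mem_minimalPrimes_span_finset (s := (Finset.univ.erase i0).image y) ?_
    convert hmin
    ext z; simp
  have h5 : ((Finset.univ.erase i0).image y).card < d := by
    refine (Finset.card_image_le).trans_lt ?_
    rw [Finset.card_erase_of_mem (Finset.mem_univ _), Finset.card_fin]
    have := i0.2; omega
  have h6 := IsLocalRing.maximalIdeal_height_eq_ringKrullDim (R := R)
  rw [hd] at h6
  have h7 : (maximalIdeal R).height = d := by exact_mod_cast h6
  rw [h7] at hcard
  have : d ≤ ((Finset.univ.erase i0).image y).card := by exact_mod_cast hcard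
  omega

/-- `a` has leading form `G` of degree `n` -/
def HasForm (n : ℕ) (a : R) (G : MvPolynomial (Fin d) (ResidueField R)) : Prop :=
  ∃ F : MvPolynomial (Fin d) R, F.IsHomogeneous n ∧ MvPolynomial.map (residue R) F = G ∧
    a - MvPolynomial.aeval x F ∈ (maximalIdeal R) ^ (n + 1)

lemma HasForm.exists (hx : Ideal.span (Set.range x) = maximalIdeal R) {n : ℕ} {a : R}
    (ha : a ∈ maximalIdeal R ^ n) : ∃ G, HasForm x n a G := by
  obtain ⟨F, hF, rfl⟩ := exists_form x hx n a ha
  exact ⟨_, F, hF, rfl, by simp⟩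

lemma aeval_mem_of_map_eq_zero (hx : Ideal.span (Set.range x) = maximalIdeal R) {n : ℕ}
    {F : MvPolynomial (Fin d) R} (hF : F.IsHomogeneous n)
    (h : MvPolynomial.map (residue R) F = 0) :
    MvPolynomial.aeval x F ∈ (maximalIdeal R) ^ (n + 1) := by
  rw [MvPolynomial.aeval_eq_eval₂Hom, MvPolynomial.coe_eval₂Hom, MvPolynomial.eval₂_eq]
  refine Ideal.sum_mem _ fun m hm => ?_
  rw [add_comm, pow_add, pow_one]
  refine Ideal.mul_mem_mul ?_ ?_
  · have := congrArg (MvPolynomial.coeff m) h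
    rw [MvPolynomial.coeff_map, MvPolynomial.coeff_zero, residue_eq_zero_iff] at this
    exact this
  · have := form_mem x hx (F := MvPolynomial.monomial m (1 : R)) (n := n)
      (MvPolynomial.isHomogeneous_monomial _ (by
        have h := hF (MvPolynomial.mem_support_iff.mp hm)
        rw [← h, Finsupp.weight_apply, Finsupp.degree_apply, Finsupp.sum]; simp))
    simpa [MvPolynomial.aeval_monomial, Finsupp.prod] using this

lemma HasForm.mem (hx : Ideal.span (Set.range x) = maximalIdeal R) {n : ℕ} {a : R}
    {G} (h : HasForm x n a G) : a ∈ maximalIdeal R ^ n := by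
  obtain ⟨F, hF, -, h⟩ := h
  have := Ideal.add_mem _ (Ideal.pow_le_pow_right (Nat.le_succ n) h) (form_mem x hx hF)
  simpa using this

lemma HasForm.mem_succ_iff [IsNoetherianRing R] [Infinite (ResidueField R)]
    (hx : Ideal.span (Set.range x) = maximalIdeal R) (hd : ringKrullDim R = d) {n : ℕ} {a : R}
    {G} (h : HasForm x n a G) : a ∈ maximalIdeal R ^ (n + 1) ↔ G = 0 := by
  obtain ⟨F, hF, rfl, h⟩ := h
  constructor
  · intro ha
    refine form_map_eq_zero x hx hd hF ?_
    simpa using Ideal.sub_mem _ ha h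
  · intro h0
    simpa using Ideal.add_mem _ h (aeval_mem_of_map_eq_zero x hx hF h0)

lemma HasForm.mul (hx : Ideal.span (Set.range x) = maximalIdeal R) {n m : ℕ} {a b : R}
    {G H} (h : HasForm x n a G) (h' : HasForm x m b H) : HasForm x (n + m) (a * b) (G * H) := by
  have hb := h'.mem x hx
  obtain ⟨F, hF, rfl, h⟩ := h
  obtain ⟨F', hF', rfl, h'⟩ := h'
  refine ⟨F * F', hF.mul hF', by simp, ?_⟩
  have e : a * b - MvPolynomial.aeval x (F * F') = (a - MvPolynomial.aeval x F) * b +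
      MvPolynomial.aeval x F * (b - MvPolynomial.aeval x F') := by
    rw [map_mul]; ring
  rw [e]
  refine Ideal.add_mem _ ?_ ?_
  · have := Ideal.mul_mem_mul h hb
    rwa [← pow_add, show n + 1 + m = n + m + 1 by ring] at this
  · have := Ideal.mul_mem_mul (form_mem x hx hF) h'
    rwa [← pow_add] at this

lemma exists_order [IsNoetherianRing R] {a : R} (ha : a ≠ 0) :
    ∃ n, a ∈ maximalIdeal R ^ n ∧ a ∉ maximalIdeal R ^ (n + 1) := by
  have h := Ideal.iInf_pow_eq_bot_of_isLocalRing (maximalIdeal R) (Ideal.IsPrime.ne_top inferInstance)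
  have : ∃ n, a ∉ maximalIdeal R ^ n := by
    by_contra hcon
    push Not at hcon
    apply ha
    rw [← Ideal.mem_bot, ← h, Ideal.mem_iInf]
    exact hcon
  classical
  have h0 : Nat.find this ≠ 0 := by
    intro h0
    have := Nat.find_spec this
    rw [h0] at this; simp at this
  obtain ⟨k, hk⟩ := Nat.exists_eq_succ_of_ne_zero h0
  refine ⟨k, ?_, ?_⟩
  · by_contra hc
    have := Nat.find_min' this hc
    omega
  · have := Nat.find_spec this
    rwa [hk] at this

lemma exists_form_ne_zero [IsNoetherianRing R] [Infinite (ResidueField R)]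
    (hx : Ideal.span (Set.range x) = maximalIdeal R) (hd : ringKrullDim R = d) {a : R} (ha : a ≠ 0) :
    ∃ n G, G ≠ 0 ∧ HasForm x n a G := by
  obtain ⟨n, h1, h2⟩ := exists_order ha
  obtain ⟨G, hG⟩ := HasForm.exists x hx h1
  exact ⟨n, G, fun h => h2 ((hG.mem_succ_iff x hx hd).mpr h), hG⟩

lemma isDomain_of_regular [IsNoetherianRing R] [Infinite (ResidueField R)]
    (hx : Ideal.span (Set.range x) = maximalIdeal R) (hd : ringKrullDim R = d) : IsDomain R := by
  have : NoZeroDivisors R := by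
    refine ⟨fun {a b} hab => ?_⟩
    by_contra! hcon
    obtain ⟨n, G, hG, h1⟩ := exists_form_ne_zero x hx hd hcon.1
    obtain ⟨m, H, hH, h2⟩ := exists_form_ne_zero x hx hd hcon.2
    have := (h1.mul x hx h2).mem_succ_iff x hx hd
    rw [hab] at this
    exact (mul_ne_zero hG hH) (this.mp (Ideal.zero_mem _))
  exact NoZeroDivisors.to_isDomain R

lemma HasForm.unique [IsNoetherianRing R] [Infinite (ResidueField R)]
    (hx : Ideal.span (Set.range x) = maximalIdeal R) (hd : ringKrullDim R = d) {n m : ℕ} {a : R}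
    {G H} (h : HasForm x n a G) (h' : HasForm x m a H) (hG : G ≠ 0) (hH : H ≠ 0) :
    n = m ∧ G = H := by
  have key : ∀ {n m : ℕ} {a : R} {G H}, HasForm x n a G → HasForm x m a H → G ≠ 0 → m ≤ n := by
    intro n m a G H h h' hG
    by_contra hlt
    exact hG ((h.mem_succ_iff x hx hd).mp (Ideal.pow_le_pow_right (by omega) (h'.mem x hx)))
  obtain rfl : n = m := le_antisymm (key h' h hH) (key h h' hG)
  refine ⟨rfl, ?_⟩
  obtain ⟨F, hF, rfl, h⟩ := h
  obtain ⟨F', hF', rfl, h'⟩ := h'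
  have := form_map_eq_zero x hx hd (hF.sub hF') (by
    have := Ideal.sub_mem _ h' h
    convert this using 1
    rw [map_sub]; ring)
  rw [map_sub] at this
  exact sub_eq_zero.mp this

lemma dvd_of_pow_dvd {A : Type*} [CommRing A] [IsDomain A] [IsNoetherianRing A]
    [IsIntegrallyClosed A] {G H I : A} (hI : I ≠ 0) (hH : H ≠ 0)
    (h : ∀ n : ℕ, H ^ n ∣ I * G ^ n) : H ∣ G := by
  let K := FractionRing A
  let q : K := algebraMap A K G / algebraMap A K H
  have hHK : algebraMap A K H ≠ 0 := by simpa using hH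
  have hq : IsAlmostIntegral A q := by
    refine ⟨I, mem_nonZeroDivisors_of_ne_zero hI, fun n => ?_⟩
    obtain ⟨s, hs⟩ := h n
    refine ⟨s, ?_⟩
    have := congrArg (algebraMap A K) hs
    simp only [map_mul, map_pow] at this
    rw [Algebra.smul_def, div_pow, mul_div_assoc', this, mul_div_cancel_left₀ _ (pow_ne_zero _ hHK)]
  have hii : IsIntegral A q := hq.isIntegral
  obtain ⟨r, hr⟩ := IsIntegrallyClosed.isIntegral_iff.mp hii
  refine ⟨r, ?_⟩
  apply IsFractionRing.injective A K
  rw [map_mul, hr]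
  simp only [q]; rw [mul_div_cancel₀ _ hHK]

lemma isIntegrallyClosed_of_regular [IsNoetherianRing R] [Infinite (ResidueField R)]
    (hx : Ideal.span (Set.range x) = maximalIdeal R) (hd : ringKrullDim R = d) :
    IsIntegrallyClosed R := by
  have := isDomain_of_regular x hx hd
  have key : ∀ b c : R, b ≠ 0 → c ≠ 0 → ∀ a : R, (∀ n : ℕ, b ^ n ∣ c * a ^ n) →
      ∀ N : ℕ, ∃ r, a - b * r ∈ maximalIdeal R ^ N := by
    intro b c hb hc a ha N
    induction N with
    | zero => exact ⟨0, by simp⟩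
    | succ N ih =>
      obtain ⟨r, hr⟩ := ih
      set a' := a - b * r with ha'
      have hda : ∀ n : ℕ, b ^ n ∣ c * a' ^ n := by
        intro n
        rw [ha', sub_eq_add_neg, add_pow, Finset.mul_sum]
        refine Finset.dvd_sum fun i hi => ?_
        have hin : i ≤ n := Nat.lt_succ_iff.mp (Finset.mem_range.mp hi)
        have : c * (a ^ i * (-(b * r)) ^ (n - i) * (n.choose i : R)) =
          (c * a ^ i) * b ^ (n - i) * ((-r) ^ (n - i) * (n.choose i)) := by
          rw [← mul_neg, mul_pow]; ring
        rw [this, ← Nat.add_sub_of_le hin, pow_add, Nat.add_sub_cancel_left]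
        exact Dvd.dvd.mul_right (mul_dvd_mul_right (ha i) _) _
      by_cases ha0 : a' ∈ maximalIdeal R ^ (N + 1)
      · exact ⟨r, ha0⟩
      have ha'0 : a' ≠ 0 := fun h => ha0 (h ▸ Ideal.zero_mem _)
      obtain ⟨β, H, hH, hbH⟩ := exists_form_ne_zero x hx hd hb
      obtain ⟨γ, I, hI, hcI⟩ := exists_form_ne_zero x hx hd hc
      obtain ⟨G, haG⟩ := HasForm.exists x hx hr
      have hG : G ≠ 0 := fun h => ha0 ((haG.mem_succ_iff x hx hd).mpr h)
      have hpow : ∀ {a : R} {k : ℕ} {G}, HasForm x k a G → ∀ n : ℕ, HasForm x (n * k) (a ^ n) (G ^ n) := by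
        intro a k G h n
        induction n with
        | zero =>
          refine ⟨1, ?_, by simp, by simp⟩
          rw [zero_mul]; exact MvPolynomial.isHomogeneous_one _ _
        | succ n ih =>
          rw [pow_succ, pow_succ, add_mul, one_mul]; exact ih.mul x hx h
      have hdv : ∀ n : ℕ, n * β ≤ γ + n * N ∧ H ^ n ∣ I * G ^ n := by
        intro n
        obtain ⟨s, hs⟩ := hda n
        have hs0 : s ≠ 0 := by
          rintro rfl
          rw [mul_zero] at hs
          exact mul_ne_zero hc (pow_ne_zero _ ha'0) hs
        obtain ⟨σ, S, hS, hsS⟩ := exists_form_ne_zero x hx hd hs0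
        have h1 := hcI.mul x hx (hpow haG n)
        have h2 := (hpow hbH n).mul x hx hsS
        rw [← hs] at h2
        obtain ⟨e1, e2⟩ := h1.unique x hx hd h2 (mul_ne_zero hI (pow_ne_zero _ hG))
          (mul_ne_zero (pow_ne_zero _ hH) hS)
        exact ⟨by omega, ⟨S, e2⟩⟩
      have hβN : β ≤ N := by
        by_contra hlt
        have := (hdv (γ + 1)).1
        have h3 : (γ + 1) * (N + 1) ≤ (γ + 1) * β := Nat.mul_le_mul_left _ (by omega)
        rw [mul_add] at h3; omega
      obtain ⟨Q, hQ⟩ := dvd_of_pow_dvd hI hH fun n => (hdv n).2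
      have hHhom : H.IsHomogeneous β := by
        obtain ⟨F, hF, rfl, -⟩ := hbH; exact hF.map _
      have hGhom : G.IsHomogeneous N := by
        obtain ⟨F, hF, rfl, -⟩ := haG; exact hF.map _
      -- homogeneous component
      have hQ' : G = H * MvPolynomial.homogeneousComponent (N - β) Q := by
        have h4 := MvPolynomial.homogeneousComponent_of_mem (m := N) hGhom
        rw [if_pos rfl] at h4
        rw [← h4]
        conv_lhs => rw [hQ]
        conv_lhs => rw [← MvPolynomial.sum_homogeneousComponent Q, Finset.mul_sum, map_sum]
        have h7 : ∀ i, MvPolynomial.homogeneousComponent N (H * MvPolynomial.homogeneousComponent i Q)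
            = if N = β + i then H * MvPolynomial.homogeneousComponent i Q else 0 := fun i =>
          MvPolynomial.homogeneousComponent_of_mem
            (hHhom.mul (MvPolynomial.homogeneousComponent_isHomogeneous _ _))
        simp only [h7]
        rw [Finset.sum_eq_single (N - β)]
        · rw [if_pos (by omega)]
        · intro i _ hi
          rw [if_neg (by omega)]
        · intro hi
          rw [MvPolynomial.homogeneousComponent_eq_zero _ _ (by simp at hi; omega)]; simp
      obtain ⟨F, hF⟩ := MvPolynomial.map_surjective (residue R) residue_surjective Q
      let F' := MvPolynomial.homogeneousComponent (N - β) F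
      have hF' : HasForm x (N - β) (MvPolynomial.aeval x F')
          (MvPolynomial.homogeneousComponent (N - β) Q) := by
        refine ⟨F', MvPolynomial.homogeneousComponent_isHomogeneous _ _, ?_, by simp⟩
        rw [← hF]
        ext m
        simp only [F', MvPolynomial.coeff_map, MvPolynomial.coeff_homogeneousComponent]
        split_ifs <;> simp
      have h5 := hbH.mul x hx hF'
      rw [← hQ', Nat.add_sub_of_le hβN] at h5
      refine ⟨r + MvPolynomial.aeval x F', ?_⟩
      have e : a - b * (r + MvPolynomial.aeval x F') = a' - b * MvPolynomial.aeval x F' := by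
        rw [ha']; ring
      rw [e]
      obtain ⟨P1, hP1, e1, m1⟩ := haG
      obtain ⟨P2, hP2, e2, m2⟩ := h5
      have h6 : MvPolynomial.aeval x (P1 - P2) ∈ maximalIdeal R ^ (N + 1) :=
        aeval_mem_of_map_eq_zero x hx (hP1.sub hP2) (by rw [map_sub, e1, e2, sub_self])
      have := Ideal.add_mem _ (Ideal.sub_mem _ m1 m2) h6
      convert this using 1
      rw [map_sub]; ring
  refine (isIntegrallyClosed_iff (FractionRing R)).mpr fun {q} hq => ?_
  obtain ⟨a, b, hb, rfl⟩ := IsFractionRing.div_surjective (A := R) q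
  have hb0 : b ≠ 0 := nonZeroDivisors.ne_zero hb
  obtain ⟨c, hc, hcn⟩ := hq.isAlmostIntegral
  have hbK : algebraMap R (FractionRing R) b ≠ 0 := by simpa using hb0
  have hdiv : ∀ n : ℕ, b ^ n ∣ c * a ^ n := by
    intro n
    obtain ⟨s, hs⟩ := hcn n
    refine ⟨s, ?_⟩
    apply IsFractionRing.injective R (FractionRing R)
    rw [map_mul, map_mul, hs, Algebra.smul_def, div_pow, map_pow, map_pow]
    field_simp
  have hmem : a ∈ Ideal.span {b} := by
    refine krull_closed (Ideal.IsPrime.ne_top (I := maximalIdeal R) inferInstance) fun N => ?_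
    obtain ⟨r, hr⟩ := key b c hb0 (nonZeroDivisors.ne_zero hc) a hdiv N
    have : a = (a - b * r) + b * r := by ring
    rw [this]
    exact Ideal.add_mem _ (Ideal.mem_sup_right hr)
      (Ideal.mem_sup_left (Ideal.mul_mem_right _ _ (Ideal.mem_span_singleton_self b)))
  obtain ⟨r, rfl⟩ := Ideal.mem_span_singleton'.mp hmem
  exact ⟨r, by rw [map_mul, mul_div_cancel_right₀ _ hbK]⟩

end RegularNormal

end NeronSemistable
end

noncomputable section
namespace NeronSemistable

open TensorProduct

/-- elements of a reduced Artinian ring are von Neumann regular -/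
theorem vonNeumann {E : Type*} [CommRing E] [IsArtinianRing E] [IsReduced E] (a : E) :
    ∃ y, a * (a * y) = a := by
  obtain ⟨n, y, hy⟩ := IsArtinian.exists_pow_succ_smul_dvd a (1 : E)
  refine ⟨y, ?_⟩
  have h1 : a ^ n * (1 - a * y) = 0 := by
    simp only [smul_eq_mul, mul_one, Nat.succ_eq_add_one] at hy
    rw [mul_sub, mul_one, ← mul_assoc, ← pow_succ, hy, sub_self]
  have h2 : (a * (1 - a * y)) ^ (n + 1) = 0 := by
    rw [mul_pow, pow_succ a, pow_succ (1 - a * y)]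
    linear_combination (a * (1 - a * y) ^ n) * h1
  have h3 : a * (1 - a * y) = 0 := pow_eq_zero_iff (by omega) |>.mp h2
  linear_combination -h3

/-- the image of `R ∖ 0` consists of nonzerodivisors for a flat algebra over a domain. -/
theorem nzd_of_flat {R B : Type*} [CommRing R] [IsDomain R] [CommRing B] [Algebra R B]
    [Module.Flat R B] {r : R} (hr : r ≠ 0) {b : B} (h : algebraMap R B r * b = 0) : b = 0 := by
  have h1 : IsSMulRegular B r := by
    apply Module.Flat.isSMulRegular_of_isRegular (IsRegular.of_ne_zero hr)
  apply h1
  simpa [Algebra.smul_def] using h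

theorem flat_chart {R B C : Type*} [CommRing R]
    [CommRing B] [Algebra R B] [Module.Flat R B] [CommRing C] [Algebra B C] [Algebra R C]
    [IsScalarTower R B C] (P : Ideal B) [P.IsPrime] [IsLocalization.AtPrime C P] : Module.Flat R C := by
  have : Module.Flat B C := IsLocalization.flat C P.primeCompl
  exact Module.Flat.trans R B C

/-- integral elements of `S ⊗ K` come from `S`. -/
theorem int_of_bij {R : Type*} [CommRing R] [IsDomain R] [IsIntegrallyClosed R] {S : Type*} [CommRing S] [Algebra R S]
    (h : Function.Bijective (TensorProduct.toIntegralClosure R S (B := FractionRing R)))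
    (e : S ⊗[R] FractionRing R) (he : IsIntegral S e) :
    ∃ b : S, e = b ⊗ₜ 1 := by
  obtain ⟨x, hx⟩ := h.2 ⟨e, he⟩
  have hx' : e = ((TensorProduct.toIntegralClosure R S (B := FractionRing R)) x : _) := by
    rw [hx]
  rw [hx']
  clear hx hx'
  induction x with
  | zero => exact ⟨0, by simp⟩
  | add x y hx hy =>
    obtain ⟨b, hb⟩ := hx
    obtain ⟨c, hc⟩ := hy
    exact ⟨b + c, by rw [map_add, Subalgebra.coe_add, hb, hc, add_tmul]⟩
  | tmul x y =>
    obtain ⟨y, hy⟩ := y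
    obtain ⟨r, hr⟩ := IsIntegrallyClosed.isIntegral_iff.mp (show IsIntegral R y from hy)
    refine ⟨r • x, ?_⟩
    have : ((TensorProduct.toIntegralClosure R S (B := FractionRing R)) (x ⊗ₜ ⟨y, hy⟩) : S ⊗[R] FractionRing R) =
      x ⊗ₜ y := by simp [TensorProduct.toIntegralClosure]
    rw [this, ← hr, TensorProduct.smul_tmul, Algebra.algebraMap_eq_smul_one]

theorem tmul_one_inj {R : Type*} [CommRing R] [IsDomain R] {S : Type*} [CommRing S] [Algebra R S] [Module.Flat R S] {a b : S}
    (h : (a ⊗ₜ 1 : S ⊗[R] FractionRing R) = b ⊗ₜ 1) : a = b := by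
  have := Algebra.TensorProduct.includeLeft_injective (R := R) (A := S) (B := FractionRing R) (S := R)
    (IsFractionRing.injective R (FractionRing R))
  exact this h

theorem tensor_frac_form {R : Type*} [CommRing R] [IsDomain R] {S : Type*} [CommRing S] [Algebra R S] (x : S ⊗[R] FractionRing R) :
    ∃ (y : S) (r : R), r ≠ 0 ∧ x * ((algebraMap R S r) ⊗ₜ 1) = y ⊗ₜ 1 := by
  induction x with
  | zero => exact ⟨0, 1, one_ne_zero, by simp⟩
  | add x y hx hy =>
    obtain ⟨b, r, hr, hb⟩ := hx
    obtain ⟨c, s, hs, hc⟩ := hy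
    refine ⟨b * algebraMap R S s + c * algebraMap R S r, r * s, mul_ne_zero hr hs, ?_⟩
    have e : ((algebraMap R S (r * s)) ⊗ₜ 1 : S ⊗[R] FractionRing R) =
      ((algebraMap R S r) ⊗ₜ 1) * ((algebraMap R S s) ⊗ₜ 1) := by simp
    have e1 : ((b * algebraMap R S s) ⊗ₜ 1 : S ⊗[R] FractionRing R) =
      (b ⊗ₜ 1) * ((algebraMap R S s) ⊗ₜ 1) := by simp
    have e2 : ((c * algebraMap R S r) ⊗ₜ 1 : S ⊗[R] FractionRing R) =
      (c ⊗ₜ 1) * ((algebraMap R S r) ⊗ₜ 1) := by simp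
    rw [add_tmul, e, e1, e2, ← hb, ← hc]; ring
  | tmul x y =>
    obtain ⟨a, r, hr, rfl⟩ := IsFractionRing.div_surjective (A := R) y
    have hr' : r ≠ 0 := nonZeroDivisors.ne_zero hr
    refine ⟨a • x, r, hr', ?_⟩
    rw [Algebra.TensorProduct.tmul_mul_tmul, mul_one, ← Algebra.commutes, ← Algebra.smul_def,
      TensorProduct.smul_tmul, TensorProduct.smul_tmul, Algebra.smul_def, Algebra.smul_def, mul_one,
      mul_div_cancel₀]
    simpa using hr'

theorem chart_dvd {R B C : Type*} [CommRing R] [IsDomain R] [IsIntegrallyClosed R]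
    [CommRing B] [Algebra R B] [Algebra.Etale R B] [CommRing C] [Algebra B C] [Algebra R C]
    [IsScalarTower R B C] (P : Ideal B) [P.IsPrime] [IsLocalization.AtPrime C P]
    (a : B) : algebraMap B C a = 0 ∨ ∃ r : R, r ≠ 0 ∧ algebraMap B C a ∣ algebraMap R C r := by
  let K := FractionRing R
  let E := B ⊗[R] K
  have : Module.Finite K (K ⊗[R] B) := Algebra.FormallyUnramified.finite_of_free K _
  have : IsArtinianRing (K ⊗[R] B) := IsArtinianRing.of_finite K _
  have : IsReduced (K ⊗[R] B) := Algebra.FormallyUnramified.isReduced_of_field K _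
  let ε := Algebra.TensorProduct.comm R K B
  have : IsArtinianRing E := ε.surjective.isArtinianRing
  have : IsReduced E := isReduced_of_injective ε.symm ε.symm.injective
  obtain ⟨y, hy⟩ := vonNeumann (E := E) (a ⊗ₜ 1)
  set a' : E := a ⊗ₜ 1 with ha'
  have hidem : (a' * y) * (a' * y) = a' * y := by linear_combination y * hy
  have hii : IsIntegral B (a' * y) := by
    refine ⟨Polynomial.X ^ 2 - Polynomial.X, ?_, ?_⟩
    · monicity!
    · simp [pow_two, hidem]
  obtain ⟨e, he⟩ := int_of_bij TensorProduct.toIntegralClosure_bijective_of_smooth _ hii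
  have he2 : e * e = e := tmul_one_inj (R := R) (by
    have : ((e * e) ⊗ₜ 1 : E) = (e ⊗ₜ 1) * (e ⊗ₜ 1) := by simp
    rw [this, ← he, hidem])
  have hae : a * e = a := tmul_one_inj (R := R) (by
    have : ((a * e) ⊗ₜ 1 : E) = (a ⊗ₜ 1) * (e ⊗ₜ 1) := by simp
    rw [this, ← he]; exact hy)
  have : IsLocalRing C := IsLocalization.AtPrime.isLocalRing C P
  by_cases hP : e ∈ P
  · left
    have h1 : (1 - e) ∉ P := fun h => (Ideal.ne_top_iff_one P).mp ‹P.IsPrime›.ne_top (by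
      have := P.add_mem h hP; simpa using this)
    have h2 : IsUnit (algebraMap B C (1 - e)) := IsLocalization.map_units C (⟨1 - e, h1⟩ : P.primeCompl)
    have h3 : algebraMap B C (1 - e) * algebraMap B C a = 0 := by
      rw [← map_mul]; convert map_zero (algebraMap B C); linear_combination -hae
    exact (h2.mul_right_eq_zero).mp h3
  · right
    obtain ⟨z, r, hr, hz⟩ := tensor_frac_form y
    refine ⟨r, hr, ?_⟩
    have h4 : a * z = e * algebraMap R B r := tmul_one_inj (R := R) (by
      have e1 : ((a * z) ⊗ₜ 1 : E) = (a ⊗ₜ 1) * (z ⊗ₜ 1) := by simp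
      have e2 : ((e * algebraMap R B r) ⊗ₜ 1 : E) = (e ⊗ₜ 1) * ((algebraMap R B r) ⊗ₜ 1) := by simp
      rw [e1, e2, ← hz, ← he]; ring)
    have h2 : IsUnit (algebraMap B C e) := IsLocalization.map_units C (⟨e, hP⟩ : P.primeCompl)
    rw [IsScalarTower.algebraMap_apply R B C]
    have h5 : algebraMap B C a ∣ algebraMap B C e * algebraMap B C (algebraMap R B r) := by
      rw [← map_mul, ← h4, map_mul]; exact dvd_mul_right _ _
    exact (h2.dvd_mul_left).mp h5

theorem chart_dvd' {R B C : Type*} [CommRing R] [IsDomain R] [IsIntegrallyClosed R]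
    [CommRing B] [Algebra R B] [Algebra.Etale R B] [CommRing C] [Algebra B C] [Algebra R C]
    [IsScalarTower R B C] (P : Ideal B) [P.IsPrime] [IsLocalization.AtPrime C P]
    (a : C) : a = 0 ∨ ∃ r : R, r ≠ 0 ∧ a ∣ algebraMap R C r := by
  obtain ⟨x, s, rfl⟩ := IsLocalization.exists_mk'_eq P.primeCompl a
  have hs : IsUnit (algebraMap B C s) := IsLocalization.map_units C s
  have h : IsLocalization.mk' C x s * algebraMap B C s = algebraMap B C x := IsLocalization.mk'_spec _ _ _
  rcases chart_dvd (R := R) (C := C) P x with h0 | ⟨r, hr, hd⟩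
  · left
    rw [h0] at h
    exact hs.mul_left_eq_zero.mp h
  · right
    exact ⟨r, hr, (Dvd.intro _ h).trans hd⟩

theorem chart_isDomain {R B C : Type*} [CommRing R] [IsDomain R] [IsIntegrallyClosed R]
    [CommRing B] [Algebra R B] [Algebra.Etale R B] [CommRing C] [Algebra B C] [Algebra R C]
    [IsScalarTower R B C] (P : Ideal B) [P.IsPrime] [IsLocalization.AtPrime C P]
    : IsDomain C := by
  have : IsLocalRing C := IsLocalization.AtPrime.isLocalRing C P
  have := flat_chart (R := R) (B := B) (C := C) P
  have : NoZeroDivisors C := by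
    constructor
    intro a b hab
    by_contra! hh
    obtain ⟨r, hr, c, hc⟩ := (chart_dvd' (R := R) (B := B) P a).resolve_left hh.1
    exact hh.2 (nzd_of_flat hr (by rw [hc, mul_right_comm, hab, zero_mul]))
  exact NoZeroDivisors.to_isDomain C

theorem intClosed_of {R C : Type*} [CommRing R] [IsDomain R] [IsIntegrallyClosed R]
    [CommRing C] [IsDomain C] [Algebra R C] (hinj : Function.Injective (algebraMap R C))
    (hbij : Function.Bijective (TensorProduct.toIntegralClosure R C (B := FractionRing R)))
    (hden : ∀ f : FractionRing C, IsIntegral C f → ∃ (r : R) (c : C), r ≠ 0 ∧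
      algebraMap C (FractionRing C) (algebraMap R C r) * f = algebraMap C (FractionRing C) c) :
    IsIntegrallyClosed C := by
  let L := FractionRing C
  let K := FractionRing R
  let φ : C ⊗[R] K →ₐ[C] L := Algebra.TensorProduct.lift (Algebra.ofId C L)
    (IsFractionRing.liftAlgHom (g := Algebra.ofId R L) (by
      have : (⇑(Algebra.ofId R L)) = (algebraMap C L) ∘ (algebraMap R C) := by
        ext x; exact (IsScalarTower.algebraMap_apply R C L x)
      rw [this]
      exact (IsFractionRing.injective C L).comp hinj)) (fun _ _ => Commute.all _ _)
  have hφ : ∀ c : C, φ (c ⊗ₜ 1) = algebraMap C L c := fun c => by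
    simp [φ]
  have hφinj : Function.Injective φ := by
    rw [injective_iff_map_eq_zero]
    intro x hx
    obtain ⟨y, r, hr, hy⟩ := tensor_frac_form x
    have hy0 : y = 0 := by
      have := congrArg φ hy
      rw [map_mul, hx, zero_mul, hφ] at this
      exact (IsFractionRing.injective C L) (by rw [← this, map_zero])
    rw [hy0, zero_tmul] at hy
    have hu : ((algebraMap R C r) ⊗ₜ 1 : C ⊗[R] K) * (1 ⊗ₜ (algebraMap R K r)⁻¹) = 1 := by
      rw [Algebra.TensorProduct.tmul_mul_tmul, one_mul, mul_one, Algebra.algebraMap_eq_smul_one,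
        TensorProduct.smul_tmul, Algebra.smul_def, mul_inv_cancel₀]
      · rfl
      · simpa using hr
    calc x = x * (((algebraMap R C r) ⊗ₜ 1 : C ⊗[R] K) * (1 ⊗ₜ (algebraMap R K r)⁻¹)) := by
          rw [hu, mul_one]
      _ = 0 := by rw [← mul_assoc, hy, zero_mul]
  rw [isIntegrallyClosed_iff L]
  intro f hf
  obtain ⟨r, c, hr, hrc⟩ := hden f hf
  let e : C ⊗[R] K := c ⊗ₜ (algebraMap R K r)⁻¹
  have hrL : algebraMap C L (algebraMap R C r) ≠ 0 := by
    simpa using (map_ne_zero_iff _ hinj).mpr hr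
  have he : φ e = f := by
    have h1 : e * ((algebraMap R C r) ⊗ₜ 1) = c ⊗ₜ 1 := by
      simp only [e]
      rw [Algebra.TensorProduct.tmul_mul_tmul, mul_one, ← Algebra.commutes, ← Algebra.smul_def,
        TensorProduct.smul_tmul, Algebra.smul_def, mul_inv_cancel₀]
      simpa using hr
    have h2 := congrArg φ h1
    rw [map_mul, hφ, hφ] at h2
    apply mul_right_cancel₀ hrL
    rw [h2, ← hrc, mul_comm]
  rw [← he] at hf ⊢
  obtain ⟨b, hb⟩ := int_of_bij hbij e ((isIntegral_algHom_iff φ hφinj).mp hf)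
  exact ⟨b, by rw [hb, hφ]⟩

theorem chart_isIntegrallyClosed {R B C : Type*} [CommRing R] [IsDomain R] [IsIntegrallyClosed R]
    [CommRing B] [Algebra R B] [Algebra.Etale R B] [CommRing C] [Algebra B C] [Algebra R C]
    [IsScalarTower R B C] (P : Ideal B) [P.IsPrime] [IsLocalization.AtPrime C P] :
    IsIntegrallyClosed C := by
  have := chart_isDomain (R := R) (B := B) (C := C) P
  have hfl := flat_chart (R := R) (B := B) (C := C) P
  have hinj : Function.Injective (algebraMap R C) := by
    rw [injective_iff_map_eq_zero]
    intro r h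
    by_contra hr
    exact one_ne_zero (nzd_of_flat (B := C) hr (b := 1) (by simpa using h))
  apply intClosed_of hinj (TensorProduct.toIntegralClosure_bijective_of_tower (S := B)
      TensorProduct.toIntegralClosure_bijective_of_smooth
      (TensorProduct.toIntegralClosure_bijective_of_isLocalization P.primeCompl))
  intro f hf
  obtain ⟨c, a, ha, rfl⟩ := IsFractionRing.div_surjective (A := C) f
  have ha' : a ≠ 0 := nonZeroDivisors.ne_zero ha
  obtain ⟨r, hr, d, hd⟩ := (chart_dvd' (R := R) (B := B) P a).resolve_left ha'
  have haL : algebraMap C (FractionRing C) a ≠ 0 := by simpa using ha'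
  refine ⟨r, c * d, hr, ?_⟩
  rw [mul_div_assoc', div_eq_iff haL, hd, map_mul, map_mul]; ring

theorem mvPoly_isIntegrallyClosed {R σ : Type*} [CommRing R] [IsDomain R] [IsIntegrallyClosed R] :
    IsIntegrallyClosed (MvPolynomial σ R) := by
  let K := FractionRing R
  let C := MvPolynomial σ R
  let D := MvPolynomial σ K
  let L := FractionRing C
  let L' := FractionRing D
  let μ : C →+* D := MvPolynomial.map (algebraMap R K)
  have hμ : Function.Injective μ := MvPolynomial.map_injective _ (IsFractionRing.injective R K)
  have hinj : Function.Injective (algebraMap R C) := MvPolynomial.C_injective σ R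
  have hμC : ∀ r : R, μ (MvPolynomial.C r) = MvPolynomial.C (algebraMap R K r) :=
    fun r => MvPolynomial.map_C _ _
  have hμX : ∀ i, μ (MvPolynomial.X i) = MvPolynomial.X i := fun r => MvPolynomial.map_X _ _
  apply intClosed_of hinj TensorProduct.toIntegralClosure_mvPolynomial_bijective
  intro f hf
  let j : C →+* L' := (algebraMap D L').comp μ
  have hj : Function.Injective j := (IsFractionRing.injective D L').comp hμ
  let J : L →+* L' := IsFractionRing.lift hj
  have hJ : ∀ c, J (algebraMap C L c) = j c := fun c => IsFractionRing.lift_algebraMap hj c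
  have hJf : IsIntegral D (J f) := by
    obtain ⟨p, hp, hp0⟩ := hf
    refine ⟨p.map μ, hp.map _, ?_⟩
    rw [Polynomial.eval₂_map]
    have := congrArg J hp0
    rw [Polynomial.hom_eval₂, map_zero] at this
    have e : J.comp (algebraMap C (FractionRing C)) = (algebraMap D L').comp μ := by
      apply RingHom.ext; intro c; exact hJ c
    rw [e] at this
    exact this
  obtain ⟨g, hg⟩ := IsIntegrallyClosed.isIntegral_iff.mp hJf
  obtain ⟨r, hr⟩ : ∃ r : R, r ≠ 0 ∧ ∃ c : C, μ c = MvPolynomial.C (algebraMap R K r) * g := by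
    clear hg
    induction g using MvPolynomial.induction_on with
    | C a =>
      obtain ⟨x, y, hy, rfl⟩ := IsFractionRing.div_surjective (A := R) a
      have hy' : y ≠ 0 := nonZeroDivisors.ne_zero hy
      refine ⟨y, hy', MvPolynomial.C x, ?_⟩
      rw [← map_mul, mul_div_cancel₀]
      · exact hμC x
      · simpa using hy'
    | add p q hp hq =>
      obtain ⟨r, hr, c, hc⟩ := hp
      obtain ⟨s, hs, d, hd⟩ := hq
      refine ⟨r * s, mul_ne_zero hr hs, MvPolynomial.C s * c + MvPolynomial.C r * d, ?_⟩
      rw [map_add, map_mul, map_mul, hc, hd, hμC, hμC, map_mul, map_mul]; ring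
    | mul_X p n hp =>
      obtain ⟨r, hr, c, hc⟩ := hp
      exact ⟨r, hr, c * MvPolynomial.X n, by rw [map_mul, hc, hμX, mul_assoc]⟩
  obtain ⟨hr, c, hc⟩ := hr
  refine ⟨r, c, hr, ?_⟩
  apply J.injective
  rw [map_mul, ← hg, hJ, hJ]
  simp only [j, RingHom.comp_apply, hc, ← map_mul]
  congr 2
  exact hμC r

/-- smooth over normal is normal -/
theorem smooth_normal {R B : Type*} [CommRing R] [IsDomain R] [IsIntegrallyClosed R]
    [CommRing B] [Algebra R B] [Algebra.Smooth R B] (P : Ideal B) [P.IsPrime] :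
    IsDomain (Localization.AtPrime P) ∧ IsIntegrallyClosed (Localization.AtPrime P) := by
  obtain ⟨f, hf, n, i1, i2, i3⟩ :=
    Algebra.IsSmoothAt.exists_isStandardEtale_mvPolynomial (R := R) (p := P)
  have hdis : Disjoint (Submonoid.powers f : Set B) P :=
    (Ideal.disjoint_powers_iff_notMem_of_isPrime _).mpr hf
  let Q : Ideal (Localization.Away f) := P.map (algebraMap B (Localization.Away f))
  have hQ : Q.IsPrime := IsLocalization.isPrime_of_isPrime_disjoint (.powers f) _ _ ‹_› hdis
  have hQc : Q.comap (algebraMap B (Localization.Away f)) = P :=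
    IsLocalization.under_map_of_isPrime_disjoint (.powers f) _ ‹_› hdis
  have hn := mvPoly_isIntegrallyClosed (R := R) (σ := Fin n)
  have h1 := chart_isDomain (R := MvPolynomial (Fin n) R) (B := Localization.Away f)
    (C := Localization.AtPrime Q) Q
  have h2 := chart_isIntegrallyClosed (R := MvPolynomial (Fin n) R) (B := Localization.Away f)
    (C := Localization.AtPrime Q) Q
  have h3 : IsLocalization.AtPrime (Localization.AtPrime Q) (Q.comap (algebraMap B (Localization.Away f))) :=
    IsLocalization.isLocalization_atPrime_localization_atPrime (.powers f) Q
  have h4 : IsLocalization.AtPrime (Localization.AtPrime Q) P := by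
    convert h3; exact hQc.symm
  let ε : Localization.AtPrime P ≃ₐ[B] Localization.AtPrime Q := IsLocalization.algEquiv P.primeCompl _ _
  refine ⟨ε.toMulEquiv.isDomain _, .of_equiv ε.toRingEquiv.symm⟩

end NeronSemistable
end

noncomputable section
namespace NeronSemistable

open IsLocalRing

theorem hensel_std {R B : Type*} [CommRing R] [HenselianLocalRing R] [CommRing B] [Algebra R B]
    [Algebra.IsStandardEtale R B] (τ : B →ₐ[R] ResidueField R) :
    ∃ σ : B →ₐ[R] R, (Algebra.ofId R (ResidueField R)).comp σ = τ := by
  obtain ⟨p⟩ := Algebra.IsStandardEtale.nonempty_standardEtalePresentation (R := R) (S := B)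
  obtain ⟨a₀, ha₀⟩ := residue_surjective (τ p.x)
  have hm := p.hasMap.map τ
  have key : ∀ (q : Polynomial R) (a : R), residue R a = τ p.x →
      residue R (q.eval a) = Polynomial.aeval (τ p.x) q := by
    intro q a ha
    rw [← ha]
    change algebraMap R (ResidueField R) _ = Polynomial.aeval (algebraMap R (ResidueField R) a) q
    rw [Polynomial.aeval_algebraMap_apply, Polynomial.coe_aeval_eq_eval]
  have h1 : p.f.eval a₀ ∈ maximalIdeal R := by
    rw [← residue_eq_zero_iff, key _ _ ha₀]; exact hm.1
  have h2 : IsUnit (p.f.derivative.eval a₀) := by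
    rw [← residue_ne_zero_iff_isUnit, key _ _ ha₀]
    exact (hm.isUnit_derivative_f).ne_zero
  obtain ⟨a, har, haa⟩ := HenselianLocalRing.is_henselian p.f p.monic_f a₀ h1 h2
  have ha : residue R a = τ p.x := by
    rw [← ha₀, ← sub_eq_zero, ← map_sub, residue_eq_zero_iff]; exact haa
  have hma : p.P.HasMap a := by
    refine ⟨by simpa [Polynomial.aeval_def, Polynomial.eval₂_id] using har, ?_⟩
    rw [Polynomial.coe_aeval_eq_eval, ← residue_ne_zero_iff_isUnit, key _ _ ha]
    exact hm.2.ne_zero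
  refine ⟨(p.P.lift a hma).comp p.equivRing.toAlgHom, ?_⟩
  apply p.hom_ext
  have e : p.equivRing p.x = p.P.X := by simp
  change residue R ((p.P.lift a hma) (p.equivRing p.x)) = _
  rw [e, StandardEtalePair.lift_X]
  exact ha

theorem hensel_lift {R B : Type*} [CommRing R] [HenselianLocalRing R] [CommRing B] [Algebra R B]
    [Algebra.Etale R B] (τ : B →ₐ[R] ResidueField R) :
    ∃ σ : B →ₐ[R] R, (Algebra.ofId R (ResidueField R)).comp σ = τ := by
  have hP : (RingHom.ker τ).IsPrime := RingHom.ker_isPrime _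
  obtain ⟨f, hf, hs⟩ := Algebra.IsEtaleAt.exists_isStandardEtale (R := R) (RingHom.ker τ)
  have hu : ∀ y : Submonoid.powers f, IsUnit (τ y) := by
    rintro ⟨_, n, rfl⟩
    simp only [map_pow]
    exact (IsUnit.mk0 _ hf).pow n
  let τ' : Localization.Away f →ₐ[R] ResidueField R := IsLocalization.liftAlgHom (M := .powers f) hu
  obtain ⟨σ, hσ⟩ := hensel_std τ'
  refine ⟨σ.comp (IsScalarTower.toAlgHom R B (Localization.Away f)), ?_⟩
  rw [← AlgHom.comp_assoc, hσ]
  ext b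
  simp [τ']

theorem residue_triv {R B : Type*} [CommRing R] [IsLocalRing R] [IsSepClosed (ResidueField R)]
    [CommRing B] [Algebra R B] [Algebra.Etale R B] (P : Ideal B) [P.IsPrime]
    (hP : P.comap (algebraMap R B) = maximalIdeal R) :
    ∃ τ : B →ₐ[R] ResidueField R, RingHom.ker τ = P := by
  let C := Localization.AtPrime P
  have : Algebra.FormallyUnramified R C := .comp R B C
  have : Algebra.EssFiniteType R C := .comp R B C
  have : IsLocalHom (algebraMap R C) := by
    constructor
    intro a ha
    by_contra hh
    have h1 : algebraMap R B a ∈ P := by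
      have : a ∈ maximalIdeal R := hh
      rw [← hP] at this; exact this
    have h2 : algebraMap B C (algebraMap R B a) ∈ maximalIdeal C := by
      rw [← Localization.AtPrime.map_eq_maximalIdeal]; exact Ideal.mem_map_of_mem _ h1
    rw [← IsScalarTower.algebraMap_apply] at h2
    exact h2 ha
  have hb := IsSepClosed.algebraMap_bijective (ResidueField R) (ResidueField C)
  let ε : ResidueField R ≃ₐ[ResidueField R] ResidueField C := AlgEquiv.ofBijective (Algebra.ofId _ _) hb
  let ε' : ResidueField C →ₐ[R] ResidueField R := ε.symm.toAlgHom.restrictScalars R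
  refine ⟨ε'.comp (IsScalarTower.toAlgHom R B (ResidueField C)), ?_⟩
  ext b
  rw [RingHom.mem_ker, AlgHom.comp_apply, map_eq_zero_iff _ (by exact ε.symm.injective)]
  change residue C (algebraMap B C b) = 0 ↔ _
  rw [residue_eq_zero_iff]
  exact IsLocalization.AtPrime.to_map_mem_maximal_iff C P b

theorem hensel_section {R B : Type*} [CommRing R] [HenselianLocalRing R] [IsSepClosed (ResidueField R)]
    [CommRing B] [Algebra R B] [Algebra.Etale R B] (P : Ideal B) [P.IsPrime]
    (hP : P.comap (algebraMap R B) = maximalIdeal R) :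
    ∃ σ : B →ₐ[R] R, (maximalIdeal R).comap σ = P := by
  obtain ⟨τ, hτ⟩ := residue_triv P hP
  obtain ⟨σ, hσ⟩ := hensel_lift τ
  refine ⟨σ, ?_⟩
  rw [← hτ, ← hσ]
  ext b
  rw [Ideal.mem_comap, RingHom.mem_ker, AlgHom.comp_apply]
  exact (residue_eq_zero_iff (R := R) (σ b)).symm

theorem infinite_of_sepClosed (k : Type*) [Field k] [IsSepClosed k] : Infinite k := by
  classical
  by_contra h
  rw [not_infinite_iff_finite] at h
  have := Fintype.ofFinite k
  -- `X^q - X + 1`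
  let q := Fintype.card k
  let p : Polynomial k := Polynomial.X ^ q - Polynomial.X + 1
  have hq : 1 < q := Fintype.one_lt_card
  have hc : (q : k) = 0 := by simp [q]
  have hx : Polynomial.derivative (Polynomial.X ^ q : Polynomial k) = 0 := by
    rw [Polynomial.derivative_X_pow, hc]; simp
  have hd : p.derivative = -1 := by simp [p, hx]
  have hsep : p.Separable := ⟨0, -1, by rw [hd]; ring⟩
  have hdeg : p.degree ≠ 0 := by
    have : p.degree = q := by
      have e : p = Polynomial.X ^ q + (-Polynomial.X + 1) := by simp only [p]; ring
      rw [e]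
      rw [Polynomial.degree_add_eq_left_of_degree_lt, Polynomial.degree_X_pow]
      rw [Polynomial.degree_X_pow]
      refine lt_of_le_of_lt (b := (1 : WithBot ℕ)) ?_ (by exact_mod_cast hq)
      compute_degree
    rw [this]; exact_mod_cast (by omega)
  obtain ⟨x, hx⟩ := IsSepClosed.exists_root p hdeg hsep
  have : x ^ q = x := FiniteField.pow_card x
  simp [p, Polynomial.IsRoot, this] at hx

end NeronSemistable
end

noncomputable section
namespace NeronSemistable

theorem gauss_exists_max {R Γ : Type*} [CommRing R] [IsNoetherianRing R]
    [LinearOrderedCommGroupWithZero Γ] (v : Valuation R Γ) (hv : ∀ r, v r ≤ 1)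
    (hv0 : ∀ r, r ≠ 0 → v r ≠ 0)
    {n : ℕ} (p : MvPowerSeries (Fin n) R) (hp : p ≠ 0) :
    ∃ α : Fin n →₀ ℕ, (∀ β, v (MvPowerSeries.coeff β p) ≤ v (MvPowerSeries.coeff α p)) ∧
      v (MvPowerSeries.coeff α p) ≠ 0 ∧
      ∀ β, (MonomialOrder.lex (σ := Fin n)).toSyn β < (MonomialOrder.lex (σ := Fin n)).toSyn α →
        v (MvPowerSeries.coeff β p) < v (MvPowerSeries.coeff α p) := by
  classical
  let I : Ideal R := Ideal.span (Set.range fun β => MvPowerSeries.coeff β p)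
  obtain ⟨t, ht, htI⟩ := (Submodule.fg_span_iff_fg_span_finset_subset (R := R) _).1
    (IsNoetherian.noetherian I)
  have hne : ∃ β, MvPowerSeries.coeff β p ≠ 0 := by
    by_contra hh
    push Not at hh
    exact hp (MvPowerSeries.ext (by simpa using hh))
  obtain ⟨β₀, hβ₀⟩ := hne
  have htne : t.Nonempty := by
    by_contra hh
    rw [Finset.not_nonempty_iff_eq_empty] at hh
    have : MvPowerSeries.coeff β₀ p ∈ I := Ideal.subset_span ⟨β₀, rfl⟩
    change _ ∈ Submodule.span R _ at this
    rw [htI, hh] at this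
    simp at this
    exact hβ₀ this
  obtain ⟨a, hat, ha⟩ := t.exists_max_image v htne
  have hmem : ∀ x ∈ I, v x ≤ v a := by
    intro x hx
    change _ ∈ Submodule.span R _ at hx
    rw [htI] at hx
    induction hx using Submodule.span_induction with
    | mem x h => exact ha x h
    | zero => simp
    | add x y _ _ h1 h2 => exact (v.map_add x y).trans (max_le h1 h2)
    | smul r x _ h => rw [smul_eq_mul, map_mul]; exact (mul_le_of_le_one_left' (hv r)).trans h
  obtain ⟨γ, hγ⟩ := ht hat
  let s : Set (MonomialOrder.lex (σ := Fin n)).syn :=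
    {x | v (MvPowerSeries.coeff ((MonomialOrder.lex (σ := Fin n)).toSyn.symm x) p) = v a}
  obtain ⟨x, hx, hmin⟩ := WellFounded.has_min (wellFounded_lt (α := (MonomialOrder.lex (σ := Fin n)).syn)) s
    ⟨(MonomialOrder.lex (σ := Fin n)).toSyn γ, by
      simp only [s, Set.mem_ofPred_eq, AddEquiv.symm_apply_apply]; rw [← hγ]⟩
  have hx' : v (MvPowerSeries.coeff ((MonomialOrder.lex (σ := Fin n)).toSyn.symm x) p) = v a := hx
  refine ⟨(MonomialOrder.lex (σ := Fin n)).toSyn.symm x, ?_, ?_, ?_⟩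
  · intro β; rw [hx']; exact hmem _ (Ideal.subset_span ⟨β, rfl⟩)
  · rw [hx']
    intro h0
    have := hmem _ (Ideal.subset_span ⟨β₀, rfl⟩)
    rw [h0] at this
    exact hv0 _ hβ₀ (le_zero_iff.1 this)
  · intro β hβ
    rw [hx']
    refine lt_of_le_of_ne (hmem _ (Ideal.subset_span ⟨β, rfl⟩)) ?_
    intro h
    rw [AddEquiv.apply_symm_apply] at hβ
    exact hmin ((MonomialOrder.lex (σ := Fin n)).toSyn β) (by
      simp only [s, Set.mem_ofPred_eq, AddEquiv.symm_apply_apply]; exact h) hβ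

theorem gauss_val {R Γ : Type*} [CommRing R] [IsNoetherianRing R]
    [LinearOrderedCommGroupWithZero Γ] (v : Valuation R Γ) (hv : ∀ r, v r ≤ 1)
    (hv0 : ∀ r, r ≠ 0 → v r ≠ 0)
    {n : ℕ} (p p' : MvPowerSeries (Fin n) R) (ρ : R) (hρ : ρ ≠ 0)
    (h : p * p' = MvPowerSeries.C ρ) (β : Fin n →₀ ℕ) :
    v (MvPowerSeries.coeff β p) ≤ v (MvPowerSeries.coeff 0 p) ∧
      MvPowerSeries.coeff 0 p ≠ 0 := by
  classical
  have hne : p * p' ≠ 0 := by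
    rw [h]; intro h0
    have := congrArg (MvPowerSeries.coeff 0) h0
    simp at this
    exact hρ this
  obtain ⟨α, h1, h2, h3⟩ := gauss_exists_max v hv hv0 p (left_ne_zero_of_mul hne)
  obtain ⟨α', h1', h2', h3'⟩ := gauss_exists_max v hv hv0 p' (right_ne_zero_of_mul hne)
  have hco := congrArg (MvPowerSeries.coeff (α + α')) h
  rw [MvPowerSeries.coeff_mul, ← Finset.add_sum_erase _ _
    (Finset.HasAntidiagonal.mem_antidiagonal.2 (rfl : (α, α').1 + (α, α').2 = α + α'))] at hco
  have hlt : v (∑ x ∈ (Finset.HasAntidiagonal.antidiagonal (α + α')).erase (α, α'),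
      MvPowerSeries.coeff x.1 p * MvPowerSeries.coeff x.2 p') <
      v (MvPowerSeries.coeff α p * MvPowerSeries.coeff α' p') := by
    apply v.map_sum_lt
    · rw [map_mul]; exact mul_ne_zero h2 h2'
    · rintro ⟨a, a'⟩ ha
      rw [Finset.mem_erase, Finset.HasAntidiagonal.mem_antidiagonal] at ha
      obtain ⟨hn, ha⟩ := ha
      dsimp only at ha ⊢
      rw [map_mul, map_mul]
      rcases lt_trichotomy ((MonomialOrder.lex (σ := Fin n)).toSyn a)
        ((MonomialOrder.lex (σ := Fin n)).toSyn α) with hl | hl | hl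
      · exact lt_of_le_of_lt (mul_le_mul_right (h1' a') _) (mul_lt_mul_of_pos_right (h3 _ hl) (zero_lt_iff.2 h2'))
      · have e1 : a = α := (MonomialOrder.lex (σ := Fin n)).toSyn.injective hl
        subst e1
        exact absurd (by rw [add_left_cancel ha]) hn
      · have hl' : (MonomialOrder.lex (σ := Fin n)).toSyn a' <
            (MonomialOrder.lex (σ := Fin n)).toSyn α' := by
          have e := congrArg (MonomialOrder.lex (σ := Fin n)).toSyn ha
          rw [map_add, map_add] at e
          by_contra hh
          rw [not_lt] at hh
          exact absurd e (ne_of_gt (add_lt_add_of_lt_of_le hl hh))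
        exact lt_of_le_of_lt (mul_le_mul_left (h1 a) _) (mul_lt_mul_of_pos_left (h3' _ hl') (zero_lt_iff.2 h2))
  have hz : α + α' = 0 := by
    by_contra hz
    rw [MvPowerSeries.coeff_C, if_neg hz] at hco
    have := v.map_add_eq_of_lt_left hlt
    rw [hco, map_zero, map_mul] at this
    exact mul_ne_zero h2 h2' this.symm
  have hα : α = 0 := (add_eq_zero.1 hz).1
  subst hα
  exact ⟨h1 β, fun h0 => h2 (by rw [h0, map_zero])⟩

theorem gauss {R : Type*} [CommRing R] [IsDomain R] [IsNoetherianRing R] [IsIntegrallyClosed R]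
    {n : ℕ} (p p' : MvPowerSeries (Fin n) R) (ρ : R) (hρ : ρ ≠ 0)
    (h : p * p' = MvPowerSeries.C ρ) :
    ∃ q, p = MvPowerSeries.C (MvPowerSeries.coeff 0 p) * q := by
  let K := FractionRing R
  have hdvd : ∀ β, MvPowerSeries.coeff 0 p ∣ MvPowerSeries.coeff β p := by
    intro β
    let S : Subring K := (algebraMap R K).range
    let x : K := algebraMap R K (MvPowerSeries.coeff β p) / algebraMap R K (MvPowerSeries.coeff 0 p)
    let e : R ≃+* S := RingEquiv.ofBijective (algebraMap R K).rangeRestrict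
      ⟨fun a b hab => IsFractionRing.injective R K (congrArg Subtype.val hab),
        (algebraMap R K).rangeRestrict_surjective⟩
    have hS : IsIntegrallyClosedIn S K := by
      rw [isIntegrallyClosedIn_iff]
      refine ⟨Subtype.val_injective, ?_⟩
      intro y hy
      have : IsIntegral R y := by
        obtain ⟨q, hq, hq0⟩ := hy
        refine ⟨q.map (e.symm : S →+* R), hq.map _, ?_⟩
        rw [Polynomial.eval₂_map]
        convert hq0 using 2
        ext z
        obtain ⟨w, rfl⟩ := e.surjective z
        simp [e]
        rfl
      obtain ⟨z, rfl⟩ := IsIntegrallyClosed.isIntegral_iff.1 this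
      exact ⟨⟨_, z, rfl⟩, rfl⟩
    have hx : x ∈ S := by
      by_contra hx
      obtain ⟨V, hV, hxV⟩ := Subring.exists_le_valuationSubring_of_isIntegrallyClosedIn hx
      have := gauss_val (V.valuation.comap (algebraMap R K)) (fun r => by
        exact (V.valuation_le_one_iff _).2 (hV ⟨r, rfl⟩)) (fun r hr => by
          rw [Valuation.comap_apply, Valuation.ne_zero_iff]
          exact (map_ne_zero_iff _ (IsFractionRing.injective R K)).2 hr) p p' ρ hρ h β
      apply hxV
      rw [← V.valuation_le_one_iff]
      simp only [x, map_div₀]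
      exact div_le_one_of_le₀ this.1 zero_le
    have h0 := (gauss_val (Valuation.comap (algebraMap R K) (⊤ : ValuationSubring K).valuation)
      (fun r => by exact ((⊤ : ValuationSubring K).valuation_le_one_iff _).2 trivial) (fun r hr => by
          rw [Valuation.comap_apply, Valuation.ne_zero_iff]
          exact (map_ne_zero_iff _ (IsFractionRing.injective R K)).2 hr) p p' ρ hρ h β).2
    obtain ⟨r, hr⟩ := hx
    refine ⟨r, IsFractionRing.injective R K ?_⟩
    rw [map_mul, hr]
    exact (mul_div_cancel₀ _ ((map_ne_zero_iff _ (IsFractionRing.injective R K)).2 h0)).symm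
  choose q hq using hdvd
  refine ⟨(show MvPowerSeries (Fin n) R from fun β => q β), ?_⟩
  ext β
  rw [MvPowerSeries.coeff_C_mul]
  exact hq β

theorem coeff_of_mem_pow {R : Type*} [CommRing R] {n : ℕ} (N : ℕ) (x : MvPowerSeries (Fin n) R)
    (hx : x ∈ (Ideal.span (Set.range MvPowerSeries.X) : Ideal (MvPowerSeries (Fin n) R)) ^ N)
    (α : Fin n →₀ ℕ) (hα : α.degree < N) : MvPowerSeries.coeff α x = 0 := by
  classical
  induction N generalizing x α with
  | zero => omega
  | succ N ih =>
    rw [pow_succ] at hx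
    induction hx using Submodule.mul_induction_on' with
    | mem_mul_mem a ha b hb =>
      rw [Ideal.mem_span_range_iff_exists_fun] at hb
      obtain ⟨c, rfl⟩ := hb
      rw [Finset.mul_sum, map_sum]
      refine Finset.sum_eq_zero fun i _ => ?_
      rw [← mul_assoc]
      by_cases h : 1 ≤ α i
      · have e : α = (α - Finsupp.single i 1) + Finsupp.single i 1 := by
          rw [tsub_add_cancel_of_le]; simpa using h
        have hd : α.degree = (α - Finsupp.single i 1).degree + 1 := by
          conv_lhs => rw [e]
          simp
        rw [e, MvPowerSeries.X, MvPowerSeries.coeff_add_mul_monomial, mul_one]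
        exact ih _ (Ideal.mul_mem_right _ _ ha) _ (by omega)
      · rw [MvPowerSeries.X, MvPowerSeries.coeff_mul_monomial, if_neg]
        simpa using h
    | add x _ y _ h1 h2 => rw [map_add, h1, h2, add_zero]

theorem section_ker {R C : Type*} [CommRing R] [CommRing C] [IsLocalRing C] [IsNoetherianRing C]
    {n : ℕ} [Algebra R C] [Algebra (MvPolynomial (Fin n) R) C]
    [IsScalarTower R (MvPolynomial (Fin n) R) C] [Algebra.FormallyUnramified (MvPolynomial (Fin n) R) C]
    [Nontrivial R] (σ : C →ₐ[R] R) :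
    RingHom.ker σ = Ideal.span (Set.range fun i : Fin n =>
      algebraMap (MvPolynomial (Fin n) R) C (MvPolynomial.X i) -
        algebraMap R C (σ (algebraMap (MvPolynomial (Fin n) R) C (MvPolynomial.X i)))) := by
  set w : Fin n → C := fun i : Fin n =>
      algebraMap (MvPolynomial (Fin n) R) C (MvPolynomial.X i) -
        algebraMap R C (σ (algebraMap (MvPolynomial (Fin n) R) C (MvPolynomial.X i))) with hw
  set J := Ideal.span (Set.range w)
  set I : Ideal C := RingHom.ker σ
  have hJI : J ≤ I := by
    rw [Ideal.span_le]
    rintro _ ⟨i, rfl⟩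
    change σ _ = 0
    simp [w]
  refine le_antisymm ?_ hJI
  have hIm : I ≤ IsLocalRing.maximalIdeal C := IsLocalRing.le_maximalIdeal (RingHom.ker_ne_top _)
  refine Submodule.le_of_le_smul_of_le_jacobson_bot (I := I) (IsNoetherian.noetherian _)
    (hIm.trans (IsLocalRing.maximalIdeal_le_jacobson _)) ?_
  let Q : Ideal C := J ⊔ I • I
  let π : C →ₐ[MvPolynomial (Fin n) R] C ⧸ Q := Ideal.Quotient.mkₐ _ Q
  let ψ₀ : C →+* C ⧸ Q := (Ideal.Quotient.mk Q).comp ((algebraMap R C).comp σ.toRingHom)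
  let ψ : C →ₐ[MvPolynomial (Fin n) R] C ⧸ Q := { ψ₀ with
    commutes' := by
      intro g
      change ψ₀ (algebraMap _ C g) = Ideal.Quotient.mk Q (algebraMap _ C g)
      have : ψ₀.comp (algebraMap (MvPolynomial (Fin n) R) C) =
          (Ideal.Quotient.mk Q).comp (algebraMap (MvPolynomial (Fin n) R) C) := by
        apply MvPolynomial.ringHom_ext
        · intro r
          change Ideal.Quotient.mk Q (algebraMap R C (σ (algebraMap (MvPolynomial (Fin n) R) C
            (algebraMap R _ r)))) = Ideal.Quotient.mk Q (algebraMap (MvPolynomial (Fin n) R) C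
            (algebraMap R _ r))
          rw [← IsScalarTower.algebraMap_apply, AlgHom.commutes]; rfl
        · intro i
          change Ideal.Quotient.mk Q _ = Ideal.Quotient.mk Q _
          rw [eq_comm, Ideal.Quotient.eq]
          exact Ideal.mem_sup_left (Ideal.subset_span ⟨i, rfl⟩)
      exact congrArg (fun h => h g) this }
  have hnil : IsNilpotent (I.map (Ideal.Quotient.mk Q)) := by
    refine ⟨2, ?_⟩
    rw [← Ideal.map_pow, pow_two, Submodule.zero_eq_bot, Ideal.map_eq_bot_iff_le_ker, Ideal.mk_ker]
    exact le_sup_right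
  have heq : π = ψ := by
    apply Algebra.FormallyUnramified.ext (I.map (Ideal.Quotient.mk Q)) hnil
    intro x
    rw [Ideal.Quotient.eq]
    change Ideal.Quotient.mk Q x - Ideal.Quotient.mk Q (algebraMap R C (σ x)) ∈ _
    rw [← map_sub]
    refine Ideal.mem_map_of_mem _ ?_
    change σ _ = 0
    simp
  intro x hx
  have h1 : π x = ψ x := by rw [heq]
  have h2 : ψ x = 0 := by
    change Ideal.Quotient.mk Q (algebraMap R C (σ x)) = 0
    rw [show σ x = 0 from hx]; simp
  exact Ideal.Quotient.eq_zero_iff_mem.1 (h1.trans h2)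

theorem section_approx {R C : Type*} [CommRing R] [CommRing C] {n : ℕ} [Algebra R C]
    (σ : C →ₐ[R] R) (w : Fin n → C) (hk : RingHom.ker σ = Ideal.span (Set.range w)) (N : ℕ) (c : C) :
    ∃ g : MvPolynomial (Fin n) R, c - MvPolynomial.aeval w g ∈ Ideal.span (Set.range w) ^ N := by
  induction N generalizing c with
  | zero => exact ⟨0, by simp⟩
  | succ N ih =>
    have h1 : c - algebraMap R C (σ c) ∈ Ideal.span (Set.range w) := by
      rw [← hk]; change σ _ = 0; simp
    rw [Ideal.mem_span_range_iff_exists_fun] at h1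
    obtain ⟨d, hd⟩ := h1
    choose g hg using fun i => ih (d i)
    refine ⟨MvPolynomial.C (σ c) + ∑ i, g i * MvPolynomial.X i, ?_⟩
    have : c - MvPolynomial.aeval w (MvPolynomial.C (σ c) + ∑ i, g i * MvPolynomial.X i) =
        ∑ i, (d i - MvPolynomial.aeval w (g i)) * w i := by
      simp only [map_add, map_sum, map_mul, MvPolynomial.aeval_C, MvPolynomial.aeval_X, sub_mul,
        Finset.sum_sub_distrib]
      rw [hd]; ring
    rw [this, pow_succ]
    exact Ideal.sum_mem _ fun i _ => Ideal.mul_mem_mul (hg i) (Ideal.subset_span ⟨i, rfl⟩)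

theorem section_dvd {R C : Type*} [CommRing R] [IsDomain R] [IsNoetherianRing R]
    [IsIntegrallyClosed R] [CommRing C] [IsLocalRing C] [IsNoetherianRing C]
    {n : ℕ} [Algebra R C] [Algebra (MvPolynomial (Fin n) R) C]
    [IsScalarTower R (MvPolynomial (Fin n) R) C] [Algebra.FormallyEtale (MvPolynomial (Fin n) R) C]
    (σ : C →ₐ[R] R) (p p' : C) (ρ : R) (hρ : ρ ≠ 0) (h : p * p' = algebraMap R C ρ) :
    algebraMap R C (σ p) ∣ p := by
  classical
  have hk := section_ker (n := n) σ
  set w : Fin n → C := fun i : Fin n =>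
      algebraMap (MvPolynomial (Fin n) R) C (MvPolynomial.X i) -
        algebraMap R C (σ (algebraMap (MvPolynomial (Fin n) R) C (MvPolynomial.X i))) with hw
  set a : Fin n → R := fun i => σ (algebraMap (MvPolynomial (Fin n) R) C (MvPolynomial.X i)) with ha
  let PS := MvPowerSeries (Fin n) R
  let IX : Ideal PS := Ideal.span (Set.range MvPowerSeries.X)
  let evX : MvPolynomial (Fin n) R →ₐ[R] PS := MvPolynomial.aeval
    (fun i => MvPowerSeries.C (a i) + MvPowerSeries.X i)
  letI : Algebra (MvPolynomial (Fin n) R) PS := evX.toAlgebra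
  have halg : ∀ g, algebraMap (MvPolynomial (Fin n) R) PS g = evX g := fun _ => rfl
  have hCalg : ∀ r, algebraMap R PS r = MvPowerSeries.C r := fun _ => rfl
  let ψ₀ : C →+* PS ⧸ IX := (Ideal.Quotient.mk IX).comp ((MvPowerSeries.C).comp σ.toRingHom)
  let ψ : C →ₐ[MvPolynomial (Fin n) R] PS ⧸ IX := { ψ₀ with
    commutes' := by
      intro g
      change ψ₀ (algebraMap _ C g) = Ideal.Quotient.mk IX (evX g)
      have : ψ₀.comp (algebraMap (MvPolynomial (Fin n) R) C) =
          (Ideal.Quotient.mk IX).comp evX.toRingHom := by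
        apply MvPolynomial.ringHom_ext
        · intro r
          change Ideal.Quotient.mk IX (MvPowerSeries.C (σ (algebraMap (MvPolynomial (Fin n) R) C
            (algebraMap R _ r)))) = Ideal.Quotient.mk IX (evX (algebraMap R _ r))
          rw [← IsScalarTower.algebraMap_apply, AlgHom.commutes, AlgHom.commutes]; rfl
        · intro i
          change Ideal.Quotient.mk IX (MvPowerSeries.C (a i)) = Ideal.Quotient.mk IX (evX _)
          rw [eq_comm, Ideal.Quotient.eq]
          simp only [evX, MvPolynomial.aeval_X, add_sub_cancel_left]
          exact Ideal.subset_span ⟨i, rfl⟩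
      exact congrArg (fun h => h g) this }
  haveI : IsAdicComplete IX PS := inferInstanceAs (IsAdicComplete (Ideal.span (Set.range MvPowerSeries.X) : Ideal (MvPowerSeries (Fin n) R)) (MvPowerSeries (Fin n) R))
  obtain ⟨Θ, hΘ⟩ := Algebra.FormallySmooth.exists_mkₐ_comp_eq_of_isAdicComplete ψ
  have hΘR : ∀ r, Θ (algebraMap R C r) = MvPowerSeries.C r := by
    intro r
    rw [IsScalarTower.algebraMap_apply R (MvPolynomial (Fin n) R) C, AlgHom.commutes, halg,
      AlgHom.commutes]; rfl
  have hΘw : ∀ i, Θ (w i) = MvPowerSeries.X i := by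
    intro i
    simp only [w, map_sub]
    rw [AlgHom.commutes, halg, hΘR]
    simp [evX, a]
  have hΘg : ∀ g : MvPolynomial (Fin n) R, Θ (MvPolynomial.aeval w g) = (g : PS) := by
    intro g
    have : (Θ : C →+* PS).comp (MvPolynomial.aeval w : MvPolynomial (Fin n) R →ₐ[R] C).toRingHom =
        MvPolynomial.coeToMvPowerSeries.ringHom := by
      apply MvPolynomial.ringHom_ext
      · intro r
        change Θ (MvPolynomial.aeval w (MvPolynomial.C r)) = _
        rw [MvPolynomial.aeval_C, hΘR]; exact (MvPolynomial.coe_C r).symm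
      · intro i
        change Θ (MvPolynomial.aeval w (MvPolynomial.X i)) = _
        rw [MvPolynomial.aeval_X, hΘw]; exact (MvPolynomial.coe_X i).symm
    exact congrArg (fun h => h g) this
  have hΘ0 : ∀ c, MvPowerSeries.coeff 0 (Θ c) = σ c := by
    intro c
    have h1 : Ideal.Quotient.mk IX (Θ c) = Ideal.Quotient.mk IX (MvPowerSeries.C (σ c)) :=
      congrArg (fun h => h c) hΘ
    rw [Ideal.Quotient.eq, ← pow_one IX] at h1
    have := coeff_of_mem_pow 1 _ h1 0 (by simp)
    rw [map_sub, sub_eq_zero] at this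
    rw [this]; simp
  obtain ⟨q, hq⟩ := gauss (Θ p) (Θ p') ρ hρ (by rw [← map_mul, h, hΘR])
  rw [hΘ0] at hq
  rw [← Ideal.mem_span_singleton]
  set J := Ideal.span (Set.range w)
  have hJ : J ≠ ⊤ := by
    rw [← hk]; exact RingHom.ker_ne_top _
  refine krull_closed (J := J) hJ fun N => ?_
  obtain ⟨g, hg⟩ := section_approx σ w hk N p
  have hmap : ∀ x ∈ J ^ N, Θ x ∈ IX ^ N := by
    intro x hx
    have : J.map (Θ : C →+* PS) ≤ IX := by
      rw [Ideal.map_span, Ideal.span_le]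
      rintro _ ⟨_, ⟨i, rfl⟩, rfl⟩
      exact Ideal.subset_span ⟨i, (hΘw i).symm⟩
    refine Ideal.pow_right_mono this N ?_
    rw [← Ideal.map_pow]
    exact Ideal.mem_map_of_mem (Θ : C →+* PS) hx
  have hcoef : ∀ α : Fin n →₀ ℕ, α.degree < N → σ p ∣ MvPolynomial.coeff α g := by
    intro α hα
    have h1 := coeff_of_mem_pow N _ (hmap _ hg) α hα
    rw [map_sub, hΘg, map_sub, sub_eq_zero, hq, MvPowerSeries.coeff_C_mul,
      MvPolynomial.coeff_coe] at h1
    exact ⟨_, h1.symm⟩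
  suffices hs : MvPolynomial.aeval w g ∈ Ideal.span {algebraMap R C (σ p)} ⊔ J ^ N by
    have := Ideal.add_mem _ hs (Ideal.mem_sup_right hg)
    rwa [add_sub_cancel] at this
  rw [MvPolynomial.aeval_def, MvPolynomial.eval₂_eq]
  refine Ideal.sum_mem _ fun α _ => ?_
  by_cases hα : α.degree < N
  · obtain ⟨r, hr⟩ := hcoef α hα
    refine Ideal.mem_sup_left (Ideal.mem_span_singleton.2 ?_)
    rw [hr, map_mul, mul_assoc]; exact dvd_mul_right _ _
  · refine Ideal.mem_sup_right (Ideal.mul_mem_left _ _ ?_)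
    have : ∏ i ∈ α.support, w i ^ α i ∈ J ^ α.degree := by
      rw [Finsupp.degree_apply, ← Finset.prod_pow_eq_pow_sum]
      exact Ideal.prod_mem_prod fun i _ => Ideal.pow_mem_pow (Ideal.subset_span (Set.mem_range_self i)) _
    exact Ideal.pow_le_pow_right (not_lt.1 hα) this

/-- An element of `C` dividing a nonzero constant is a constant times a unit. -/
theorem section_unit {R C : Type*} [CommRing R] [IsDomain R] [IsNoetherianRing R]
    [IsIntegrallyClosed R] [CommRing C] [IsDomain C] [IsLocalRing C] [IsNoetherianRing C]
    {n : ℕ} [Algebra R C] [Algebra (MvPolynomial (Fin n) R) C]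
    [IsScalarTower R (MvPolynomial (Fin n) R) C] [Algebra.FormallyEtale (MvPolynomial (Fin n) R) C]
    (σ : C →ₐ[R] R) (p p' : C) (ρ : R) (hρ : ρ ≠ 0) (h : p * p' = algebraMap R C ρ) :
    ∃ d : R, d ∣ ρ ∧ ∃ u : C, IsUnit u ∧ p = algebraMap R C d * u := by
  obtain ⟨u, hu⟩ := section_dvd (n := n) σ p p' ρ hρ h
  obtain ⟨u', hu'⟩ := section_dvd (n := n) σ p' p ρ hρ (by rw [mul_comm, h])
  have hd : σ p * σ p' = ρ := by rw [← map_mul, h]; simp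
  refine ⟨σ p, ⟨_, hd.symm⟩, u, ?_, hu⟩
  have hinj : Function.Injective (algebraMap R C) := by
    intro x y hxy
    have := congrArg σ hxy
    simpa using this
  have h1 : algebraMap R C ρ * (u * u') = algebraMap R C ρ * 1 := by
    rw [mul_one]
    conv_rhs => rw [← h, hu, hu']
    rw [← hd, map_mul]; ring
  exact IsUnit.of_mul_eq_one _ (mul_left_cancel₀ ((map_ne_zero_iff _ hinj).2 hρ) h1)

end NeronSemistable
end

noncomputable section
namespace NeronSemistable

open IsLocalRing

/-- the ideal `(c : y)` -/
def colonI {R : Type*} [CommRing R] (c : Ideal R) (y : R) : Ideal R :=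
  Submodule.comap (LinearMap.mulRight R y) c

theorem mem_colonI {R : Type*} [CommRing R] {c : Ideal R} {y r : R} :
    r ∈ colonI c y ↔ r * y ∈ c := Iff.rfl

theorem flat_colon {R C : Type*} [CommRing R] [CommRing C] [Algebra R C] [Module.Flat R C]
    (c : Ideal R) (y : R) (z : C)
    (h : algebraMap R C y * z ∈ c.map (algebraMap R C)) :
    z ∈ (colonI c y).map (algebraMap R C) := by
  classical
  obtain ⟨t, ht, a, hs⟩ := (Submodule.mem_span_image_iff_exists_fun C).1 h
  let f : Option t → R := fun i => i.elim y (fun j => -j.1)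
  let x : Option t → C := fun i => i.elim z (fun j => a j)
  have hrel : ∑ i, f i • x i = 0 := by
    rw [Fintype.sum_option]
    simp only [f, x, Option.elim]
    rw [Algebra.smul_def, ← hs, ← Finset.sum_add_distrib]
    refine Finset.sum_eq_zero fun i _ => ?_
    rw [Algebra.smul_def (-(i : R)), smul_eq_mul, map_neg]; ring
  obtain ⟨k, A, w, h1, h2⟩ := Module.Flat.isTrivialRelation_of_sum_smul_eq_zero (R := R) (M := C) hrel
  have hz : z = ∑ j, A none j • w j := h1 none
  rw [hz]
  refine Ideal.sum_mem _ fun j _ => ?_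
  rw [Algebra.smul_def]
  refine Ideal.mul_mem_right _ _ (Ideal.mem_map_of_mem _ ?_)
  rw [mem_colonI]
  have := h2 j
  rw [Fintype.sum_option] at this
  simp only [f, Option.elim] at this
  rw [mul_comm, eq_neg_of_add_eq_zero_left this]
  refine neg_mem (Ideal.sum_mem _ fun i _ => Ideal.mul_mem_right _ _ (neg_mem (ht i.2)))

theorem nzd_fibre {R C : Type*} [CommRing R] [IsLocalRing R] [IsNoetherianRing R] [CommRing C]
    [IsLocalRing C] [IsNoetherianRing C] [Algebra R C] [Module.Flat R C] [IsLocalHom (algebraMap R C)]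
    (c : C) (hc : ∀ a, c * a ∈ (maximalIdeal R).map (algebraMap R C) →
      a ∈ (maximalIdeal R).map (algebraMap R C)) (I : Ideal R) :
    ∀ a, c * a ∈ Ideal.map (algebraMap R C) I → a ∈ Ideal.map (algebraMap R C) I := by
  induction I using IsNoetherian.induction with
  | _ I ih =>
  intro a ha
  by_cases htop : I = ⊤
  · subst htop; rw [Ideal.map_top]; trivial
  by_cases hm : I = maximalIdeal R
  · subst hm; exact hc a ha
  have hIm : I < maximalIdeal R := lt_of_le_of_ne (le_maximalIdeal htop) hm
  obtain ⟨y, hy, hyI⟩ := SetLike.exists_of_lt hIm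
  have hgt : I < I ⊔ Ideal.span {y} := by
    refine lt_of_le_of_ne le_sup_left fun h => hyI ?_
    rw [h]; exact Ideal.mem_sup_right (Ideal.mem_span_singleton_self y)
  have hle : I ≤ colonI I y := fun r hr => mem_colonI.2 (Ideal.mul_mem_right _ _ hr)
  -- decomposition
  have hdec : ∀ a, c * a ∈ Ideal.map (algebraMap R C) I → ∃ a', a - algebraMap R C y * a' ∈ Ideal.map (algebraMap R C) I ∧
      c * a' ∈ Ideal.map (algebraMap R C) (colonI I y) := by
    intro a ha
    have := ih _ hgt a (Ideal.map_mono le_sup_left ha)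
    rw [Ideal.map_sup, Ideal.map_span, Set.image_singleton, Submodule.mem_sup] at this
    obtain ⟨i, hi, j, hj, hij⟩ := this
    obtain ⟨a', rfl⟩ := Ideal.mem_span_singleton.1 hj
    refine ⟨a', by rw [← hij]; simpa using hi, flat_colon _ _ _ ?_⟩
    have : algebraMap R C y * (c * a') = c * a - c * i := by rw [← hij]; ring
    rw [this]
    exact sub_mem ha (Ideal.mul_mem_left _ _ hi)
  by_cases hcol : colonI I y = I
  · -- Nakayama
    let N : Ideal C := colonI (Ideal.map (algebraMap R C) I) c
    have hN : N ≤ Ideal.map (algebraMap R C) I := by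
      refine Submodule.le_of_le_smul_of_le_jacobson_bot (I := maximalIdeal C) (IsNoetherian.noetherian _)
        (maximalIdeal_le_jacobson _) ?_
      intro n hn
      obtain ⟨a', h1, h2⟩ := hdec n (by rw [mul_comm]; exact hn)
      rw [hcol] at h2
      rw [show n = (n - algebraMap R C y * a') + algebraMap R C y * a' by ring]
      refine add_mem (Ideal.mem_sup_left h1) (Ideal.mem_sup_right ?_)
      refine Submodule.smul_mem_smul ?_ (by rw [mul_comm] at h2; exact h2)
      exact map_mem_nonunits_iff (algebraMap R C) y |>.2 hy
    exact hN (show a * c ∈ _ by rw [mul_comm]; exact ha)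
  · obtain ⟨a', h1, h2⟩ := hdec a ha
    have h3 := ih _ (lt_of_le_of_ne hle (Ne.symm hcol)) a' h2
    have h4 : algebraMap R C y * a' ∈ Ideal.map (algebraMap R C) I := by
      have : Ideal.map (algebraMap R C) (colonI I y) ≤ colonI (Ideal.map (algebraMap R C) I) (algebraMap R C y) := by
        rw [Ideal.map_le_iff_le_comap]
        intro r hr
        rw [Ideal.mem_comap, mem_colonI, ← map_mul]
        exact Ideal.mem_map_of_mem _ hr
      have := this h3
      rwa [mem_colonI, mul_comm] at this
    have := add_mem h1 h4
    rwa [sub_add_cancel] at this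

/-- orders along the second component -/
theorem exists_ord {C : Type*} [CommRing C] [IsLocalRing C] [IsNoetherianRing C] (q : Ideal C) (x : C)
    (hmax : q ⊔ Ideal.span {x} = maximalIdeal C) (c : C) (hc : c ∉ q) :
    ∃ a : ℕ, ∃ v : C, IsUnit v ∧ c - v * x ^ a ∈ q := by
  have hJ : Ideal.span {x} ≠ ⊤ := fun h => by
    rw [h, sup_top_eq] at hmax; exact (maximalIdeal.isMaximal C).ne_top hmax.symm
  have : ∃ N, c ∉ q ⊔ Ideal.span {x} ^ N := by
    by_contra hh
    push Not at hh
    exact hc (krull_closed hJ hh)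
  classical
  let N := Nat.find this
  have hN : c ∉ q ⊔ Ideal.span {x} ^ N := Nat.find_spec this
  have hN0 : N ≠ 0 := by
    intro h
    rw [h] at hN; simp at hN
  obtain ⟨a, ha⟩ := Nat.exists_eq_succ_of_ne_zero hN0
  have hlt : c ∈ q ⊔ Ideal.span {x} ^ a := by
    by_contra hh
    have := Nat.find_min' this hh
    omega
  rw [Ideal.span_singleton_pow, Submodule.mem_sup] at hlt
  obtain ⟨i, hi, j, hj, hij⟩ := hlt
  obtain ⟨v, rfl⟩ := Ideal.mem_span_singleton.1 hj
  refine ⟨a, v, ?_, ?_⟩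
  · by_contra hv
    have hv : v ∈ q ⊔ Ideal.span {x} := by rw [hmax]; exact hv
    obtain ⟨k, hk, l, hl, rfl⟩ := Submodule.mem_sup.1 hv
    obtain ⟨l, rfl⟩ := Ideal.mem_span_singleton.1 hl
    apply hN
    rw [ha, ← hij, Ideal.span_singleton_pow]
    rw [show i + x ^ a * (k + x * l) = (i + x ^ a * k) + x ^ a.succ * l by rw [pow_succ]; ring]
    exact add_mem (Ideal.mem_sup_left (add_mem hi (Ideal.mul_mem_left _ _ hk)))
      (Ideal.mem_sup_right (Ideal.mem_span_singleton.2 ⟨l, rfl⟩))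
  · rw [← hij, mul_comm v]; simpa using hi

/-- normalized half of the edge lemma -/
theorem edge_half {R C : Type*} [CommRing R] [IsLocalRing R] [IsNoetherianRing R]
    [CommRing C] [IsLocalRing C] [IsNoetherianRing C] [Algebra R C] [Module.Flat R C]
    [IsLocalHom (algebraMap R C)] (q1 q2 : Ideal C) [hq1 : q1.IsPrime] [hq2 : q2.IsPrime]
    (hm1 : (maximalIdeal R).map (algebraMap R C) ≤ q1)
    (hm2 : (maximalIdeal R).map (algebraMap R C) ≤ q2)
    (hii : q1 ⊓ q2 ≤ (maximalIdeal R).map (algebraMap R C))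
    (P : C) (d1 d2 : R) (s1 t1 s2 v : C) (hs1 : s1 ∉ q1) (hs2 : s2 ∉ q2)
    (h1 : s1 * P = algebraMap R C d1 * t1) (t2 : C) (h2 : s2 * P = algebraMap R C d2 * t2)
    (hv : IsUnit v) (ht2 : t2 - s2 * v ∈ q2) : d1 ∣ d2 := by
  by_contra hnd
  let I : Ideal R := Ideal.span {d1, d2}
  have hcol : colonI (Ideal.span {d1}) d2 ≤ maximalIdeal R := by
    refine le_maximalIdeal fun h => hnd ?_
    have : (1 : R) ∈ colonI (Ideal.span {d1}) d2 := by rw [h]; trivial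
    rw [mem_colonI, one_mul] at this
    exact Ideal.mem_span_singleton.1 this
  have hd1 : algebraMap R C d1 ∈ I.map (algebraMap R C) :=
    Ideal.mem_map_of_mem _ (Ideal.subset_span (by simp))
  have hd2 : algebraMap R C d2 ∈ I.map (algebraMap R C) :=
    Ideal.mem_map_of_mem _ (Ideal.subset_span (by simp))
  have hs1P : s1 * P ∈ I.map (algebraMap R C) := by rw [h1]; exact Ideal.mul_mem_right _ _ hd1
  have hs2P : s2 * P ∈ I.map (algebraMap R C) := by rw [h2]; exact Ideal.mul_mem_right _ _ hd2
  have hc : ∃ c, c ∉ q1 ∧ c ∉ q2 ∧ c * P ∈ I.map (algebraMap R C) := by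
    by_cases ha : s1 ∈ q2
    · by_cases hb : s2 ∈ q1
      · refine ⟨s1 + s2, fun h => hs1 ((Ideal.add_mem_iff_left _ hb).1 h), fun h => hs2
          ((Ideal.add_mem_iff_right _ ha).1 h), ?_⟩
        rw [add_mul]; exact add_mem hs1P hs2P
      · exact ⟨s2, hb, hs2, hs2P⟩
    · exact ⟨s1, hs1, ha, hs1P⟩
  obtain ⟨c, hc1, hc2, hcP⟩ := hc
  have hP : P ∈ I.map (algebraMap R C) := by
    refine nzd_fibre c (fun a ha => hii ⟨?_, ?_⟩) I P hcP
    · exact (hq1.mem_or_mem (hm1 ha)).resolve_left hc1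
    · exact (hq2.mem_or_mem (hm2 ha)).resolve_left hc2
  rw [Ideal.map_span, Set.image_pair, Ideal.mem_span_pair] at hP
  obtain ⟨α, β, hαβ⟩ := hP
  have key : ∀ z w : C, algebraMap R C d2 * z = algebraMap R C d1 * w →
      z ∈ (maximalIdeal R).map (algebraMap R C) := by
    intro z w hzw
    refine Ideal.map_mono hcol (flat_colon _ _ _ ?_)
    rw [hzw, Ideal.map_span, Set.image_singleton]
    exact Ideal.mul_mem_right _ _ (Ideal.mem_span_singleton_self _)
  have hβ1 : β ∈ q1 := by
    have : s1 * β ∈ q1 := hm1 (key (s1 * β) (t1 - s1 * α) (by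
      rw [mul_sub, ← h1, ← hαβ]; ring))
    exact (hq1.mem_or_mem this).resolve_left hs1
  have hβ2 : s2 * (β - v) ∈ q2 := by
    have : s2 * β - t2 ∈ q2 := hm2 (key (s2 * β - t2) (- (s2 * α)) (by
      rw [mul_sub, ← h2, ← hαβ]; ring))
    have := add_mem this ht2
    rwa [show s2 * β - t2 + (t2 - s2 * v) = s2 * (β - v) by ring] at this
  have hβ2 := (hq2.mem_or_mem hβ2).resolve_left hs2
  have hb1 : β ∈ maximalIdeal C := le_maximalIdeal hq1.ne_top hβ1
  have hb2 : β - v ∈ maximalIdeal C := le_maximalIdeal hq2.ne_top hβ2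
  have := sub_mem hb1 hb2
  rw [sub_sub_cancel] at this
  exact this hv

theorem edge_norm {R C : Type*} [CommRing R] [IsDomain R] [IsLocalRing R] [IsNoetherianRing R]
    [CommRing C] [IsLocalRing C] [IsNoetherianRing C] [Algebra R C] [Module.Flat R C]
    [IsLocalHom (algebraMap R C)] (q1 q2 : Ideal C) [hq1 : q1.IsPrime] [hq2 : q2.IsPrime]
    (hm1 : (maximalIdeal R).map (algebraMap R C) ≤ q1)
    (hm2 : (maximalIdeal R).map (algebraMap R C) ≤ q2)
    (hii : q1 ⊓ q2 ≤ (maximalIdeal R).map (algebraMap R C))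
    (P P' : C) (ρ : R) (hρ : ρ ≠ 0) (w : C) (hw : IsUnit w) (hP : P * P' = algebraMap R C ρ * w)
    (d1 d2 : R) (hd1 : d1 ∣ ρ) (hd2 : d2 ∣ ρ)
    (s1 t1 s2 t2 v : C) (hs1 : s1 ∉ q1) (ht1 : t1 ∉ q1) (hs2 : s2 ∉ q2)
    (h1 : s1 * P = algebraMap R C d1 * t1) (h2 : s2 * P = algebraMap R C d2 * t2)
    (hv : IsUnit v) (ht2 : t2 - s2 * v ∈ q2) : Associated d1 d2 := by
  have H1 := edge_half q1 q2 hm1 hm2 hii P d1 d2 s1 t1 s2 v hs1 hs2 h1 t2 h2 hv ht2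
  obtain ⟨e1, rfl⟩ := hd1
  obtain ⟨e2, he2⟩ := hd2
  have hne1 : d1 ≠ 0 := left_ne_zero_of_mul hρ
  have hne2 : d2 ≠ 0 := by rw [he2] at hρ; exact left_ne_zero_of_mul hρ
  have c1 : t1 * P' = algebraMap R C e1 * (s1 * w) := by
    have : algebraMap R C d1 * (t1 * P' - algebraMap R C e1 * (s1 * w)) = 0 := by
      rw [mul_sub, ← mul_assoc, ← h1, mul_assoc, hP, map_mul]; ring
    exact sub_eq_zero.1 (nzd_of_flat hne1 this)
  have c2 : t2 * P' = algebraMap R C e2 * (s2 * w) := by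
    have : algebraMap R C d2 * (t2 * P' - algebraMap R C e2 * (s2 * w)) = 0 := by
      rw [mul_sub, ← mul_assoc, ← h2, mul_assoc, hP, he2, map_mul]; ring
    exact sub_eq_zero.1 (nzd_of_flat hne2 this)
  have ht2' : t2 ∉ q2 := by
    intro h
    have : s2 * v ∈ q2 := by have := sub_mem h ht2; rwa [sub_sub_cancel] at this
    rcases hq2.mem_or_mem this with h | h
    · exact hs2 h
    · exact hq2.ne_top (Ideal.eq_top_of_isUnit_mem _ h hv)
  obtain ⟨v', rfl⟩ := hv
  have H2 := edge_half q1 q2 hm1 hm2 hii P' e1 e2 t1 (s1 * w) t2 (↑v'⁻¹ * w) ht1 ht2' c1 (s2 * w) c2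
    (v'⁻¹.isUnit.mul hw) (by
      have := Ideal.mul_mem_left q2 (-(↑v'⁻¹ * w)) ht2
      rw [show -(↑v'⁻¹ * w) * (t2 - s2 * ↑v') = s2 * w * (↑v'⁻¹ * ↑v') - t2 * (↑v'⁻¹ * w) by ring] at this
      simpa using this)
  refine associated_of_dvd_dvd H1 ?_
  obtain ⟨y, rfl⟩ := H2
  refine ⟨y, mul_left_cancel₀ (right_ne_zero_of_mul hρ) ?_⟩
  linear_combination he2

/-- The edge lemma. -/
theorem edge {R C : Type*} [CommRing R] [IsDomain R] [IsLocalRing R] [IsNoetherianRing R]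
    [CommRing C] [IsLocalRing C] [IsNoetherianRing C] [Algebra R C] [Module.Flat R C]
    [IsLocalHom (algebraMap R C)] (q1 q2 : Ideal C) [hq1 : q1.IsPrime] [hq2 : q2.IsPrime]
    (hm1 : (maximalIdeal R).map (algebraMap R C) ≤ q1)
    (hm2 : (maximalIdeal R).map (algebraMap R C) ≤ q2)
    (hii : q1 ⊓ q2 ≤ (maximalIdeal R).map (algebraMap R C))
    (x1 x2 u : C) (b : R) (hb : b ≠ 0) (hu : IsUnit u) (hx : x1 * x2 = algebraMap R C b * u)
    (h12 : x2 ∉ q1) (h21 : x1 ∉ q2) (hmax : q2 ⊔ Ideal.span {x1} = maximalIdeal C)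
    (P P' : C) (ρ : R) (hρ : ρ ≠ 0) (hP : P * P' = algebraMap R C ρ)
    (d1 d2 : R) (hd1 : d1 ∣ ρ) (hd2 : d2 ∣ ρ)
    (s1 t1 s2 t2 : C) (hs1 : s1 ∉ q1) (ht1 : t1 ∉ q1) (hs2 : s2 ∉ q2) (ht2 : t2 ∉ q2)
    (h1 : s1 * P = algebraMap R C d1 * t1) (h2 : s2 * P = algebraMap R C d2 * t2) :
    ∃ e : ℕ, Associated (d1 * b ^ e) d2 ∨ Associated d1 (d2 * b ^ e) := by
  obtain ⟨i, v, hv, hi⟩ := exists_ord q2 x1 hmax s2 hs2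
  obtain ⟨j, v', hv', hj⟩ := exists_ord q2 x1 hmax t2 ht2
  obtain ⟨vi, rfl⟩ := hv
  rcases le_total i j with hij | hij
  · -- `t₂/s₂` has order `e = j - i ≥ 0`
    obtain ⟨e, rfl⟩ := Nat.exists_eq_add_of_le hij
    refine ⟨e, Or.inr ?_⟩
    refine edge_norm q1 q2 hm1 hm2 hii (P * x2 ^ e) (P' * x1 ^ e) (ρ * b ^ e)
      (mul_ne_zero hρ (pow_ne_zero _ hb)) (u ^ e) (hu.pow e) ?_ d1 (d2 * b ^ e)
      (hd1.mul_right _) (mul_dvd_mul_right hd2 _) s1 (t1 * x2 ^ e) (s2 * x1 ^ e) (t2 * u ^ e)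
      (↑vi⁻¹ * v' * u ^ e) hs1 ?_ ?_ ?_ ?_ ((vi⁻¹.isUnit.mul hv').mul (hu.pow e)) ?_
    · calc P * x2 ^ e * (P' * x1 ^ e) = (P * P') * (x1 * x2) ^ e := by ring
        _ = _ := by rw [hP, hx, map_mul, map_pow]; ring
    · exact fun h => (hq1.mem_or_mem h).elim ht1 fun h => h12 (hq1.mem_of_pow_mem _ h)
    · exact fun h => (hq2.mem_or_mem h).elim hs2 fun h => h21 (hq2.mem_of_pow_mem _ h)
    · calc s1 * (P * x2 ^ e) = (s1 * P) * x2 ^ e := by ring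
        _ = _ := by rw [h1]; ring
    · calc s2 * x1 ^ e * (P * x2 ^ e) = (s2 * P) * (x1 * x2) ^ e := by ring
        _ = _ := by rw [h2, hx, map_mul, map_pow]; ring
    · have e1 := Ideal.mul_mem_left q2 (u ^ e) hj
      have e2 := Ideal.mul_mem_left q2 (x1 ^ e * (↑vi⁻¹ * v' * u ^ e)) hi
      have := sub_mem e1 e2
      convert this using 1
      have h3 : (vi : C) * ↑vi⁻¹ = 1 := by simp
      linear_combination (- x1 ^ (i + e) * v' * u ^ e) * h3
  · obtain ⟨e, rfl⟩ := Nat.exists_eq_add_of_le hij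
    refine ⟨e, Or.inl ?_⟩
    refine edge_norm q1 q2 hm1 hm2 hii (P * x1 ^ e) (P' * x2 ^ e) (ρ * b ^ e)
      (mul_ne_zero hρ (pow_ne_zero _ hb)) (u ^ e) (hu.pow e) ?_ (d1 * b ^ e) d2
      (mul_dvd_mul_right hd1 _) (hd2.mul_right _) (s1 * x2 ^ e) (t1 * u ^ e) s2 (t2 * x1 ^ e)
      (↑vi⁻¹ * v') ?_ ?_ hs2 ?_ ?_ (vi⁻¹.isUnit.mul hv') ?_
    · calc P * x1 ^ e * (P' * x2 ^ e) = (P * P') * (x1 * x2) ^ e := by ring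
        _ = _ := by rw [hP, hx, map_mul, map_pow]; ring
    · exact fun h => (hq1.mem_or_mem h).elim hs1 fun h => h12 (hq1.mem_of_pow_mem _ h)
    · exact fun h => (hq1.mem_or_mem h).elim ht1 fun h =>
        hq1.ne_top (Ideal.eq_top_of_isUnit_mem _ h (hu.pow e))
    · calc s1 * x2 ^ e * (P * x1 ^ e) = (s1 * P) * (x1 * x2) ^ e := by ring
        _ = _ := by rw [h1, hx, map_mul, map_pow]; ring
    · calc s2 * (P * x1 ^ e) = (s2 * P) * x1 ^ e := by ring
        _ = _ := by rw [h2]; ring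
    · have e1 := Ideal.mul_mem_left q2 (x1 ^ e) hj
      have e2 := Ideal.mul_mem_left q2 (↑vi⁻¹ * v') hi
      have := sub_mem e1 e2
      convert this using 1
      have h3 : (vi : C) * ↑vi⁻¹ = 1 := by simp
      linear_combination (- x1 ^ (j + e) * v') * h3

end NeronSemistable
end

noncomputable section
namespace NeronSemistable

theorem etale_quot {W B C : Type*} [CommRing W] [CommRing B] [Algebra W B] [Algebra.Etale W B]
    [CommRing C] [Algebra B C] [Algebra W C] [IsScalarTower W B C] (P : Ideal B) [P.IsPrime]
    [IsLocalization.AtPrime C P] (I : Ideal W) [IsDomain (W ⧸ I)] [IsIntegrallyClosed (W ⧸ I)]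
    (hI : I.map (algebraMap W B) ≤ P) :
    (I.map (algebraMap W C)).IsPrime ∧
      ∀ a : W, algebraMap W C a ∈ I.map (algebraMap W C) → a ∈ I := by
  set J := I.map (algebraMap W B) with hJ
  have hJC : I.map (algebraMap W C) = J.map (algebraMap B C) := by
    rw [hJ, Ideal.map_map, ← IsScalarTower.algebraMap_eq]
  have het : Algebra.Etale (W ⧸ I) (B ⧸ J) :=
    Algebra.Etale.of_equiv (Algebra.TensorProduct.quotIdealMapEquivQuotTensor B I).symm
  let P' : Ideal (B ⧸ J) := P.map (Ideal.Quotient.mk J)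
  have hP' : P'.IsPrime := Ideal.map_isPrime_of_surjective Ideal.Quotient.mk_surjective
    (by simpa using hI)
  have hcom : P'.comap (Ideal.Quotient.mk J) = P := by
    rw [Ideal.comap_map_of_surjective _ Ideal.Quotient.mk_surjective]
    rw [← RingHom.ker_eq_comap_bot, Ideal.mk_ker]
    exact sup_eq_left.2 hI
  have hcompl : Algebra.algebraMapSubmonoid (B ⧸ J) P.primeCompl = P'.primeCompl := by
    have h1 := Ideal.map_primeCompl_comap_of_surjective (f := Ideal.Quotient.mk J)
      Ideal.Quotient.mk_surjective P'
    have h2 : ∀ (Q : Ideal B) [Q.IsPrime], Q = P →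
        Q.primeCompl.map (Ideal.Quotient.mk J) = P.primeCompl.map (Ideal.Quotient.mk J) := by
      rintro Q _ rfl; rfl
    rw [← h1, h2 _ hcom]; rfl
  letI iA : Algebra (W ⧸ I) (C ⧸ J.map (algebraMap B C)) :=
    ((algebraMap (B ⧸ J) (C ⧸ J.map (algebraMap B C))).comp (algebraMap (W ⧸ I) (B ⧸ J))).toAlgebra
  haveI : IsScalarTower (W ⧸ I) (B ⧸ J) (C ⧸ J.map (algebraMap B C)) :=
    IsScalarTower.of_algebraMap_eq' rfl
  have hloc : IsLocalization.AtPrime (C ⧸ J.map (algebraMap B C)) P' := by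
    have : IsLocalization (Algebra.algebraMapSubmonoid (B ⧸ J) P.primeCompl)
      (C ⧸ J.map (algebraMap B C)) := inferInstance
    rw [hcompl] at this
    exact this
  have hdom := chart_isDomain (R := W ⧸ I) (B := B ⧸ J) (C := C ⧸ J.map (algebraMap B C)) P'
  have hfl := flat_chart (R := W ⧸ I) (B := B ⧸ J) (C := C ⧸ J.map (algebraMap B C)) P'
  rw [hJC]
  refine ⟨(Ideal.Quotient.isDomain_iff_prime _).1 hdom, fun a ha => ?_⟩
  by_contra hne
  have h0 : (Ideal.Quotient.mk I a) ≠ 0 := by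
    rwa [Ne, Ideal.Quotient.eq_zero_iff_mem]
  have h1 := nzd_of_flat (B := C ⧸ J.map (algebraMap B C)) h0 (b := 1) (by
    rw [mul_one]
    have : algebraMap (W ⧸ I) (C ⧸ J.map (algebraMap B C)) (Ideal.Quotient.mk I a)
      = Ideal.Quotient.mk _ (algebraMap W C a) := by
      rw [IsScalarTower.algebraMap_apply W B C]; rfl
    rw [this, Ideal.Quotient.eq_zero_iff_mem]; exact ha)
  exact one_ne_zero h1

/-- The product of the first `l` coordinates in the standard model is `b`. -/
theorem std_prod (R : Type u) [CommRing R] (n l : ℕ) (b : R) :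
    (∏ i : Fin n, if (i : ℕ) < l then stdCoord R n l b i else 1) =
      algebraMap R (stdRing R n l b) b := by
  have h : Ideal.Quotient.mk (Ideal.span {(∏ i : Fin n,
      if (i : ℕ) < l then (MvPolynomial.X i : MvPolynomial (Fin n) R) else 1) -
      MvPolynomial.C b}) ((∏ i : Fin n,
      if (i : ℕ) < l then (MvPolynomial.X i : MvPolynomial (Fin n) R) else 1) -
      MvPolynomial.C b) = 0 :=
    Ideal.Quotient.eq_zero_iff_mem.2 (Ideal.subset_span rfl)
  rw [map_sub, sub_eq_zero, map_prod] at h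
  refine Eq.trans ?_ (h.trans rfl)
  refine Finset.prod_congr rfl fun i _ => ?_
  split_ifs <;> simp [stdCoord]

/-- Universal property of the standard model. -/
def stdLift {R E : Type*} [CommRing R] [CommRing E] [Algebra R E] (n l : ℕ) (b : R)
    (y : Fin n → E) (hy : (∏ i : Fin n, if (i : ℕ) < l then y i else 1) = algebraMap R E b) :
    stdRing R n l b →ₐ[R] E :=
  Ideal.Quotient.liftₐ _ (MvPolynomial.aeval y) (by
    intro a ha
    rw [Ideal.mem_span_singleton] at ha
    obtain ⟨c, rfl⟩ := ha
    rw [map_mul, map_sub, map_prod]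
    have : (∏ i : Fin n, MvPolynomial.aeval y
        (if (i : ℕ) < l then (MvPolynomial.X i : MvPolynomial (Fin n) R) else 1)) =
        algebraMap R E b := by
      rw [← hy]
      refine Finset.prod_congr rfl fun i _ => ?_
      split_ifs <;> simp
    rw [this, MvPolynomial.aeval_C, sub_self, zero_mul])

theorem stdLift_coord {R E : Type u} [CommRing R] [CommRing E] [Algebra R E] (n l : ℕ) (b : R)
    (y : Fin n → E) (hy : (∏ i : Fin n, if (i : ℕ) < l then y i else 1) = algebraMap R E b)
    (i : Fin n) : stdLift n l b y hy (stdCoord R n l b i) = y i := by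
  have : stdLift n l b y hy (stdCoord R n l b i) = MvPolynomial.aeval y
    (MvPolynomial.X i : MvPolynomial (Fin n) R) := rfl
  rw [this, MvPolynomial.aeval_X]

theorem std_ext {R E : Type u} [CommRing R] [CommRing E] (n l : ℕ) (b : R)
    (g h : stdRing R n l b →+* E)
    (h1 : ∀ r : R, g (algebraMap R _ r) = h (algebraMap R _ r))
    (h2 : ∀ i, g (stdCoord R n l b i) = h (stdCoord R n l b i)) : g = h := by
  apply Ideal.Quotient.ringHom_ext
  apply MvPolynomial.ringHom_ext
  · exact h1
  · exact h2

/-- the ideal generated by `𝔞` and some of the coordinates -/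
def stdIdeal {R : Type u} [CommRing R] (n l : ℕ) (b : R) (𝔞 : Ideal R) (s : Set (Fin n)) :
    Ideal (stdRing R n l b) :=
  𝔞.map (algebraMap R (stdRing R n l b)) ⊔ Ideal.span (stdCoord R n l b '' s)

open Classical in
theorem stdIdeal_equiv {R : Type u} [CommRing R] (n l : ℕ) (b : R) (𝔞 : Ideal R)
    (s : Set (Fin n)) (hb : b ∈ 𝔞) (j : Fin n) (hj : (j : ℕ) < l) (hjs : j ∈ s) :
    ∃ e : (stdRing R n l b ⧸ stdIdeal n l b 𝔞 s) ≃+* MvPolynomial {i : Fin n // i ∉ s} (R ⧸ 𝔞),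
      (∀ i (hi : i ∉ s), e (Ideal.Quotient.mk _ (stdCoord R n l b i)) = MvPolynomial.X ⟨i, hi⟩) ∧
      ∀ r, e (Ideal.Quotient.mk _ (algebraMap R _ r)) = MvPolynomial.C (Ideal.Quotient.mk 𝔞 r) := by
  let y : Fin n → MvPolynomial {i : Fin n // i ∉ s} (R ⧸ 𝔞) :=
    fun i => if h : i ∈ s then 0 else MvPolynomial.X ⟨i, h⟩
  have hy : (∏ i : Fin n, if (i : ℕ) < l then y i else 1) =
      algebraMap R (MvPolynomial {i : Fin n // i ∉ s} (R ⧸ 𝔞)) b := by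
    have h1 : algebraMap R (MvPolynomial {i : Fin n // i ∉ s} (R ⧸ 𝔞)) b = 0 := by
      rw [IsScalarTower.algebraMap_apply R (R ⧸ 𝔞), Ideal.Quotient.algebraMap_eq,
        Ideal.Quotient.eq_zero_iff_mem.2 hb, map_zero]
    rw [h1]
    apply Finset.prod_eq_zero (Finset.mem_univ j)
    simp [y, hj, hjs]
  let φ := stdLift n l b y hy
  have hφc : ∀ i, φ (stdCoord R n l b i) = y i := stdLift_coord n l b y hy
  have hφr : ∀ r, φ (algebraMap R _ r) = MvPolynomial.C (Ideal.Quotient.mk 𝔞 r) := fun r => by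
    rw [AlgHom.commutes]; rfl
  have hle : ∀ a ∈ stdIdeal n l b 𝔞 s, φ.toRingHom a = 0 := by
    have : stdIdeal n l b 𝔞 s ≤ RingHom.ker φ.toRingHom := by
      refine sup_le (Ideal.map_le_iff_le_comap.2 fun r hr => ?_) (Ideal.span_le.2 ?_)
      · change φ (algebraMap R _ r) = 0
        rw [hφr, Ideal.Quotient.eq_zero_iff_mem.2 hr, map_zero]
      · rintro _ ⟨i, hi, rfl⟩
        change φ _ = 0
        rw [hφc]; simp [y, hi]
    exact this
  let φ' := Ideal.Quotient.lift _ φ.toRingHom hle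
  have hφ' : ∀ w, φ' (Ideal.Quotient.mk _ w) = φ w := fun w => rfl
  let ψ : MvPolynomial {i : Fin n // i ∉ s} (R ⧸ 𝔞) →+*
      (stdRing R n l b ⧸ stdIdeal n l b 𝔞 s) :=
    MvPolynomial.eval₂Hom (Ideal.Quotient.lift 𝔞
      ((Ideal.Quotient.mk (stdIdeal n l b 𝔞 s)).comp (algebraMap R (stdRing R n l b)))
      (fun r hr => Ideal.Quotient.eq_zero_iff_mem.2
        (Ideal.mem_sup_left (Ideal.mem_map_of_mem _ hr))))
      (fun i => Ideal.Quotient.mk _ (stdCoord R n l b i.1))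
  have h1 : ψ.comp φ' = RingHom.id _ := by
    apply Ideal.Quotient.ringHom_ext
    refine std_ext (E := stdRing R n l b ⧸ stdIdeal n l b 𝔞 s) n l b _ _ ?_ ?_
    · intro r
      simp only [RingHom.comp_apply, hφ', RingHom.id_apply, hφr]
      simp only [ψ, MvPolynomial.coe_eval₂Hom, MvPolynomial.eval₂_C]
      rfl
    · intro i
      simp only [RingHom.comp_apply, hφ', RingHom.id_apply, hφc]
      by_cases hi : i ∈ s
      · simp only [y, hi, dif_pos, map_zero]
        symm
        exact Ideal.Quotient.eq_zero_iff_mem.2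
          (Ideal.mem_sup_right (Ideal.subset_span ⟨i, hi, rfl⟩))
      · simp only [y, hi, dif_neg, not_false_eq_true, ψ, MvPolynomial.coe_eval₂Hom,
          MvPolynomial.eval₂_X]
  have h2 : φ'.comp ψ = RingHom.id _ := by
    apply MvPolynomial.ringHom_ext
    · intro r
      obtain ⟨r, rfl⟩ := Ideal.Quotient.mk_surjective r
      simp only [ψ, RingHom.comp_apply, MvPolynomial.coe_eval₂Hom, MvPolynomial.eval₂_C]
      exact hφr r
    · intro i
      simp only [ψ, RingHom.comp_apply, MvPolynomial.coe_eval₂Hom, MvPolynomial.eval₂_X]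
      refine (hφc i.1).trans ?_
      simp [y, i.2]
  refine ⟨RingEquiv.ofRingHom φ' ψ h2 h1, fun i hi => ?_, fun r => ?_⟩
  · refine (hφc i).trans ?_
    simp [y, hi]
  · exact hφr r

theorem stdIdeal_facts {R : Type u} [CommRing R] (n l : ℕ) (b : R) (𝔞 : Ideal R)
    [IsDomain (R ⧸ 𝔞)] [IsIntegrallyClosed (R ⧸ 𝔞)]
    (s : Set (Fin n)) (hb : b ∈ 𝔞) (j : Fin n) (hj : (j : ℕ) < l) (hjs : j ∈ s) :
    IsDomain (stdRing R n l b ⧸ stdIdeal n l b 𝔞 s) ∧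
    IsIntegrallyClosed (stdRing R n l b ⧸ stdIdeal n l b 𝔞 s) ∧
    (∀ i ∉ s, stdCoord R n l b i ∉ stdIdeal n l b 𝔞 s) ∧
    (∀ r, algebraMap R _ r ∈ stdIdeal n l b 𝔞 s → r ∈ 𝔞) := by
  obtain ⟨e, he1, he2⟩ := stdIdeal_equiv n l b 𝔞 s hb j hj hjs
  have hd : IsDomain (stdRing R n l b ⧸ stdIdeal n l b 𝔞 s) :=
    MulEquiv.isDomain (MvPolynomial {i : Fin n // i ∉ s} (R ⧸ 𝔞)) e.toMulEquiv
  have := mvPoly_isIntegrallyClosed (R := R ⧸ 𝔞) (σ := {i : Fin n // i ∉ s})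
  refine ⟨hd, IsIntegrallyClosed.of_equiv e.symm, fun i hi hmem => ?_, fun r hr => ?_⟩
  · have := he1 i hi
    rw [Ideal.Quotient.eq_zero_iff_mem.2 hmem, map_zero] at this
    exact MvPolynomial.X_ne_zero _ this.symm
  · have := he2 r
    rw [Ideal.Quotient.eq_zero_iff_mem.2 hr, map_zero] at this
    have h3 := MvPolynomial.C_injective _ _ (this.symm.trans (map_zero _).symm)
    exact Ideal.Quotient.eq_zero_iff_mem.1 h3

open Classical in
theorem std_nzd {R : Type*} [CommRing R] (n l : ℕ) (hl : 0 < l) (hln : l ≤ n) (b : R) (I : Ideal R)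
    (h : MvPolynomial (Fin n) R)
    (hh : ((∏ i : Fin n, if (i : ℕ) < l then MvPolynomial.X i else 1) - MvPolynomial.C b) * h ∈
      I.map (MvPolynomial.C : R →+* MvPolynomial (Fin n) R)) :
    h ∈ I.map (MvPolynomial.C : R →+* MvPolynomial (Fin n) R) := by
  let δ : Fin n →₀ ℕ := ∑ i : Fin n, if (i : ℕ) < l then Finsupp.single i 1 else 0
  have hδ : (∏ i : Fin n, if (i : ℕ) < l then (MvPolynomial.X i : MvPolynomial (Fin n) R) else 1)
      = MvPolynomial.monomial δ 1 := by
    rw [MvPolynomial.monomial_sum_one]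
    refine Finset.prod_congr rfl fun i _ => ?_
    split_ifs <;> rfl
  have hdeg : 0 < δ.degree := by
    rw [map_sum]
    refine Finset.sum_pos' (fun _ _ => Nat.zero_le _) ⟨⟨0, by omega⟩, Finset.mem_univ _, ?_⟩
    simp [hl]
  rw [MvPolynomial.mem_map_C_iff] at hh ⊢
  by_contra hne
  push Not at hne
  obtain ⟨e0, he0⟩ := hne
  have hfin : (h.support.filter (fun e => h.coeff e ∉ I)).Nonempty := by
    refine ⟨e0, Finset.mem_filter.2 ⟨?_, he0⟩⟩
    rw [MvPolynomial.mem_support_iff]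
    intro h0; exact he0 (h0 ▸ I.zero_mem)
  obtain ⟨e, he, hmax⟩ := Finset.exists_max_image _ (fun e : Fin n →₀ ℕ => e.degree) hfin
  rw [Finset.mem_filter] at he
  have h1 := hh (δ + e)
  rw [hδ, sub_mul, MvPolynomial.coeff_sub, MvPolynomial.coeff_monomial_mul, one_mul,
    MvPolynomial.coeff_C_mul] at h1
  have h2 : h.coeff (δ + e) ∈ I := by
    by_contra hc
    have := hmax (δ + e) (Finset.mem_filter.2 ⟨MvPolynomial.mem_support_iff.2
      (fun h0 => hc (h0 ▸ I.zero_mem)), hc⟩)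
    rw [map_add] at this
    omega
  exact he.2 ((Submodule.sub_mem_iff_left I (I.mul_mem_left b h2)).1 h1)

theorem std_flat {R : Type u} [CommRing R] (n l : ℕ) (hl : 0 < l) (hln : l ≤ n) (b : R) :
    Module.Flat R (stdRing R n l b) := by
  apply Module.Flat.of_forall_isTrivialRelation
  intro m f x hx
  choose p hp using fun i => Ideal.Quotient.mk_surjective (x i)
  set g := (∏ i : Fin n, if (i : ℕ) < l then (MvPolynomial.X i : MvPolynomial (Fin n) R) else 1)
    - MvPolynomial.C b with hg
  have h0 : Ideal.Quotient.mk (Ideal.span {g}) (∑ i, f i • p i) = 0 := by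
    rw [map_sum, ← hx]
    refine Finset.sum_congr rfl fun i _ => ?_
    rw [← hp i]; rfl
  rw [Ideal.Quotient.eq_zero_iff_mem, Ideal.mem_span_singleton] at h0
  obtain ⟨h, hh⟩ := h0
  have hI : h ∈ (Ideal.span (Set.range f)).map (MvPolynomial.C : R →+* MvPolynomial (Fin n) R) := by
    apply std_nzd n l hl hln b
    rw [← hg, ← hh]
    refine Ideal.sum_mem _ fun i _ => ?_
    rw [Algebra.smul_def]
    exact Ideal.mul_mem_right _ _ (Ideal.mem_map_of_mem _ (Ideal.subset_span ⟨i, rfl⟩))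
  rw [Ideal.map_span, ← Set.range_comp, Ideal.mem_span_range_iff_exists_fun] at hI
  obtain ⟨c, hc⟩ := hI
  have hrel : ∑ i, f i • (p i - g * c i) = 0 := by
    simp only [smul_sub, Finset.sum_sub_distrib]
    rw [hh, ← hc, Finset.mul_sum, sub_eq_zero]
    refine Finset.sum_congr rfl fun i _ => ?_
    rw [Algebra.smul_def]; simp only [Function.comp, MvPolynomial.algebraMap_eq]; ring
  obtain ⟨κ, a, y, hy1, hy2⟩ := (Module.Flat.iff_forall_isTrivialRelation
    (R := R) (M := MvPolynomial (Fin n) R)).1 inferInstance hrel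
  refine ⟨κ, a, fun j => Ideal.Quotient.mk _ (y j), fun i => ?_, hy2⟩
  have := congrArg (Ideal.Quotient.mk (Ideal.span {g})) (hy1 i)
  rw [map_sub, map_mul, Ideal.Quotient.eq_zero_iff_mem.2 (Ideal.subset_span (Set.mem_singleton g)),
    zero_mul, sub_zero, hp, map_sum] at this
  rw [this]
  rfl

theorem std_flat' {R : Type u} [CommRing R] (n : ℕ) :
    Module.Flat R (stdRing R n 0 1) := by
  have : Ideal.span {(∏ i : Fin n, if (i : ℕ) < 0 then (MvPolynomial.X i : MvPolynomial (Fin n) R)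
    else 1) - MvPolynomial.C 1} = ⊥ := by simp
  have e : (MvPolynomial (Fin n) R) ≃ₐ[R] stdRing R n 0 1 :=
    ((AlgEquiv.quotientBot R (MvPolynomial (Fin n) R)).symm.trans
      (Ideal.quotientEquivAlgOfEq R this.symm))
  exact Module.Flat.of_linearEquiv e.symm.toLinearEquiv

/-- the extension of the maximal ideal of `D` -/
abbrev mExt (D C : Type*) [CommRing D] [IsLocalRing D] [CommRing C] [Algebra D C] : Ideal C :=
  (IsLocalRing.maximalIdeal D).map (algebraMap D C)

/-- Algebraic consequences of a local chart. -/
structure LocalChart (D C : Type*) [CommRing D] [IsLocalRing D] [CommRing C] [Algebra D C]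
    {ι : Type} [Fintype ι] (x : ι → C) (b : D) : Prop where
  ne : Nonempty ι
  hb : b ∈ IsLocalRing.maximalIdeal D
  prod : ∃ v, IsUnit v ∧ ∏ i, x i = algebraMap D C b * v
  prime1 : ∀ j, (mExt D C ⊔ Ideal.span {x j}).IsPrime
  notmem : ∀ i j, i ≠ j → x i ∉ mExt D C ⊔ Ideal.span {x j}
  prime2 : ∀ i j, i ≠ j → (mExt D C ⊔ Ideal.span {x i, x j}).IsPrime
  notmem2 : ∀ i j k, i ≠ j → k ≠ i → k ≠ j → x k ∉ mExt D C ⊔ Ideal.span {x i, x j}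

section
variable {D C : Type*} [CommRing D] [IsLocalRing D] [CommRing C] [Algebra D C]
    {ι : Type} [Fintype ι] {x : ι → C} {b : D}

/-- the prime `(m, x_j)` -/
abbrev lcq (D : Type*) {C : Type*} [CommRing D] [IsLocalRing D] [CommRing C] [Algebra D C]
    {ι : Type} (x : ι → C) (j : ι) : Ideal C := mExt D C ⊔ Ideal.span {x j}

theorem LocalChart.prod_mem (h : LocalChart D C x b) : ∏ i, x i ∈ mExt D C := by
  obtain ⟨v, _, hv⟩ := h.prod
  rw [hv]
  exact Ideal.mul_mem_right _ _ (Ideal.mem_map_of_mem _ h.hb)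

theorem LocalChart.exists_le (h : LocalChart D C x b) (Q : Ideal C) [Q.IsPrime]
    (hQ : mExt D C ≤ Q) : ∃ j, lcq D x j ≤ Q := by
  have h1 := hQ h.prod_mem
  obtain ⟨j, -, hj⟩ := (Ideal.IsPrime.prod_mem_iff (p := Q)).1 h1
  exact ⟨j, sup_le hQ (by rwa [Ideal.span_singleton_le_iff_mem])⟩

theorem LocalChart.inf_aux (h : LocalChart D C x b) (s : Finset ι) (y : C)
    (hy : ∀ j ∈ s, y ∈ lcq D x j) : y ∈ mExt D C ⊔ Ideal.span {∏ j ∈ s, x j} := by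
  classical
  induction s using Finset.induction_on generalizing y with
  | empty => simp
  | insert a s ha ih =>
    rw [Finset.prod_insert ha]
    have h1 := ih y (fun j hj => hy j (Finset.mem_insert_of_mem hj))
    obtain ⟨μ, hμ, w, hw, rfl⟩ := Submodule.mem_sup.1 h1
    obtain ⟨c, rfl⟩ := Ideal.mem_span_singleton'.1 hw
    have h2 := hy a (Finset.mem_insert_self _ _)
    have h3 : c * ∏ j ∈ s, x j ∈ lcq D x a := by
      have := sub_mem h2 ((le_sup_left : mExt D C ≤ lcq D x a) hμ)
      simpa using this
    have hp := h.prime1 a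
    rcases hp.mem_or_mem h3 with h4 | h4
    · obtain ⟨μ', hμ', w', hw', h5⟩ := Submodule.mem_sup.1 h4
      obtain ⟨c', rfl⟩ := Ideal.mem_span_singleton'.1 hw'
      rw [← h5]
      refine Submodule.mem_sup.2 ⟨μ + μ' * ∏ j ∈ s, x j, add_mem hμ (Ideal.mul_mem_right _ _ hμ'),
        c' * (x a * ∏ j ∈ s, x j), Ideal.mem_span_singleton'.2 ⟨_, rfl⟩, by ring⟩
    · exfalso
      obtain ⟨j, hj, hm⟩ := (Ideal.IsPrime.prod_mem_iff (p := lcq D x a)).1 h4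
      exact h.notmem j a (fun e => ha (e ▸ hj)) hm

theorem LocalChart.inf (h : LocalChart D C x b) (y : C) (hy : ∀ j, y ∈ lcq D x j) :
    y ∈ mExt D C := by
  have := h.inf_aux Finset.univ y (fun j _ => hy j)
  rwa [sup_eq_left.2] at this
  rw [Ideal.span_singleton_le_iff_mem]
  exact h.prod_mem

theorem LocalChart.eq_of_le (h : LocalChart D C x b) {i j : ι} (hle : lcq D x i ≤ lcq D x j) :
    i = j := by
  by_contra hne
  exact h.notmem i j hne (hle (Ideal.mem_sup_right (Ideal.mem_span_singleton_self _)))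

end

section
variable {D O C : Type*} [CommRing D] [IsLocalRing D] [CommRing O] [CommRing C] [Algebra D O]
    [Algebra D C] [Algebra O C] [IsScalarTower D O C] [Module.FaithfullyFlat O C]
    {ι : Type} [Fintype ι] {x : ι → C} {b : D}

theorem mem_of_ff {O C : Type*} [CommRing O] [CommRing C] [Algebra O C]
    [Module.FaithfullyFlat O C] (I : Ideal O) (y : O)
    (hy : algebraMap O C y ∈ I.map (algebraMap O C)) : y ∈ I := by
  have := Ideal.comap_map_eq_self_of_faithfullyFlat (A := O) (B := C) I
  rw [← this]; exact hy

theorem mExt_map (D O C : Type*) [CommRing D] [IsLocalRing D] [CommRing O] [CommRing C] [Algebra D O]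
    [Algebra D C] [Algebra O C] [IsScalarTower D O C] :
    (mExt D O).map (algebraMap O C) = mExt D C := by
  rw [Ideal.map_map, ← IsScalarTower.algebraMap_eq]

/-- every minimal prime over `mO` is the contraction of a `q_j`. -/
theorem LocalChart.exists_of_min (h : LocalChart D C x b) (Q : Ideal O)
    (hQ : Q ∈ (mExt D O).minimalPrimes) : ∃ j, (lcq D x j).comap (algebraMap O C) = Q := by
  have hQp : Q.IsPrime := hQ.1.1
  obtain ⟨Q', hQ'⟩ := PrimeSpectrum.comap_surjective_of_faithfullyFlat (A := O) (B := C) ⟨Q, hQp⟩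
  have e : Q'.asIdeal.comap (algebraMap O C) = Q := congrArg PrimeSpectrum.asIdeal hQ'
  have hp : Q'.asIdeal.IsPrime := Q'.2
  obtain ⟨j, hj⟩ := h.exists_le Q'.asIdeal (by
    rw [← mExt_map D O C, Ideal.map_le_iff_le_comap, e]; exact hQ.1.2)
  refine ⟨j, le_antisymm ?_ ?_⟩
  · rw [← e]; exact Ideal.comap_mono hj
  · have := h.prime1 j
    refine hQ.2 ⟨inferInstance, ?_⟩ ?_
    · rw [← Ideal.map_le_iff_le_comap, mExt_map]; exact le_sup_left
    · rw [← e]; exact Ideal.comap_mono hj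

theorem LocalChart.comap_min (h : LocalChart D C x b) (j : ι) :
    (lcq D x j).comap (algebraMap O C) ∈ (mExt D O).minimalPrimes := by
  have hp := h.prime1 j
  refine ⟨⟨inferInstance, ?_⟩, ?_⟩
  · rw [← Ideal.map_le_iff_le_comap, mExt_map]; exact le_sup_left
  · rintro Q ⟨hQp, hQm⟩ hle
    obtain ⟨Q', hle', hp', hlies⟩ := Ideal.exists_ideal_le_liesOver_of_le (p := Q)
      (q := (lcq D x j).comap (algebraMap O C)) (lcq D x j) hle
    have hc : Q'.comap (algebraMap O C) = Q := hlies.over.symm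
    obtain ⟨i, hi⟩ := h.exists_le Q' (by
      rw [← mExt_map D O C, Ideal.map_le_iff_le_comap, hc]; exact hQm)
    have := h.eq_of_le (hi.trans hle')
    subst this
    rw [← hc]; exact Ideal.comap_mono hi

theorem LocalChart.inf_O (h : LocalChart D C x b) (y : O)
    (hy : ∀ Q ∈ (mExt D O).minimalPrimes, y ∈ Q) : y ∈ mExt D O := by
  apply mem_of_ff (C := C)
  rw [mExt_map]
  apply h.inf
  intro j
  exact hy _ (h.comap_min j)
end

theorem LocalChart.mem_pow {A C : Type*} [CommRing A] [IsLocalRing A] [CommRing C] [Algebra A C]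
    {ι : Type} [Fintype ι] {x : ι → C} {b : A} (h : LocalChart A C x b) (t : A)
    (ht : IsLocalRing.maximalIdeal A = Ideal.span {t})
    (hreg : ∀ c : C, algebraMap A C t * c = 0 → c = 0) (L : ℕ) (y : C)
    (hy : ∀ j, ∃ s ∉ lcq A x j, algebraMap A C t ^ L ∣ s * y) : algebraMap A C t ^ L ∣ y := by
  have hm : mExt A C = Ideal.span {algebraMap A C t} := by
    rw [mExt, ht, Ideal.map_span, Set.image_singleton]
  have hreg' : ∀ (k : ℕ) (c d : C), algebraMap A C t ^ k * c = algebraMap A C t ^ k * d → c = d := by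
    intro k
    induction k with
    | zero => intro c d h; simpa using h
    | succ k ih =>
      intro c d h
      apply ih
      have := hreg (algebraMap A C t ^ k * c - algebraMap A C t ^ k * d) (by
        linear_combination h)
      exact sub_eq_zero.1 this
  induction L generalizing y with
  | zero => simp
  | succ L ih =>
    obtain ⟨y', rfl⟩ := ih y (fun j => by
      obtain ⟨s, hs, hd⟩ := hy j
      exact ⟨s, hs, (pow_dvd_pow _ (Nat.le_succ L)).trans hd⟩)
    have : y' ∈ mExt A C := by
      apply h.inf
      intro j
      obtain ⟨s, hs, e, he⟩ := hy j
      have hp := h.prime1 j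
      have h1 : s * y' = algebraMap A C t * e := hreg' L _ _ (by
        linear_combination he)
      have h2 : s * y' ∈ lcq A x j := by
        rw [h1]
        apply Ideal.mem_sup_left
        rw [hm]; exact Ideal.mul_mem_right _ _ (Ideal.mem_span_singleton_self _)
      exact (hp.mem_or_mem h2).resolve_left hs
    rw [hm, Ideal.mem_span_singleton] at this
    rw [pow_succ]
    exact mul_dvd_mul_left _ this

theorem local_principal {O C : Type*} [CommRing O] [CommRing C] [IsLocalRing C] [Algebra O C]
    [Module.FaithfullyFlat O C] (I : Ideal O) (F : C) (hF : ∀ c, F * c = 0 → c = 0)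
    (hI : I.map (algebraMap O C) = Ideal.span {F}) :
    ∃ a ∈ I, ∃ v, IsUnit v ∧ algebraMap O C a = F * v := by
  by_contra! hcon
  have key : I.map (algebraMap O C) ≤ Ideal.span {F} * IsLocalRing.maximalIdeal C := by
    rw [Ideal.map_le_iff_le_comap]
    intro a ha
    have : algebraMap O C a ∈ Ideal.span {F} := by rw [← hI]; exact Ideal.mem_map_of_mem _ ha
    obtain ⟨v, hv⟩ := Ideal.mem_span_singleton.1 this
    rw [Ideal.mem_comap, hv]
    apply Ideal.mul_mem_mul (Ideal.mem_span_singleton_self _)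
    rw [IsLocalRing.mem_maximalIdeal]
    intro hu
    exact hcon a ha v hu hv
  have h1 : F ∈ Ideal.span {F} * IsLocalRing.maximalIdeal C := key (by
    rw [hI]; exact Ideal.mem_span_singleton_self _)
  obtain ⟨m, hm, e⟩ := Ideal.mem_span_singleton_mul.1 h1
  have h2 := hF (m - 1) (by linear_combination e)
  have h3 : m = 1 := sub_eq_zero.1 h2
  rw [h3] at hm
  exact (Ideal.ne_top_iff_one _).1 (IsLocalRing.maximalIdeal.isMaximal C).ne_top hm

open Classical in
theorem local_cartier {A O C : Type*} [CommRing A] [IsLocalRing A] [CommRing O] [IsNoetherianRing O]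
    [CommRing C] [IsLocalRing C] [Algebra A O]
    [Algebra A C] [Algebra O C] [IsScalarTower A O C] [Module.FaithfullyFlat O C]
    {ι : Type} [Fintype ι] {x : ι → C} {b : A} (h : LocalChart A C x b) (t : A)
    (ht : IsLocalRing.maximalIdeal A = Ideal.span {t})
    (hreg : ∀ c : C, algebraMap A C t * c = 0 → c = 0)
    (κ : ℕ) (hκ : 0 < κ) (w : A) (hw : IsUnit w) (hb : b = t ^ κ * w) (e : ℕ)
    (S : Set (Ideal O)) :
    ∃ a a' : O, a * a' = algebraMap A O t ^ (κ * e) ∧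
      ∀ Q ∈ (mExt A O).minimalPrimes, (Q ∈ S → a' ∉ Q) ∧ (Q ∉ S → a ∉ Q) := by
  have hm : mExt A C = Ideal.span {algebraMap A C t} := by
    rw [mExt, ht, Ideal.map_span, Set.image_singleton]
  set τ := algebraMap A C t with hτ
  set L := κ * e with hL
  let J0 : Finset ι := Finset.univ.filter (fun j => (lcq A x j).comap (algebraMap O C) ∈ S)
  let F : C := ∏ j ∈ J0, x j ^ e
  let F' : C := ∏ j ∈ J0ᶜ, x j ^ e
  obtain ⟨v, hv, hprod⟩ := h.prod
  have hFF : F * F' = τ ^ L * (algebraMap A C w * v) ^ e := by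
    have : F * F' = (∏ j, x j) ^ e := by
      rw [← Finset.prod_pow, ← Finset.prod_mul_prod_compl J0]
    rw [this, hprod, hb, map_mul, map_pow, hL, pow_mul, ← mul_pow]; ring
  have hun : IsUnit ((algebraMap A C w * v) ^ e) := ((hw.map _).mul hv).pow e
  have hreg' : ∀ c, τ ^ L * c = 0 → c = 0 := by
    intro c
    have : ∀ (k : ℕ) (c : C), τ ^ k * c = 0 → c = 0 := by
      intro k
      induction k with
      | zero => intro c h; simpa using h
      | succ k ih => intro c h; apply hreg; apply ih; linear_combination h
    exact this L c
  have hregF : ∀ c, F * c = 0 → c = 0 := by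
    intro c hc
    apply hreg'
    apply (hun.mul_right_eq_zero).1
    have : (algebraMap A C w * v) ^ e * (τ ^ L * c) = F' * (F * c) := by
      linear_combination (-c) * hFF
    rw [this, hc, mul_zero]
  have hregF' : ∀ c, F' * c = 0 → c = 0 := by
    intro c hc
    apply hreg'
    apply (hun.mul_right_eq_zero).1
    have : (algebraMap A C w * v) ^ e * (τ ^ L * c) = F * (F' * c) := by
      linear_combination (-c) * hFF
    rw [this, hc, mul_zero]
  -- s_j
  let s : ι → C := fun j => ∏ i ∈ Finset.univ.erase j, x i
  have hs : ∀ j, s j ∉ lcq A x j := by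
    intro j hj
    have hp := h.prime1 j
    obtain ⟨i, hi, hm⟩ := (Ideal.IsPrime.prod_mem_iff (p := lcq A x j)).1 hj
    exact h.notmem i j (Finset.ne_of_mem_erase hi) hm
  have hsx : ∀ j, τ ^ κ ∣ s j * x j := by
    intro j
    have : s j * x j = ∏ i, x i := by
      rw [mul_comm]; exact Finset.mul_prod_erase _ _ (Finset.mem_univ j)
    rw [this, hprod, hb, map_mul, map_pow]
    exact ⟨algebraMap A C w * v, by ring⟩
  have hsxe : ∀ j, τ ^ L ∣ s j ^ e * x j ^ e := by
    intro j
    rw [← mul_pow, hL, pow_mul]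
    exact pow_dvd_pow_of_dvd (hsx j) e
  have hsc : ∀ j c, c ∈ lcq A x j → τ ∣ s j * c := by
    intro j c hc
    obtain ⟨μ, hμ, y, hy, rfl⟩ := Submodule.mem_sup.1 hc
    rw [hm, Ideal.mem_span_singleton] at hμ
    rw [Ideal.mem_span_singleton] at hy
    rw [mul_add]
    refine dvd_add (hμ.mul_left _) ?_
    obtain ⟨y', rfl⟩ := hy
    rw [← mul_assoc]
    exact ((dvd_pow_self τ hκ.ne').trans (hsx j)).mul_right _
  -- prime avoidance
  obtain ⟨c, hc1, hc2⟩ : ∃ c : O, (∀ j ∉ J0, algebraMap O C c ∈ lcq A x j) ∧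
      ∀ j ∈ J0, algebraMap O C c ∉ lcq A x j := by
    let I : Ideal O := J0ᶜ.inf (fun j => (lcq A x j).comap (algebraMap O C))
    have hnot : ¬ ((I : Set O) ⊆ ⋃ j ∈ (J0 : Set ι), ((lcq A x j).comap (algebraMap O C) : Set O)) := by
      intro hsub
      have hpr : ∀ i, ((lcq A x i).comap (algebraMap O C)).IsPrime := fun i => by
        have := h.prime1 i
        infer_instance
      obtain ⟨j, hj, hle⟩ := (Ideal.subset_union_prime (s := J0)
        (f := fun j => (lcq A x j).comap (algebraMap O C)) (h.ne.some) (h.ne.some)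
        (fun i _ _ _ => hpr i)).1 hsub
      have := hpr j
      obtain ⟨i, hi, hle'⟩ := ((hpr j).inf_le').1 hle
      have e1 := (h.comap_min (O := O) j).2 (h.comap_min (O := O) i).1 hle'
      have e2 : (lcq A x i).comap (algebraMap O C) = (lcq A x j).comap (algebraMap O C) :=
        le_antisymm hle' e1
      rw [Finset.mem_compl] at hi
      apply hi
      simp only [J0, Finset.mem_filter, Finset.mem_univ, true_and] at hj ⊢
      rw [e2]; exact hj
    rw [Set.not_subset] at hnot
    obtain ⟨c, hc, hc'⟩ := hnot
    refine ⟨c, fun j hj => ?_, fun j hj hm => hc' ?_⟩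
    · have : c ∈ I := hc
      have := (Finset.inf_le (f := fun j => (lcq A x j).comap (algebraMap O C))
        (Finset.mem_compl.2 hj)) this
      exact this
    · simp only [Set.mem_iUnion]
      exact ⟨j, hj, hm⟩
  set γ := algebraMap O C c with hγ
  have hFc : τ ^ L ∣ F * γ ^ L := by
    apply h.mem_pow t ht hreg
    intro j
    have hp := h.prime1 j
    by_cases hj : j ∈ J0
    · refine ⟨s j ^ e, fun hh => hs j (hp.mem_of_pow_mem _ hh), ?_⟩
      have : x j ^ e ∣ F := Finset.dvd_prod_of_mem _ hj
      rw [← mul_assoc]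
      exact ((hsxe j).trans (mul_dvd_mul_left _ this)).mul_right _
    · refine ⟨s j ^ L, fun hh => hs j (hp.mem_of_pow_mem _ hh), ?_⟩
      have : s j ^ L * (F * γ ^ L) = (s j * γ) ^ L * F := by ring
      rw [this]
      exact (pow_dvd_pow_of_dvd (hsc j γ (hc1 j hj)) L).mul_right _
  have hcF : ∀ y, τ ^ L ∣ γ ^ L * y → F ∣ y := by
    intro y hy
    have h1 : τ ^ L ∣ y * F' := by
      apply h.mem_pow t ht hreg
      intro j
      have hp := h.prime1 j
      by_cases hj : j ∈ J0
      · refine ⟨γ ^ L, fun hh => hc2 j hj (hp.mem_of_pow_mem _ hh), ?_⟩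
        rw [← mul_assoc]; exact hy.mul_right _
      · refine ⟨s j ^ e, fun hh => hs j (hp.mem_of_pow_mem _ hh), ?_⟩
        have : x j ^ e ∣ F' := Finset.dvd_prod_of_mem (fun j => x j ^ e) (Finset.mem_compl.2 hj)
        have h2 := ((hsxe j).trans (mul_dvd_mul_left _ this)).mul_left y
        convert h2 using 1; ring
    obtain ⟨g, hg⟩ := h1
    obtain ⟨un, hun'⟩ := hun
    have h3 : F' * (y - F * (↑un⁻¹ * g)) = 0 := by
      have h4 : (un : C) * ↑un⁻¹ = 1 := un.mul_inv
      have h5 : F * F' = τ ^ L * (un : C) := by rw [hFF, hun']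
      linear_combination hg - (↑un⁻¹ * g) * h5 - τ ^ L * g * h4
    exact ⟨_, sub_eq_zero.1 (hregF' _ h3)⟩
  let I : Ideal O := colonI (Ideal.span {algebraMap A O t ^ L}) (c ^ L)
  have hmap : (Ideal.span {algebraMap A O t ^ L}).map (algebraMap O C) = Ideal.span {τ ^ L} := by
    rw [Ideal.map_span, Set.image_singleton, map_pow, ← IsScalarTower.algebraMap_apply]
  have hI : I.map (algebraMap O C) = Ideal.span {F} := by
    apply le_antisymm
    · rw [Ideal.map_le_iff_le_comap]
      intro a ha
      rw [Ideal.mem_comap, Ideal.mem_span_singleton]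
      apply hcF
      have h1 := Ideal.mem_map_of_mem (algebraMap O C) (mem_colonI.1 ha)
      rw [hmap, Ideal.mem_span_singleton, map_mul, map_pow] at h1
      rwa [mul_comm]
    · rw [Ideal.span_singleton_le_iff_mem]
      apply flat_colon
      rw [hmap, Ideal.mem_span_singleton, map_pow, mul_comm]
      exact hFc
  obtain ⟨a, ha, v', hv', hav⟩ := local_principal I F hregF hI
  have htl : algebraMap A O t ^ L ∈ Ideal.span {a} := by
    apply mem_of_ff (C := C)
    rw [Ideal.map_span, Set.image_singleton, Ideal.mem_span_singleton, hav, map_pow,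
      ← IsScalarTower.algebraMap_apply, hv'.mul_right_dvd]
    obtain ⟨un, hun'⟩ := hun
    refine ⟨F' * ↑un⁻¹, ?_⟩
    rw [← mul_assoc, hFF, ← hun', mul_assoc, un.mul_inv, mul_one]
  obtain ⟨a', ha'⟩ := Ideal.mem_span_singleton.1 htl
  refine ⟨a, a', ha'.symm, fun Q hQ => ?_⟩
  obtain ⟨j, rfl⟩ := h.exists_of_min Q hQ
  have hp := h.prime1 j
  have hnot : ∀ (T : Finset ι), j ∉ T → ∏ i ∈ T, x i ^ e ∉ lcq A x j := by
    intro T hj hmem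
    obtain ⟨i, hi, hm⟩ := (Ideal.IsPrime.prod_mem_iff (p := lcq A x j)).1 hmem
    exact h.notmem i j (fun e => hj (e ▸ hi)) (hp.mem_of_pow_mem _ hm)
  constructor
  · intro hS hmem
    have hj : j ∈ J0 := by simp only [J0, Finset.mem_filter, Finset.mem_univ, true_and]; exact hS
    apply hnot J0ᶜ (by simpa using hj)
    have h1 : F * F' = F * (v' * algebraMap O C a' * (algebraMap A C w * v) ^ e) := by
      rw [hFF]
      have : algebraMap O C a * algebraMap O C a' = τ ^ L := by
        rw [← map_mul, ← ha', map_pow, ← IsScalarTower.algebraMap_apply]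
      rw [← this, hav]; ring
    have h2 := hregF (F' - v' * algebraMap O C a' * (algebraMap A C w * v) ^ e) (by
      linear_combination h1)
    change F' ∈ _
    rw [sub_eq_zero.1 h2]
    exact Ideal.mul_mem_right _ _ (Ideal.mul_mem_left _ _ hmem)
  · intro hS hmem
    have hj : j ∉ J0 := by simp only [J0, Finset.mem_filter, Finset.mem_univ, true_and]; exact hS
    apply hnot J0 hj
    rw [Ideal.mem_comap, hav] at hmem
    exact (hp.mem_or_mem hmem).resolve_right (fun hh => hp.ne_top (Ideal.eq_top_of_isUnit_mem _ hh hv'))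

theorem lc_edge {R C : Type*} [CommRing R] [IsDomain R] [IsLocalRing R] [IsNoetherianRing R]
    [CommRing C] [IsNoetherianRing C] [Algebra R C] [Module.Flat R C]
    {ι : Type} [Fintype ι] {x : ι → C} {b : R} (h : LocalChart R C x b) (hb : b ≠ 0)
    (i j : ι) (hij : i ≠ j) (P P' : C) (ρ : R) (hρ : ρ ≠ 0) (hP : P * P' = algebraMap R C ρ)
    (d1 d2 : R) (hd1 : d1 ∣ ρ) (hd2 : d2 ∣ ρ) (s1 t1 s2 t2 : C)
    (hs1 : s1 ∉ lcq R x i) (ht1 : t1 ∉ lcq R x i) (hs2 : s2 ∉ lcq R x j) (ht2 : t2 ∉ lcq R x j)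
    (h1 : s1 * P = algebraMap R C d1 * t1) (h2 : s2 * P = algebraMap R C d2 * t2) :
    ∃ e, Associated (d1 * b ^ e) d2 ∨ Associated d1 (d2 * b ^ e) := by
  classical
  let Q : Ideal C := mExt R C ⊔ Ideal.span {x i, x j}
  have hQ : Q.IsPrime := h.prime2 i j hij
  let C' := Localization.AtPrime Q
  have hqi := h.prime1 i
  have hqj := h.prime1 j
  have hmi : x i ∈ Q := Ideal.mem_sup_right (Ideal.subset_span (by simp))
  have hmj : x j ∈ Q := Ideal.mem_sup_right (Ideal.subset_span (by simp))
  have hle : ∀ k, x k ∈ Q → lcq R x k ≤ Q := fun k hk =>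
    sup_le le_sup_left (by rwa [Ideal.span_singleton_le_iff_mem])
  have hdis : ∀ k, x k ∈ Q → Disjoint (Q.primeCompl : Set C) (lcq R x k) := fun k hk => by
    rw [Set.disjoint_left]
    intro a ha ha'
    exact ha (hle k hk ha')
  let q1 : Ideal C' := (lcq R x i).map (algebraMap C C')
  let q2 : Ideal C' := (lcq R x j).map (algebraMap C C')
  have hq1 : q1.IsPrime := IsLocalization.isPrime_of_isPrime_disjoint Q.primeCompl _ _ hqi (hdis i hmi)
  have hq2 : q2.IsPrime := IsLocalization.isPrime_of_isPrime_disjoint Q.primeCompl _ _ hqj (hdis j hmj)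
  have hc1 : q1.comap (algebraMap C C') = lcq R x i :=
    IsLocalization.under_map_of_isPrime_disjoint Q.primeCompl _ hqi (hdis i hmi)
  have hc2 : q2.comap (algebraMap C C') = lcq R x j :=
    IsLocalization.under_map_of_isPrime_disjoint Q.primeCompl _ hqj (hdis j hmj)
  have hn1 : ∀ a, a ∉ lcq R x i → algebraMap C C' a ∉ q1 := fun a ha hh => ha (by rw [← hc1]; exact hh)
  have hn2 : ∀ a, a ∉ lcq R x j → algebraMap C C' a ∉ q2 := fun a ha hh => ha (by rw [← hc2]; exact hh)
  have hflat : Module.Flat R C' := flat_chart (B := C) Q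
  have hmap : ∀ a : R, algebraMap R C' a = algebraMap C C' (algebraMap R C a) :=
    fun a => IsScalarTower.algebraMap_apply R C C' a
  have hmm : mExt R C' = (mExt R C).map (algebraMap C C') := (mExt_map R C C').symm
  have hmaxC' : IsLocalRing.maximalIdeal C' = Q.map (algebraMap C C') :=
    (Localization.AtPrime.map_eq_maximalIdeal).symm
  have hloc : IsLocalHom (algebraMap R C') := by
    constructor
    intro a ha
    by_contra hna
    have : algebraMap R C' a ∈ IsLocalRing.maximalIdeal C' := by
      rw [hmaxC', hmap]
      apply Ideal.mem_map_of_mem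
      exact Ideal.mem_sup_left (Ideal.mem_map_of_mem _ ((IsLocalRing.mem_maximalIdeal a).2 hna))
    exact (IsLocalRing.mem_maximalIdeal _).1 this ha
  obtain ⟨v, hv, hprod⟩ := h.prod
  let o : C := ∏ k ∈ (Finset.univ.erase i).erase j, x k
  have ho : o ∉ Q := by
    intro hmem
    obtain ⟨k, hk, hkm⟩ := (Ideal.IsPrime.prod_mem_iff (p := Q)).1 hmem
    simp only [Finset.mem_erase, Finset.mem_univ, and_true] at hk
    exact h.notmem2 i j k hij hk.2 hk.1 hkm
  have hxo : x i * x j * o = algebraMap R C b * v := by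
    rw [← hprod, mul_assoc]
    rw [Finset.mul_prod_erase (Finset.univ.erase i) x (Finset.mem_erase.2 ⟨hij.symm, Finset.mem_univ _⟩),
      Finset.mul_prod_erase _ _ (Finset.mem_univ i)]
  have hou : IsUnit (algebraMap C C' o) := IsLocalization.map_units C' (⟨o, ho⟩ : Q.primeCompl)
  obtain ⟨ou, hou'⟩ := hou
  have hx : algebraMap C C' (x i) * algebraMap C C' (x j) =
      algebraMap R C' b * (algebraMap C C' v * ↑ou⁻¹) := by
    have := congrArg (algebraMap C C') hxo
    simp only [map_mul] at this
    rw [hmap]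
    have h4 : (ou : C') * ↑ou⁻¹ = 1 := ou.mul_inv
    rw [← hou'] at this
    linear_combination ↑ou⁻¹ * this - (algebraMap C C' (x i) * algebraMap C C' (x j)) * h4
  refine edge (C := C') q1 q2 (hmm.le.trans (Ideal.map_mono le_sup_left))
    (hmm.le.trans (Ideal.map_mono le_sup_left)) ?_ (algebraMap C C' (x i)) (algebraMap C C' (x j))
    (algebraMap C C' v * ↑ou⁻¹) b hb ((hv.map _).mul ou⁻¹.isUnit) hx
    (hn1 _ (h.notmem j i hij.symm)) (hn2 _ (h.notmem i j hij)) ?_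
    (algebraMap C C' P) (algebraMap C C' P') ρ hρ (by rw [← map_mul, hP, ← hmap])
    d1 d2 hd1 hd2 (algebraMap C C' s1) (algebraMap C C' t1) (algebraMap C C' s2) (algebraMap C C' t2)
    (hn1 _ hs1) (hn1 _ ht1) (hn2 _ hs2) (hn2 _ ht2)
    (by rw [← map_mul, h1, map_mul, ← hmap]) (by rw [← map_mul, h2, map_mul, ← hmap])
  · rintro y ⟨hy1, hy2⟩
    obtain ⟨a, s, rfl⟩ := IsLocalization.exists_mk'_eq Q.primeCompl y
    have hs : IsUnit (algebraMap C C' s) := IsLocalization.map_units C' s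
    have hspec : IsLocalization.mk' C' a s * algebraMap C C' s = algebraMap C C' a :=
      IsLocalization.mk'_spec _ _ _
    have ha1 : a ∈ lcq R x i := by
      rw [← hc1, Ideal.mem_comap, ← hspec]; exact Ideal.mul_mem_right _ _ hy1
    have ha2 : a ∈ lcq R x j := by
      rw [← hc2, Ideal.mem_comap, ← hspec]; exact Ideal.mul_mem_right _ _ hy2
    have ha := h.inf_aux {i, j} a (by
      intro k hk
      simp only [Finset.mem_insert, Finset.mem_singleton] at hk
      rcases hk with rfl | rfl <;> assumption)
    rw [Finset.prod_pair hij] at ha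
    have : algebraMap C C' a ∈ mExt R C' := by
      have h3 := Ideal.mem_map_of_mem (algebraMap C C') ha
      rw [Ideal.map_sup, ← hmm, Ideal.map_span, Set.image_singleton, map_mul, hx] at h3
      refine (sup_le le_rfl ?_ : mExt R C' ⊔ _ ≤ mExt R C') h3
      rw [Ideal.span_singleton_le_iff_mem]
      exact Ideal.mul_mem_right _ _ (Ideal.mem_map_of_mem _ h.hb)
    rw [← hspec] at this
    exact (Ideal.mul_unit_mem_iff_mem _ hs).1 this
  · rw [hmaxC']
    have : Q = lcq R x j ⊔ Ideal.span {x i} := by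
      simp only [Q, lcq]
      rw [Ideal.span_insert, sup_assoc, sup_comm (Ideal.span {x i})]
    refine Eq.trans ?_ (congrArg (Ideal.map (algebraMap C C')) this).symm
    rw [Ideal.map_sup, Ideal.map_span, Set.image_singleton]

/-- comparison of two charts of the same ring -/
theorem lc_compare {R C : Type*} [CommRing R] [IsDomain R] [IsLocalRing R] [IsNoetherianRing R]
    [CommRing C] [IsNoetherianRing C] [Algebra R C] [Module.Flat R C]
    {ι ι' : Type} [Fintype ι] [Fintype ι'] {x : ι → C} {x' : ι' → C} {b b' : R}
    (h : LocalChart R C x b) (h' : LocalChart R C x' b') (hb : b ≠ 0) (hb' : b' ≠ 0)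
    (i j : ι) (hij : i ≠ j) : ∃ e, 0 < e ∧ Associated b' (b ^ e) := by
  classical
  have key : ∀ k : ι, ∃ a : ι', lcq R x' a = lcq R x k := by
    intro k
    have hp := h.prime1 k
    obtain ⟨a, ha⟩ := h'.exists_le (lcq R x k) le_sup_left
    have hpa := h'.prime1 a
    obtain ⟨k', hk'⟩ := h.exists_le (lcq R x' a) le_sup_left
    have := h.eq_of_le (hk'.trans ha)
    subst this
    exact ⟨a, le_antisymm ha hk'⟩
  obtain ⟨a, ha⟩ := key i
  obtain ⟨a2, ha2⟩ := key j
  have hne : a ≠ a2 := by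
    rintro rfl
    exact hij (h.eq_of_le (ha.symm.trans ha2).le)
  obtain ⟨v, hv, hprod⟩ := h'.prod
  obtain ⟨v, rfl⟩ := hv
  have hpa := h'.prime1 a
  let o : C := ∏ k ∈ Finset.univ.erase a, x' k
  have ho : o ∉ lcq R x i := by
    intro hmem
    rw [← ha] at hmem
    obtain ⟨k, hk, hkm⟩ := (Ideal.IsPrime.prod_mem_iff (p := lcq R x' a)).1 hmem
    exact h'.notmem k a (Finset.ne_of_mem_erase hk) hkm
  have hxo : x' a * o = algebraMap R C b' * v := by
    rw [← hprod]; exact Finset.mul_prod_erase _ _ (Finset.mem_univ a)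
  have hpi := h.prime1 i
  have hunit : (v : C) ∉ lcq R x i := fun hh => hpi.ne_top (Ideal.eq_top_of_isUnit_mem _ hh v.isUnit)
  have hpj := h.prime1 j
  obtain ⟨e, he⟩ := lc_edge h hb i j hij (x' a) (o * ↑v⁻¹) b' hb'
    (by rw [← mul_assoc, hxo, mul_assoc, v.mul_inv, mul_one]) b' 1 dvd_rfl (one_dvd _)
    o v 1 (x' a) ho hunit ((Ideal.ne_top_iff_one _).1 hpj.ne_top)
    (by rw [← ha2]; exact h'.notmem a a2 hne) (by rw [mul_comm, hxo]) (by simp)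
  have hb'm : ¬ IsUnit b' := (IsLocalRing.mem_maximalIdeal _).1 h'.hb
  rcases he with he | he
  · exact (hb'm (isUnit_of_dvd_unit (dvd_mul_right _ _) (he.isUnit_iff.2 isUnit_one))).elim
  · rw [one_mul] at he
    refine ⟨e, Nat.pos_of_ne_zero ?_, he⟩
    rintro rfl
    rw [pow_zero] at he
    exact hb'm (he.isUnit_iff.2 isUnit_one)

open MvPolynomial in
theorem typeS_aux (R : Type u) [CommRing R] (n l : ℕ) (b : R) (j : Fin (n + 1)) (hj : (j : ℕ) < l)
    (E : Type u) [CommRing E] [Algebra (stdRing R (n+1) l b) E]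
    [IsLocalization.Away (∏ i : Fin n, if ((j.succAbove i : Fin (n+1)) : ℕ) < l then
      stdCoord R (n+1) l b (j.succAbove i) else 1) E] :
    ∃ φ : MvPolynomial (Fin n) R →+* E, φ.Etale ∧
      φ.comp MvPolynomial.C = (algebraMap (stdRing R (n+1) l b) E).comp (algebraMap R _) := by
  let W := stdRing R (n+1) l b
  let π0 : MvPolynomial (Fin n) R := ∏ i : Fin n, if ((j.succAbove i : Fin (n+1)) : ℕ) < l then X i else 1
  set π : W := ∏ i : Fin n, if ((j.succAbove i : Fin (n+1)) : ℕ) < l then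
      stdCoord R (n+1) l b (j.succAbove i) else 1 with hπ
  let E0 := Localization.Away π0
  let iE : Algebra R E := ((algebraMap W E).comp (algebraMap R W)).toAlgebra
  let α : MvPolynomial (Fin n) R →ₐ[R] E :=
    aeval (fun i => algebraMap W E (stdCoord R (n+1) l b (j.succAbove i)))
  have hαπ : α π0 = algebraMap W E π := by
    simp only [π0, hπ, map_prod]
    refine Finset.prod_congr rfl fun i _ => ?_
    split_ifs
    · simp [α]
    · simp
  have hαu : IsUnit (α.toRingHom π0) := by
    change IsUnit (α π0)
    rw [hαπ]; exact IsLocalization.Away.algebraMap_isUnit π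
  let α' : E0 →+* E := IsLocalization.Away.lift π0 hαu
  have hα' : ∀ p, α' (algebraMap _ E0 p) = α p := fun p => IsLocalization.Away.lift_eq π0 hαu p
  let y : Fin (n+1) → E0 := j.insertNth (IsLocalization.Away.invSelf π0 * algebraMap R E0 b)
    (fun i => algebraMap (MvPolynomial (Fin n) R) E0 (X i))
  have hyj : y j = IsLocalization.Away.invSelf π0 * algebraMap R E0 b := by simp [y]
  have hys : ∀ i, y (j.succAbove i) = algebraMap (MvPolynomial (Fin n) R) E0 (X i) := by
    intro i; simp [y]
  have hinv : algebraMap (MvPolynomial (Fin n) R) E0 π0 * IsLocalization.Away.invSelf π0 = 1 :=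
    IsLocalization.Away.mul_invSelf π0
  have hyp : (∏ i : Fin n, if ((j.succAbove i : Fin (n+1)) : ℕ) < l then y (j.succAbove i) else 1) =
      algebraMap _ E0 π0 := by
    simp only [π0, map_prod]
    refine Finset.prod_congr rfl fun i _ => ?_
    split_ifs
    · exact hys i
    · simp
  have hy : (∏ i : Fin (n+1), if (i : ℕ) < l then y i else 1) = algebraMap R E0 b := by
    rw [Fin.prod_univ_succAbove _ j, if_pos hj, hyp, hyj]
    linear_combination (algebraMap R E0 b) * hinv
  let β : W →ₐ[R] E0 := stdLift (n+1) l b y hy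
  have hβc : ∀ i, β (stdCoord R (n+1) l b i) = y i := fun i => stdLift_coord _ _ _ _ _ _
  have hβπ : β π = algebraMap _ E0 π0 := by
    rw [← hyp, hπ, map_prod]
    refine Finset.prod_congr rfl fun i _ => ?_
    split_ifs
    · exact hβc _
    · simp
  have hβu : IsUnit (β.toRingHom π) := by
    change IsUnit (β π)
    rw [hβπ]; exact IsLocalization.Away.algebraMap_isUnit π0
  let β' : E →+* E0 := IsLocalization.Away.lift π hβu
  have hβ' : ∀ p, β' (algebraMap W E p) = β p := fun p => IsLocalization.Away.lift_eq π hβu p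
  have c1 : β'.comp α' = RingHom.id E0 := by
    apply IsLocalization.ringHom_ext (Submonoid.powers π0)
    apply MvPolynomial.ringHom_ext
    · intro r
      simp only [RingHom.comp_apply, RingHom.id_apply, hα']
      have : α (MvPolynomial.C r) = algebraMap W E (algebraMap R W r) := by
        change α (algebraMap R _ r) = _
        rw [α.commutes]; rfl
      rw [this, hβ', β.commutes]; rfl
    · intro i
      simp only [RingHom.comp_apply, RingHom.id_apply, hα']
      have : α (X i) = algebraMap W E (stdCoord R (n+1) l b (j.succAbove i)) := by simp [α]
      rw [this, hβ', hβc, hys]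
  have hstd := std_prod R (n+1) l b
  rw [Fin.prod_univ_succAbove _ j, if_pos hj, ← hπ] at hstd
  have c2 : α'.comp β' = RingHom.id E := by
    apply IsLocalization.ringHom_ext (Submonoid.powers π)
    apply std_ext (E := E)
    · intro r
      simp only [RingHom.comp_apply, RingHom.id_apply, hβ']
      rw [β.commutes]
      have : algebraMap R E0 r = algebraMap (MvPolynomial (Fin n) R) E0 (algebraMap R _ r) :=
        IsScalarTower.algebraMap_apply _ _ _ _
      rw [this, hα', α.commutes]; rfl
    · intro i
      simp only [RingHom.comp_apply, RingHom.id_apply, hβ', hβc]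
      rcases Fin.eq_self_or_eq_succAbove j i with rfl | ⟨k, rfl⟩
      · have hu : IsUnit (algebraMap W E π) := IsLocalization.Away.algebraMap_isUnit π
        apply hu.mul_left_cancel
        have h1 : algebraMap W E π * α' (IsLocalization.Away.invSelf π0) = 1 := by
          rw [← hαπ, ← hα', ← map_mul, hinv, map_one]
        have h2 : α' (algebraMap R E0 b) = algebraMap W E (algebraMap R W b) := by
          have : algebraMap R E0 b = algebraMap (MvPolynomial (Fin n) R) E0 (algebraMap R _ b) :=
            IsScalarTower.algebraMap_apply _ _ _ _
          rw [this, hα', α.commutes]; rfl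
        rw [hyj, map_mul, h2, ← map_mul (algebraMap W E) π, mul_comm π, hstd]
        linear_combination (algebraMap W E (algebraMap R W b)) * h1
      · rw [hys, hα']; simp [α]
  have hbij : Function.Bijective α' := ⟨fun a b hab => by
      have := congrArg β' hab
      rwa [← RingHom.comp_apply, ← RingHom.comp_apply, c1] at this,
    fun a => ⟨β' a, by rw [← RingHom.comp_apply, c2]; rfl⟩⟩
  refine ⟨α'.comp (algebraMap _ E0), ?_, ?_⟩
  · refine RingHom.Etale.stableUnderComposition _ _ ?_ (RingHom.Etale.of_bijective hbij)
    change RingHom.Etale _; rw [RingHom.etale_algebraMap]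
    exact Algebra.Etale.of_isLocalizationAway π0
  · ext r
    simp only [RingHom.comp_apply, hα']
    change α (algebraMap R _ r) = _
    rw [α.commutes]; rfl

theorem typeS_zero (R : Type u) [CommRing R] (n : ℕ) :
    ∃ φ : MvPolynomial (Fin n) R →+* stdRing R n 0 1, φ.Etale ∧
      φ.comp MvPolynomial.C = algebraMap R _ := by
  have h : Ideal.span {(∏ i : Fin n, if (i : ℕ) < 0 then (MvPolynomial.X i : MvPolynomial (Fin n) R)
    else 1) - MvPolynomial.C 1} = ⊥ := by simp
  refine ⟨Ideal.Quotient.mk _, RingHom.Etale.of_bijective ⟨?_, Ideal.Quotient.mk_surjective⟩, rfl⟩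
  rw [injective_iff_map_eq_zero]
  intro a ha
  rw [Ideal.Quotient.eq_zero_iff_mem, h] at ha
  exact ha

/-- `C` is a local ring of an étale scheme over the standard model. -/
def ChartAt (D C : Type u) [CommRing D] [CommRing C] [Algebra D C] (n l : ℕ) (b : D)
    (xc : Fin n → C) : Prop :=
  ∃ (B : Type u) (_ : CommRing B) (_ : Algebra (stdRing D n l b) B) (_ : Algebra B C)
    (P : Ideal B) (_ : P.IsPrime), Algebra.Etale (stdRing D n l b) B ∧
    IsLocalization.AtPrime C P ∧
    (∀ d, algebraMap B C (algebraMap (stdRing D n l b) B (algebraMap D _ d)) = algebraMap D C d) ∧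
    ∀ i, algebraMap B C (algebraMap (stdRing D n l b) B (stdCoord D n l b i)) = xc i

/-- `C` is a local ring of an étale scheme over affine space. -/
def TypeS (D C : Type u) [CommRing D] [CommRing C] [Algebra D C] : Prop :=
  ∃ (N : ℕ) (B : Type u) (_ : CommRing B) (_ : Algebra (MvPolynomial (Fin N) D) B) (_ : Algebra B C)
    (P : Ideal B) (_ : P.IsPrime), Algebra.Etale (MvPolynomial (Fin N) D) B ∧
    IsLocalization.AtPrime C P ∧
    (∀ d, algebraMap B C (algebraMap (MvPolynomial (Fin N) D) B (MvPolynomial.C d)) = algebraMap D C d)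

theorem flat_comp {D W B C : Type*} [CommRing D] [CommRing W] [CommRing B] [CommRing C] [Algebra D W]
    [Module.Flat D W] [Algebra W B] [Module.Flat W B] [Algebra B C] (P : Ideal B) [P.IsPrime]
    [IsLocalization.AtPrime C P] [Algebra D C]
    (h1 : ∀ d, algebraMap B C (algebraMap W B (algebraMap D W d)) = algebraMap D C d) :
    Module.Flat D C := by
  let _ : Algebra D B := ((algebraMap W B).comp (algebraMap D _)).toAlgebra
  have : IsScalarTower D W B := IsScalarTower.of_algebraMap_eq' rfl
  have : IsScalarTower D B C := IsScalarTower.of_algebraMap_eq (fun x => (h1 x).symm)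
  have : Module.Flat D B := Module.Flat.trans D W B
  exact flat_chart P

section
variable {D C : Type u} [CommRing D] [CommRing C] [Algebra D C] {n l : ℕ} {b : D} {xc : Fin n → C}

theorem ChartAt.prod (h : ChartAt D C n l b xc) :
    (∏ i : Fin n, if (i : ℕ) < l then xc i else 1) = algebraMap D C b := by
  obtain ⟨B, _, _, _, P, _, -, -, h1, h2⟩ := h
  have := congrArg (fun z => algebraMap B C (algebraMap (stdRing D n l b) B z)) (std_prod D n l b)
  simp only [h1, map_prod] at this
  rw [← this]
  refine Finset.prod_congr rfl fun i _ => ?_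
  split_ifs <;> simp [h2]

theorem ChartAt.noeth [IsNoetherianRing D] (h : ChartAt D C n l b xc) : IsNoetherianRing C := by
  obtain ⟨B, _, _, _, P, _, h0, h3, h1, h2⟩ := h
  have : IsNoetherianRing B := Algebra.FiniteType.isNoetherianRing (stdRing D n l b) B
  exact IsLocalization.isNoetherianRing P.primeCompl C inferInstance

theorem ChartAt.killed (h : ChartAt D C n 0 b xc) : algebraMap D C (1 - b) = 0 := by
  have := h.prod
  simp at this
  simp [← this]

theorem ChartAt.flat (h : ChartAt D C n l b xc) (hln : l ≤ n) (hl : 0 < l ∨ b = 1) :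
    Module.Flat D C := by
  have hf : Module.Flat D (stdRing D n l b) := by
    rcases Nat.eq_zero_or_pos l with h0 | h0
    · subst h0
      obtain rfl : b = 1 := by simpa using hl
      exact std_flat' n
    · exact std_flat n l h0 hln b
  obtain ⟨B, _, _, _, P, _, h0, h3, h1, h2⟩ := h
  exact flat_comp (W := stdRing D n l b) P h1

theorem TypeS.noeth [IsNoetherianRing D] (h : TypeS D C) : IsNoetherianRing C := by
  obtain ⟨N, B, _, _, _, P, _, h0, h3, h1⟩ := h
  have : IsNoetherianRing B := Algebra.FiniteType.isNoetherianRing (MvPolynomial (Fin N) D) B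
  exact IsLocalization.isNoetherianRing P.primeCompl C inferInstance

theorem TypeS.normal [IsDomain D] [IsIntegrallyClosed D] (h : TypeS D C) :
    IsDomain C ∧ IsIntegrallyClosed C := by
  obtain ⟨N, B, _, _, _, P, _, h0, h3, h1⟩ := h
  have := mvPoly_isIntegrallyClosed (R := D) (σ := Fin N)
  let _ : Algebra (MvPolynomial (Fin N) D) C :=
    ((algebraMap B C).comp (algebraMap (MvPolynomial (Fin N) D) B)).toAlgebra
  have : IsScalarTower (MvPolynomial (Fin N) D) B C := IsScalarTower.of_algebraMap_eq' rfl
  exact ⟨chart_isDomain (R := MvPolynomial (Fin N) D) (B := B) P,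
    chart_isIntegrallyClosed (R := MvPolynomial (Fin N) D) (B := B) P⟩

theorem TypeS.flat (h : TypeS D C) : Module.Flat D C := by
  obtain ⟨N, B, _, _, _, P, _, h0, h3, h1⟩ := h
  let _ : Algebra D B := ((algebraMap (MvPolynomial (Fin N) D) B).comp (algebraMap D _)).toAlgebra
  have : IsScalarTower D (MvPolynomial (Fin N) D) B := IsScalarTower.of_algebraMap_eq' rfl
  have : IsScalarTower D B C := IsScalarTower.of_algebraMap_eq (fun x => (h1 x).symm)
  have : Module.Flat D B := Module.Flat.trans D (MvPolynomial (Fin N) D) B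
  exact flat_chart P

variable [IsLocalRing D] [IsLocalRing C]

theorem TypeS.prime (h : TypeS D C) (hloc : mExt D C ≤ IsLocalRing.maximalIdeal C) :
    (mExt D C).IsPrime := by
  obtain ⟨N, B, _, _, _, P, _, h0, h3, h1⟩ := h
  let W := MvPolynomial (Fin N) D
  let _ : Algebra W C := ((algebraMap B C).comp (algebraMap W B)).toAlgebra
  have : IsScalarTower W B C := IsScalarTower.of_algebraMap_eq' rfl
  have : IsScalarTower D W C := IsScalarTower.of_algebraMap_eq (fun x => (h1 x).symm)
  let m := IsLocalRing.maximalIdeal D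
  let _ : Field (D ⧸ m) := Ideal.Quotient.field m
  let I : Ideal W := m.map (algebraMap D W)
  let e := MvPolynomial.quotientEquivQuotientMvPolynomial (σ := Fin N) m
  have hd : IsDomain (W ⧸ I) := MulEquiv.isDomain (MvPolynomial (Fin N) (D ⧸ m)) e.symm.toMulEquiv
  have := mvPoly_isIntegrallyClosed (R := D ⧸ m) (σ := Fin N)
  have hi : IsIntegrallyClosed (W ⧸ I) := IsIntegrallyClosed.of_equiv e.toRingEquiv
  have hI : I.map (algebraMap W C) = mExt D C := by
    simp only [I, Ideal.map_map, ← IsScalarTower.algebraMap_eq]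
    rfl
  have := etale_quot (C := C) P I (by
    rw [Ideal.map_le_iff_le_comap, ← IsLocalization.AtPrime.comap_maximalIdeal C P,
      Ideal.comap_comap, ← Ideal.map_le_iff_le_comap]
    rw [← IsScalarTower.algebraMap_eq, hI]; exact hloc)
  rw [← hI]; exact this.1

end

section
variable {D C : Type u} [CommRing D] [CommRing C] [Algebra D C] {n l : ℕ} {b : D} {xc : Fin n → C}
  [IsLocalRing C]

/-- prime ideals `(𝔞, x_s)` in a chart. -/
theorem ChartAt.stdPrime (h : ChartAt D C n l b xc) (𝔞 : Ideal D) [IsDomain (D ⧸ 𝔞)]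
    [IsIntegrallyClosed (D ⧸ 𝔞)] (hb : b ∈ 𝔞)
    (hloc : 𝔞.map (algebraMap D C) ≤ IsLocalRing.maximalIdeal C) (s : Set (Fin n))
    (hs : ∀ i ∈ s, xc i ∈ IsLocalRing.maximalIdeal C) (j : Fin n) (hj : (j : ℕ) < l) (hjs : j ∈ s) :
    (𝔞.map (algebraMap D C) ⊔ Ideal.span (xc '' s)).IsPrime ∧
    (∀ i ∉ s, xc i ∉ 𝔞.map (algebraMap D C) ⊔ Ideal.span (xc '' s)) ∧
    (∀ r, algebraMap D C r ∈ 𝔞.map (algebraMap D C) ⊔ Ideal.span (xc '' s) → r ∈ 𝔞) := by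
  obtain ⟨B, _, _, _, P, _, h0, h3, h1, h2⟩ := h
  obtain ⟨g1, g2, g3, g4⟩ := stdIdeal_facts n l b 𝔞 s hb j hj hjs
  let W := stdRing D n l b
  let _ : Algebra W C := ((algebraMap B C).comp (algebraMap W B)).toAlgebra
  have : IsScalarTower W B C := IsScalarTower.of_algebraMap_eq' rfl
  have hWC : (algebraMap W C).comp (algebraMap D W) = algebraMap D C := by
    ext d; exact h1 d
  have hI : (stdIdeal n l b 𝔞 s).map (algebraMap W C) =
      𝔞.map (algebraMap D C) ⊔ Ideal.span (xc '' s) := by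
    unfold stdIdeal
    rw [Ideal.map_sup, Ideal.map_map, Ideal.map_span, ← Set.image_comp, hWC]
    congr 2
    refine Set.image_congr fun i _ => ?_
    exact h2 i
  have hle : 𝔞.map (algebraMap D C) ⊔ Ideal.span (xc '' s) ≤ IsLocalRing.maximalIdeal C := by
    refine sup_le hloc (Ideal.span_le.2 ?_)
    rintro _ ⟨i, hi, rfl⟩
    exact hs i hi
  have := etale_quot (C := C) P (stdIdeal n l b 𝔞 s) (by
    rw [Ideal.map_le_iff_le_comap, ← IsLocalization.AtPrime.under_maximalIdeal C P]
    change _ ≤ ((IsLocalRing.maximalIdeal C).comap (algebraMap B C)).comap (algebraMap W B)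
    rw [Ideal.comap_comap, ← Ideal.map_le_iff_le_comap]
    rw [← IsScalarTower.algebraMap_eq, hI]; exact hle)
  rw [← hI]
  refine ⟨this.1, fun i hi hmem => g3 i hi (this.2 _ ?_), fun r hr => g4 r (this.2 _ ?_)⟩
  · rw [← h2 i] at hmem; exact hmem
  · rw [← h1 r] at hr; exact hr

/-- the vanishing coordinates at the closed point -/
abbrev chartJ (l : ℕ) (xc : Fin n → C) : Type :=
  {i : Fin n // (i : ℕ) < l ∧ xc i ∈ IsLocalRing.maximalIdeal C}

variable [IsLocalRing D]

open Classical in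
theorem ChartAt.prodJ (h : ChartAt D C n l b xc) :
    ∃ v : C, IsUnit v ∧ ∏ i : chartJ l xc, xc i = algebraMap D C b * v := by
  have hp := h.prod
  have : (∏ i : Fin n, if (i : ℕ) < l then xc i else 1) =
      (∏ i : chartJ l xc, xc i) *
        ∏ i : Fin n, (if (i : ℕ) < l ∧ xc i ∈ IsLocalRing.maximalIdeal C then 1 else
          if (i : ℕ) < l then xc i else 1) := by
    have h1 : (∏ i : chartJ l xc, xc i) =
        ∏ i : Fin n, if (i : ℕ) < l ∧ xc i ∈ IsLocalRing.maximalIdeal C then xc i else 1 := by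
      rw [← Finset.prod_filter]
      exact (Finset.prod_subtype (Finset.univ.filter (fun i : Fin n =>
        (i : ℕ) < l ∧ xc i ∈ IsLocalRing.maximalIdeal C)) (by simp) xc).symm
    rw [h1, ← Finset.prod_mul_distrib]
    refine Finset.prod_congr rfl fun i _ => ?_
    by_cases h2 : (i : ℕ) < l <;> by_cases h3 : xc i ∈ IsLocalRing.maximalIdeal C <;> simp [h2, h3]
  rw [this] at hp
  have hu : IsUnit (∏ i : Fin n, (if (i : ℕ) < l ∧ xc i ∈ IsLocalRing.maximalIdeal C then 1 else
          if (i : ℕ) < l then xc i else 1)) := by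
    rw [IsUnit.prod_iff]
    intro i _
    by_cases h2 : (i : ℕ) < l <;> by_cases h3 : xc i ∈ IsLocalRing.maximalIdeal C <;> simp [h2, h3]
    simpa using h3
  obtain ⟨w, hw⟩ := hu
  rw [← hw] at hp
  refine ⟨(w⁻¹ : Cˣ), Units.isUnit _, ?_⟩
  rw [← hp, mul_assoc]; simp

theorem ChartAt.hb (h : ChartAt D C n l b xc) (j : chartJ l xc) :
    b ∈ IsLocalRing.maximalIdeal D := by
  classical
  intro hu
  obtain ⟨v, hv, h1⟩ := h.prodJ
  have h2 : IsUnit (∏ i : chartJ l xc, xc i) := by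
    rw [h1]; exact (hu.map _).mul hv
  rw [IsUnit.prod_iff] at h2
  exact j.2.2 (h2 j (Finset.mem_univ _))

open Classical in
theorem ChartAt.localChart (h : ChartAt D C n l b xc)
    (hloc : mExt D C ≤ IsLocalRing.maximalIdeal C) (j : chartJ l xc) :
    LocalChart D C (fun i : chartJ l xc => xc i) b := by
  let _ : Field (D ⧸ IsLocalRing.maximalIdeal D) := Ideal.Quotient.field _
  have key := fun (s : Set (Fin n)) => h.stdPrime (IsLocalRing.maximalIdeal D) (h.hb j) hloc s
  have hs1 : ∀ i : chartJ l xc, xc '' {i.1} = {xc i} := by intro i; simp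
  have hs2 : ∀ i j : chartJ l xc, xc '' {i.1, j.1} = {xc i, xc j} := by
    intro i j; simp [Set.image_pair]
  refine ⟨⟨j⟩, h.hb j, h.prodJ, fun i => ?_, fun i k hik => ?_, fun i k hik => ?_, fun i k m hik hmi hmk => ?_⟩
  · have := (key {i.1} (by simpa using i.2.2) i i.2.1 (by simp)).1
    rwa [hs1] at this
  · have := (key {k.1} (by simpa using k.2.2) k k.2.1 (by simp)).2.1 i (by simpa [Subtype.ext_iff] using hik)
    rwa [hs1] at this
  · have := (key {i.1, k.1} (by simpa using ⟨i.2.2, k.2.2⟩) i i.2.1 (by simp)).1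
    rwa [hs2] at this
  · have := (key {i.1, k.1} (by simpa using ⟨i.2.2, k.2.2⟩) i i.2.1 (by simp)).2.1 m
      (by simpa [Subtype.ext_iff, not_or] using ⟨fun h => hmi (Subtype.ext h), fun h => hmk (Subtype.ext h)⟩)
    rwa [hs2] at this

end

theorem TypeS.of_away {D W B C : Type u} [CommRing D] [CommRing W] [CommRing B] [CommRing C]
    [Algebra D C] [Algebra W B] [Algebra.Etale W B] [Algebra B C] [Algebra D W] (P : Ideal B) [P.IsPrime]
    [IsLocalization.AtPrime C P]
    (h1 : ∀ d, algebraMap B C (algebraMap W B (algebraMap D W d)) = algebraMap D C d)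
    (π : W) (hπ : algebraMap W B π ∉ P) (N : ℕ)
    (hφ : ∃ φ : MvPolynomial (Fin N) D →+* Localization.Away π, φ.Etale ∧
      φ.comp MvPolynomial.C = (algebraMap W (Localization.Away π)).comp (algebraMap D W)) :
    TypeS D C := by
  obtain ⟨φ, hφ, hc⟩ := hφ
  let E := Localization.Away π
  let B' := Localization.Away (algebraMap W B π)
  let g : E →+* B' := IsLocalization.Away.map E B' (algebraMap W B) π
  have hg : g.Etale := by
    have := RingHom.Etale.propertyIsLocal.localizationAwayPreserves (algebraMap W B) π E B'
    apply this
    rw [RingHom.etale_algebraMap]; infer_instance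
  have hgφ : (g.comp φ).Etale := RingHom.Etale.stableUnderComposition _ _ hφ hg
  let _ : Algebra (MvPolynomial (Fin N) D) B' := (g.comp φ).toAlgebra
  have hunit : IsUnit (algebraMap B C (algebraMap W B π)) :=
    IsLocalization.map_units C (⟨_, hπ⟩ : P.primeCompl)
  let ι : B' →+* C := IsLocalization.Away.lift (algebraMap W B π) hunit
  let _ : Algebra B' C := ι.toAlgebra
  have hι : ∀ x, ι (algebraMap B B' x) = algebraMap B C x := fun x =>
    IsLocalization.Away.lift_eq (algebraMap W B π) hunit x
  have : IsScalarTower B B' C := IsScalarTower.of_algebraMap_eq (fun x => (hι x).symm)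
  have hlr : IsLocalRing C := IsLocalization.AtPrime.isLocalRing C P
  refine ⟨N, B', inferInstance, inferInstance, inferInstance, (IsLocalRing.maximalIdeal C).comap (algebraMap B' C), inferInstance, ?_, ?_, ?_⟩
  · rw [← RingHom.etale_algebraMap]; exact hgφ
  · have hle : Submonoid.powers (algebraMap W B π) ≤ P.primeCompl := by
      rintro _ ⟨k, rfl⟩
      exact fun h => hπ (‹P.IsPrime›.mem_of_pow_mem k h)
    have := IsLocalization.isLocalization_of_submonoid_le B' C (Submonoid.powers (algebraMap W B π)) P.primeCompl hle
    have h5 : ∀ y : (((IsLocalRing.maximalIdeal C).comap (algebraMap B' C)).primeCompl), IsUnit (algebraMap B' C y) := by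
      rintro ⟨y, hy⟩
      by_contra hh
      exact hy hh
    refine IsLocalization.of_le_of_exists_dvd (P.primeCompl.map (algebraMap B B')) _ ?_ ?_
    · rintro _ ⟨y, hy, rfl⟩ hmem
      have hmem : algebraMap B' C (algebraMap B B' y) ∈ IsLocalRing.maximalIdeal C := hmem
      rw [← IsScalarTower.algebraMap_apply] at hmem
      exact hmem (IsLocalization.map_units C (⟨y, hy⟩ : P.primeCompl))
    · intro y hy
      obtain ⟨⟨y0, s⟩, hs⟩ := IsLocalization.surj (Submonoid.powers (algebraMap W B π)) y
      refine ⟨algebraMap B B' y0, ⟨y0, ?_, rfl⟩, ⟨_, hs.symm⟩⟩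
      intro hy0
      apply hy
      change algebraMap B' C y ∈ IsLocalRing.maximalIdeal C
      have h6 := congrArg (algebraMap B' C) hs
      rw [map_mul, ← IsScalarTower.algebraMap_apply, ← IsScalarTower.algebraMap_apply] at h6
      have h7 : algebraMap B C y0 ∈ IsLocalRing.maximalIdeal C := by
        rw [← IsLocalization.AtPrime.under_maximalIdeal C P] at hy0; exact hy0
      rw [← h6] at h7
      refine (Ideal.IsPrime.mem_or_mem inferInstance h7).resolve_right fun h8 => h8 ?_
      exact IsLocalization.map_units C (⟨s, hle s.2⟩ : P.primeCompl)
  · intro d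
    change ι (g (φ (MvPolynomial.C d))) = _
    have := congrArg (fun r => r d) hc
    simp only [RingHom.comp_apply] at this
    have hgm : g (algebraMap W E (algebraMap D W d)) = algebraMap B B' (algebraMap W B (algebraMap D W d)) :=
      IsLocalization.map_eq _ _
    rw [this, hgm, hι, h1]

section
variable {D C : Type u} [CommRing D] [CommRing C] [Algebra D C] {n l : ℕ} {b : D} {xc : Fin n → C}
  [IsLocalRing C]

theorem ChartAt.typeS (h : ChartAt D C n l b xc) (hln : l ≤ n) (hl : 0 < l ∨ b = 1)
    (hJ : Subsingleton (chartJ l xc)) : TypeS D C := by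
  classical
  rcases Nat.eq_zero_or_pos l with h0 | h0
  · subst h0
    obtain rfl : b = 1 := by simpa using hl
    obtain ⟨B, _, _, _, P, _, h0, h3, h1, h2⟩ := h
    refine TypeS.of_away P h1 (1 : stdRing D n 0 1) (by rw [map_one]; exact fun h => Ideal.IsPrime.ne_top' ((Ideal.eq_top_iff_one _).2 h)) n ?_
    obtain ⟨φ, hφ, hc⟩ := typeS_zero D n
    refine ⟨(algebraMap _ _).comp φ, RingHom.Etale.stableUnderComposition _ _ hφ ?_, ?_⟩
    · refine RingHom.Etale.of_bijective ?_
      exact (IsLocalization.atOne (stdRing D n 0 1) (Localization.Away (1 : stdRing D n 0 1))).bijective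
    · rw [RingHom.comp_assoc, hc]
  · have hj : ∃ j : Fin n, (j : ℕ) < l ∧ ∀ i : Fin n, i ≠ j → (i : ℕ) < l → xc i ∉ IsLocalRing.maximalIdeal C := by
      by_cases hne : Nonempty (chartJ l xc)
      · obtain ⟨j⟩ := hne
        exact ⟨j, j.2.1, fun i hi hil hm => hi (congrArg Subtype.val (hJ.elim ⟨i, hil, hm⟩ j))⟩
      · exact ⟨⟨0, by omega⟩, h0, fun i _ hil hm => hne ⟨⟨i, hil, hm⟩⟩⟩
    obtain ⟨j, hjl, hj⟩ := hj
    obtain ⟨n, rfl⟩ : ∃ k, n = k + 1 := ⟨n - 1, by omega⟩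
    obtain ⟨B, _, _, _, P, _, h0, h3, h1, h2⟩ := h
    refine TypeS.of_away P h1 (∏ i : Fin n, if ((j.succAbove i : Fin (n+1)) : ℕ) < l then
      stdCoord D (n+1) l b (j.succAbove i) else 1) ?_ n (typeS_aux D n l b j hjl _)
    rw [map_prod]
    intro hmem
    obtain ⟨i, -, hi⟩ := (Ideal.IsPrime.prod_mem_iff (p := P)).1 hmem
    split_ifs at hi with hlt
    · refine hj _ (Fin.succAbove_ne j i) hlt ?_
      rw [← h2]
      rw [← IsLocalization.AtPrime.under_maximalIdeal C P] at hi
      exact hi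
    · rw [map_one] at hi
      exact Ideal.IsPrime.ne_top' ((Ideal.eq_top_iff_one _).2 hi)

end

end NeronSemistable
end

noncomputable section
namespace NeronSemistable

open IsLocalRing TensorProduct

/-- sections through rational points -/
theorem etale_section {R B : Type u} [CommRing R] [HenselianLocalRing R] [IsSepClosed (ResidueField R)]
    [CommRing B] (N : ℕ) [Algebra (MvPolynomial (Fin N) R) B] [Algebra.Etale (MvPolynomial (Fin N) R) B]
    (c : Fin N → R) (Q : Ideal B) [Q.IsPrime]
    (hQ : ∀ p : MvPolynomial (Fin N) R, algebraMap _ B p ∈ Q ↔ MvPolynomial.eval c p ∈ maximalIdeal R) :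
    ∃ σ : B →+* R, (maximalIdeal R).comap σ = Q ∧
      ∀ p : MvPolynomial (Fin N) R, σ (algebraMap _ B p) = MvPolynomial.eval c p := by
  let W := MvPolynomial (Fin N) R
  let ev : W →+* R := MvPolynomial.eval c
  let iA : Algebra W R := ev.toAlgebra
  have hev : ∀ w : W, algebraMap W R w = ev w := fun w => rfl
  let r1 : R →+* B ⧸ Q := ((Ideal.Quotient.mk Q).comp (algebraMap W B)).comp (MvPolynomial.C)
  have hr1 : ∀ r, r1 r = Ideal.Quotient.mk Q (algebraMap W B (MvPolynomial.C r)) := fun r => rfl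
  let r1a : R →ₐ[W] B ⧸ Q := { r1 with
    commutes' := by
      intro w
      change r1 (ev w) = Ideal.Quotient.mk Q (algebraMap W B w)
      rw [hr1, Ideal.Quotient.eq, ← map_sub, hQ]
      simp [ev] }
  let r2a : B →ₐ[W] B ⧸ Q := Ideal.Quotient.mkₐ W Q
  let θ : R ⊗[W] B →ₐ[W] B ⧸ Q := Algebra.TensorProduct.lift r1a r2a (fun _ _ => Commute.all _ _)
  let Q'' : Ideal (R ⊗[W] B) := RingHom.ker θ.toRingHom
  have : Q''.IsPrime := RingHom.ker_isPrime _
  have hcom : Q''.comap (algebraMap R (R ⊗[W] B)) = maximalIdeal R := by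
    ext r
    change θ (r ⊗ₜ 1) = 0 ↔ _
    simp only [θ, Algebra.TensorProduct.lift_tmul, map_one, mul_one]
    change r1 r = 0 ↔ _
    rw [hr1, Ideal.Quotient.eq_zero_iff_mem, hQ]; simp
  obtain ⟨σ, hσ⟩ := hensel_section Q'' hcom
  refine ⟨σ.toRingHom.comp (Algebra.TensorProduct.includeRight : B →ₐ[W] R ⊗[W] B).toRingHom, ?_, ?_⟩
  · rw [← Ideal.comap_comap]
    ext x
    have : σ.toRingHom.comp (RingHom.id _) = σ.toRingHom := rfl
    have h2 : (Algebra.TensorProduct.includeRight : B →ₐ[W] R ⊗[W] B) x ∈ Ideal.comap σ (maximalIdeal R) ↔ x ∈ Q := by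
      rw [hσ]
      change θ ((1 : R) ⊗ₜ x) = 0 ↔ _
      simp only [θ, Algebra.TensorProduct.lift_tmul, map_one, one_mul]
      exact Ideal.Quotient.eq_zero_iff_mem
    exact h2
  · intro p
    change σ ((1 : R) ⊗ₜ[W] (algebraMap W B p)) = _
    have : (1 : R) ⊗ₜ[W] (algebraMap W B p) = (algebraMap R (R ⊗[W] B)) (ev p) := by
      change _ = (ev p) ⊗ₜ[W] (1 : B)
      rw [Algebra.algebraMap_eq_smul_one, ← TensorProduct.smul_tmul, Algebra.smul_def, hev, mul_one]
    rw [this, σ.commutes]; rfl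

theorem exists_rational {R B : Type u} [CommRing R] [IsLocalRing R] [Infinite (ResidueField R)]
    [CommRing B] (N : ℕ) [Algebra (MvPolynomial (Fin N) R) B] [Algebra.Etale (MvPolynomial (Fin N) R) B]
    (P : Ideal B) [P.IsPrime] (hP : ∀ r ∈ maximalIdeal R, algebraMap (MvPolynomial (Fin N) R) B (MvPolynomial.C r) ∈ P)
    (g : B) (hg : g ∉ P) :
    ∃ (c : Fin N → R) (Q : Ideal B), Q.IsPrime ∧ g ∉ Q ∧
     ∀ p : MvPolynomial (Fin N) R, algebraMap _ B p ∈ Q ↔ MvPolynomial.eval c p ∈ maximalIdeal R := by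
  let W := MvPolynomial (Fin N) R
  have hopen : IsOpenMap (PrimeSpectrum.comap (algebraMap W B)) :=
    PrimeSpectrum.isOpenMap_comap_of_hasGoingDown_of_finitePresentation
  have h1 := hopen _ (PrimeSpectrum.basicOpen g).isOpen
  let pt : PrimeSpectrum B := ⟨P, inferInstance⟩
  have hmem : PrimeSpectrum.comap (algebraMap W B) pt ∈
      PrimeSpectrum.comap (algebraMap W B) '' (PrimeSpectrum.basicOpen g : Set (PrimeSpectrum B)) :=
    ⟨pt, hg, rfl⟩
  obtain ⟨_, ⟨F, rfl⟩, hF1, hF2⟩ := PrimeSpectrum.isTopologicalBasis_basic_opens.exists_subset_of_mem_open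
    hmem h1
  have hFP : algebraMap W B F ∉ P := hF1
  have hF0 : MvPolynomial.map (residue R) F ≠ 0 := by
    intro h0
    apply hFP
    rw [← F.support_sum_monomial_coeff, map_sum]
    refine Ideal.sum_mem _ fun m _ => ?_
    have : MvPolynomial.coeff m F ∈ maximalIdeal R := by
      have := congrArg (MvPolynomial.coeff m) h0
      rw [MvPolynomial.coeff_map, MvPolynomial.coeff_zero] at this
      exact (residue_eq_zero_iff _).1 this
    rw [← mul_one (MvPolynomial.coeff m F), ← MvPolynomial.C_mul_monomial, map_mul]
    exact Ideal.mul_mem_right _ _ (hP _ this)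
  obtain ⟨c0, hc0⟩ : ∃ c0 : Fin N → ResidueField R, MvPolynomial.eval c0 (MvPolynomial.map (residue R) F) ≠ 0 := by
    by_contra! hh
    exact hF0 (MvPolynomial.funext (fun x => by rw [hh x, map_zero]))
  choose c hc using fun i => residue_surjective (R := R) (c0 i)
  have hce : ∀ p : W, MvPolynomial.eval c p ∈ maximalIdeal R ↔ MvPolynomial.eval c0 (MvPolynomial.map (residue R) p) = 0 := by
    intro p
    rw [← residue_eq_zero_iff, MvPolynomial.eval_map, MvPolynomial.eval, MvPolynomial.coe_eval₂Hom, MvPolynomial.hom_eval₂]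
    congr! 1
    congr 1
    ext i; exact hc i
  let 𝔫 : PrimeSpectrum W := ⟨(maximalIdeal R).comap (MvPolynomial.eval c), inferInstance⟩
  have hn : 𝔫 ∈ (PrimeSpectrum.basicOpen F : Set (PrimeSpectrum W)) := by
    change F ∉ 𝔫.asIdeal
    change ¬ (MvPolynomial.eval c F ∈ maximalIdeal R)
    rw [hce]; exact hc0
  obtain ⟨Q, hQ1, hQ2⟩ := hF2 hn
  refine ⟨c, Q.asIdeal, Q.2, hQ1, fun p => ?_⟩
  have := congrArg PrimeSpectrum.asIdeal hQ2
  have h4 : p ∈ (PrimeSpectrum.comap (algebraMap W B) Q).asIdeal ↔ p ∈ 𝔫.asIdeal := by rw [this]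
  exact h4

theorem TypeS.unit {R C : Type u} [CommRing R] [IsDomain R] [IsNoetherianRing R] [IsIntegrallyClosed R]
    [HenselianLocalRing R] [IsSepClosed (ResidueField R)] [CommRing C] [IsLocalRing C] [Algebra R C]
    (h : TypeS R C) (hm : mExt R C = maximalIdeal C) (α β : C) (ρ : R) (hρ : ρ ≠ 0)
    (hab : α * β = algebraMap R C ρ) :
    ∃ d : R, d ∣ ρ ∧ ∃ u : C, IsUnit u ∧ α = algebraMap R C d * u := by
  classical
  have : Infinite (ResidueField R) := infinite_of_sepClosed _
  obtain ⟨N, B, _, _, _, P, _, h0, h3, h1⟩ := h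
  let W := MvPolynomial (Fin N) R
  let iRB : Algebra R B := ((algebraMap W B).comp (algebraMap R W)).toAlgebra
  have : IsScalarTower R W B := IsScalarTower.of_algebraMap_eq' rfl
  have hRB : IsScalarTower R B C := IsScalarTower.of_algebraMap_eq (fun x => (h1 x).symm)
  have : IsNoetherianRing B := Algebra.FiniteType.isNoetherianRing W B
  have hmC : (maximalIdeal C).comap (algebraMap B C) = P := IsLocalization.AtPrime.under_maximalIdeal C P
  have hmB : mExt R B ≤ P := by
    rw [← hmC, Ideal.map_le_iff_le_comap, Ideal.comap_comap, ← IsScalarTower.algebraMap_eq,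
      ← Ideal.map_le_iff_le_comap]
    exact hm.le
  have hmBC : (mExt R B).map (algebraMap B C) = maximalIdeal C := by
    rw [← hm, Ideal.map_map, ← IsScalarTower.algebraMap_eq]
  -- fractions
  obtain ⟨s, hs⟩ := IsLocalization.exist_integer_multiples_of_finset P.primeCompl ({α, β} : Finset C)
  obtain ⟨a0, ha0⟩ := hs α (by simp)
  obtain ⟨b0, hb0⟩ := hs β (by simp)
  rw [Algebra.smul_def] at ha0 hb0
  obtain ⟨c, hc⟩ : ∃ c : P.primeCompl, (c : B) * (a0 * b0) = c * (algebraMap R B ρ * s * s) := by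
    apply (IsLocalization.eq_iff_exists P.primeCompl C).1
    simp only [map_mul, ha0, hb0, ← IsScalarTower.algebraMap_apply]
    rw [← hab]; ring
  -- other minimal primes
  have hfin := (mExt R B).finite_minimalPrimes_of_isNoetherianRing
  obtain ⟨g, hgP, hg⟩ : ∃ g ∉ P, ∀ Q ∈ (mExt R B).minimalPrimes, Q ≠ P → g ∈ Q := by
    by_contra! hh
    let T := hfin.toFinset.filter (fun Q => Q ≠ P)
    have h5 : (T.inf id : Ideal B) ≤ P := by
      intro x hx
      by_contra hxP
      obtain ⟨Q, hQ, hQP, hxQ⟩ := hh x hxP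
      exact hxQ ((Finset.inf_le (f := id) (by simp [T, hQ, hQP]) : T.inf id ≤ Q) hx)
    obtain ⟨Q, hQ, hQP⟩ := (Ideal.IsPrime.inf_le' inferInstance).1 h5
    simp only [T, Finset.mem_filter, Set.Finite.mem_toFinset] at hQ
    apply hQ.2
    refine le_antisymm hQP ?_
    have h6 := Ideal.map_mono (f := algebraMap B C) hQ.1.1.2
    rw [hmBC] at h6
    have : Q.IsPrime := hQ.1.1.1
    have h7 : Disjoint (P.primeCompl : Set B) (Q : Set B) := by
      rw [Set.disjoint_left]; exact fun x hx hxQ => hx (hQP hxQ)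
    rw [← IsLocalization.under_map_of_isPrime_disjoint P.primeCompl C inferInstance h7, ← hmC]
    exact Ideal.comap_mono h6
  have hall : (s : B) * c * g ∉ P :=
    fun h => (‹P.IsPrime›.mem_or_mem h).elim (fun h => (‹P.IsPrime›.mem_or_mem h).elim s.2 c.2) hgP
  obtain ⟨cc, Q, hQ, hgQ, hQc⟩ := exists_rational N P (fun r hr => hmB (Ideal.mem_map_of_mem _ hr)) _ hall
  have hsQ : (s : B) ∉ Q := fun h => hgQ (Ideal.mul_mem_right _ _ (Ideal.mul_mem_right _ _ h))
  have hcQ : (c : B) ∉ Q := fun h => hgQ (Ideal.mul_mem_right _ _ (Ideal.mul_mem_left _ _ h))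
  have hgQ : g ∉ Q := fun h => hgQ (Ideal.mul_mem_left _ _ h)
  let CQ := Localization.AtPrime Q
  have hT : TypeS R CQ := ⟨N, B, inferInstance, inferInstance, inferInstance, Q, hQ, h0, inferInstance, fun d => rfl⟩
  have hmBQ : mExt R B ≤ Q := by
    rw [Ideal.map_le_iff_le_comap]
    intro r hr
    have := (hQc (MvPolynomial.C r)).2 (by simpa using hr)
    exact this
  have hmCQ : (maximalIdeal CQ).comap (algebraMap B CQ) = Q := IsLocalization.AtPrime.under_maximalIdeal CQ Q
  have hpr := hT.prime (by
    rw [Ideal.map_le_iff_le_comap, IsScalarTower.algebraMap_eq R B CQ, ← Ideal.comap_comap, hmCQ,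
      ← Ideal.map_le_iff_le_comap]
    exact hmBQ)
  have hPQ : P ≤ Q := by
    have hp1 : ((mExt R CQ).comap (algebraMap B CQ)).IsPrime := inferInstance
    have hp2 : mExt R B ≤ (mExt R CQ).comap (algebraMap B CQ) := by
      rw [← Ideal.map_le_iff_le_comap, Ideal.map_map, ← IsScalarTower.algebraMap_eq]
    obtain ⟨p, hp, hple⟩ := Ideal.exists_minimalPrimes_le hp2
    have hpQ : p ≤ Q := by
      refine (hple.trans ?_).trans hmCQ.le
      exact Ideal.comap_mono (by
        rw [Ideal.map_le_iff_le_comap, IsScalarTower.algebraMap_eq R B CQ, ← Ideal.comap_comap, hmCQ,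
          ← Ideal.map_le_iff_le_comap]
        exact hmBQ)
    by_cases hpP : p = P
    · rwa [← hpP]
    · exact absurd (hpQ (hg p hp hpP)) hgQ
  obtain ⟨σ, hσ1, hσ2⟩ := etale_section N cc Q hQc
  have hσu : ∀ y : Q.primeCompl, IsUnit (σ y) := by
    intro y
    by_contra hh
    have h9 : σ y ∈ maximalIdeal R := hh
    exact y.2 (hσ1.le h9)
  let σ' : CQ →+* R := IsLocalization.lift (M := Q.primeCompl) hσu
  have hσ' : ∀ x, σ' (algebraMap B CQ x) = σ x := fun x => IsLocalization.lift_eq hσu x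
  let σa : CQ →ₐ[R] R := { σ' with
    commutes' := by
      intro r
      change σ' (algebraMap B CQ (algebraMap W B (algebraMap R W r))) = r
      rw [hσ', hσ2]
      exact MvPolynomial.eval_C r }
  have hN := hT.normal
  have := hN.1
  have := hT.noeth
  have : Algebra.FormallyEtale B CQ := Algebra.FormallyEtale.of_isLocalization Q.primeCompl
  have : Algebra.FormallyEtale W CQ := Algebra.FormallyEtale.comp W B CQ
  have hsu : IsUnit (algebraMap B CQ s) := IsLocalization.map_units CQ (⟨s, hsQ⟩ : Q.primeCompl)
  obtain ⟨su, hsu⟩ := hsu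
  have hcu : IsUnit (algebraMap B CQ c) := IsLocalization.map_units CQ (⟨c, hcQ⟩ : Q.primeCompl)
  obtain ⟨d, hd, u, hu, hdu⟩ := section_unit (n := N) σa (algebraMap B CQ a0 * (su⁻¹ : CQˣ))
    (algebraMap B CQ b0 * (su⁻¹ : CQˣ)) ρ hρ (by
      apply hcu.mul_left_cancel
      have := congrArg (algebraMap B CQ) hc
      simp only [map_mul, ← hsu] at this
      rw [IsScalarTower.algebraMap_apply R B CQ]
      calc _ = (algebraMap B CQ c * (algebraMap B CQ a0 * algebraMap B CQ b0)) * ((su⁻¹ : CQˣ) * (su⁻¹ : CQˣ)) := by ring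
        _ = (algebraMap B CQ c * algebraMap B CQ (algebraMap R B ρ)) * ((su * (su⁻¹ : CQˣ)) * (su * (su⁻¹ : CQˣ))) := by rw [this]; ring
        _ = _ := by simp)
  have hlu : ∀ y : Q.primeCompl, IsUnit (algebraMap B C y) := fun y =>
    IsLocalization.map_units C (⟨y, fun h => y.2 (hPQ h)⟩ : P.primeCompl)
  let τ : CQ →+* C := IsLocalization.lift (M := Q.primeCompl) hlu
  have hτ : ∀ x, τ (algebraMap B CQ x) = algebraMap B C x := fun x => IsLocalization.lift_eq hlu x
  refine ⟨d, hd, τ u, hu.map τ, ?_⟩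
  have h10 := congrArg τ hdu
  have hsC : IsUnit (algebraMap B C s) := IsLocalization.map_units C s
  apply hsC.mul_left_cancel
  rw [← ha0]
  have h11 : algebraMap B CQ a0 = algebraMap R CQ d * u * algebraMap B CQ s := by
    rw [← hdu, ← hsu, mul_assoc]; simp
  rw [← hτ, h11, map_mul, map_mul, hτ, IsScalarTower.algebraMap_apply R B CQ, hτ, ← IsScalarTower.algebraMap_apply]
  ring

end NeronSemistable
end

noncomputable section
namespace NeronSemistable

theorem elemOrd_iff {A : Type u} [CommRing A] (a : A) (m : ℕ) :
    elemOrd A a m ↔ Ring.ord A a = m := by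
  unfold elemOrd Ring.ord
  rw [← Module.coe_length]
  exact WithBot.coe_inj

theorem elemOrd_unit {A : Type u} [CommRing A] (a : A) (ha : IsUnit a) (m : ℕ) (h : elemOrd A a m) :
    m = 0 := by
  rw [elemOrd_iff, Ring.ord_of_isUnit ha] at h
  exact_mod_cast h.symm

theorem elemOrd_exists {A : Type u} [CommRing A] [IsDomain A] [IsNoetherianRing A]
    (hd : ringKrullDim A = 1) (a : A) (ha : a ≠ 0) : ∃ m, elemOrd A a m := by
  have : Ring.KrullDimLE 1 A := by
    rw [Ring.krullDimLE_iff, hd]; rfl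
  have := Ring.ord_ne_top (mem_nonZeroDivisors_of_ne_zero ha)
  obtain ⟨m, hm⟩ := ENat.ne_top_iff_exists.mp this
  exact ⟨m, (elemOrd_iff a m).2 hm.symm⟩

theorem elemOrd_mul {A : Type u} [CommRing A] [IsDomain A] {a b : A} (hb : b ≠ 0) {m n : ℕ}
    (ha' : elemOrd A a m) (hb' : elemOrd A b n) : elemOrd A (a * b) (m + n) := by
  rw [elemOrd_iff] at *
  rw [Ring.ord_mul A (mem_nonZeroDivisors_of_ne_zero hb), ha', hb']
  push_cast; rfl

theorem elemOrd_uniq {A : Type u} [CommRing A] {a : A} {m n : ℕ}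
    (h : elemOrd A a m) (h' : elemOrd A a n) : m = n := by
  rw [elemOrd_iff] at *
  exact_mod_cast h.symm.trans h'

theorem elemOrd_dvr {A : Type u} [CommRing A] [IsDomain A] [IsDiscreteValuationRing A] {t w : A}
    (ht : Irreducible t) (hw : IsUnit w) (m : ℕ) : elemOrd A (t ^ m * w) m := by
  rw [elemOrd_iff, Ring.ord_mul_of_isUnit_right hw, Ring.ord_pow (mem_nonZeroDivisors_of_ne_zero ht.ne_zero),
    Ring.ord_of_irreducible ht]
  simp

theorem dvr_of_colon {L : Type u} [CommRing L] [IsDomain L] [IsNoetherianRing L] [IsLocalRing L]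
    [IsIntegrallyClosed L] (h y : L) (hh : h ≠ 0)
    (H : ∀ x, x ∈ IsLocalRing.maximalIdeal L ↔ h ∣ x * y) : IsDiscreteValuationRing L := by
  have hhm : h ∈ IsLocalRing.maximalIdeal L := (H h).2 (dvd_mul_right h y)
  have hnf : ¬ IsField L := by
    intro hf
    rw [IsLocalRing.isField_iff_maximalIdeal_eq] at hf
    rw [hf] at hhm
    exact hh hhm
  have hy : ¬ h ∣ y := by
    intro h1
    have : (1 : L) ∈ IsLocalRing.maximalIdeal L := (H 1).2 (by simpa)
    exact (Ideal.ne_top_iff_one _).1 (IsLocalRing.maximalIdeal.isMaximal L).ne_top this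
  refine ((IsDiscreteValuationRing.TFAE L hnf).out 0 4).2 ?_
  by_contra hP
  -- every x y = h z with z ∈ m
  have key : ∀ x ∈ IsLocalRing.maximalIdeal L, ∃ z ∈ IsLocalRing.maximalIdeal L, x * y = h * z := by
    intro x hx
    obtain ⟨z, hz⟩ := (H x).1 hx
    refine ⟨z, ?_, hz⟩
    by_contra hzu
    have hzu : IsUnit z := by simpa using hzu
    apply hP
    refine ⟨x, le_antisymm ?_ ?_⟩
    · intro x' hx'
      obtain ⟨z', hz'⟩ := (H x').1 hx'
      obtain ⟨v, hv⟩ := hzu.exists_right_inv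
      refine Ideal.mem_span_singleton.2 ⟨z' * v, ?_⟩
      have hy0 : y ≠ 0 := fun h0 => hy (h0 ▸ dvd_zero h)
      refine mul_right_cancel₀ hy0 ?_
      calc x' * y = h * z' * (z * v) := by rw [hz', hv, mul_one]
        _ = (x * y) * (z' * v) := by rw [hz]; ring
        _ = _ := by ring
    · exact (Ideal.span_singleton_le_iff_mem _).2 hx
  -- integrality
  let K := FractionRing L
  let _ : Field K := inferInstanceAs (Field (FractionRing L))
  set k : K := algebraMap L K y / algebraMap L K h
  have hhK : algebraMap L K h ≠ 0 := by simpa using hh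
  have hii : IsIntegral L k := by
    let N : Submodule L K := Submodule.map (Algebra.linearMap L K) (IsLocalRing.maximalIdeal L)
    refine isIntegral_of_smul_mem_submodule (N := N) ?_ ?_ k ?_
    · rw [Submodule.ne_bot_iff]
      exact ⟨algebraMap L K h, ⟨h, hhm, rfl⟩, hhK⟩
    · exact ((IsNoetherian.noetherian (IsLocalRing.maximalIdeal L)).map _)
    · rintro _ ⟨x, hx, rfl⟩
      obtain ⟨z, hz, hz'⟩ := key x hx
      refine ⟨z, hz, ?_⟩
      have := congrArg (algebraMap L K) hz'
      simp only [map_mul] at this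
      simp only [Algebra.linearMap_apply, smul_eq_mul, k]
      field_simp
      linear_combination -this
  obtain ⟨z, hz⟩ := IsIntegrallyClosed.isIntegral_iff.1 hii
  apply hy
  refine ⟨z, IsFractionRing.injective L K ?_⟩
  rw [map_mul, hz, mul_div_cancel₀ _ hhK]

theorem lemG {B : Type u} [CommRing B] [IsDomain B] [IsNoetherianRing B] (M : Submonoid B)
    (hM : M ≤ nonZeroDivisors B)
    (h1 h2 : B) (hh2 : h2 ≠ 0)
    (H : ∀ (Q : Ideal B) (_ : Q.IsPrime), Disjoint (M : Set B) (Q : Set B) →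
      ∃ (L : Type u) (_ : CommRing L) (_ : Algebra B L) (_ : IsDomain L),
        IsLocalization.AtPrime L Q ∧ IsIntegrallyClosed L ∧
        (ringKrullDim L = 1 → Associated (algebraMap B L h1) (algebraMap B L h2))) :
    ∃ ρ ∈ M, h2 ∣ ρ * h1 := by
  by_contra hcon
  push Not at hcon
  let Bm := Localization M
  have hne : (Ideal.Quotient.mk (Ideal.span {algebraMap B Bm h2}) (algebraMap B Bm h1)) ≠ 0 := by
    rw [Ne, Ideal.Quotient.eq_zero_iff_mem, Ideal.mem_span_singleton]
    rintro ⟨c, hc⟩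
    obtain ⟨⟨c', r⟩, hcr⟩ := IsLocalization.surj M c
    apply hcon r r.2
    refine ⟨c', IsLocalization.injective Bm hM ?_⟩
    simp only at hcr
    rw [map_mul, map_mul, hc, ← hcr]; ring
  have : IsNoetherianRing Bm := IsLocalization.isNoetherianRing M Bm inferInstance
  obtain ⟨Q', hQ', hle⟩ := exists_le_isAssociatedPrime_of_isNoetherianRing Bm _ hne
  rw [isAssociatedPrime_iff] at hQ'
  obtain ⟨hQp, yb, hyb⟩ := hQ'
  obtain ⟨y, rfl⟩ := Ideal.Quotient.mk_surjective yb
  have memQ : ∀ x, x ∈ Q' ↔ algebraMap B Bm h2 ∣ x * y := by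
    intro x
    rw [hyb, Submodule.mem_colon_singleton, Submodule.mem_bot, ← Ideal.mem_span_singleton,
      ← Ideal.Quotient.eq_zero_iff_mem, map_mul]
    rfl
  have memQ1 : ∀ x, algebraMap B Bm h2 ∣ x * algebraMap B Bm h1 → x ∈ Q' := by
    intro x hx
    apply hle
    rw [Submodule.mem_colon_singleton, Submodule.mem_bot]
    rw [← Ideal.mem_span_singleton, ← Ideal.Quotient.eq_zero_iff_mem, map_mul] at hx
    exact hx
  obtain ⟨L, _, _, _, hL, hLi, hA⟩ := H (Q'.comap (algebraMap B Bm)) inferInstance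
    ((IsLocalization.isPrime_iff_isPrime_disjoint M Bm Q').1 hQp).2
  have : IsLocalRing L := IsLocalization.AtPrime.isLocalRing L (Q'.comap (algebraMap B Bm))
  have : IsNoetherianRing L := IsLocalization.isNoetherianRing (Q'.comap (algebraMap B Bm)).primeCompl L inferInstance
  obtain ⟨⟨y0, r⟩, hyr⟩ := IsLocalization.surj M y
  simp only at hyr
  have hru : IsUnit (algebraMap B Bm r) := IsLocalization.map_units Bm r
  have hBL : Function.Injective (algebraMap B L) :=
    IsLocalization.injective L (Ideal.primeCompl_le_nonZeroDivisors (Q'.comap (algebraMap B Bm)))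
  have hBm : Function.Injective (algebraMap B Bm) := IsLocalization.injective Bm hM
  have memQB : ∀ x : B, x ∈ Q'.comap (algebraMap B Bm) ↔ algebraMap B L h2 ∣ algebraMap B L (x * y0) := by
    intro x
    rw [Ideal.mem_comap, memQ, ← hru.dvd_mul_right (b := algebraMap B Bm x * y), mul_assoc, hyr, ← map_mul]
    constructor
    · rintro ⟨c, hc⟩
      obtain ⟨⟨c', q⟩, hcq⟩ := IsLocalization.surj M c
      simp only at hcq
      have h3 : x * y0 * q = h2 * c' := by
        apply hBm
        rw [map_mul, hc, map_mul, ← hcq]; ring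
      have hqu : IsUnit (algebraMap B L q) := by
        refine IsLocalization.map_units L (⟨q, ?_⟩ : (Q'.comap (algebraMap B Bm)).primeCompl)
        intro hq
        exact hQp.ne_top (Ideal.eq_top_of_isUnit_mem _ hq (IsLocalization.map_units Bm q))
      rw [← hqu.dvd_mul_right, ← map_mul, h3, map_mul]
      exact dvd_mul_right _ _
    · rintro ⟨c, hc⟩
      obtain ⟨⟨c', q⟩, hcq⟩ := IsLocalization.surj (Q'.comap (algebraMap B Bm)).primeCompl c
      simp only at hcq
      have h3 : x * y0 * q = h2 * c' := by
        apply hBL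
        rw [map_mul, hc, map_mul, ← hcq]; ring
      have h4 : algebraMap B Bm q * algebraMap B Bm x ∈ Q' := by
        rw [memQ, ← hru.dvd_mul_right, mul_assoc, mul_assoc, hyr, ← map_mul, ← map_mul]
        refine ⟨algebraMap B Bm c', ?_⟩
        rw [← map_mul, ← h3]; ring_nf
      have h5 := (hQp.mem_or_mem h4).resolve_left q.2
      rwa [memQ, ← hru.dvd_mul_right, mul_assoc, hyr, ← map_mul] at h5
  have : IsDiscreteValuationRing L := by
    refine dvr_of_colon (algebraMap B L h2) (algebraMap B L y0) (fun h => hh2 (hBL (by simpa using h))) ?_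
    intro x
    obtain ⟨⟨x', q⟩, hq⟩ := IsLocalization.surj (Q'.comap (algebraMap B Bm)).primeCompl x
    simp only at hq
    have hqu : IsUnit (algebraMap B L q) := IsLocalization.map_units L q
    rw [← hqu.dvd_mul_right, mul_right_comm, hq, ← map_mul, ← memQB,
      ← IsLocalization.AtPrime.to_map_mem_maximal_iff L (Q'.comap (algebraMap B Bm)) x', ← hq]
    exact (Ideal.mul_unit_mem_iff_mem _ hqu).symm
  obtain ⟨c, hc⟩ := (hA (IsDiscreteValuationRing.ringKrullDim_eq_one L)).symm.dvd
  obtain ⟨⟨c', q⟩, hcq⟩ := IsLocalization.surj (Q'.comap (algebraMap B Bm)).primeCompl c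
  simp only at hcq
  refine q.2 (memQ1 _ ⟨algebraMap B Bm c', ?_⟩)
  rw [← map_mul, ← map_mul]
  congr 1
  apply hBL
  rw [map_mul, hc, map_mul, ← hcq]; ring

/-- symmetric consequence -/
theorem lemG_sym {B : Type u} [CommRing B] [IsDomain B] [IsNoetherianRing B] (M : Submonoid B)
    (hM : M ≤ nonZeroDivisors B)
    (h1 h2 : B) (hh1 : h1 ≠ 0) (hh2 : h2 ≠ 0)
    (H : ∀ (Q : Ideal B) (_ : Q.IsPrime), Disjoint (M : Set B) (Q : Set B) →
      ∃ (L : Type u) (_ : CommRing L) (_ : Algebra B L) (_ : IsDomain L),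
        IsLocalization.AtPrime L Q ∧ IsIntegrallyClosed L ∧
        (ringKrullDim L = 1 → Associated (algebraMap B L h1) (algebraMap B L h2))) :
    ∃ ρ ∈ M, ∃ α β, ρ * h1 = α * h2 ∧ ρ * h2 = β * h1 ∧ α * β = ρ * ρ := by
  obtain ⟨ρ, hρ, α, hα⟩ := lemG M hM h1 h2 hh2 H
  obtain ⟨ρ', hρ', β, hβ⟩ := lemG M hM h2 h1 hh1 fun Q hQ hd => by
    obtain ⟨L, i1, i2, i3, i4, i5, i6⟩ := H Q hQ hd
    exact ⟨L, i1, i2, i3, i4, i5, fun h => (i6 h).symm⟩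
  refine ⟨ρ * ρ', M.mul_mem hρ hρ', ρ' * α, ρ * β, ?_, ?_, ?_⟩
  · linear_combination ρ' * hα
  · linear_combination ρ * hβ
  · refine mul_left_cancel₀ (mul_ne_zero hh1 hh2) ?_
    linear_combination (- ρ * ρ' * h1*β) * hα - (ρ * ρ'*ρ*h1) * hβ

theorem assoc_of_ord {L : Type u} [CommRing L] [IsDomain L] [IsNoetherianRing L] [IsLocalRing L]
    [IsIntegrallyClosed L] (hd : ringKrullDim L = 1) {a b : L} {m : ℕ} (ha : elemOrd L a m)
    (hb : elemOrd L b m) : Associated a b := by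
  have h1 : Ring.DimensionLEOne L := by
    have : Ring.KrullDimLE 1 L := by
      rw [Ring.krullDimLE_iff, hd]; rfl
    exact (Ring.krullDimLE_one_iff_of_noZeroDivisors).1 this |> fun h => ⟨fun {p} hp hpp => h p hp hpp⟩
  have : IsDedekindDomain L := {}
  have hnf : ¬ IsField L := by
    intro hf
    rw [(ringKrullDim_eq_zero_of_isField hf)] at hd
    exact absurd hd (by norm_num)
  have : IsDiscreteValuationRing L := ((IsDiscreteValuationRing.TFAE L hnf).out 0 2).2 this
  rw [elemOrd_iff] at ha hb
  exact (Ring.ord_eq_iff_associated a b).1 (ha.trans hb.symm)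

/-- The structure map from the base ring to a stalk. -/
def stkHom {D : CommRingCat.{u}} {Y : Scheme.{u}} (f : Y ⟶ Spec D) (y : Y) :
    D ⟶ Y.presheaf.stalk y :=
  (Scheme.ΓSpecIso D).inv ≫ f.appTop ≫ Y.presheaf.germ ⊤ y (TopologicalSpace.Opens.mem_top _)

/-- The stalk as an algebra over the base ring. -/
def Stk {D : CommRingCat.{u}} {Y : Scheme.{u}} (_f : Y ⟶ Spec D) (y : Y) : Type u :=
  Y.presheaf.stalk y

section
variable {D : CommRingCat.{u}} {Y : Scheme.{u}} (f : Y ⟶ Spec D) (y : Y)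

instance : CommRing (Stk f y) := inferInstanceAs (CommRing (Y.presheaf.stalk y))
instance : IsLocalRing (Stk f y) := inferInstanceAs (IsLocalRing (Y.presheaf.stalk y))
instance : Algebra D (Stk f y) := (stkHom f y).hom.toAlgebra

theorem stk_algebraMap : algebraMap D (Stk f y) = (stkHom f y).hom := rfl

theorem stkHom_comp {D' : CommRingCat.{u}} {Y' : Scheme.{u}} (f' : Y' ⟶ Spec D') (ψ : D ⟶ D')
    (g : Y' ⟶ Y) (h : g ≫ f = f' ≫ Spec.map ψ) (y' : Y') :
    stkHom f (g y') ≫ g.stalkMap y' = ψ ≫ stkHom f' y' := by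
  have h1 : f.appTop ≫ g.appTop = (Spec.map ψ).appTop ≫ f'.appTop := by
    rw [← Scheme.Hom.comp_appTop, ← Scheme.Hom.comp_appTop, h]
  have h2 : Y.presheaf.germ ⊤ (g y') (TopologicalSpace.Opens.mem_top _) ≫ g.stalkMap y' =
      g.appTop ≫ Y'.presheaf.germ ⊤ y' (TopologicalSpace.Opens.mem_top _) :=
    Scheme.Hom.germ_stalkMap g ⊤ y' (TopologicalSpace.Opens.mem_top _)
  unfold stkHom
  rw [Category.assoc, Category.assoc, h2, reassoc_of% h1, ← Scheme.ΓSpecIso_inv_naturality_assoc]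

theorem stkHom_comp' {Y' : Scheme.{u}} (g : Y' ⟶ Y) (y' : Y') :
    stkHom f (g y') ≫ g.stalkMap y' = stkHom (g ≫ f) y' := by
  have := stkHom_comp f (g ≫ f) (𝟙 D) g (by simp) y'
  simpa using this

theorem stkHom_spec {y₁ y : Y} (h : y₁ ⤳ y) :
    stkHom f y ≫ Y.presheaf.stalkSpecializes h = stkHom f y₁ := by
  unfold stkHom
  rw [Category.assoc, Category.assoc, TopCat.Presheaf.germ_stalkSpecializes]

theorem stkHom_germ (V : Y.Opens) (hy : y ∈ V) :
    (Scheme.ΓSpecIso D).inv ≫ f.appLE ⊤ V le_top ≫ Y.presheaf.germ V y hy = stkHom f y := by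
  unfold stkHom
  have h2 : f.appLE ⊤ V le_top ≫ Y.presheaf.germ V y hy =
      f.appTop ≫ Y.presheaf.germ ⊤ y (TopologicalSpace.Opens.mem_top _) := by
    delta Scheme.Hom.appLE
    rw [Category.assoc, Y.presheaf.germ_res]
    rfl
  rw [h2]

theorem stkHom_isUnit (r : D) : IsUnit (stkHom f y r) ↔ r ∉ (f y).asIdeal := by
  have h2 : (Spec D).presheaf.germ ⊤ (f y) (TopologicalSpace.Opens.mem_top _) ≫ f.stalkMap y =
      f.appTop ≫ Y.presheaf.germ ⊤ y (TopologicalSpace.Opens.mem_top _) :=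
    Scheme.Hom.germ_stalkMap f ⊤ y (TopologicalSpace.Opens.mem_top _)
  unfold stkHom
  rw [← h2]
  simp only [CommRingCat.comp_apply]
  rw [isUnit_map_iff (f.stalkMap y).hom, ← Scheme.mem_basicOpen (Spec D), basicOpen_eq_of_affine]
  rfl

theorem stkHom_mem (r : D) : algebraMap D (Stk f y) r ∈ IsLocalRing.maximalIdeal (Stk f y) ↔ r ∈ (f y).asIdeal := by
  rw [IsLocalRing.mem_maximalIdeal, mem_nonunits_iff, ← not_iff_not, not_not, ← stkHom_isUnit]
  rfl

end
/-- local rings of affine open -/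
theorem exists_affine {Y : Scheme.{u}} (y : Y) (V : Y.Opens) (hy : y ∈ V) :
    ∃ (W : Y.Opens), IsAffineOpen W ∧ y ∈ W ∧ W ≤ V := by
  obtain ⟨_, ⟨W, hW, rfl⟩, hyW, h⟩ :=
    Y.isBasis_affineOpens.exists_subset_of_mem_open (show y ∈ (V : Set Y) from hy) V.2
  exact ⟨W, hW, hyW, h⟩

theorem etale_extract {W : CommRingCat.{u}} {Y : Scheme.{u}} (g : Y ⟶ Spec W) [Etale g] (y : Y) :
    ∃ (B : Type u) (_ : CommRing B) (_ : Algebra W B) (_ : Algebra B (Stk g y)) (P : Ideal B)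
      (_ : P.IsPrime), Algebra.Etale W B ∧ IsLocalization.AtPrime (Stk g y) P ∧
      ∀ w, algebraMap B (Stk g y) (algebraMap W B w) = algebraMap W (Stk g y) w := by
  obtain ⟨V, hV, hy, -⟩ := exists_affine y ⊤ (TopologicalSpace.Opens.mem_top _)
  have h1 : (g.appLE ⊤ V le_top).hom.Etale :=
    HasRingHomProperty.appLE @Etale g inferInstance ⟨⊤, isAffineOpen_top _⟩ ⟨V, hV⟩ le_top
  have h2 : ((Scheme.ΓSpecIso W).inv ≫ g.appLE ⊤ V le_top).hom.Etale :=
    RingHom.Etale.respectsIso.2 _ (Scheme.ΓSpecIso W).symm.commRingCatIsoToRingEquiv h1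
  refine ⟨Γ(Y, V), inferInstance, ((Scheme.ΓSpecIso W).inv ≫ g.appLE ⊤ V le_top).hom.toAlgebra,
    (Y.presheaf.germ V y hy).hom.toAlgebra, (hV.primeIdealOf ⟨y, hy⟩).asIdeal, inferInstance, h2,
    hV.isLocalization_stalk ⟨y, hy⟩, fun w => ?_⟩
  have := stkHom_germ g y V hy
  rw [stk_algebraMap, ← this]
  rfl

theorem stkHom_post {D W : CommRingCat.{u}} {Y : Scheme.{u}} (g : Y ⟶ Spec W) (φ : D ⟶ W) (y : Y) :
    stkHom (g ≫ Spec.map φ) y = φ ≫ stkHom g y := by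
  unfold stkHom
  rw [Scheme.Hom.comp_appTop, Category.assoc, ← Scheme.ΓSpecIso_inv_naturality_assoc]

theorem stk_congr {D : CommRingCat.{u}} {Y : Scheme.{u}} {f g : Y ⟶ Spec D} (h : f = g) (y : Y) :
    stkHom f y = stkHom g y := by rw [h]

theorem smooth_stk_normal0 {D : CommRingCat.{u}} [IsDomain D] [IsIntegrallyClosed D] {Y : Scheme.{u}}
    (f : Y ⟶ Spec D) (hf : Smooth f) (y : Y) :
    IsDomain (Stk f y) ∧ IsIntegrallyClosed (Stk f y) := by
  obtain ⟨W, hW, hyW, hWV⟩ := exists_affine y ⊤ (TopologicalSpace.Opens.mem_top _)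
  have h1 : (f.appLE ⊤ W le_top).hom.Smooth :=
    HasRingHomProperty.appLE @Smooth f inferInstance ⟨⊤, isAffineOpen_top _⟩ ⟨W, hW⟩ le_top
  have h2 : ((Scheme.ΓSpecIso D).inv ≫ f.appLE ⊤ W le_top).hom.Smooth :=
    RingHom.Smooth.propertyIsLocal.respectsIso.2 _ (Scheme.ΓSpecIso D).symm.commRingCatIsoToRingEquiv h1
  let _ : Algebra D Γ(Y, W) := ((Scheme.ΓSpecIso D).inv ≫ f.appLE ⊤ W le_top).hom.toAlgebra
  have : Algebra.Smooth D Γ(Y, W) := h2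
  let _ : Algebra Γ(Y, W) (Stk f y) := (Y.presheaf.germ W y hyW).hom.toAlgebra
  let P := (hW.primeIdealOf ⟨y, hyW⟩).asIdeal
  have hP : IsLocalization.AtPrime (Stk f y) P := hW.isLocalization_stalk ⟨y, hyW⟩
  obtain ⟨i1, i2⟩ := smooth_normal (R := D) P
  let e := IsLocalization.algEquiv P.primeCompl (Localization.AtPrime P) (Stk f y)
  exact ⟨e.symm.toMulEquiv.isDomain _, IsIntegrallyClosed.of_equiv e.toRingEquiv⟩

/-- smooth points over a normal domain are normal -/
theorem smooth_stk_normal {D : CommRingCat.{u}} [IsDomain D] [IsIntegrallyClosed D] {Y : Scheme.{u}}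
    (f : Y ⟶ Spec D) (V : Y.Opens) (hf : Smooth (V.ι ≫ f)) (y : Y) (hy : y ∈ V) :
    IsDomain (Stk f y) ∧ IsIntegrallyClosed (Stk f y) := by
  let y' : V.toScheme := ⟨y, hy⟩
  obtain ⟨i1, i2⟩ := smooth_stk_normal0 _ hf y'
  let e : Stk f y ≃+* Stk (V.ι ≫ f) y' := (asIso (V.ι.stalkMap y')).commRingCatIsoToRingEquiv
  exact ⟨e.toMulEquiv.isDomain _, IsIntegrallyClosed.of_equiv e.symm⟩

/-- A chart of `f` at `y`; `J` is the set of branch coordinates vanishing at the point. -/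
def HasChart {D : CommRingCat.{u}} {Y : Scheme.{u}} (f : Y ⟶ Spec D) (y : Y) (n l : ℕ) (b : D)
    (J : Set (Fin n)) : Prop :=
  ∃ (U : Scheme.{u}) (gX : U ⟶ Y) (x' : ↑U) (gT : U ⟶ stdScheme ↥D n l b),
      Etale gX ∧ Etale gT ∧ gX x' = y ∧ gT ≫ stdSpec D n l b = gX ≫ f ∧
      ∀ i : Fin n, i ∈ J ↔ ((i : ℕ) < l ∧ stdCoord ↥D n l b i ∈ (gT.base x').asIdeal)

theorem chartAt_stk {D : CommRingCat.{u}} {Y U : Scheme.{u}} (f : Y ⟶ Spec D) {n l : ℕ} {b : D}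
    (gX : U ⟶ Y) (gT : U ⟶ stdScheme ↥D n l b) (hT : Etale gT)
    (h : gT ≫ stdSpec D n l b = gX ≫ f) (x' : U) :
    ChartAt D (Stk (gX ≫ f) x') n l b (fun i =>
      stkHom (D := CommRingCat.of (stdRing D n l b)) gT x' (stdCoord D n l b i)) := by
  have : Etale (Y := Spec (CommRingCat.of (stdRing D n l b))) gT := hT
  obtain ⟨B, i1, i2, i3, P, i4, h1, h2, h3⟩ := etale_extract (W := CommRingCat.of (stdRing D n l b)) gT x'
  refine ⟨B, i1, i2, i3, P, i4, h1, h2, fun d => ?_, fun i => h3 _⟩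
  refine (h3 _).trans ?_
  have h4 := stkHom_post (W := CommRingCat.of (stdRing D n l b)) gT
    (CommRingCat.ofHom (algebraMap ↥D (stdRing ↥D n l b))) x'
  have h5 := stk_congr h x'
  rw [stk_algebraMap, ← h5]
  exact (congrArg (fun F => F.hom d) h4).symm

/-- algebra structure on stalks from a morphism -/
@[reducible] def stkAlg {D : CommRingCat.{u}} {Y U : Scheme.{u}} (f : Y ⟶ Spec D) (g : U ⟶ Y) (x' : U) :
    Algebra (Stk f (g x')) (Stk (g ≫ f) x') := (g.stalkMap x').hom.toAlgebra

theorem stkAlg_tower {D : CommRingCat.{u}} {Y U : Scheme.{u}} (f : Y ⟶ Spec D) (g : U ⟶ Y) (x' : U) :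
    let _ := stkAlg f g x'
    IsScalarTower D (Stk f (g x')) (Stk (g ≫ f) x') := by
  let _ := stkAlg f g x'
  refine IsScalarTower.of_algebraMap_eq fun d => ?_
  exact (congrArg (fun F => F.hom d) (stkHom_comp' f g x')).symm

theorem stkAlg_local {D : CommRingCat.{u}} {Y U : Scheme.{u}} (f : Y ⟶ Spec D) (g : U ⟶ Y) (x' : U) :
    let _ := stkAlg f g x'
    IsLocalHom (algebraMap (Stk f (g x')) (Stk (g ≫ f) x')) := by
  let _ := stkAlg f g x'
  exact inferInstanceAs (IsLocalHom (g.stalkMap x').hom)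

theorem stkAlg_ff {D : CommRingCat.{u}} {Y U : Scheme.{u}} (f : Y ⟶ Spec D) (g : U ⟶ Y) [Flat g] (x' : U) :
    let _ := stkAlg f g x'
    Module.FaithfullyFlat (Stk f (g x')) (Stk (g ≫ f) x') := by
  let _ := stkAlg f g x'
  have := stkAlg_local f g x'
  have : Module.Flat (Stk f (g x')) (Stk (g ≫ f) x') := Flat.stalkMap g x'
  exact Module.FaithfullyFlat.of_flat_of_isLocalHom

/-- ring-level chart on a local ring `O` over `D` -/
def OChart (D O : Type u) [CommRing D] [CommRing O] [Algebra D O] (n l : ℕ) (b : D) (J : Set (Fin n)) : Prop :=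
  ∃ (C : Type u) (_ : CommRing C) (_ : IsLocalRing C) (_ : Algebra D C) (_ : Algebra O C)
    (_ : IsScalarTower D O C) (xc : Fin n → C), ChartAt D C n l b xc ∧
    IsLocalHom (algebraMap O C) ∧ Module.FaithfullyFlat O C ∧
    (∀ i : Fin n, i ∈ J ↔ ((i : ℕ) < l ∧ xc i ∈ IsLocalRing.maximalIdeal C)) ∧
    ∀ _ : IsLocalRing O, (IsLocalRing.maximalIdeal O).map (algebraMap O C) = IsLocalRing.maximalIdeal C

theorem stkAlg_unr {D : CommRingCat.{u}} {Y U : Scheme.{u}} (f : Y ⟶ Spec D) (g : U ⟶ Y) [Etale g] (x' : U) :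
    let _ := stkAlg f g x'
    (IsLocalRing.maximalIdeal (Stk f (g x'))).map (algebraMap (Stk f (g x')) (Stk (g ≫ f) x')) =
      IsLocalRing.maximalIdeal _ := by
  let _ := stkAlg f g x'
  have := stkAlg_local f g x'
  have : Algebra.EssFiniteType (Stk f (g x')) (Stk (g ≫ f) x') := LocallyOfFiniteType.stalkMap g x'
  have : Algebra.FormallyUnramified (Stk f (g x')) (Stk (g ≫ f) x') := FormallyUnramified.stalkMap g x'
  exact Algebra.FormallyUnramified.map_maximalIdeal

theorem HasChart.oChart {D : CommRingCat.{u}} {Y : Scheme.{u}} {f : Y ⟶ Spec D} {y : Y} {n l : ℕ} {b : D}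
    {J : Set (Fin n)} (h : HasChart f y n l b J) : OChart D (Stk f y) n l b J := by
  obtain ⟨U, gX, x', gT, h1, h2, rfl, h3, h4⟩ := h
  refine ⟨Stk (gX ≫ f) x', inferInstance, inferInstance, inferInstance, stkAlg f gX x', stkAlg_tower f gX x',
    _, chartAt_stk f gX gT h2 h3 x', stkAlg_local f gX x', stkAlg_ff f gX x', fun i => ?_, fun _ => stkAlg_unr f gX x'⟩
  rw [h4]
  exact and_congr Iff.rfl (stkHom_mem (D := CommRingCat.of (stdRing D n l b)) gT x' _).symm

/-- functoriality of the standard ring in the base -/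
def stdMap {D D' : CommRingCat.{u}} (φ : D ⟶ D') (n l : ℕ) (b : D) :
    CommRingCat.of (stdRing D n l b) ⟶ CommRingCat.of (stdRing D' n l (φ b)) :=
  letI : Algebra D (stdRing D' n l (φ b)) := ((algebraMap D' (stdRing D' n l (φ b))).comp φ.hom).toAlgebra
  CommRingCat.ofHom (stdLift (R := D) (E := stdRing D' n l (φ b)) n l b
    (fun i => stdCoord D' n l (φ b) i) (std_prod D' n l (φ b))).toRingHom

theorem stdMap_coord {D D' : CommRingCat.{u}} (φ : D ⟶ D') (n l : ℕ) (b : D) (i : Fin n) :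
    stdMap φ n l b (stdCoord D n l b i) = stdCoord D' n l (φ b) i := by
  let _ : Algebra D (stdRing D' n l (φ b)) := ((algebraMap D' (stdRing D' n l (φ b))).comp φ.hom).toAlgebra
  exact stdLift_coord (R := D) (E := stdRing D' n l (φ b)) n l b _ (std_prod D' n l (φ b)) i

theorem stdMap_alg {D D' : CommRingCat.{u}} (φ : D ⟶ D') (n l : ℕ) (b : D) (d : D) :
    stdMap φ n l b (algebraMap D (stdRing D n l b) d) = algebraMap D' (stdRing D' n l (φ b)) (φ d) := by
  let _ : Algebra D (stdRing D' n l (φ b)) := ((algebraMap D' (stdRing D' n l (φ b))).comp φ.hom).toAlgebra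
  exact (stdLift (R := D) (E := stdRing D' n l (φ b)) n l b
    (fun i => stdCoord D' n l (φ b) i) (std_prod D' n l (φ b))).commutes d

theorem std_desc {D D' E : CommRingCat.{u}} (φ : D ⟶ D') (n l : ℕ) (b : D)
    (i1 : CommRingCat.of (stdRing D n l b) ⟶ E) (i2 : D' ⟶ E)
    (h : CommRingCat.ofHom (algebraMap D (stdRing D n l b)) ≫ i1 = φ ≫ i2) :
    ∃ m : CommRingCat.of (stdRing D' n l (φ b)) ⟶ E, stdMap φ n l b ≫ m = i1 ∧
      CommRingCat.ofHom (algebraMap D' (stdRing D' n l (φ b))) ≫ m = i2 := by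
  let _ : Algebra D' E := i2.hom.toAlgebra
  have hc : ∀ d, i1 (algebraMap D (stdRing D n l b) d) = i2 (φ d) := fun d =>
    congrArg (fun F => F.hom d) h
  let m' := stdLift (R := D') (E := E) n l (φ b) (fun i => i1 (stdCoord D n l b i)) (by
    have h1 := congrArg (fun x => i1 x) (std_prod D n l b)
    refine Eq.trans ?_ (h1.trans (hc b))
    simp only [map_prod]
    refine Finset.prod_congr rfl fun i _ => ?_
    split_ifs <;> simp)
  have h1 : ∀ i, m' (stdCoord D' n l (φ b) i) = i1 (stdCoord D n l b i) := fun i =>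
    stdLift_coord (R := D') (E := E) n l (φ b) _ _ i
  have h2 : ∀ d, m' (algebraMap D' _ d) = i2 d := fun d => m'.commutes d
  refine ⟨CommRingCat.ofHom m'.toRingHom, CommRingCat.hom_ext ?_, CommRingCat.hom_ext (RingHom.ext h2)⟩
  refine std_ext (R := D) (E := E) n l b _ _ (fun d => ?_) (fun i => ?_)
  · change m' (stdMap φ n l b (algebraMap D (stdRing D n l b) d)) = i1 (algebraMap D (stdRing D n l b) d)
    rw [stdMap_alg, hc, h2]
  · change m' (stdMap φ n l b (stdCoord D n l b i)) = i1 (stdCoord D n l b i)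
    rw [stdMap_coord, h1]

theorem std_desc_uniq {D D' E : CommRingCat.{u}} (φ : D ⟶ D') (n l : ℕ) (b : D)
    (m m' : CommRingCat.of (stdRing D' n l (φ b)) ⟶ E) (h1 : stdMap φ n l b ≫ m = stdMap φ n l b ≫ m')
    (h2 : CommRingCat.ofHom (algebraMap D' (stdRing D' n l (φ b))) ≫ m =
      CommRingCat.ofHom (algebraMap D' (stdRing D' n l (φ b))) ≫ m') : m = m' := by
  refine CommRingCat.hom_ext ?_
  refine std_ext (R := D') (E := E) n l (φ b) _ _ (fun d => congrArg (fun F => F.hom d) h2) (fun i => ?_)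
  have := congrArg (fun F => F.hom (stdCoord D n l b i)) h1
  change m (stdMap φ n l b (stdCoord D n l b i)) = m' (stdMap φ n l b (stdCoord D n l b i)) at this
  rwa [stdMap_coord] at this

theorem std_isPushout {D D' : CommRingCat.{u}} (φ : D ⟶ D') (n l : ℕ) (b : D) :
    IsPushout (CommRingCat.ofHom (algebraMap D (stdRing D n l b))) φ (stdMap φ n l b)
      (CommRingCat.ofHom (algebraMap D' (stdRing D' n l (φ b)))) := by
  refine ⟨⟨CommRingCat.hom_ext (RingHom.ext fun d => stdMap_alg φ n l b d)⟩,
    ⟨PushoutCocone.IsColimit.mk _ (fun s => (std_desc φ n l b s.inl s.inr s.condition).choose)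
      (fun s => (std_desc φ n l b s.inl s.inr s.condition).choose_spec.1)
      (fun s => (std_desc φ n l b s.inl s.inr s.condition).choose_spec.2) ?_⟩⟩
  intro s m h1 h2
  exact std_desc_uniq φ n l b _ _ (h1.trans (std_desc φ n l b s.inl s.inr s.condition).choose_spec.1.symm)
    (h2.trans (std_desc φ n l b s.inl s.inr s.condition).choose_spec.2.symm)

theorem std_isPullback {D D' : CommRingCat.{u}} (φ : D ⟶ D') (n l : ℕ) (b : D) :
    IsPullback (X := stdScheme D n l b) (P := stdScheme D' n l (φ b)) (Spec.map (stdMap φ n l b))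
      (stdSpec D' n l (φ b)) (stdSpec D n l b) (Spec.map φ) :=
  isPullback_SpecMap_of_isPushout _ _ _ _ (std_isPushout φ n l b)

theorem chart_bc {D D' : CommRingCat.{u}} (φ : D ⟶ D') {n l : ℕ} {b : D} {U U' : Scheme.{u}}
    (gT : U ⟶ stdScheme D n l b) (hT : Etale gT) (q : U' ⟶ U) (f' : U' ⟶ Spec D')
    (h : IsPullback q f' (gT ≫ stdSpec D n l b) (Spec.map φ)) :
    ∃ gT' : U' ⟶ stdScheme D' n l (φ b), Etale gT' ∧ gT' ≫ stdSpec D' n l (φ b) = f' ∧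
      ∀ (x : U') (i : Fin n), stdCoord D' n l (φ b) i ∈ (gT'.base x).asIdeal ↔
        stdCoord D n l b i ∈ (gT.base (q x)).asIdeal := by
  have hs := std_isPullback φ n l b
  have hw : (q ≫ gT) ≫ stdSpec D n l b = f' ≫ Spec.map φ := by rw [Category.assoc, h.w]
  refine ⟨hs.lift (q ≫ gT) f' hw, ?_, hs.lift_snd _ _ _, fun x i => ?_⟩
  · have h2 : IsPullback q (hs.lift (q ≫ gT) f' hw) gT (Spec.map (stdMap φ n l b)) := by
      refine IsPullback.of_bot (h₃₁ := Spec.map φ) ?_ (hs.lift_fst _ _ _).symm hs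
      rw [hs.lift_snd]
      exact h
    exact MorphismProperty.of_isPullback (P := @Etale) h2 hT
  · have h3 : gT.base (q x) = (Spec.map (stdMap φ n l b)) ((hs.lift (q ≫ gT) f' hw) x) := by
      have := congrArg (fun F : U' ⟶ stdScheme D n l b => F x) (hs.lift_fst (q ≫ gT) f' hw)
      exact this.symm
    rw [h3, ← stdMap_coord φ n l b i]
    rfl

theorem HasChart.generalize {D : CommRingCat.{u}} {Y : Scheme.{u}} {f : Y ⟶ Spec D} {z y : Y} {n l : ℕ} {b : D}
    {J : Set (Fin n)} (h : HasChart f z n l b J) (hy : y ⤳ z) : ∃ J', HasChart f y n l b J' := by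
  obtain ⟨U, gX, x', gT, h1, h2, rfl, h3, h4⟩ := h
  obtain ⟨y', -, rfl⟩ := Flat.generalizingMap gX hy
  exact ⟨{i | ((i : ℕ) < l ∧ stdCoord ↥D n l b i ∈ (gT.base y').asIdeal)}, U, gX, y', gT, h1, h2, rfl, h3,
    fun i => Iff.rfl⟩

theorem HasChart.bc {D D' : CommRingCat.{u}} (φ : D ⟶ D') {Y : Scheme.{u}} {f : Y ⟶ Spec D} {n l : ℕ} {b : D}
    {J : Set (Fin n)} (z : ↑(pullback f (Spec.map φ)))
    (h : HasChart f (pullback.fst f (Spec.map φ) z) n l b J) :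
    HasChart (pullback.snd f (Spec.map φ)) z n l (φ b) J := by
  obtain ⟨U, gX, x', gT, h1, h2, hx, h3, h4⟩ := h
  obtain ⟨x, hx1, hx2⟩ := Scheme.Pullback.exists_preimage_pullback (f := gX) (g := pullback.fst f (Spec.map φ)) x' z hx
  have hp : IsPullback (pullback.fst gX (pullback.fst f (Spec.map φ)))
      (pullback.snd gX (pullback.fst f (Spec.map φ)) ≫ pullback.snd f (Spec.map φ))
      (gT ≫ stdSpec D n l b) (Spec.map φ) := by
    rw [h3]
    exact IsPullback.paste_vert (IsPullback.of_hasPullback _ _) (IsPullback.of_hasPullback _ _)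
  obtain ⟨gT', h5, h6, h7⟩ := chart_bc φ gT h2 _ _ hp
  refine ⟨_, pullback.snd gX _, x, gT', inferInstance, h5, hx2, h6, fun i => ?_⟩
  rw [h4, h7, hx1]

theorem chart_base {R : CommRingCat.{u}} [HenselianLocalRing R] [IsSepClosed (IsLocalRing.ResidueField R)]
    {X : Scheme.{u}} (f : X ⟶ Spec R) (x : X) (hx : (f x).asIdeal = IsLocalRing.maximalIdeal R)
    (c : ChartData f x) : ∃ n l b J, l ≤ n ∧ HasChart f x n l b J := by
  obtain ⟨R', n, l, hln, b, etS, hS, -, -, U, -, gX, hX, x', rfl, gT, hT, comm⟩ := c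
  obtain ⟨φ, rfl⟩ := Spec.map_surjective etS
  have hφ : φ.hom.Etale := (HasRingHomProperty.Spec_iff (P := @Etale)).1 hS
  let _ : Algebra R R' := φ.hom.toAlgebra
  have : Algebra.Etale R R' := hφ
  let t : PrimeSpectrum R' := (gT ≫ stdSpec R' n l b) x'
  obtain ⟨σ, hσ⟩ := hensel_section (R := R) (B := R') t.asIdeal (by
    have h1 : Spec.map φ t = f (gX x') := by
      have := congrArg (fun F : U ⟶ Spec R => F x') comm
      exact this
    rw [← hx, ← h1]
    rfl)
  let σ' : R' ⟶ R := CommRingCat.ofHom σ.toRingHom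
  have hσφ : φ ≫ σ' = 𝟙 R := by
    ext r
    exact σ.commutes r
  have e1 : Spec.map σ' ≫ Spec.map φ = 𝟙 (Spec R) := by
    rw [← Spec.map_comp, hσφ, Spec.map_id]
  have e2 : Etale (Spec.map σ') := by
    have : Etale (Spec.map σ' ≫ Spec.map φ) := by rw [e1]; infer_instance
    have : Etale (Spec.map φ) := hS
    exact Etale.of_comp _ (Spec.map φ)
  obtain ⟨y, hy1, hy2⟩ := Scheme.Pullback.exists_preimage_pullback (f := gT ≫ stdSpec R' n l b) (g := Spec.map σ') x'
    (IsLocalRing.closedPoint R : PrimeSpectrum R) (by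
      refine PrimeSpectrum.ext ?_
      exact hσ.symm)
  obtain ⟨gT', h5, h6, h7⟩ := chart_bc σ' gT hT (pullback.fst (gT ≫ stdSpec R' n l b) (Spec.map σ')) _ (IsPullback.of_hasPullback _ _)
  have : Etale gX := hX
  refine ⟨n, l, σ' b, _, hln, _, pullback.fst _ _ ≫ gX, y, gT', inferInstance, h5, ?_, ?_, fun i => Iff.rfl⟩
  · rw [← hy1]; rfl
  · rw [h6, Category.assoc, ← comm, ← Category.assoc gT, pullback.condition_assoc, e1, Category.comp_id]

theorem loc_of_loc {R S T : Type*} [CommRing R] [CommRing S] [CommRing T] [Algebra R S] [Algebra R T] [Algebra S T]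
    [IsScalarTower R S T] (M : Submonoid R) [IsLocalization M S] (p : Ideal S) [p.IsPrime]
    [h : IsLocalization.AtPrime T (p.comap (algebraMap R S))] : IsLocalization.AtPrime T p := by
  have hu : ∀ r : R, algebraMap R S r ∉ p → IsUnit (algebraMap R T r) := fun r hr =>
    IsLocalization.map_units (M := (p.comap (algebraMap R S)).primeCompl) T ⟨r, hr⟩
  have key : ∀ s : S, algebraMap S T s = 0 → ∃ c : S, c ∉ p ∧ c * s = 0 := by
    intro s hs
    obtain ⟨⟨r, m⟩, hrm⟩ := IsLocalization.surj M s
    have h1 : algebraMap R T r = 0 := by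
      rw [IsScalarTower.algebraMap_apply R S T, ← hrm, map_mul, hs, zero_mul]
    obtain ⟨c, hc⟩ := (IsLocalization.map_eq_zero_iff (p.comap (algebraMap R S)).primeCompl T r).1 h1
    refine ⟨algebraMap R S c, c.2, ?_⟩
    have hm : IsUnit (algebraMap R S m) := IsLocalization.map_units S m
    apply hm.mul_left_injective
    dsimp only
    rw [mul_assoc, hrm, ← map_mul, hc, map_zero, zero_mul]
  refine ⟨fun y => ?_, fun t => ?_, fun {a b} hab => ?_⟩
  · obtain ⟨⟨r, m⟩, hrm⟩ := IsLocalization.surj M y.1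
    have hm : IsUnit (algebraMap R S m) := IsLocalization.map_units S m
    have h1 : algebraMap R S r ∉ p := by
      rw [← hrm]
      intro hh
      rcases Ideal.IsPrime.mem_or_mem inferInstance hh with h2 | h2
      · exact y.2 h2
      · exact Ideal.IsPrime.ne_top' (Ideal.eq_top_of_isUnit_mem _ h2 hm)
    have h2 := hu r h1
    rw [IsScalarTower.algebraMap_apply R S T, ← hrm, map_mul] at h2
    exact isUnit_of_mul_isUnit_left h2
  · obtain ⟨⟨r, m⟩, hrm⟩ := IsLocalization.surj (p.comap (algebraMap R S)).primeCompl t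
    refine ⟨⟨algebraMap R S r, ⟨algebraMap R S m, m.2⟩⟩, ?_⟩
    dsimp only at hrm ⊢
    rw [← IsScalarTower.algebraMap_apply R S T, ← IsScalarTower.algebraMap_apply R S T, hrm]
  · obtain ⟨c, hc, h1⟩ := key (a - b) (by rw [map_sub, hab, sub_self])
    exact ⟨⟨c, hc⟩, by rw [mul_sub, sub_eq_zero] at h1; exact h1⟩

/-- the algebra structure given by a specialization -/
@[reducible] def specAlg {D : CommRingCat.{u}} {Y : Scheme.{u}} (f : Y ⟶ Spec D) {y' y : Y} (h : y' ⤳ y) :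
    Algebra (Stk f y) (Stk f y') := (Y.presheaf.stalkSpecializes h).hom.toAlgebra

theorem specAlg_tower {D : CommRingCat.{u}} {Y : Scheme.{u}} (f : Y ⟶ Spec D) {y' y : Y} (h : y' ⤳ y) :
    letI := specAlg f h
    IsScalarTower D (Stk f y) (Stk f y') := by
  let _ := specAlg f h
  exact IsScalarTower.of_algebraMap_eq fun d => (congrArg (fun F => F.hom d) (stkHom_spec f h)).symm

/-- prime ideals of a stalk are generalizations -/
theorem exists_gen {D : CommRingCat.{u}} {Y : Scheme.{u}} (f : Y ⟶ Spec D) (y : Y) (Q : Ideal (Stk f y)) [Q.IsPrime] :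
    ∃ (y' : Y) (h : y' ⤳ y), letI := specAlg f h; IsLocalization.AtPrime (Stk f y') Q := by
  obtain ⟨W, hW, hy, -⟩ := exists_affine y ⊤ (TopologicalSpace.Opens.mem_top _)
  let _ : Algebra Γ(Y, W) (Stk f y) := (Y.presheaf.germ W y hy).hom.toAlgebra
  have h1 : IsLocalization.AtPrime (Stk f y) (hW.primeIdealOf ⟨y, hy⟩).asIdeal := hW.isLocalization_stalk ⟨y, hy⟩
  let q : PrimeSpectrum Γ(Y, W) := ⟨Q.comap (algebraMap Γ(Y, W) (Stk f y)), inferInstance⟩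
  let y' : Y := hW.fromSpec q
  have hy' : y' ∈ W := by
    have := Set.mem_range_self (f := hW.fromSpec) q
    rwa [hW.range_fromSpec] at this
  have e : hW.primeIdealOf ⟨y', hy'⟩ = q := by
    have h2 := hW.fromSpec_primeIdealOf ⟨y', hy'⟩
    exact hW.fromSpec.isOpenEmbedding.injective h2
  have hle : q ⤳ hW.primeIdealOf ⟨y, hy⟩ := by
    rw [← PrimeSpectrum.le_iff_specializes]
    have h3 : Q ≤ IsLocalRing.maximalIdeal (Stk f y) := IsLocalRing.le_maximalIdeal Ideal.IsPrime.ne_top'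
    intro a ha
    have h4 : algebraMap Γ(Y, W) (Stk f y) a ∈ IsLocalRing.maximalIdeal (Stk f y) := h3 ha
    rwa [IsLocalization.AtPrime.to_map_mem_maximal_iff (Stk f y) (hW.primeIdealOf ⟨y, hy⟩).asIdeal] at h4
  have hs : y' ⤳ y := by
    have := hle.map hW.fromSpec.continuous
    rwa [hW.fromSpec_primeIdealOf] at this
  refine ⟨y', hs, ?_⟩
  let _ := specAlg f hs
  let _ : Algebra Γ(Y, W) (Stk f y') := (Y.presheaf.germ W y' hy').hom.toAlgebra
  have h5 : IsLocalization.AtPrime (Stk f y') (Q.comap (algebraMap Γ(Y, W) (Stk f y))) := by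
    have := hW.isLocalization_stalk ⟨y', hy'⟩
    rw [e] at this
    exact this
  have : IsScalarTower Γ(Y, W) (Stk f y) (Stk f y') := IsScalarTower.of_algebraMap_eq fun d =>
    (congrArg (fun F => F.hom d) (Y.presheaf.germ_stalkSpecializes hy hs)).symm
  exact loc_of_loc (R := Γ(Y, W)) (hW.primeIdealOf ⟨y, hy⟩).asIdeal.primeCompl Q

theorem spec_to_closed {D : CommRingCat.{u}} [IsLocalRing D] {Y : Scheme.{u}} (f : Y ⟶ Spec D) [UniversallyClosed f]
    (y : Y) : ∃ z, y ⤳ z ∧ (f z).asIdeal = IsLocalRing.maximalIdeal D := by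
  have h1 : IsClosed (f '' (closure {y})) := f.isClosedMap _ isClosed_closure
  have h2 : (IsLocalRing.closedPoint D : PrimeSpectrum D) ∈ f '' (closure {y}) := by
    have h3 : f y ⤳ (IsLocalRing.closedPoint D : PrimeSpectrum D) := by
      exact (PrimeSpectrum.le_iff_specializes (R := D) _ _).1 (IsLocalRing.le_maximalIdeal (f y).2.ne_top)
    exact h3.mem_closed h1 ⟨y, subset_closure rfl, rfl⟩
  obtain ⟨z, hz, hz2⟩ := h2
  exact ⟨z, specializes_iff_mem_closure.2 hz, by rw [hz2]; rfl⟩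

theorem HasChart.exists_open {D : CommRingCat.{u}} {Y : Scheme.{u}} {f : Y ⟶ Spec D} {y : Y} {n l : ℕ} {b : D}
    {J : Set (Fin n)} (h : HasChart f y n l b J) :
    ∃ V : Set Y, IsOpen V ∧ y ∈ V ∧ ∀ y' ∈ V, ∃ J', HasChart f y' n l b J' := by
  obtain ⟨U, gX, x', gT, h1, h2, rfl, h3, h4⟩ := h
  refine ⟨Set.range gX, ?_, ⟨x', rfl⟩, ?_⟩
  · exact gX.isOpenMap.isOpen_range
  · rintro _ ⟨y', rfl⟩
    exact ⟨_, U, gX, y', gT, h1, h2, rfl, h3, fun i => Iff.rfl⟩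

/-- an irreducible neighbourhood at a point with integral local ring -/
theorem exists_irr {Y : Scheme.{u}} [IsLocallyNoetherian Y] (y : Y) (hd : IsDomain (Y.presheaf.stalk y)) :
    ∃ (V : Set Y) (ξ : Y), IsOpen V ∧ y ∈ V ∧ ξ ∈ V ∧ ∀ y' ∈ V, ξ ⤳ y' := by
  obtain ⟨W, hW, hy, -⟩ := exists_affine y ⊤ (TopologicalSpace.Opens.mem_top _)
  let S := Y.presheaf.stalk y
  let _ : Algebra Γ(Y, W) S := (Y.presheaf.germ W y hy).hom.toAlgebra
  have h1 : IsLocalization.AtPrime S (hW.primeIdealOf ⟨y, hy⟩).asIdeal := hW.isLocalization_stalk ⟨y, hy⟩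
  have : IsNoetherianRing Γ(Y, W) := IsLocallyNoetherian.component_noetherian ⟨W, hW⟩
  let P := (hW.primeIdealOf ⟨y, hy⟩).asIdeal
  let K := RingHom.ker (algebraMap Γ(Y, W) S)
  have hK : K.IsPrime := RingHom.ker_isPrime _
  obtain ⟨s, hs⟩ := (isNoetherianRing_iff_ideal_fg Γ(Y, W)).1 inferInstance K
  have h2 : ∃ c : Γ(Y, W), c ∉ P ∧ ∀ a ∈ K, c * a = 0 := by
    have h3 : ∀ a : Γ(Y, W), ∃ c : Γ(Y, W), c ∉ P ∧ (a ∈ K → c * a = 0) := by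
      intro a
      by_cases ha : a ∈ K
      · obtain ⟨c, hc⟩ := (IsLocalization.map_eq_zero_iff P.primeCompl S a).1 ha
        exact ⟨c, c.2, fun _ => hc⟩
      · exact ⟨1, fun h => (hW.primeIdealOf ⟨y, hy⟩).2.ne_top ((Ideal.eq_top_iff_one _).2 h), fun h => absurd h ha⟩
    choose c hc hc2 using h3
    refine ⟨∏ a ∈ s, c a, ?_, ?_⟩
    · have : P.IsPrime := (hW.primeIdealOf ⟨y, hy⟩).2
      intro hh
      obtain ⟨a, -, ha⟩ := (Ideal.IsPrime.prod_mem_iff (hp := this)).1 hh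
      exact hc a ha
    · have : K ≤ (Ideal.span {∏ a ∈ s, c a}).annihilator := by
        rw [← hs, Ideal.span_le]
        intro a ha
        rw [SetLike.mem_coe, Submodule.mem_annihilator_span_singleton]
        obtain ⟨e, he⟩ := Finset.dvd_prod_of_mem c ha
        rw [he, smul_eq_mul, ← mul_assoc, mul_comm a, hc2 a (hs ▸ Ideal.subset_span ha), zero_mul]
      intro a ha
      have := this ha
      rw [Submodule.mem_annihilator_span_singleton, smul_eq_mul] at this
      rwa [mul_comm]
  obtain ⟨c, hc, hcK⟩ := h2
  have hKP : K ≤ P := by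
    intro a ha
    have h4 : algebraMap Γ(Y, W) S a ∈ IsLocalRing.maximalIdeal S := by
      rw [RingHom.mem_ker.1 ha]; exact zero_mem _
    rwa [IsLocalization.AtPrime.to_map_mem_maximal_iff S P] at h4
  refine ⟨hW.fromSpec '' {q | c ∉ q.asIdeal}, hW.fromSpec ⟨K, hK⟩, ?_, ?_, ?_, ?_⟩
  · exact hW.fromSpec.isOpenEmbedding.isOpenMap _ (PrimeSpectrum.isOpen_basicOpen (a := c))
  · exact ⟨hW.primeIdealOf ⟨y, hy⟩, hc, hW.fromSpec_primeIdealOf ⟨y, hy⟩⟩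
  · exact ⟨⟨K, hK⟩, fun h => hc (hKP h), rfl⟩
  · rintro _ ⟨q, hq, rfl⟩
    refine Specializes.map ?_ hW.fromSpec.continuous
    refine (PrimeSpectrum.le_iff_specializes (R := Γ(Y, W)) _ _).1 ?_
    intro a ha
    have h5 : c * a ∈ q.asIdeal := by rw [hcK a ha]; exact zero_mem _
    exact (q.2.mem_or_mem h5).resolve_left hq

theorem exists_generic {Y : Scheme.{u}} [IsLocallyNoetherian Y] (S : Set Y) (hS : _root_.IsConnected S)
    (hd : ∀ y ∈ S, IsDomain (Y.presheaf.stalk y)) : ∃ ξ : Y, ∀ y ∈ S, ξ ⤳ y := by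
  obtain ⟨⟨y0, hy0⟩, hS⟩ := hS
  have hx := fun y : S => exists_irr y.1 (hd y.1 y.2)
  choose V ξ hV hyV hξ hall using hx
  refine ⟨ξ ⟨y0, hy0⟩, fun y hy => ?_⟩
  have hdis : ∀ a b : S, (V a ∩ V b).Nonempty → ξ a = ξ b := by
    rintro a b ⟨p, hpa, hpb⟩
    have h1 : ξ a ∈ V b := (hall a p hpa).mem_open (hV b) hpb
    have h2 : ξ b ∈ V a := (hall b p hpb).mem_open (hV a) hpa
    exact ((hall a _ h2).antisymm (hall b _ h1)).eq
  by_contra hcon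
  obtain ⟨p, -, hp1, hp2⟩ := hS (⋃ a ∈ {a | ξ a = ξ ⟨y0, hy0⟩}, V a) (⋃ a ∈ {a | ξ a ≠ ξ ⟨y0, hy0⟩}, V a)
    (isOpen_biUnion fun a _ => hV a) (isOpen_biUnion fun a _ => hV a) (by
      intro a ha
      by_cases h : ξ ⟨a, ha⟩ = ξ ⟨y0, hy0⟩
      · exact Or.inl (Set.mem_biUnion (x := ⟨a, ha⟩) h (hyV _))
      · exact Or.inr (Set.mem_biUnion (x := ⟨a, ha⟩) h (hyV _)))
    ⟨y0, hy0, Set.mem_biUnion (x := ⟨y0, hy0⟩) rfl (hyV _)⟩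
    ⟨y, hy, Set.mem_biUnion (x := ⟨y, hy⟩) (fun h => hcon (h ▸ hall _ _ (hyV _))) (hyV _)⟩
  simp only [Set.mem_iUnion] at hp1 hp2
  obtain ⟨a, ha, hpa⟩ := hp1
  obtain ⟨b, hb, hpb⟩ := hp2
  exact hb ((hdis a b ⟨p, hpa, hpb⟩).symm.trans ha)

theorem conn_fiber {X S : Scheme.{u}} {f : X ⟶ S} (h : GeomConnFibers f) (s : S) :
    _root_.IsConnected (f ⁻¹' {s}) := by
  let K := AlgebraicClosure (S.residueField s)
  let g : Spec (CommRingCat.of K) ⟶ S :=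
    Spec.map (CommRingCat.ofHom (algebraMap (S.residueField s) K)) ≫ S.fromSpecResidueField s
  have h1 : ConnectedSpace ↑(pullback f g) := h K g
  have hg : Set.range g = {s} := by
    apply Set.eq_singleton_iff_nonempty_unique_mem.2
    refine ⟨Set.range_nonempty _, ?_⟩
    rintro _ ⟨y, rfl⟩
    have : g y ∈ Set.range (S.fromSpecResidueField s) :=
      ⟨Spec.map (CommRingCat.ofHom (algebraMap (S.residueField s) K)) y, (Scheme.Hom.comp_apply _ _ _).symm⟩
    exact (by simpa using this : s = g y).symm
  have h2 : Set.range (pullback.fst f g) = f ⁻¹' {s} := by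
    rw [Scheme.Pullback.range_fst, hg]
  rw [← h2]
  exact isConnected_range (pullback.fst f g).continuous

theorem geomConn_bc {X S T : Scheme.{u}} {f : X ⟶ S} (h : GeomConnFibers f) (g : T ⟶ S) :
    GeomConnFibers (pullback.snd f g) := by
  intro K _ _ g'
  have h1 : ConnectedSpace ↑(pullback f (g' ≫ g)) := h K (g' ≫ g)
  exact (Scheme.homeoOfIso (pullbackLeftPullbackSndIso f g g')).symm.surjective.connectedSpace
    (Scheme.homeoOfIso (pullbackLeftPullbackSndIso f g g')).symm.continuous

/-- The package of properties used for both `X/S` and `X_T/T`. -/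
structure Fam {D : CommRingCat.{u}} [IsLocalRing D] {Y : Scheme.{u}} (f : Y ⟶ Spec D) : Prop where
  proper : IsProper f
  conn : GeomConnFibers f
  charts : ∀ z, (f z).asIdeal = IsLocalRing.maximalIdeal D → ∃ n l b J, l ≤ n ∧ HasChart f z n l b J
  smooth : ∃ V : Y.Opens, Smooth (V.ι ≫ f) ∧ ∀ y, (f y).asIdeal = ⊥ → y ∈ V

theorem OChart.flat {D O : Type u} [CommRing D] [CommRing O] [IsDomain D] [Algebra D O] {n l : ℕ} {b : D} {J : Set (Fin n)}
    (h : OChart D O n l b J) (hln : l ≤ n) (hl : 0 < l ∨ b = 1) (r : D) (hr : r ≠ 0) (a : O)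
    (ha : algebraMap D O r * a = 0) : a = 0 := by
  obtain ⟨C, _, _, _, _, _, xc, h1, h2, h3, -⟩ := h
  have := h1.flat hln hl
  have h4 : algebraMap D C r * algebraMap O C a = 0 := by
    rw [IsScalarTower.algebraMap_apply D O C, ← map_mul, ha, map_zero]
  have h5 := nzd_of_flat hr h4
  exact FaithfulSMul.algebraMap_injective O C (by rw [h5, map_zero])

theorem OChart.killed {D O : Type u} [CommRing D] [CommRing O] [Algebra D O] {n : ℕ} {b : D} {J : Set (Fin n)}
    (h : OChart D O n 0 b J) : algebraMap D O (1 - b) = 0 := by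
  obtain ⟨C, _, _, _, _, _, xc, h1, h2, h3, -⟩ := h
  apply FaithfulSMul.algebraMap_injective O C
  rw [← IsScalarTower.algebraMap_apply D O C, h1.killed, map_zero]

section
variable {D : CommRingCat.{u}} [IsLocalRing D] [IsDomain D] [IsNoetherianRing D] [IsIntegrallyClosed D]
  {Y : Scheme.{u}} {f : Y ⟶ Spec D}

/-- existence of a good chart -/
def Good (f : Y ⟶ Spec D) (y : Y) : Prop := ∃ n l b J, l ≤ n ∧ (0 < l ∨ b = 1) ∧ HasChart f y n l b J

theorem Good.nzd {y : Y} (h : Good f y) (r : D) (hr : r ≠ 0) (a : Stk f y)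
    (ha : algebraMap D (Stk f y) r * a = 0) : a = 0 := by
  obtain ⟨n, l, b, J, h1, h2, h3⟩ := h
  exact h3.oChart.flat h1 h2 r hr a ha

theorem Fam.good (F : Fam f) (y : Y) : Good f y := by
  have := F.proper
  let s : PrimeSpectrum D := IsLocalRing.closedPoint D
  let B : Set Y := {y | ∃ n b J, b ≠ 1 ∧ HasChart f y n 0 b J}
  have hGo : IsOpen {y | Good f y} := by
    rw [isOpen_iff_forall_mem_open]
    rintro y ⟨n, l, b, J, h1, h2, h3⟩
    obtain ⟨V, hV, hy, hh⟩ := h3.exists_open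
    refine ⟨V, fun y' hy' => ?_, hV, hy⟩
    obtain ⟨J', hJ'⟩ := hh y' hy'
    exact ⟨n, l, b, J', h1, h2, hJ'⟩
  have hBo : IsOpen B := by
    rw [isOpen_iff_forall_mem_open]
    rintro y ⟨n, b, J, h1, h3⟩
    obtain ⟨V, hV, hy, hh⟩ := h3.exists_open
    refine ⟨V, fun y' hy' => ?_, hV, hy⟩
    obtain ⟨J', hJ'⟩ := hh y' hy'
    exact ⟨n, b, J', h1, hJ'⟩
  have hk : ∀ y ∈ B, ∃ r : D, r ≠ 0 ∧ algebraMap D (Stk f y) r = 0 := by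
    rintro y ⟨n, b, J, h1, h3⟩
    exact ⟨1 - b, sub_ne_zero.2 (Ne.symm h1), h3.oChart.killed⟩
  have hdis : ∀ y ∈ B, ¬ Good f y := by
    intro y hy hg
    obtain ⟨r, hr, h0⟩ := hk y hy
    have := hg.nzd r hr 1 (by rw [h0, zero_mul])
    exact one_ne_zero this
  have hcov : f ⁻¹' {s} ⊆ {y | Good f y} ∪ B := by
    intro z hz
    have hz' : f z = s := hz
    have : (f z).asIdeal = IsLocalRing.maximalIdeal D := by rw [hz']; rfl
    obtain ⟨n, l, b, J, h1, h2⟩ := F.charts z this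
    by_cases hl : 0 < l ∨ b = 1
    · exact Or.inl ⟨n, l, b, J, h1, hl, h2⟩
    · push Not at hl
      obtain rfl : l = 0 := by omega
      exact Or.inr ⟨n, b, J, hl.2, h2⟩
  have hall : ∀ z, f z = s → Good f z := by
    obtain ⟨y0, hy0⟩ := (conn_fiber F.conn (⟨⊥, Ideal.isPrime_bot⟩ : PrimeSpectrum D)).nonempty
    have hy0' : (f y0).asIdeal = ⊥ := by
      have : f y0 = (⟨⊥, Ideal.isPrime_bot⟩ : PrimeSpectrum D) := hy0
      rw [this]
    obtain ⟨z0, hz0, hz0'⟩ := spec_to_closed f y0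
    have hz0s : z0 ∈ f ⁻¹' {s} := PrimeSpectrum.ext hz0'
    have hzG : z0 ∈ {y | Good f y} := by
      rcases hcov hz0s with h | h
      · exact h
      · exfalso
        obtain ⟨r, hr, h0⟩ := hk y0 (hz0.mem_open hBo h)
        have h3 := (stkHom_isUnit f y0 r).2 (by rw [hy0']; exact hr)
        have h4 : stkHom f y0 r = 0 := h0
        rw [h4] at h3
        exact not_isUnit_zero (M₀ := Stk f y0) h3
    intro z hz
    rcases hcov hz with h | h
    · exact h
    · exfalso
      obtain ⟨w, -, hw1, hw2⟩ := (conn_fiber F.conn s).isPreconnected _ _ hGo hBo hcov ⟨z0, hz0s, hzG⟩ ⟨z, hz, h⟩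
      exact hdis w hw2 hw1
  obtain ⟨z, hz1, hz2⟩ := spec_to_closed f y
  exact hz1.mem_open hGo (hall z (PrimeSpectrum.ext hz2))

theorem Fam.nzd (F : Fam f) (y : Y) (r : D) (hr : r ≠ 0) (a : Stk f y)
    (ha : algebraMap D (Stk f y) r * a = 0) : a = 0 := (F.good y).nzd r hr a ha

theorem Fam.b_ne_zero (F : Fam f) {y : Y} {n l : ℕ} {b : D} {J : Set (Fin n)} (h : HasChart f y n l b J)
    (i j : Fin n) (hi : i ∈ J) (hj : j ∈ J) (hij : i ≠ j) : b ≠ 0 := by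
  rintro rfl
  obtain ⟨V, hV, hV'⟩ := F.smooth
  obtain ⟨U, gX, x', gT, h1, h2, rfl, h3, h4⟩ := h
  have hc := chartAt_stk f gX gT h2 h3 x'
  set xc : Fin n → Stk (gX ≫ f) x' := fun i =>
      stkHom (D := CommRingCat.of (stdRing D n l 0)) gT x' (stdCoord D n l 0 i) with hxc
  have hJ : ∀ i, i ∈ J ↔ ((i : ℕ) < l ∧ xc i ∈ IsLocalRing.maximalIdeal (Stk (gX ≫ f) x')) := by
    intro i
    rw [h4]
    exact and_congr Iff.rfl (stkHom_mem (D := CommRingCat.of (stdRing D n l 0)) gT x' _).symm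
  have e0 : D ≃+* D ⧸ (⊥ : Ideal D) := (RingEquiv.quotientBot D).symm
  have : IsDomain (D ⧸ (⊥ : Ideal D)) := e0.symm.toMulEquiv.isDomain _
  have : IsIntegrallyClosed (D ⧸ (⊥ : Ideal D)) := IsIntegrallyClosed.of_equiv e0
  have key := fun s => hc.stdPrime ⊥ (Ideal.zero_mem _) (by simp) s
  obtain ⟨p1, -, p3⟩ := key {i, j} (by
    rintro k (rfl | rfl)
    exacts [((hJ _).1 hi).2, ((hJ _).1 hj).2]) i ((hJ i).1 hi).1 (by simp)
  simp only [Ideal.map_bot, bot_sup_eq] at p1 p3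
  obtain ⟨u', hu, hloc⟩ := exists_gen (gX ≫ f) x' (Ideal.span (xc '' {i, j}))
  let _ := specAlg (gX ≫ f) hu
  have htow := specAlg_tower (gX ≫ f) hu
  have hu0 : (f (gX u')).asIdeal = ⊥ := by
    rw [eq_bot_iff]
    intro r hr
    have hr' : algebraMap D (Stk (gX ≫ f) u') r ∈ IsLocalRing.maximalIdeal _ := by
      rw [stkHom_mem]; simpa using hr
    rw [IsScalarTower.algebraMap_apply D (Stk (gX ≫ f) x') (Stk (gX ≫ f) u')] at hr'
    rw [IsLocalization.AtPrime.to_map_mem_maximal_iff _ (Ideal.span (xc '' {i, j}))] at hr'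
    exact p3 r hr'
  have hdom : IsDomain (Stk (gX ≫ f) u') := by
    refine (smooth_stk_normal (gX ≫ f) (gX ⁻¹ᵁ V) ?_ u' (hV' _ hu0)).1
    have : (gX ⁻¹ᵁ V).ι ≫ gX ≫ f = (gX ∣_ V) ≫ V.ι ≫ f := by simp
    rw [this]
    have : Smooth (gX ∣_ V) := inferInstance
    infer_instance
  have hp := hc.prod
  rw [map_zero] at hp
  have hp2 := congrArg (algebraMap (Stk (gX ≫ f) x') (Stk (gX ≫ f) u')) hp
  rw [map_zero, map_prod, Finset.prod_eq_zero_iff] at hp2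
  obtain ⟨k, -, hk⟩ := hp2
  have hkl : (k : ℕ) < l := by
    by_contra hkl
    rw [if_neg hkl, map_one] at hk
    exact one_ne_zero hk
  rw [if_pos hkl] at hk
  change algebraMap (Stk (gX ≫ f) x') (Stk (gX ≫ f) u') (xc k) = 0 at hk
  rw [IsLocalization.map_eq_zero_iff (Ideal.span (xc '' {i, j})).primeCompl] at hk
  obtain ⟨⟨t, ht⟩, htk⟩ := hk
  have hkey2 : ∀ m ∈ ({i, j} : Set (Fin n)), m ≠ k → False := by
    intro m hm hmk
    have hmJ : m ∈ J := by rcases hm with rfl | rfl <;> assumption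
    obtain ⟨q1, q2, q3⟩ := key {m} (by rintro _ rfl; exact ((hJ _).1 hmJ).2) m ((hJ m).1 hmJ).1 rfl
    simp only [Ideal.map_bot, bot_sup_eq] at q1 q2 q3
    have h5 := q2 k (by simpa using hmk.symm)
    have h6 : t * xc k ∈ Ideal.span (xc '' {m}) := by
      change t * xc k = 0 at htk
      rw [htk]; exact Ideal.zero_mem _
    refine ht (Ideal.span_mono (Set.image_mono (by simpa using hm)) ((q1.mem_or_mem h6).resolve_right h5))
  by_cases hik : i = k
  · exact hkey2 j (by simp) (fun h => hij (hik.trans h.symm))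
  · exact hkey2 i (by simp) hik

theorem Fam.noeth (F : Fam f) : IsLocallyNoetherian Y := by
  have := F.proper
  exact LocallyOfFiniteType.isLocallyNoetherian f

theorem Fam.stk_noeth (F : Fam f) (y : Y) : IsNoetherianRing (Stk f y) := by
  have := F.noeth
  exact inferInstanceAs (IsNoetherianRing (Y.presheaf.stalk y))

theorem Fam.exists_gen_zero (F : Fam f) (y : Y) (Q : Ideal (Stk f y)) [Q.IsPrime]
    (hQ : ∀ r : D, algebraMap D (Stk f y) r ∈ Q → r = 0) :
    ∃ (y' : Y) (h : y' ⤳ y), (f y').asIdeal = ⊥ ∧ IsDomain (Stk f y') ∧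
      letI := specAlg f h; IsLocalization.AtPrime (Stk f y') Q := by
  obtain ⟨V, hV, hV'⟩ := F.smooth
  obtain ⟨y', hu, hloc⟩ := exists_gen f y Q
  let _ := specAlg f hu
  have htow := specAlg_tower f hu
  have hu0 : (f y').asIdeal = ⊥ := by
    rw [eq_bot_iff]
    intro r hr
    have hr' : algebraMap D (Stk f y') r ∈ IsLocalRing.maximalIdeal _ := by
      rw [stkHom_mem]; simpa using hr
    rw [IsScalarTower.algebraMap_apply D (Stk f y) (Stk f y')] at hr'
    rw [IsLocalization.AtPrime.to_map_mem_maximal_iff _ Q] at hr'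
    exact hQ r hr'
  exact ⟨y', hu, hu0, (smooth_stk_normal f V hV y' (hV' _ hu0)).1, hloc⟩

theorem Fam.integral (F : Fam f) : IsIntegral Y := by
  have := F.noeth
  obtain ⟨V, hV, hV'⟩ := F.smooth
  have hgen := conn_fiber F.conn (⟨⊥, Ideal.isPrime_bot⟩ : PrimeSpectrum D)
  have hbot : ∀ y, y ∈ f ⁻¹' {(⟨⊥, Ideal.isPrime_bot⟩ : PrimeSpectrum D)} → (f y).asIdeal = ⊥ := by
    intro y hy
    have : f y = (⟨⊥, Ideal.isPrime_bot⟩ : PrimeSpectrum D) := hy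
    rw [this]
  obtain ⟨ξ, hξ⟩ := exists_generic _ hgen (fun y hy => (smooth_stk_normal f V hV y (hV' y (hbot y hy))).1)
  have hass : ∀ (y : Y) (a : Stk f y), a ≠ 0 → ∃ Q : Ideal (Stk f y), Q.IsPrime ∧
      (∀ r : D, algebraMap D (Stk f y) r ∈ Q → r = 0) ∧ ∀ t, t * a = 0 → t ∈ Q := by
    intro y a ha
    have := F.stk_noeth y
    obtain ⟨Q, hQ, hQ2⟩ := exists_le_isAssociatedPrime_of_isNoetherianRing (Stk f y) a ha
    obtain ⟨hQp, c, hc⟩ := isAssociatedPrime_iff.1 hQ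
    refine ⟨Q, hQp, fun r hr => ?_, fun t ht => ?_⟩
    · by_contra hr0
      have hc0 : c = 0 := by
        refine F.nzd y r hr0 c ?_
        rw [hc, Submodule.mem_colon_singleton] at hr
        simpa using hr
      refine hQp.ne_top ((Ideal.eq_top_iff_one _).2 ?_)
      rw [hc, hc0, Submodule.mem_colon_singleton]
      simp
    · exact hQ2 (by rw [Submodule.mem_colon_singleton]; simpa using ht)
  have hgen : ∀ y : Y, ξ ⤳ y := by
    intro y
    obtain ⟨Q, hQ, h1, -⟩ := hass y 1 one_ne_zero
    obtain ⟨y', h2, h3, -⟩ := F.exists_gen_zero y Q h1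
    exact (hξ y' (PrimeSpectrum.ext h3)).trans h2
  have hred : IsReduced Y := by
    have : ∀ y : Y, _root_.IsReduced (Y.presheaf.stalk y) := by
      intro y
      suffices h0 : _root_.IsReduced (Stk f y) from h0
      refine ⟨fun a ha => ?_⟩
      by_contra ha0
      obtain ⟨Q, hQ, h1, h2⟩ := hass y a ha0
      obtain ⟨y', h2', h3, h4, h5⟩ := F.exists_gen_zero y Q h1
      let _ := specAlg f h2'
      have h6 : algebraMap (Stk f y) (Stk f y') a = 0 := (ha.map (algebraMap (Stk f y) (Stk f y'))).eq_zero
      rw [IsLocalization.map_eq_zero_iff Q.primeCompl] at h6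
      obtain ⟨⟨t, ht⟩, h7⟩ := h6
      exact ht (h2 t h7)
    exact isReduced_of_isReduced_stalk Y
  have : IrreducibleSpace Y := by
    have h1 : closure {ξ} = (Set.univ : Set Y) := Set.eq_univ_of_forall fun y => (hgen y).mem_closure
    have h2 : IsIrreducible (Set.univ : Set Y) := by
      rw [← h1]; exact isIrreducible_singleton.closure
    have : PreirreducibleSpace Y := ⟨h2.2⟩
    exact ⟨⟨ξ⟩⟩
  exact isIntegral_of_irreducibleSpace_of_isReduced Y

end

section
variable {D : CommRingCat.{u}} {Y : Scheme.{u}} (f : Y ⟶ Spec D)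

/-- the prime of the stalk at `z` given by a generization -/
def primeOf {η z : Y} (h : η ⤳ z) : Ideal (Stk f z) :=
  (IsLocalRing.maximalIdeal (Stk f η)).comap (specAlg f h).algebraMap

theorem mem_primeOf {η z : Y} (h : η ⤳ z) (a : Stk f z) :
    a ∈ primeOf f h ↔ (specAlg f h).algebraMap a ∈ IsLocalRing.maximalIdeal (Stk f η) := Iff.rfl

instance primeOf_prime {η z : Y} (h : η ⤳ z) : (primeOf f h).IsPrime := by
  unfold primeOf; infer_instance

theorem primeOf_facts {η z : Y} (h : η ⤳ z) (W : Y.Opens) (hW : IsAffineOpen W) (hz : z ∈ W) (hη : η ∈ W) :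
    (primeOf f h).comap (Y.presheaf.germ W z hz).hom = (hW.primeIdealOf ⟨η, hη⟩).asIdeal := by
  ext a
  let _ : Algebra Γ(Y, W) (Stk f η) := (Y.presheaf.germ W η hη).hom.toAlgebra
  have h1 : IsLocalization.AtPrime (Stk f η) (hW.primeIdealOf ⟨η, hη⟩).asIdeal := hW.isLocalization_stalk ⟨η, hη⟩
  rw [← IsLocalization.AtPrime.to_map_mem_maximal_iff (Stk f η) (hW.primeIdealOf ⟨η, hη⟩).asIdeal]
  refine Iff.trans (show _ ↔ (specAlg f h).algebraMap ((Y.presheaf.germ W z hz).hom a) ∈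
    IsLocalRing.maximalIdeal (Stk f η) from Iff.rfl) ?_
  have := congrArg (fun F => F.hom a) (Y.presheaf.germ_stalkSpecializes hz h)
  exact iff_of_eq (congrArg (fun v => v ∈ IsLocalRing.maximalIdeal (Stk f η)) this)

theorem specAlg_loc {η z : Y} (h : η ⤳ z) :
    letI := specAlg f h; IsLocalization.AtPrime (Stk f η) (primeOf f h) := by
  obtain ⟨W, hW, hz, -⟩ := exists_affine z ⊤ (TopologicalSpace.Opens.mem_top _)
  have hη : η ∈ W := h.mem_open W.2 hz
  let _ : Algebra Γ(Y, W) (Stk f z) := (Y.presheaf.germ W z hz).hom.toAlgebra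
  have h1 : IsLocalization.AtPrime (Stk f z) (hW.primeIdealOf ⟨z, hz⟩).asIdeal := hW.isLocalization_stalk ⟨z, hz⟩
  let _ := specAlg f h
  let _ : Algebra Γ(Y, W) (Stk f η) := (Y.presheaf.germ W η hη).hom.toAlgebra
  have e : (primeOf f h).comap (algebraMap Γ(Y, W) (Stk f z)) = (hW.primeIdealOf ⟨η, hη⟩).asIdeal :=
    primeOf_facts f h W hW hz hη
  have h5 : IsLocalization.AtPrime (Stk f η) ((primeOf f h).comap (algebraMap Γ(Y, W) (Stk f z))) := by
    have h6 : IsLocalization.AtPrime (Stk f η) (hW.primeIdealOf ⟨η, hη⟩).asIdeal := hW.isLocalization_stalk ⟨η, hη⟩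
    unfold IsLocalization.AtPrime at h6 ⊢
    convert h6
  have : IsScalarTower Γ(Y, W) (Stk f z) (Stk f η) := IsScalarTower.of_algebraMap_eq fun d =>
    (congrArg (fun F => F.hom d) (Y.presheaf.germ_stalkSpecializes hz h)).symm
  exact loc_of_loc (R := Γ(Y, W)) (hW.primeIdealOf ⟨z, hz⟩).asIdeal.primeCompl (primeOf f h)

theorem primeOf_le {η₁ η₂ z : Y} (h₁ : η₁ ⤳ z) (h₂ : η₂ ⤳ z) :
    primeOf f h₁ ≤ primeOf f h₂ ↔ η₁ ⤳ η₂ := by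
  constructor
  · intro hle
    obtain ⟨W, hW, hz, -⟩ := exists_affine z ⊤ (TopologicalSpace.Opens.mem_top _)
    have hη₁ : η₁ ∈ W := h₁.mem_open W.2 hz
    have hη₂ : η₂ ∈ W := h₂.mem_open W.2 hz
    have h3 : hW.primeIdealOf ⟨η₁, hη₁⟩ ⤳ hW.primeIdealOf ⟨η₂, hη₂⟩ := by
      rw [← PrimeSpectrum.le_iff_specializes]
      change (hW.primeIdealOf ⟨η₁, hη₁⟩).asIdeal ≤ (hW.primeIdealOf ⟨η₂, hη₂⟩).asIdeal
      rw [← primeOf_facts f h₁ W hW hz hη₁, ← primeOf_facts f h₂ W hW hz hη₂]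
      exact Ideal.comap_mono hle
    have := h3.map hW.fromSpec.continuous
    rwa [hW.fromSpec_primeIdealOf, hW.fromSpec_primeIdealOf] at this
  · intro h a ha
    rw [mem_primeOf] at ha ⊢
    have e : (specAlg f h₁).algebraMap a = (specAlg f h).algebraMap ((specAlg f h₂).algebraMap a) :=
      (congrArg (fun F => F.hom a) (Y.presheaf.stalkSpecializes_comp h h₂)).symm
    rw [e] at ha
    by_contra hc
    have hu : IsUnit ((specAlg f h₂).algebraMap a) := by simpa using hc
    exact ha (hu.map _)

theorem primeOf_inj {η₁ η₂ z : Y} (h₁ : η₁ ⤳ z) (h₂ : η₂ ⤳ z) (h : primeOf f h₁ = primeOf f h₂) : η₁ = η₂ :=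
  (((primeOf_le f h₁ h₂).1 h.le).antisymm ((primeOf_le f h₂ h₁).1 h.ge)).eq

theorem exists_primeOf (z : Y) (Q : Ideal (Stk f z)) [Q.IsPrime] : ∃ (η : Y) (h : η ⤳ z), primeOf f h = Q := by
  obtain ⟨η, h, hl⟩ := exists_gen f z Q
  refine ⟨η, h, ?_⟩
  let _ := specAlg f h
  exact IsLocalization.AtPrime.comap_maximalIdeal (Stk f η) Q

theorem algebraMap_mem_primeOf {η z : Y} (h : η ⤳ z) (r : D) :
    algebraMap D (Stk f z) r ∈ primeOf f h ↔ r ∈ (f η).asIdeal := by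
  rw [mem_primeOf, ← stkHom_mem]
  have := (specAlg_tower f h)
  let _ := specAlg f h
  rw [IsScalarTower.algebraMap_apply D (Stk f z) (Stk f η)]

end

section
variable {D : CommRingCat.{u}} [IsLocalRing D] {Y : Scheme.{u}} {f : Y ⟶ Spec D}

theorem asIdeal_le (s : Spec D) : s.asIdeal ≤ IsLocalRing.maximalIdeal D :=
  IsLocalRing.le_maximalIdeal s.2.ne_top

theorem mExt_le_primeOf {η z : Y} (h : η ⤳ z) :
    mExt D (Stk f z) ≤ primeOf f h ↔ (f η).asIdeal = IsLocalRing.maximalIdeal D := by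
  rw [mExt, Ideal.map_le_iff_le_comap]
  constructor
  · intro h1
    exact le_antisymm (asIdeal_le _) fun r hr => (algebraMap_mem_primeOf f h r).1 (h1 hr)
  · intro h1 r hr
    exact (algebraMap_mem_primeOf f h r).2 (by rwa [h1])

/-- generic points of the closed fibre -/
def IsGen (f : Y ⟶ Spec D) (η : Y) : Prop :=
  (f η).asIdeal = IsLocalRing.maximalIdeal D ∧ ∀ y, y ⤳ η → (f y).asIdeal = IsLocalRing.maximalIdeal D → y = η

theorem isGen_iff {η z : Y} (h : η ⤳ z) : IsGen f η ↔ primeOf f h ∈ (mExt D (Stk f z)).minimalPrimes := by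
  constructor
  · rintro ⟨h1, h2⟩
    refine ⟨⟨inferInstance, (mExt_le_primeOf h).2 h1⟩, ?_⟩
    rintro Q ⟨hQ, hQ2⟩ hle
    obtain ⟨y, hy, rfl⟩ := exists_primeOf f z Q
    have := h2 y ((primeOf_le f hy h).1 hle) ((mExt_le_primeOf hy).1 hQ2)
    subst this
    exact le_rfl
  · intro h1
    refine ⟨(mExt_le_primeOf h).1 h1.1.2, fun y hy hy2 => ?_⟩
    have hyz := hy.trans h
    exact (hy.antisymm ((primeOf_le f h hyz).1 (h1.2 ⟨inferInstance, (mExt_le_primeOf hyz).2 hy2⟩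
      ((primeOf_le f hyz h).2 hy)))).eq

theorem exists_isGen_of_min (z : Y) (Q : Ideal (Stk f z)) (hQ : Q ∈ (mExt D (Stk f z)).minimalPrimes) :
    ∃ (η : Y) (h : η ⤳ z), IsGen f η ∧ primeOf f h = Q := by
  have := hQ.1.1
  obtain ⟨η, h, rfl⟩ := exists_primeOf f z Q
  exact ⟨η, h, (isGen_iff h).2 hQ, rfl⟩

theorem mExt_le_max (z : Y) (hz : (f z).asIdeal = IsLocalRing.maximalIdeal D) :
    mExt D (Stk f z) ≤ IsLocalRing.maximalIdeal (Stk f z) := by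
  rw [mExt, Ideal.map_le_iff_le_comap]
  intro r hr
  exact (stkHom_mem f z r).2 (by rwa [hz])

theorem exists_isGen (z : Y) (hz : (f z).asIdeal = IsLocalRing.maximalIdeal D) : ∃ η, η ⤳ z ∧ IsGen f η := by
  obtain ⟨Q, hQ, -⟩ := Ideal.exists_minimalPrimes_le (mExt_le_max z hz)
  obtain ⟨η, h, h1, -⟩ := exists_isGen_of_min z Q hQ
  exact ⟨η, h, h1⟩

end

/-- an `OChart` with local chart -/
def OLoc (D O : Type u) [CommRing D] [IsLocalRing D] [CommRing O] [Algebra D O] (ι : Type) (b : D) : Prop :=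
  ∃ (C : Type u) (_ : CommRing C) (_ : IsLocalRing C) (_ : Algebra D C) (_ : Algebra O C)
    (_ : IsScalarTower D O C) (_ : Fintype ι) (x : ι → C), LocalChart D C x b ∧ IsNoetherianRing C ∧ Module.Flat D C ∧
    Module.FaithfullyFlat O C ∧ mExt D C ≤ IsLocalRing.maximalIdeal C ∧ (∀ i, x i ∈ IsLocalRing.maximalIdeal C)

/-- smooth-type charts -/
def OSmooth (D O : Type u) [CommRing D] [CommRing O] [Algebra D O] : Prop :=
  ∃ (C : Type u) (_ : CommRing C) (_ : IsLocalRing C) (_ : Algebra D C) (_ : Algebra O C)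
    (_ : IsScalarTower D O C), TypeS D C ∧ IsLocalHom (algebraMap O C) ∧ Module.FaithfullyFlat O C ∧
    ∀ _ : IsLocalRing O, (IsLocalRing.maximalIdeal O).map (algebraMap O C) = IsLocalRing.maximalIdeal C

section
variable {D O : Type u} [CommRing D] [IsLocalRing D] [CommRing O] [IsLocalRing O] [Algebra D O] {n l : ℕ} {b : D}
  {J : Set (Fin n)}

theorem mExt_le_C {C : Type u} [CommRing C] [IsLocalRing C] [Algebra D C] [Algebra O C] [IsScalarTower D O C]
    (hl : IsLocalHom (algebraMap O C)) (h : mExt D O ≤ IsLocalRing.maximalIdeal O) :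
    mExt D C ≤ IsLocalRing.maximalIdeal C := by
  rw [← mExt_map D O C, Ideal.map_le_iff_le_comap]
  intro a ha
  exact map_nonunit (algebraMap O C) a (h ha)

theorem OChart.oLoc [IsNoetherianRing D] (h : OChart D O n l b J) (hln : l ≤ n)
    (hO : mExt D O ≤ IsLocalRing.maximalIdeal O) (j : Fin n) (hj : j ∈ J) : OLoc D O J b := by
  classical
  obtain ⟨C, _, _, _, _, _, xc, h1, h2, h3, h4, -⟩ := h
  obtain rfl : J = {i : Fin n | (i : ℕ) < l ∧ xc i ∈ IsLocalRing.maximalIdeal C} := Set.ext h4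
  have hm := mExt_le_C h2 hO
  have hl : 0 < l := lt_of_le_of_lt (Nat.zero_le _) hj.1
  exact ⟨C, inferInstance, inferInstance, inferInstance, inferInstance, inferInstance, _,
    fun i => xc i, h1.localChart hm ⟨j, hj⟩, h1.noeth, h1.flat hln (Or.inl hl), h3, hm, fun i => i.2.2⟩

theorem OChart.oSmooth (h : OChart D O n l b J) (hln : l ≤ n) (hl : 0 < l ∨ b = 1)
    (hJ : ∀ i ∈ J, ∀ j ∈ J, i = j) : OSmooth D O := by
  obtain ⟨C, _, _, _, _, _, xc, h1, h2, h3, h4, h5⟩ := h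
  refine ⟨C, inferInstance, inferInstance, inferInstance, inferInstance, inferInstance,
    h1.typeS hln hl ⟨fun i j => Subtype.ext (hJ _ ((h4 _).2 i.2) _ ((h4 _).2 j.2))⟩, h2, h3, h5⟩

theorem OSmooth.prime (h : OSmooth D O) (hO : mExt D O ≤ IsLocalRing.maximalIdeal O) : (mExt D O).IsPrime := by
  obtain ⟨C, _, _, _, _, _, h1, h2, h3, -⟩ := h
  have := h1.prime (mExt_le_C h2 hO)
  rw [← Ideal.comap_map_eq_self_of_faithfullyFlat (B := C) (mExt D O), mExt_map]
  infer_instance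

theorem OLoc.inf {ι : Type} (h : OLoc D O ι b) (y : O) (hy : ∀ Q ∈ (mExt D O).minimalPrimes, y ∈ Q) :
    y ∈ mExt D O := by
  obtain ⟨C, _, _, _, _, _, _, x, h1, -, -, h3, -⟩ := h
  exact h1.inf_O y hy

/-- a LocalChart with a single coordinate -/
theorem OSmooth.oLoc [IsNoetherianRing D] (h : OSmooth D O) (hO : mExt D O ≤ IsLocalRing.maximalIdeal O) (t : D)
    (ht : IsLocalRing.maximalIdeal D = Ideal.span {t}) : OLoc D O Unit t := by
  obtain ⟨C, _, _, _, _, _, h1, h2, h3, -⟩ := h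
  have hm := mExt_le_C h2 hO
  have hp := h1.prime hm
  have htm : t ∈ IsLocalRing.maximalIdeal D := by rw [ht]; exact Ideal.mem_span_singleton_self _
  have h0 : algebraMap D C t ∈ mExt D C := Ideal.mem_map_of_mem _ htm
  have e : mExt D C ⊔ Ideal.span {algebraMap D C t} = mExt D C :=
    sup_eq_left.2 (by rwa [Ideal.span_singleton_le_iff_mem])
  refine ⟨C, inferInstance, inferInstance, inferInstance, inferInstance, inferInstance, inferInstance,
    fun _ => algebraMap D C t, ⟨⟨()⟩, htm, ⟨1, isUnit_one, by simp⟩, fun j => by rwa [e], fun i j hij => (hij rfl).elim,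
    fun i j hij => (hij rfl).elim, fun i j k hij => (hij rfl).elim⟩, h1.noeth, h1.flat, h3, hm, fun _ => hm h0⟩

theorem OChart.subsingleton_of_max (h : OChart D O n l b J)
    (hO : mExt D O = IsLocalRing.maximalIdeal O) (i j : Fin n) (hi : i ∈ J) (hj : j ∈ J) : i = j := by
  classical
  obtain ⟨C, _, _, _, _, _, xc, h1, h2, h3, h4, h5⟩ := h
  have hm := mExt_le_C h2 hO.le
  have e : mExt D C = IsLocalRing.maximalIdeal C := by
    rw [← mExt_map D O C, hO, h5]
  have hL := h1.localChart hm ⟨j, (h4 _).1 hj⟩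
  by_contra hne
  refine hL.notmem ⟨i, (h4 _).1 hi⟩ ⟨j, (h4 _).1 hj⟩ (by simpa using hne) (Ideal.mem_sup_left ?_)
  rw [e]
  exact ((h4 _).1 hi).2

end

section
variable {D : CommRingCat.{u}} [IsLocalRing D] [IsDomain D] [IsNoetherianRing D] [IsIntegrallyClosed D]
  {Y : Scheme.{u}} {f : Y ⟶ Spec D}

theorem Fam.inf (F : Fam f) (z : Y) (hz : (f z).asIdeal = IsLocalRing.maximalIdeal D) (y : Stk f z)
    (hy : ∀ (η : Y) (h : η ⤳ z), IsGen f η → y ∈ primeOf f h) : y ∈ mExt D (Stk f z) := by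
  have hy' : ∀ Q ∈ (mExt D (Stk f z)).minimalPrimes, y ∈ Q := by
    intro Q hQ
    obtain ⟨η, h, h1, rfl⟩ := exists_isGen_of_min z Q hQ
    exact hy η h h1
  obtain ⟨n, l, b, J, h1, h2, h3⟩ := F.good z
  by_cases hJ : ∃ j, j ∈ J
  · obtain ⟨j, hj⟩ := hJ
    exact (h3.oChart.oLoc h1 (mExt_le_max z hz) j hj).inf y hy'
  · have := (h3.oChart.oSmooth h1 h2 (fun i hi => (hJ ⟨i, hi⟩).elim)).prime (mExt_le_max z hz)
    exact hy' _ (by rw [Ideal.minimalPrimes_eq_subsingleton_self]; rfl)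

theorem Fam.gen_max (F : Fam f) (η : Y) (hη : IsGen f η) : mExt D (Stk f η) = IsLocalRing.maximalIdeal (Stk f η) := by
  refine le_antisymm (mExt_le_max η hη.1) fun y hy => F.inf η hη.1 y ?_
  intro η' h h1
  obtain rfl := hη.2 η' h h1.1
  rw [mem_primeOf]
  have : (specAlg f h).algebraMap y = y :=
    congrArg (fun F => F.hom y) (Y.presheaf.stalkSpecializes_refl (x := η'))
  rwa [this]

theorem Fam.gen_smooth (F : Fam f) (η : Y) (hη : IsGen f η) : OSmooth D (Stk f η) := by
  obtain ⟨n, l, b, J, h1, h2, h3⟩ := F.good η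
  exact h3.oChart.oSmooth h1 h2 fun i hi j hj => h3.oChart.subsingleton_of_max (F.gen_max η hη) i j hi hj

end

/-- local Cartier equations in an `OLoc` -/
theorem OLoc.cartier {A O : Type u} [CommRing A] [IsLocalRing A] [IsDomain A] [CommRing O] [IsNoetherianRing O]
    [Algebra A O] {ι : Type} {b : A} (h : OLoc A O ι b) (t : A) (ht0 : t ≠ 0)
    (ht : IsLocalRing.maximalIdeal A = Ideal.span {t})
    (κ : ℕ) (hκ : 0 < κ) (w : A) (hw : IsUnit w) (hb : b = t ^ κ * w) (L : ℕ) (hL : κ ∣ L)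
    (S : Set (Ideal O)) :
    ∃ a a' : O, a * a' = algebraMap A O t ^ L ∧
      ∀ Q ∈ (mExt A O).minimalPrimes, (Q ∈ S → a' ∉ Q) ∧ (Q ∉ S → a ∉ Q) := by
  obtain ⟨e, rfl⟩ := hL
  obtain ⟨C, _, _, _, _, _, _, x, h1, -, h3, h4, -⟩ := h
  exact local_cartier h1 t ht (fun c hc => nzd_of_flat ht0 hc) κ hκ w hw hb e S

theorem Fam.cartier {A : CommRingCat.{u}} [IsDomain A] [IsDiscreteValuationRing A]
    {Y : Scheme.{u}} {f : Y ⟶ Spec A} (F : Fam f) (t : A) (ht : Irreducible t) :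
    ∃ L : ℕ, 0 < L ∧ ∀ z : Y, (f z).asIdeal = IsLocalRing.maximalIdeal A → ∀ S : Set (Ideal (Stk f z)),
      ∃ a a' : Stk f z, a * a' = algebraMap A (Stk f z) t ^ L ∧
        ∀ Q ∈ (mExt A (Stk f z)).minimalPrimes, (Q ∈ S → a' ∉ Q) ∧ (Q ∉ S → a ∉ Q) := by
  classical
  have hmax := ht.maximalIdeal_eq
  have := F.proper
  have : CompactSpace Y := (quasiCompact_iff_compactSpace f).1 inferInstance
  have key : ∀ y : Y, ∃ V : Set Y, IsOpen V ∧ y ∈ V ∧ ∃ κ : ℕ, 0 < κ ∧ ∀ L, κ ∣ L → ∀ z ∈ V,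
      (f z).asIdeal = IsLocalRing.maximalIdeal A → ∀ S : Set (Ideal (Stk f z)),
      ∃ a a' : Stk f z, a * a' = algebraMap A (Stk f z) t ^ L ∧
        ∀ Q ∈ (mExt A (Stk f z)).minimalPrimes, (Q ∈ S → a' ∉ Q) ∧ (Q ∉ S → a ∉ Q) := by
    intro y
    obtain ⟨n, l, b, J, hln, hl, hc⟩ := F.good y
    obtain ⟨V, hV, hy, H⟩ := hc.exists_open
    refine ⟨V, hV, hy, ?_⟩
    have hk : ∃ κ : ℕ, 0 < κ ∧ (b ≠ 0 → ¬ IsUnit b → ∃ w, IsUnit w ∧ b = t ^ κ * w) := by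
      by_cases hb : b = 0
      · exact ⟨1, one_pos, fun h => absurd hb h⟩
      obtain ⟨m, u, hu⟩ := IsDiscreteValuationRing.eq_unit_mul_pow_irreducible hb ht
      rcases Nat.eq_zero_or_pos m with rfl | hm
      · exact ⟨1, one_pos, fun _ h => absurd (by rw [hu]; simp) h⟩
      · exact ⟨m, hm, fun _ _ => ⟨u, u.isUnit, by rw [hu, mul_comm]⟩⟩
    obtain ⟨κ, hκ, hw⟩ := hk
    refine ⟨κ, hκ, fun L hL z hz hzc S => ?_⟩
    have := F.stk_noeth z
    obtain ⟨J', hc'⟩ := H z hz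
    have hO := mExt_le_max z hzc
    by_cases h2 : ∃ i ∈ J', ∃ j ∈ J', i ≠ j
    · obtain ⟨i, hi, j, hj, hij⟩ := h2
      have hb0 := F.b_ne_zero hc' i j hi hj hij
      have hoc := hc'.oChart.oLoc hln hO i hi
      have hbu : ¬ IsUnit b := by
        obtain ⟨C, _, _, _, _, _, _, x, h1, -⟩ := hoc
        exact h1.hb
      obtain ⟨w, hw1, hw2⟩ := hw hb0 hbu
      exact hoc.cartier t ht.ne_zero hmax κ hκ w hw1 hw2 L hL S
    · have hs := hc'.oChart.oSmooth hln hl (fun i hi j hj => by by_contra hij; exact h2 ⟨i, hi, j, hj, hij⟩)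
      exact (hs.oLoc hO t hmax).cartier t ht.ne_zero hmax 1 one_pos 1 isUnit_one (by simp) L (one_dvd _) S
  choose V hV hy κ hκ H using key
  obtain ⟨s, -, hs⟩ := isCompact_univ.elim_nhds_subcover V (fun y _ => (hV y).mem_nhds (hy y))
  refine ⟨∏ y ∈ s, κ y, Finset.prod_pos fun y _ => hκ y, fun z hz S => ?_⟩
  obtain ⟨y, hys, hyz⟩ := Set.mem_iUnion₂.1 (hs (Set.mem_univ z))
  exact H y _ (Finset.dvd_prod_of_mem κ hys) z hyz hz S

section
variable {D : CommRingCat.{u}} {Y : Scheme.{u}} (f : Y ⟶ Spec D)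

/-- germs as elements of `Stk` -/
def gm {V : Y.Opens} {y : Y} (hy : y ∈ V) : Γ(Y, V) →+* Stk f y := (Y.presheaf.germ V y hy).hom

/-- sections coming from the base -/
def bsec (V : Y.Opens) : D →+* Γ(Y, V) := ((Scheme.ΓSpecIso D).inv ≫ f.appLE ⊤ V le_top).hom

/-- restriction of sections -/
def res {V V' : Y.Opens} (h : V' ≤ V) : Γ(Y, V) →+* Γ(Y, V') := (Y.presheaf.map (homOfLE h).op).hom

theorem gm_bsec {V : Y.Opens} {y : Y} (hy : y ∈ V) (r : D) : gm f hy (bsec f V r) = algebraMap D (Stk f y) r := by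
  have := congrArg (fun F => F.hom r) (stkHom_germ f y V hy)
  exact this

theorem gm_spec {V : Y.Opens} {η z : Y} (hz : z ∈ V) (hη : η ∈ V) (h : η ⤳ z) (g : Γ(Y, V)) :
    (specAlg f h).algebraMap (gm f hz g) = gm f hη g :=
  congrArg (fun F => F.hom g) (Y.presheaf.germ_stalkSpecializes hz h)

theorem gm_mem_primeOf {V : Y.Opens} {η z : Y} (hz : z ∈ V) (hη : η ∈ V) (h : η ⤳ z) (g : Γ(Y, V)) :
    gm f hz g ∈ primeOf f h ↔ ¬ IsUnit (gm f hη g) := by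
  rw [mem_primeOf, gm_spec f hz hη h]; rfl

theorem gm_res {V V' : Y.Opens} (h : V' ≤ V) {y : Y} (hy : y ∈ V') (g : Γ(Y, V)) :
    gm f hy (res h g) = gm f (h hy) g :=
  congrArg (fun F => F.hom g) (Y.presheaf.germ_res (homOfLE h) y hy)

theorem gm_inj [IsIntegral Y] {V : Y.Opens} {y : Y} (hy : y ∈ V) : Function.Injective (gm f hy) :=
  germ_injective_of_isIntegral Y y hy

theorem stk_domain [IsIntegral Y] (y : Y) : IsDomain (Stk f y) :=
  inferInstanceAs (IsDomain (Y.presheaf.stalk y))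

theorem exists_gm {y : Y} (a : Stk f y) : ∃ (V : Y.Opens) (hy : y ∈ V) (g : Γ(Y, V)), gm f hy g = a := by
  obtain ⟨V, hy, g, hg⟩ := Y.presheaf.exists_germ_eq (x := y) a
  exact ⟨V, hy, g, hg⟩

theorem gm_nzd [IsIntegral Y] {V : Y.Opens} {y : Y} (hy : y ∈ V) (g : Γ(Y, V)) :
    g ∈ nonZeroDivisors Γ(Y, V) ↔ gm f hy g ≠ 0 := by
  have : Nonempty V := ⟨⟨y, hy⟩⟩
  rw [mem_nonZeroDivisors_iff_ne_zero, Ne, Ne, map_eq_zero_iff _ (gm_inj f hy)]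

theorem germOrd_iff {V : Y.Opens} {y : Y} (hy : y ∈ V) (g : Γ(Y, V)) (m : ℕ) :
    germOrd V g y hy m ↔ elemOrd (Stk f y) (gm f hy g) m := Iff.rfl

theorem cutsOn_res (f : Y ⟶ Spec D) [IsIntegral Y] {E : Y → ℤ} {V V' : Y.Opens} (h : V' ≤ V) {y : Y} (hy : y ∈ V')
    {h1 h2 : Γ(Y, V)} (H : CutsOn E V h1 h2) : CutsOn E V' (res h h1) (res h h2) := by
  obtain ⟨a, b, c⟩ := H
  refine ⟨?_, ?_, fun z hz hd m1 m2 k1 k2 => c z (h hz) hd m1 m2 ?_ ?_⟩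
  · rw [gm_nzd f hy, gm_res f h]; exact (gm_nzd f (h hy) _).1 a
  · rw [gm_nzd f hy, gm_res f h]; exact (gm_nzd f (h hy) _).1 b
  · rw [germOrd_iff f, gm_res f h] at k1; exact k1
  · rw [germOrd_iff f, gm_res f h] at k2; exact k2

end

section
variable {A : CommRingCat.{u}} [IsDomain A] [IsDiscreteValuationRing A] {Y : Scheme.{u}} {f : Y ⟶ Spec A}

theorem dvr_pt (s : Spec A) : s.asIdeal = ⊥ ∨ s.asIdeal = IsLocalRing.maximalIdeal A := by
  by_cases h : s.asIdeal = ⊥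
  · exact Or.inl h
  · have := s.2
    exact Or.inr (IsLocalRing.eq_maximalIdeal (this.isMaximal h))

theorem Fam.dvr_gen (F : Fam f) {t : A} (ht : Irreducible t) (w : Y) (hw : IsGen f w) :
    ∃ _ : IsDomain (Stk f w), IsDiscreteValuationRing (Stk f w) ∧ Irreducible (algebraMap A (Stk f w) t) := by
  have := F.integral
  have hd := stk_domain f w
  have := F.stk_noeth w
  have hm : IsLocalRing.maximalIdeal (Stk f w) = Ideal.span {algebraMap A (Stk f w) t} := by
    rw [← F.gen_max w hw, mExt, ht.maximalIdeal_eq, Ideal.map_span, Set.image_singleton]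
  have ht0 : algebraMap A (Stk f w) t ≠ 0 := fun h =>
    one_ne_zero (F.nzd w t ht.ne_zero 1 (by rw [h, zero_mul]))
  have hnf : ¬ IsField (Stk f w) := by
    rw [IsLocalRing.isField_iff_maximalIdeal_eq, hm, Ideal.span_singleton_eq_bot]; exact ht0
  have hdvr : IsDiscreteValuationRing (Stk f w) :=
    ((IsDiscreteValuationRing.TFAE (Stk f w) hnf).out 0 4 :
      IsDiscreteValuationRing (Stk f w) ↔ (IsLocalRing.maximalIdeal (Stk f w)).IsPrincipal).2 ⟨_, hm⟩
  exact ⟨hd, hdvr, (IsDiscreteValuationRing.irreducible_iff_uniformizer _).2 hm⟩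

theorem Fam.gen_of_div (F : Fam f) (z : Y) (hz : (f z).asIdeal = IsLocalRing.maximalIdeal A)
    (hd : IsDivisorialPt Y z) : IsGen f z := by
  have := F.integral
  have := stk_domain f z
  obtain ⟨η, h, hη⟩ := exists_isGen z hz
  have hd' : Ring.KrullDimLE 1 (Stk f z) := by
    rw [Ring.krullDimLE_iff]; exact (show ringKrullDim (Stk f z) = 1 from hd).le
  obtain ⟨t, ht⟩ := IsDiscreteValuationRing.exists_irreducible A
  have h0 : primeOf f h ≠ ⊥ := by
    intro h0
    have h1 : algebraMap A (Stk f z) t ∈ primeOf f h :=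
      (algebraMap_mem_primeOf f h t).2 (by rw [hη.1]; exact ht.not_isUnit)
    rw [h0, Ideal.mem_bot] at h1
    exact one_ne_zero (F.nzd z t ht.ne_zero 1 (by rw [h1, zero_mul]))
  have hm : (primeOf f h).IsMaximal := Ring.krullDimLE_one_iff_of_isPrime_bot.1 hd' _ h0 inferInstance
  have h2 : primeOf f (specializes_rfl : z ⤳ z) ≤ primeOf f h := by
    rw [IsLocalRing.eq_maximalIdeal hm]
    exact IsLocalRing.le_maximalIdeal (primeOf_prime f _).ne_top
  rw [((primeOf_le f _ h).1 h2).antisymm h |>.eq]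
  exact hη

theorem Fam.finite_gen (F : Fam f) : {η : Y | IsGen f η}.Finite := by
  have := F.proper
  have := F.noeth
  have : CompactSpace Y := (quasiCompact_iff_compactSpace f).1 inferInstance
  have : IsNoetherian Y := {}
  have hcl : IsClosed (f ⁻¹' {IsLocalRing.closedPoint A}) :=
    (IsLocalRing.isClosed_singleton_closedPoint A).preimage f.continuous
  obtain ⟨S, hS, h1, h2, h3⟩ := TopologicalSpace.NoetherianSpace.exists_finite_set_isClosed_irreducible hcl
  refine Set.Finite.of_finite_image (f := fun η => closure {η}) (hS.subset ?_) ?_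
  · rintro _ ⟨η, hη, rfl⟩
    have h4 : η ∈ f ⁻¹' {IsLocalRing.closedPoint A} := PrimeSpectrum.ext hη.1
    rw [h3] at h4
    obtain ⟨Z, hZ, h5⟩ := h4
    obtain ⟨ξ, hξ⟩ := QuasiSober.sober (h2 Z hZ) (h1 Z hZ)
    have h6 : ξ ∈ f ⁻¹' {IsLocalRing.closedPoint A} := by
      rw [h3]; exact ⟨Z, hZ, hξ.mem⟩
    have h7 := hη.2 ξ (hξ.specializes h5) (congrArg PrimeSpectrum.asIdeal h6)
    subst h7
    have h8 : closure {ξ} = Z := hξ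
    change closure {ξ} ∈ S
    rwa [h8]
  · intro a _ b _ hab
    exact (inseparable_iff_closure_eq.2 hab).eq

/-- the divisor `L * (sum of the generic points of the closed fibre satisfying P)` -/
def divFun (f : Y ⟶ Spec A) (P : Y → Prop) (L : ℕ) (z : Y) : ℤ :=
  open Classical in if IsGen f z ∧ P z then (L : ℤ) else 0

theorem Fam.divFun_cartier (F : Fam f) : ∃ L : ℕ, 0 < L ∧ ∀ P, IsCartierDiv (divFun f P L) := by
  obtain ⟨t, ht⟩ := IsDiscreteValuationRing.exists_irreducible A
  obtain ⟨L, hL, H⟩ := F.cartier t ht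
  refine ⟨L, hL, fun P z => ?_⟩
  have := F.integral
  have hcl : IsClosed (f ⁻¹' {IsLocalRing.closedPoint A}) :=
    (IsLocalRing.isClosed_singleton_closedPoint A).preimage f.continuous
  rcases dvr_pt (f z) with hz | hz
  · refine ⟨⟨_, hcl.isOpen_compl⟩, ?_, 1, 1, one_mem _, one_mem _, ?_⟩
    · intro hz'
      have : (f z).asIdeal = IsLocalRing.maximalIdeal A := congrArg PrimeSpectrum.asIdeal hz'
      rw [hz] at this
      exact IsDiscreteValuationRing.not_a_field A this.symm
    · intro y hy _ m1 m2 h1 h2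
      rw [elemOrd_uniq h1 h2, sub_self, divFun, if_neg]
      rintro ⟨h3, -⟩
      exact hy (PrimeSpectrum.ext h3.1)
  · obtain ⟨a, a', haa, hQ⟩ := H z hz {Q | ∃ (η : Y) (h : η ⤳ z), P η ∧ Q = primeOf f h}
    obtain ⟨V₁, hz₁, g, rfl⟩ := exists_gm f a
    obtain ⟨V₂, hz₂, g', rfl⟩ := exists_gm f a'
    let Z : Set Y := ⋃ η ∈ {η | IsGen f η ∧ ¬ η ⤳ z}, closure {η}
    have hZ : IsClosed Z := (F.finite_gen.subset fun η hη => hη.1).isClosed_biUnion fun _ _ => isClosed_closure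
    let V : Y.Opens := V₁ ⊓ V₂ ⊓ ⟨Zᶜ, hZ.isOpen_compl⟩
    have hzV : z ∈ V := by
      refine ⟨⟨hz₁, hz₂⟩, fun h => ?_⟩
      obtain ⟨η, hη, h2⟩ := Set.mem_iUnion₂.1 h
      exact hη.2 (specializes_iff_mem_closure.2 h2)
    have le₁ : V ≤ V₁ := inf_le_left.trans inf_le_left
    have le₂ : V ≤ V₂ := inf_le_left.trans inf_le_right
    have hgg : res le₁ g * res le₂ g' = bsec f V t ^ L := by
      apply gm_inj f hzV
      rw [map_mul, gm_res, gm_res, map_pow, gm_bsec, haa]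
    have hgg' : ∀ y (hy : y ∈ V), gm f hy (res le₁ g) * gm f hy (res le₂ g') = algebraMap A (Stk f y) t ^ L := by
      intro y hy
      rw [← map_mul, hgg, map_pow, gm_bsec]
    have ht0 : ∀ y, algebraMap A (Stk f y) t ≠ 0 := fun y h =>
      one_ne_zero (F.nzd y t ht.ne_zero 1 (by rw [h, zero_mul]))
    refine ⟨V, hzV, res le₁ g, 1, ?_, one_mem _, ?_⟩
    · rw [gm_nzd f hzV]
      intro h0
      have := stk_domain f z
      have := hgg' z hzV
      rw [h0, zero_mul] at this
      exact pow_ne_zero _ (ht0 z) this.symm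
    · intro y hy hd m1 m2 h1 h2
      obtain rfl := elemOrd_unit _ (by simp) m2 h2
      rw [germOrd_iff f] at h1
      rcases dvr_pt (f y) with hyb | hyc
      · have hu : IsUnit (algebraMap A (Stk f y) t ^ L) :=
          ((stkHom_isUnit f y t).2 (by rw [hyb]; exact ht.ne_zero)).pow L
        rw [← hgg' y hy] at hu
        obtain rfl := elemOrd_unit _ (isUnit_of_mul_isUnit_left hu) m1 h1
        rw [divFun, if_neg]; · simp
        rintro ⟨h3, -⟩
        exact IsDiscreteValuationRing.not_a_field A (hyb.symm.trans h3.1).symm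
      · have hg := F.gen_of_div y hyc hd
        have hyz : y ⤳ z := by
          by_contra h
          exact hy.2 (Set.mem_iUnion₂.2 ⟨y, ⟨hg, h⟩, subset_closure rfl⟩)
        obtain ⟨_, _, hirr⟩ := F.dvr_gen ht y hg
        obtain ⟨q1, q2⟩ := hQ _ ((isGen_iff hyz).1 hg)
        rw [gm_mem_primeOf f hz₁ (le₁ hy) hyz, not_not] at q2
        rw [gm_mem_primeOf f hz₂ (le₂ hy) hyz, not_not] at q1
        rw [← gm_res f le₁ hy] at q2
        rw [← gm_res f le₂ hy] at q1
        by_cases hP : P y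
        · obtain ⟨w, hw⟩ := q1 ⟨y, hyz, hP, rfl⟩
          have : gm f hy (res le₁ g) = algebraMap A (Stk f y) t ^ L * ↑w⁻¹ := by
            rw [← hgg' y hy, ← hw, mul_assoc, Units.mul_inv, mul_one]
          rw [this] at h1
          rw [elemOrd_uniq h1 (elemOrd_dvr hirr (w⁻¹).isUnit L), divFun, if_pos ⟨hg, hP⟩]; simp
        · obtain rfl := elemOrd_unit _ (q2 (by
            rintro ⟨η, h, h3, h4⟩
            exact hP (primeOf_inj f hyz h h4 ▸ h3))) m1 h1
          rw [divFun, if_neg (fun h => hP h.2)]; simp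
end

theorem poly_split {A S : Type*} [CommRing A] [IsLocalRing A] [CommRing S] (φ : A →+* S) (x : S) (k : ℕ) :
    ∀ p : Polynomial A, IsUnit (p.coeff k) → ∃ (a : ℕ) (Q : Polynomial A), IsUnit (Q.coeff 0) ∧
      p.eval₂ φ x - x ^ a * Q.eval₂ φ x ∈ (IsLocalRing.maximalIdeal A).map φ := by
  induction k with
  | zero => exact fun p hp => ⟨0, p, hp, by simp⟩
  | succ k ih =>
    intro p hp
    by_cases h0 : IsUnit (p.coeff 0)
    · exact ⟨0, p, h0, by simp⟩
    · obtain ⟨a, Q, h1, h2⟩ := ih p.divX (by simpa using hp)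
      refine ⟨a + 1, Q, h1, ?_⟩
      have h3 : φ (p.coeff 0) ∈ (IsLocalRing.maximalIdeal A).map φ := Ideal.mem_map_of_mem _ h0
      have h4 := Ideal.add_mem _ (Ideal.mul_mem_left _ x h2) h3
      have h5 := congrArg (Polynomial.eval₂ φ x) (Polynomial.divX_mul_X_add p)
      rw [Polynomial.eval₂_add, Polynomial.eval₂_mul, Polynomial.eval₂_X, Polynomial.eval₂_C] at h5
      rw [← h5]
      convert h4 using 1
      ring

theorem bsec_integral {A : CommRingCat.{u}} {Y : Scheme.{u}} (f : Y ⟶ Spec A) [UniversallyClosed f]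
    (h : Γ(Y, ⊤)) : (bsec f ⊤).IsIntegralElem h := by
  have h1 := isIntegral_appTop_of_universallyClosed f h
  obtain ⟨p, hp, hp2⟩ := h1
  refine ⟨p.map (Scheme.ΓSpecIso A).hom.hom, hp.map _, ?_⟩
  rw [Polynomial.eval₂_map]
  convert hp2 using 2
  ext a
  have : (Scheme.ΓSpecIso A).hom ≫ (Scheme.ΓSpecIso A).inv ≫ f.appLE ⊤ ⊤ le_top = f.appTop := by
    rw [Iso.hom_inv_id_assoc]
    exact Scheme.Hom.appLE_eq_app f
  exact congrArg (fun F => F.hom a) this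

/-- division of a global section by a nonzero element of the base -/
theorem exists_div {D : CommRingCat.{u}} {Y : Scheme.{u}} (f : Y ⟶ Spec D) [IsIntegral Y] (t : D)
    (ht : ∀ y, algebraMap D (Stk f y) t ≠ 0) (h : Γ(Y, ⊤))
    (H : ∀ y : Y, algebraMap D (Stk f y) t ∣ gm f (V := ⊤) (TopologicalSpace.Opens.mem_top y) h) :
    ∃ h', h = bsec f ⊤ t * h' := by
  have key : ∀ y : Y, ∃ (V : Y.Opens) (_ : y ∈ V) (g : Γ(Y, V)), ∀ z (hz : z ∈ V),
      gm f (V := ⊤) (TopologicalSpace.Opens.mem_top z) h = algebraMap D (Stk f z) t * gm f hz g := by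
    intro y
    obtain ⟨a, ha⟩ := H y
    obtain ⟨V, hy, g, rfl⟩ := exists_gm f a
    have h1 : res le_top h = bsec f V t * g := by
      apply gm_inj f hy
      rw [map_mul, gm_bsec, gm_res, ha]
    refine ⟨V, hy, g, fun z hz => ?_⟩
    rw [← gm_res f le_top hz, h1, map_mul, gm_bsec]
  choose V hV g hg using key
  have hc : TopCat.Presheaf.IsCompatible Y.presheaf V g := by
    intro i j
    by_cases hne : ∃ z, z ∈ V i ⊓ V j
    · obtain ⟨z, hz⟩ := hne
      apply gm_inj f hz
      have e1 := gm_res f (inf_le_left : V i ⊓ V j ≤ V i) hz (g i)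
      have e2 := gm_res f (inf_le_right : V i ⊓ V j ≤ V j) hz (g j)
      refine Eq.trans e1 (Eq.trans ?_ e2.symm)
      have := stk_domain f z
      exact mul_left_cancel₀ (ht z) ((hg i z hz.1).symm.trans (hg j z hz.2))
    · have : V i ⊓ V j = ⊥ := by
        ext z; constructor
        · intro hz; exact (hne ⟨z, hz⟩).elim
        · intro hz; exact hz.elim
      have : Subsingleton Γ(Y, V i ⊓ V j) := by
        rw [this]; infer_instance
      exact Subsingleton.elim _ _
  obtain ⟨s', hs, -⟩ := Y.sheaf.existsUnique_gluing' V ⊤ (fun i => homOfLE le_top)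
    (fun z _ => TopologicalSpace.Opens.mem_iSup.2 ⟨z, hV z⟩) g hc
  obtain ⟨y⟩ := (inferInstance : Nonempty Y)
  let s : Γ(Y, ⊤) := s'
  refine ⟨s, ?_⟩
  apply gm_inj f (TopologicalSpace.Opens.mem_top y)
  rw [map_mul, gm_bsec, hg y y (hV y)]
  have := hs y
  rw [← gm_res f (le_top : V y ≤ ⊤) (hV y) s]
  rw [← this]; rfl

section
variable {A : CommRingCat.{u}} [IsDomain A] [IsDiscreteValuationRing A] {Y : Scheme.{u}} {f : Y ⟶ Spec A}

theorem Fam.t_ne (F : Fam f) {t : A} (ht : t ≠ 0) (y : Y) : algebraMap A (Stk f y) t ≠ 0 := fun h =>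
  one_ne_zero (F.nzd y t ht 1 (by rw [h, zero_mul]))

theorem Fam.unit_const (F : Fam f) (h : Γ(Y, ⊤)) (w₀ : Y) (hw₀ : (f w₀).asIdeal = IsLocalRing.maximalIdeal A)
    (hu : IsUnit (gm f (V := ⊤) (TopologicalSpace.Opens.mem_top w₀) h))
    (w : Y) (hw : (f w).asIdeal = IsLocalRing.maximalIdeal A) :
    IsUnit (gm f (V := ⊤) (TopologicalSpace.Opens.mem_top w) h) := by
  have := F.proper
  obtain ⟨p, hp, hp0⟩ := bsec_integral f h
  obtain ⟨a, Q, hQ, hpQ⟩ := poly_split (bsec f ⊤) h p.natDegree p (by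
    rw [Polynomial.coeff_natDegree, hp.leadingCoeff]; exact isUnit_one)
  rw [hp0, zero_sub, neg_mem_iff] at hpQ
  set q := Q.eval₂ (bsec f ⊤) h with hq
  have hmap : ∀ z, (f z).asIdeal = IsLocalRing.maximalIdeal A →
      (IsLocalRing.maximalIdeal A).map (bsec f ⊤) ≤ (IsLocalRing.maximalIdeal (Stk f z)).comap
        (gm f (V := ⊤) (TopologicalSpace.Opens.mem_top z)) := by
    intro z hz
    rw [Ideal.map_le_iff_le_comap]
    intro r hr
    rw [Ideal.mem_comap, Ideal.mem_comap, gm_bsec]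
    exact (stkHom_mem f z r).2 (by rwa [hz])
  have hor : ∀ z, (f z).asIdeal = IsLocalRing.maximalIdeal A →
      ¬ IsUnit (gm f (V := ⊤) (TopologicalSpace.Opens.mem_top z) h) ∨
      ¬ IsUnit (gm f (V := ⊤) (TopologicalSpace.Opens.mem_top z) q) := by
    intro z hz
    by_contra hcon
    push Not at hcon
    have := hmap z hz hpQ
    rw [Ideal.mem_comap, map_mul, map_pow] at this
    exact this ((hcon.1.pow a).mul hcon.2)
  have hnot : ∀ z, IsUnit (gm f (V := ⊤) (TopologicalSpace.Opens.mem_top z) h) ∨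
      IsUnit (gm f (V := ⊤) (TopologicalSpace.Opens.mem_top z) q) := by
    intro z
    by_contra hcon
    push Not at hcon
    have h5 := congrArg (Polynomial.eval₂ (bsec f ⊤) h) (Polynomial.divX_mul_X_add Q)
    rw [Polynomial.eval₂_add, Polynomial.eval₂_mul, Polynomial.eval₂_X, Polynomial.eval₂_C, ← hq] at h5
    have h6 := congrArg (gm f (V := ⊤) (TopologicalSpace.Opens.mem_top z)) h5
    rw [map_add, map_mul, gm_bsec] at h6
    have h7 : algebraMap A (Stk f z) (Q.coeff 0) ∈ IsLocalRing.maximalIdeal (Stk f z) := by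
      rw [eq_sub_iff_add_eq'.2 h6]
      exact sub_mem hcon.2 (Ideal.mul_mem_left _ _ hcon.1)
    exact h7 (hQ.map _)
  by_contra hcon
  have hconn : _root_.IsPreconnected (f ⁻¹' {IsLocalRing.closedPoint A}) := (conn_fiber F.conn _).isPreconnected
  have hmem : ∀ z, z ∈ f ⁻¹' {IsLocalRing.closedPoint A} ↔ (f z).asIdeal = IsLocalRing.maximalIdeal A :=
    fun z => ⟨fun h => congrArg PrimeSpectrum.asIdeal h, fun h => PrimeSpectrum.ext h⟩
  obtain ⟨z, hz, hz1, hz2⟩ := hconn (Y.basicOpen h) (Y.basicOpen q) (Y.basicOpen h).2 (Y.basicOpen q).2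
    (fun z _ => (hnot z).imp (fun h' => (Y.mem_basicOpen h z trivial).2 h')
      (fun h' => (Y.mem_basicOpen q z trivial).2 h'))
    ⟨w₀, (hmem _).2 hw₀, (Y.mem_basicOpen h w₀ trivial).2 hu⟩
    ⟨w, (hmem _).2 hw, (Y.mem_basicOpen q w trivial).2 ((hnot w).resolve_left hcon)⟩
  rcases hor z ((hmem _).1 hz) with h' | h'
  · exact h' ((Y.mem_basicOpen h z trivial).1 hz1)
  · exact h' ((Y.mem_basicOpen q z trivial).1 hz2)

theorem Fam.const_ord (F : Fam f) {t : A} (ht : Irreducible t) (w₀ : Y) (hw₀ : IsGen f w₀) (m : ℕ) :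
    ∀ h : Γ(Y, ⊤), h ≠ 0 → elemOrd (Stk f w₀) (gm f (V := ⊤) (TopologicalSpace.Opens.mem_top w₀) h) m →
    ∀ w, IsGen f w → elemOrd (Stk f w) (gm f (V := ⊤) (TopologicalSpace.Opens.mem_top w) h) m := by
  have := F.integral
  have := F.proper
  induction m with
  | zero =>
    intro h h0 hm w hw
    obtain ⟨_, _, hirr⟩ := F.dvr_gen ht w hw
    obtain ⟨_, _, hirr₀⟩ := F.dvr_gen ht w₀ hw₀
    have hu : IsUnit (gm f (V := ⊤) (TopologicalSpace.Opens.mem_top w₀) h) := by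
      have h1 : gm f (V := ⊤) (TopologicalSpace.Opens.mem_top w₀) h ≠ 0 := by
        rwa [Ne, map_eq_zero_iff _ (gm_inj f _)]
      obtain ⟨k, u, hu⟩ := IsDiscreteValuationRing.eq_unit_mul_pow_irreducible h1 hirr₀
      rw [hu, mul_comm] at hm
      obtain rfl := elemOrd_uniq hm (elemOrd_dvr hirr₀ u.isUnit k)
      rw [hu]; simp
    have := elemOrd_dvr hirr (F.unit_const h w₀ hw₀.1 hu w hw.1) 0
    rwa [pow_zero, one_mul] at this
  | succ m ih =>
    intro h h0 hm
    have hall : ∀ w, IsGen f w → ¬ IsUnit (gm f (V := ⊤) (TopologicalSpace.Opens.mem_top w) h) := by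
      intro w hw hu
      exact absurd (elemOrd_unit _ (F.unit_const h w hw.1 hu w₀ hw₀.1) _ hm) (Nat.succ_ne_zero m)
    obtain ⟨h', rfl⟩ := exists_div f t (F.t_ne ht.ne_zero) h (by
      intro y
      rcases dvr_pt (f y) with hyb | hyc
      · exact ((stkHom_isUnit f y t).2 (by rw [hyb]; exact ht.ne_zero)).dvd
      · have := F.inf y hyc _ (fun η hη hg => (gm_mem_primeOf f (V := ⊤) (TopologicalSpace.Opens.mem_top y)
          (TopologicalSpace.Opens.mem_top η) hη h).2 (hall η hg))
        rwa [mExt, ht.maximalIdeal_eq, Ideal.map_span, Set.image_singleton, Ideal.mem_span_singleton] at this)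
    have h0' : h' ≠ 0 := right_ne_zero_of_mul h0
    have hstep : ∀ w, IsGen f w → ∀ k, elemOrd (Stk f w) (gm f (V := ⊤) (TopologicalSpace.Opens.mem_top w)
        (bsec f ⊤ t * h')) (k + 1) ↔ elemOrd (Stk f w) (gm f (V := ⊤) (TopologicalSpace.Opens.mem_top w) h') k := by
      intro w hw k
      obtain ⟨_, _, hirr⟩ := F.dvr_gen ht w hw
      have h1 : gm f (V := ⊤) (TopologicalSpace.Opens.mem_top w) h' ≠ 0 := by
        rwa [Ne, map_eq_zero_iff _ (gm_inj f _)]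
      obtain ⟨j, u, hu⟩ := IsDiscreteValuationRing.eq_unit_mul_pow_irreducible h1 hirr
      rw [map_mul, gm_bsec, hu]
      have e1 := elemOrd_dvr hirr u.isUnit j
      have e2 := elemOrd_dvr hirr u.isUnit (j + 1)
      rw [show algebraMap A (Stk f w) t * (↑u * algebraMap A (Stk f w) t ^ j) =
        algebraMap A (Stk f w) t ^ (j + 1) * ↑u by ring, mul_comm (u : Stk f w)]
      constructor
      · intro e; have := elemOrd_uniq e e2; obtain rfl : k = j := by omega
        exact e1
      · intro e; obtain rfl := elemOrd_uniq e e1; exact e2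
    intro w hw
    exact (hstep w hw m).2 (ih h' h0' ((hstep w₀ hw₀ m).1 hm) w hw)
end

theorem normal_of_ff {O C : Type u} [CommRing O] [IsDomain O] [CommRing C] [IsDomain C] [IsIntegrallyClosed C]
    [Algebra O C] [Module.FaithfullyFlat O C] : IsIntegrallyClosed O := by
  have hinj : Function.Injective (algebraMap O C) := FaithfulSMul.algebraMap_injective O C
  refine (isIntegrallyClosed_iff (FractionRing O)).2 fun {x} hx => ?_
  obtain ⟨a, b, hb, rfl⟩ := IsFractionRing.div_surjective (A := O) x
  have hb0 : b ≠ 0 := nonZeroDivisors.ne_zero hb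
  let φ : FractionRing O →+* FractionRing C := IsFractionRing.map hinj
  have hφ : ∀ y : O, φ (algebraMap O _ y) = algebraMap C _ (algebraMap O C y) := fun y =>
    IsLocalization.map_eq _ y
  have h1 : IsIntegral C (φ (algebraMap O _ a / algebraMap O _ b)) := by
    obtain ⟨p, hp, h0⟩ := hx
    refine ⟨p.map (algebraMap O C), hp.map _, ?_⟩
    have h2 := congrArg φ h0
    rw [map_zero, Polynomial.hom_eval₂] at h2
    rw [Polynomial.eval₂_map, ← h2]
    congr 1
    ext y
    exact (hφ y).symm
  obtain ⟨c, hc⟩ := (isIntegrallyClosed_iff (FractionRing C)).1 ‹_› h1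
  rw [map_div₀, hφ, hφ, eq_div_iff (by
    rw [Ne, map_eq_zero_iff _ (IsFractionRing.injective C (FractionRing C)), map_eq_zero_iff _ hinj]; exact hb0),
    ← map_mul] at hc
  have hc := IsFractionRing.injective C (FractionRing C) hc
  have h3 := mem_of_ff (C := C) (Ideal.span {b}) a (by
    rw [Ideal.map_span, Set.image_singleton, Ideal.mem_span_singleton]; exact ⟨c, by rw [← hc]; ring⟩)
  obtain ⟨e, rfl⟩ := Ideal.mem_span_singleton.1 h3
  refine ⟨e, ?_⟩
  rw [map_mul, mul_div_cancel_left₀]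
  rw [Ne, map_eq_zero_iff _ (IsFractionRing.injective O (FractionRing O))]; exact hb0

section
variable {R O : Type u} [CommRing R] [IsDomain R] [IsNoetherianRing R] [IsIntegrallyClosed R]
  [CommRing O] [IsLocalRing O] [Algebra R O]

theorem OSmooth.normal [IsDomain O] (h : OSmooth R O) : IsIntegrallyClosed O := by
  obtain ⟨C, _, _, _, _, _, h1, h2, h3, -⟩ := h
  obtain ⟨i1, i2⟩ := h1.normal
  exact normal_of_ff (C := C)

theorem OSmooth.dvd [IsLocalRing R] (h : OSmooth R O) (hm : mExt R O ≤ IsLocalRing.maximalIdeal O) (a b : R)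
    (hab : algebraMap R O a ∣ algebraMap R O b) : a ∣ b := by
  obtain ⟨C, _, _, _, _, _, h1, h2, h3, -⟩ := h
  have := h1.flat
  have hC := mExt_le_C h2 hm
  have : IsLocalHom (algebraMap R C) := ((IsLocalRing.local_hom_TFAE (algebraMap R C)).out 0 2).2 hC
  have : Module.FaithfullyFlat R C := Module.FaithfullyFlat.of_flat_of_isLocalHom
  obtain ⟨c, hc⟩ := hab
  refine Ideal.mem_span_singleton.1 (mem_of_ff (C := C) (Ideal.span {a}) b ?_)
  rw [Ideal.map_span, Set.image_singleton, Ideal.mem_span_singleton]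
  refine ⟨algebraMap O C c, ?_⟩
  rw [IsScalarTower.algebraMap_apply R O C b, hc, map_mul, ← IsScalarTower.algebraMap_apply]

theorem OSmooth.unit [HenselianLocalRing R] [IsSepClosed (IsLocalRing.ResidueField R)] (h : OSmooth R O)
    (hm : mExt R O = IsLocalRing.maximalIdeal O) (α β : O) (ρ : R) (hρ : ρ ≠ 0)
    (hab : α * β = algebraMap R O ρ) : ∃ d : R, d ∣ ρ ∧ ∃ u : O, IsUnit u ∧ α = algebraMap R O d * u := by
  obtain ⟨C, _, _, _, _, _, h1, h2, h3, h4⟩ := h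
  have := h1.noeth
  obtain ⟨i1, i2⟩ := h1.normal
  have := h1.flat
  have hC : mExt R C = IsLocalRing.maximalIdeal C := by
    rw [← h4 inferInstance, ← hm, mExt_map]
  obtain ⟨d, hd, u, hu, e⟩ := h1.unit hC (algebraMap O C α) (algebraMap O C β) ρ hρ (by
    rw [← map_mul, hab, ← IsScalarTower.algebraMap_apply])
  refine ⟨d, hd, ?_⟩
  rw [IsScalarTower.algebraMap_apply R O C] at e
  have h5 := mem_of_ff (C := C) (Ideal.span {algebraMap R O d}) α (by
    rw [Ideal.map_span, Set.image_singleton, Ideal.mem_span_singleton]; exact ⟨u, e⟩)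
  obtain ⟨v, rfl⟩ := Ideal.mem_span_singleton.1 h5
  refine ⟨v, ?_, rfl⟩
  have hd0 : d ≠ 0 := by rintro rfl; exact hρ (zero_dvd_iff.1 hd)
  have hdC : algebraMap O C (algebraMap R O d) ≠ 0 := by
    intro h
    rw [← IsScalarTower.algebraMap_apply] at h
    exact one_ne_zero (nzd_of_flat hd0 (b := (1 : C)) (by rw [h, zero_mul]))
  rw [map_mul] at e
  have := mul_left_cancel₀ hdC e
  exact (isUnit_map_iff (algebraMap O C) v).1 (by rw [this]; exact hu)

end

section
variable {D : CommRingCat.{u}} {Y : Scheme.{u}}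

theorem elemOrd_sum {A : Type u} [CommRing A] [IsDomain A] [IsNoetherianRing A] (hd : ringKrullDim A = 1)
    {h1 h2 k1 k2 : A} (a1 : h1 ≠ 0) (a2 : h2 ≠ 0) (b1 : k1 ≠ 0) (b2 : k2 ≠ 0) (e : h1 * k2 = k1 * h2) {m1 m2 : ℕ}
    (o1 : elemOrd A k1 m1) (o2 : elemOrd A k2 m2) :
    ∃ n1 n2, elemOrd A h1 n1 ∧ elemOrd A h2 n2 ∧ (n1 : ℤ) - n2 = m1 - m2 := by
  obtain ⟨n1, hn1⟩ := elemOrd_exists hd h1 a1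
  obtain ⟨n2, hn2⟩ := elemOrd_exists hd h2 a2
  refine ⟨n1, n2, hn1, hn2, ?_⟩
  have e1 := elemOrd_mul b2 hn1 o2
  rw [e] at e1
  have := elemOrd_uniq e1 (elemOrd_mul a2 o1 hn2)
  omega

theorem cutsOn_mul (f : Y ⟶ Spec D) [IsIntegral Y] [IsLocallyNoetherian Y] {E : Y → ℤ} {V : Y.Opens} {y : Y} (hy : y ∈ V)
    {h1 h2 k1 k2 : Γ(Y, V)} (H : CutsOn E V h1 h2) (b1 : gm f hy k1 ≠ 0) (b2 : gm f hy k2 ≠ 0)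
    (e : h1 * k2 = k1 * h2) : CutsOn E V k1 k2 := by
  obtain ⟨a, b, c⟩ := H
  refine ⟨(gm_nzd f hy _).2 b1, (gm_nzd f hy _).2 b2, fun z hz hd m1 m2 o1 o2 => ?_⟩
  have := stk_domain f z
  have : IsNoetherianRing (Stk f z) := inferInstanceAs (IsNoetherianRing (Y.presheaf.stalk z))
  obtain ⟨n1, n2, p1, p2, p3⟩ := elemOrd_sum (A := Stk f z) (show ringKrullDim (Stk f z) = 1 from hd) ((gm_nzd f hz _).1 a) ((gm_nzd f hz _).1 b)
    ((gm_nzd f hz _).1 ((gm_nzd f hy _).2 b1)) ((gm_nzd f hz _).1 ((gm_nzd f hy _).2 b2))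
    (show gm f hz h1 * gm f hz k2 = gm f hz k1 * gm f hz h2 by rw [← map_mul, e, map_mul]) ((germOrd_iff f hz k1 m1).1 o1) ((germOrd_iff f hz k2 m2).1 o2)
  rw [c z hz hd n1 n2 p1 p2, p3]

end
section
variable {R : CommRingCat.{u}} [IsLocalRing R] [IsDomain R] [IsNoetherianRing R] [IsIntegrallyClosed R]
  {X : Scheme.{u}} {f : X ⟶ Spec R}

theorem Fam.exists_cut (F : Fam f) (U : (Spec R).Opens) (hU : Smooth ((f ⁻¹ᵁ U).ι ≫ f)) {E : X → ℤ}
    (hE : IsCartierDiv E) (hE0 : ∀ z, f z ∈ U → E z = 0) (p : Spec R) (hp : p ∈ U) (x : X) :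
    ∃ ρ, ρ ∉ p.asIdeal ∧ ∃ (V : X.Opens) (_ : x ∈ V) (α β : Γ(X, V)),
      α * β = bsec f V (ρ * ρ) ∧ CutsOn E V α (bsec f V ρ) := by
  have := F.integral
  have := F.noeth
  obtain ⟨V, hxV, h1, h2, hc⟩ := hE x
  have hpp : p.asIdeal.IsPrime := p.2
  obtain ⟨W, hW, hxW, hWV⟩ := exists_affine x V hxV
  have hc := cutsOn_res f hWV hxW hc
  generalize res hWV h1 = h1 at hc
  generalize res hWV h2 = h2 at hc
  have := IsLocallyNoetherian.component_noetherian ⟨W, hW⟩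
  have : Nonempty W := ⟨⟨x, hxW⟩⟩
  have hbs : ∀ r : R, r ≠ 0 → gm f hxW (bsec f W r) ≠ 0 := fun r hr h => by
    rw [gm_bsec] at h
    exact one_ne_zero (F.nzd x r hr 1 (by rw [h, zero_mul]))
  have hM : p.asIdeal.primeCompl.map (bsec f W) ≤ nonZeroDivisors Γ(X, W) := by
    rintro _ ⟨r, hr, rfl⟩
    rw [gm_nzd f hxW]
    exact hbs r (by rintro rfl; exact hr p.asIdeal.zero_mem)
  obtain ⟨_, ⟨ρ, hρ, rfl⟩, α, β, e1, e2, e3⟩ := lemG_sym (p.asIdeal.primeCompl.map (bsec f W)) hM h1 h2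
    (nonZeroDivisors.ne_zero hc.1) (nonZeroDivisors.ne_zero hc.2.1) (fun Q hQ hdis => by
      have hy : hW.fromSpec ⟨Q, hQ⟩ ∈ W := by
        have := Set.mem_range_self (f := hW.fromSpec) ⟨Q, hQ⟩
        rw [hW.range_fromSpec] at this; exact this
      set y := hW.fromSpec ⟨Q, hQ⟩ with hydef
      have hQy : hW.primeIdealOf ⟨y, hy⟩ = ⟨Q, hQ⟩ :=
        hW.fromSpec.isOpenEmbedding.injective (hW.fromSpec_primeIdealOf ⟨y, hy⟩)
      let _ : Algebra Γ(X, W) (Stk f y) := (gm f hy).toAlgebra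
      have hl : IsLocalization.AtPrime (Stk f y) (hW.primeIdealOf ⟨y, hy⟩).asIdeal := hW.isLocalization_stalk ⟨y, hy⟩
      have hl : IsLocalization.AtPrime (Stk f y) Q := by
        have h := congrArg PrimeSpectrum.asIdeal hQy
        simp only at h
        simp only [h] at hl
        exact hl
      have hyU : f y ∈ U := by
        have hle : (f y).asIdeal ≤ p.asIdeal := by
          intro r hr
          by_contra hrp
          refine Set.disjoint_left.1 hdis ⟨r, hrp, rfl⟩ ?_
          by_contra hrQ
          have := IsLocalization.map_units (Stk f y) (⟨_, hrQ⟩ : Q.primeCompl)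
          have h2 : IsUnit (gm f hy (bsec f W r)) := this
          rw [gm_bsec] at h2
          exact (stkHom_isUnit f y r).1 h2 hr
        exact ((PrimeSpectrum.le_iff_specializes (R := R) (f y) p).1 hle).mem_open U.2 hp
      obtain ⟨i1, i2⟩ := smooth_stk_normal f (f ⁻¹ᵁ U) hU y hyU
      have := F.stk_noeth y
      refine ⟨Stk f y, inferInstance, inferInstance, i1, hl, i2, fun hd => ?_⟩
      have n1 := (gm_nzd f hy _).1 hc.1
      have n2 := (gm_nzd f hy _).1 hc.2.1
      obtain ⟨m1, o1⟩ := elemOrd_exists hd _ n1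
      obtain ⟨m2, o2⟩ := elemOrd_exists hd _ n2
      have := hc.2.2 y hy hd m1 m2 o1 o2
      rw [hE0 y hyU] at this
      obtain rfl : m1 = m2 := by omega
      exact assoc_of_ord hd o1 o2)
  have hρ0 : ρ ≠ 0 := by rintro rfl; exact hρ p.asIdeal.zero_mem
  refine ⟨ρ, hρ, W, hxW, α, β, by rw [e3]; exact (map_mul _ _ _).symm, cutsOn_mul f hxW hc ?_ (hbs ρ hρ0) (by rw [mul_comm]; exact e1)⟩
  intro h
  have := congrArg (gm f hxW) e3
  rw [map_mul, h, zero_mul, map_mul] at this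
  have hdx := stk_domain f x
  exact mul_ne_zero (hbs ρ hρ0) (hbs ρ hρ0) this.symm

/-- `E` is cut out near `η` by `d/ρ` with `d`, `ρ` from the base. -/
def IsVal (f : X ⟶ Spec R) (E : X → ℤ) (η : X) (d ρ : R) : Prop :=
  ∃ (V : X.Opens) (_ : η ∈ V) (u : Γ(X, V)), IsUnit u ∧ CutsOn E V (bsec f V d * u) (bsec f V ρ)

end

section
variable {R : CommRingCat.{u}} [IsDomain R] [IsNoetherianRing R] [IsIntegrallyClosed R]
  [HenselianLocalRing R] [IsSepClosed (IsLocalRing.ResidueField R)]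
  {X : Scheme.{u}} {f : X ⟶ Spec R}

theorem res_bsec (f : X ⟶ Spec R) [IsIntegral X] {V V' : X.Opens} (h : V' ≤ V) {y : X} (hy : y ∈ V') (r : R) :
    res h (bsec f V r) = bsec f V' r := by
  apply gm_inj f hy
  rw [gm_res, gm_bsec, gm_bsec]

theorem Fam.isVal_of_cut (F : Fam f) {E : X → ℤ} {V : X.Opens} {α β : Γ(X, V)} {ρ : R} (hρ : ρ ≠ 0)
    (hab : α * β = bsec f V (ρ * ρ)) (hc : CutsOn E V α (bsec f V ρ)) (η : X) (hη : η ∈ V) (hg : IsGen f η) :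
    ∃ d, d ∣ ρ * ρ ∧ (∃ u : Stk f η, IsUnit u ∧ gm f hη α = algebraMap R _ d * u) ∧ IsVal f E η d ρ := by
  have := F.integral
  obtain ⟨d, hd, u, hu, e⟩ := (F.gen_smooth η hg).unit (F.gen_max η hg) (gm f hη α) (gm f hη β) (ρ * ρ)
    (mul_ne_zero hρ hρ) (by rw [← map_mul, hab, gm_bsec])
  refine ⟨d, hd, ⟨u, hu, e⟩, ?_⟩
  obtain ⟨V1, hη1, g, rfl⟩ := exists_gm f u
  have hb : η ∈ X.basicOpen g := (X.mem_basicOpen g η hη1).2 hu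
  have hη2 : η ∈ X.basicOpen g ⊓ V := ⟨hb, hη⟩
  have hle : X.basicOpen g ≤ V1 := X.basicOpen_le g
  have hu2 : IsUnit (res (inf_le_left.trans hle : X.basicOpen g ⊓ V ≤ V1) g) := by
    have h1 : IsUnit (res hle g) := X.toRingedSpace.isUnit_res_basicOpen g
    have h2 := h1.map (res (inf_le_left : X.basicOpen g ⊓ V ≤ X.basicOpen g))
    convert h2 using 1
    apply gm_inj f hη2
    rw [gm_res, gm_res, gm_res]
  refine ⟨X.basicOpen g ⊓ V, hη2, _, hu2, ?_⟩
  have h3 := cutsOn_res f (inf_le_right : X.basicOpen g ⊓ V ≤ V) hη2 hc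
  rw [res_bsec f _ hη2] at h3
  convert h3 using 1
  apply gm_inj f hη2
  rw [map_mul, gm_bsec, gm_res, gm_res, e]

theorem IsVal.uniq (F : Fam f) {E : X → ℤ} {η : X} (hg : IsGen f η) {d ρ d' ρ' : R}
    (h : IsVal f E η d ρ) (h' : IsVal f E η d' ρ') : Associated (d * ρ') (d' * ρ) := by
  have := F.integral
  have := F.noeth
  obtain ⟨V, hV, u, hu, hc⟩ := h
  obtain ⟨V', hV', u', hu', hc'⟩ := h'
  have hη : η ∈ V ⊓ V' := ⟨hV, hV'⟩
  have hc := cutsOn_res f (inf_le_left : V ⊓ V' ≤ V) hη hc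
  have hc' := cutsOn_res f (inf_le_right : V ⊓ V' ≤ V') hη hc'
  rw [map_mul, res_bsec f _ hη, res_bsec f _ hη] at hc hc'
  obtain ⟨W, hη, u, u', hu, hu', hc, hc'⟩ : ∃ (W : X.Opens) (_ : η ∈ W) (u u' : Γ(X, W)), IsUnit u ∧ IsUnit u' ∧
      CutsOn E W (bsec f _ d * u) (bsec f _ ρ) ∧ CutsOn E W (bsec f _ d' * u') (bsec f _ ρ') :=
    ⟨_, hη, _, _, hu.map _, hu'.map _, hc, hc'⟩
  have hdη := stk_domain f η
  have := F.stk_noeth η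
  have hnor := (F.gen_smooth η hg).normal
  have nz : ∀ {g : Γ(X, W)}, g ∈ nonZeroDivisors _ → ∀ z (hz : z ∈ W), gm f hz g ≠ 0 :=
    fun h z hz => (gm_nzd f hz _).1 h
  obtain ⟨a1, a2, a3⟩ := hc
  obtain ⟨b1, b2, b3⟩ := hc'
  obtain ⟨_, rfl, α, β, e1, e2, -⟩ := lemG_sym (B := Stk f η) ⊥ (by rintro _ rfl; exact one_mem _)
    (gm f hη (bsec f W d * u) * gm f hη (bsec f W ρ')) (gm f hη (bsec f W d' * u') * gm f hη (bsec f W ρ))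
    (mul_ne_zero (nz a1 _ _) (nz b2 _ _)) (mul_ne_zero (nz b1 _ _) (nz a2 _ _)) (fun Q hQ _ => by
      obtain ⟨y, hy, rfl⟩ := exists_primeOf f η Q
      let _ := specAlg f hy
      have hl : IsLocalization.AtPrime (Stk f y) (primeOf f hy) := specAlg_loc f hy
      have hyW : y ∈ W := hy.mem_open W.2 hη
      have hdy := stk_domain f y
      have := F.stk_noeth y
      have hny : IsIntegrallyClosed (Stk f y) :=
        isIntegrallyClosed_of_isLocalization (Stk f y) (primeOf f hy).primeCompl
          (Ideal.primeCompl_le_nonZeroDivisors _)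
      refine ⟨Stk f y, inferInstance, inferInstance, hdy, hl, hny, fun hd => ?_⟩
      have es : ∀ g k : Γ(X, W), algebraMap (Stk f η) (Stk f y) (gm f hη g * gm f hη k) = gm f hyW g * gm f hyW k := by
        intro g k
        rw [← map_mul, ← map_mul]
        exact gm_spec f hη hyW hy _
      rw [es, es]
      obtain ⟨m1, o1⟩ := elemOrd_exists hd _ (nz a1 y hyW)
      obtain ⟨m2, o2⟩ := elemOrd_exists hd _ (nz a2 y hyW)
      obtain ⟨m3, o3⟩ := elemOrd_exists hd _ (nz b1 y hyW)
      obtain ⟨m4, o4⟩ := elemOrd_exists hd _ (nz b2 y hyW)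
      have e1 := a3 y hyW hd m1 m2 o1 o2
      have e2 := b3 y hyW hd m3 m4 o3 o4
      have o5 := elemOrd_mul (nz b2 y hyW) o1 o4
      have o6 := elemOrd_mul (nz a2 y hyW) o3 o2
      have : m1 + m4 = m3 + m2 := by omega
      rw [this] at o5
      exact assoc_of_ord hd o5 o6)
  rw [one_mul] at e1 e2
  have hv := hu.map (gm f hη)
  have hv' := hu'.map (gm f hη)
  simp only [map_mul, gm_bsec] at e1 e2
  have hm := mExt_le_max η hg.1
  refine associated_of_dvd_dvd ((F.gen_smooth η hg).dvd hm _ _ ?_) ((F.gen_smooth η hg).dvd hm _ _ ?_)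
  · rw [map_mul, map_mul, ← hv'.dvd_mul_right]
    exact ⟨β * gm f hη u, by linear_combination e2⟩
  · rw [map_mul, map_mul, ← hv.dvd_mul_right]
    exact ⟨α * gm f hη u', by linear_combination e1⟩

theorem IsVal.pullback {A : CommRingCat.{u}} [IsDomain A] [IsDiscreteValuationRing A] {Y : Scheme.{u}}
    {f' : Y ⟶ Spec A} (F' : Fam f') (ψ : R ⟶ A) (p : Y ⟶ X) (hp : p ≫ f = f' ≫ Spec.map ψ) {E : X → ℤ} {ET : Y → ℤ}
    (hET : IsDivPullback p E ET) {w : Y} (hw : IsGen f' w) {d ρ : R} (h : IsVal f E (p w) d ρ) {t : A}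
    (ht : Irreducible t) {m1 m2 : ℕ} (h1 : Associated (t ^ m1) (ψ d)) (h2 : Associated (t ^ m2) (ψ ρ)) :
    ET w = m1 - m2 := by
  obtain ⟨V, hV, u, hu, hc⟩ := h
  obtain ⟨i1, i2, hti⟩ := F'.dvr_gen ht w hw
  have hd : ringKrullDim (Stk f' w) = 1 := IsDiscreteValuationRing.ringKrullDim_eq_one _
  let φ : Stk f (p w) →+* Stk f' w := (p.stalkMap w).hom
  have hap : ∀ g : Γ(X, V), (Y.presheaf.germ (p ⁻¹ᵁ V) w hV) (p.app V g) = φ (gm f hV g) := fun g =>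
    (congrArg (fun F => F.hom g) (Scheme.Hom.germ_stalkMap p V w hV)).symm
  have hbs : ∀ r : R, φ (gm f hV (bsec f V r)) = algebraMap A (Stk f' w) (ψ r) := fun r => by
    rw [gm_bsec]
    exact congrArg (fun F => F.hom r) (stkHom_comp f f' ψ p hp w)
  obtain ⟨v1, e1⟩ := h1
  obtain ⟨v2, e2⟩ := h2
  refine hET w hd V hV _ _ hc m1 m2 ?_ ?_
  · suffices h0 : elemOrd (Stk f' w) (φ (gm f hV (bsec f V d * u))) m1 by
      rw [← hap] at h0; exact h0
    have : φ (gm f hV (bsec f V d * u)) =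
        (algebraMap A (Stk f' w) t) ^ m1 * (algebraMap A (Stk f' w) v1 * φ (gm f hV u)) := by
      rw [map_mul, map_mul, hbs, ← e1, map_mul, map_pow, mul_assoc]
    rw [this]
    exact elemOrd_dvr hti ((v1.isUnit.map _).mul ((hu.map (gm f hV)).map φ)) m1
  · suffices h0 : elemOrd (Stk f' w) (φ (gm f hV (bsec f V ρ))) m2 by
      rw [← hap] at h0; exact h0
    rw [hbs, ← e2, map_mul, map_pow]
    exact elemOrd_dvr hti (v2.isUnit.map _) m2

theorem exists_st (F : Fam f) {η z : X} (h : η ⤳ z) {d : R} {a : Stk f z} {u : Stk f η} (hu : IsUnit u)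
    (e : (specAlg f h).algebraMap a = algebraMap R (Stk f η) d * u) :
    ∃ s t, s ∉ primeOf f h ∧ t ∉ primeOf f h ∧ s * a = algebraMap R (Stk f z) d * t := by
  have := F.integral
  have := stk_domain f z
  let _ := specAlg f h
  have := specAlg_tower f h
  have hl : IsLocalization.AtPrime (Stk f η) (primeOf f h) := specAlg_loc f h
  obtain ⟨⟨t, s⟩, hts⟩ := IsLocalization.surj (primeOf f h).primeCompl u
  have hs := IsLocalization.map_units (Stk f η) s
  refine ⟨s, t, s.2, fun ht => ?_, ?_⟩
  · rw [mem_primeOf] at ht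
    exact ht (by rw [← hts]; exact hu.mul hs)
  · apply IsLocalization.injective (Stk f η) (Ideal.primeCompl_le_nonZeroDivisors (primeOf f h))
    have e' : algebraMap (Stk f z) (Stk f η) a = algebraMap R (Stk f η) d * u := e
    rw [map_mul, map_mul, e', ← IsScalarTower.algebraMap_apply]
    simp only at hts
    rw [← hts]; ring

theorem edge_val (F : Fam f) (U : (Spec R).Opens) (hU : Smooth ((f ⁻¹ᵁ U).ι ≫ f)) {E : X → ℤ}
    (hE : IsCartierDiv E) (hE0 : ∀ z, f z ∈ U → E z = 0) (p : Spec R) (hp : p ∈ U) {z : X}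
    (hz : (f z).asIdeal = IsLocalRing.maximalIdeal R) {n l : ℕ} {b : R} {J : Set (Fin n)} (hch : HasChart f z n l b J)
    (hln : l ≤ n) (hb : b ≠ 0) {j : Fin n} (hj : j ∈ J) {η₁ η₂ : X} (h₁ : η₁ ⤳ z) (h₂ : η₂ ⤳ z)
    (g₁ : IsGen f η₁) (g₂ : IsGen f η₂) (hne : η₁ ≠ η₂) :
    ∃ ρ d1 d2, ρ ∉ p.asIdeal ∧ d1 ∉ p.asIdeal ∧ d2 ∉ p.asIdeal ∧ IsVal f E η₁ d1 ρ ∧ IsVal f E η₂ d2 ρ ∧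
      ∃ e, Associated (d1 * b ^ e) d2 ∨ Associated d1 (d2 * b ^ e) := by
  have hpp : p.asIdeal.IsPrime := p.2
  obtain ⟨ρ, hρ, V, hzV, α, β, hab, hc⟩ := F.exists_cut U hU hE hE0 p hp z
  have hρ0 : ρ ≠ 0 := by rintro rfl; exact hρ p.asIdeal.zero_mem
  have hv1 : η₁ ∈ V := h₁.mem_open V.2 hzV
  have hv2 : η₂ ∈ V := h₂.mem_open V.2 hzV
  obtain ⟨d1, hd1, ⟨u1, hu1, e1⟩, iv1⟩ := F.isVal_of_cut hρ0 hab hc η₁ hv1 g₁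
  obtain ⟨d2, hd2, ⟨u2, hu2, e2⟩, iv2⟩ := F.isVal_of_cut hρ0 hab hc η₂ hv2 g₂
  have hnp : ∀ d, d ∣ ρ * ρ → d ∉ p.asIdeal := fun d hd h =>
    (hpp.mem_or_mem (p.asIdeal.mem_of_dvd hd h)).elim hρ hρ
  refine ⟨ρ, d1, d2, hρ, hnp _ hd1, hnp _ hd2, iv1, iv2, ?_⟩
  obtain ⟨s1, t1, a1, a2, a3⟩ := exists_st F h₁ hu1 ((gm_spec f hzV hv1 h₁ α).trans e1)
  obtain ⟨s2, t2, b1, b2, b3⟩ := exists_st F h₂ hu2 ((gm_spec f hzV hv2 h₂ α).trans e2)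
  obtain ⟨C, _, _, _, _, _, _, x, c1, c2, c3, c4, -⟩ := hch.oChart.oLoc hln (mExt_le_max z hz) j hj
  obtain ⟨i1, hi1⟩ := c1.exists_of_min (O := Stk f z) _ ((isGen_iff h₁).1 g₁)
  obtain ⟨i2, hi2⟩ := c1.exists_of_min (O := Stk f z) _ ((isGen_iff h₂).1 g₂)
  have hi : i1 ≠ i2 := by
    rintro rfl
    exact hne (primeOf_inj f h₁ h₂ (hi1.symm.trans hi2))
  rw [← hi1, Ideal.mem_comap] at a1 a2
  rw [← hi2, Ideal.mem_comap] at b1 b2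
  refine lc_edge c1 hb i1 i2 hi (algebraMap _ C (gm f hzV α)) (algebraMap _ C (gm f hzV β)) (ρ * ρ)
    (mul_ne_zero hρ0 hρ0) ?_ d1 d2 hd1 hd2 _ _ _ _ a1 a2 b1 b2 ?_ ?_
  · rw [← map_mul, ← map_mul, hab, gm_bsec, ← IsScalarTower.algebraMap_apply]
  · rw [← map_mul, a3, map_mul, ← IsScalarTower.algebraMap_apply]
  · rw [← map_mul, b3, map_mul, ← IsScalarTower.algebraMap_apply]

end

open TensorProduct Polynomial in
theorem exists_etale_lift {P A B : Type u} [CommRing P] [CommRing A] [CommRing B] [Algebra P A] [Algebra A B]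
    [Algebra P B] [IsScalarTower P A B] (hs : Function.Surjective (algebraMap P A)) [Algebra.IsStandardEtale A B] :
    ∃ (Q : Type u) (_ : CommRing Q) (_ : Algebra P Q) (φ : Q →ₐ[P] B), Algebra.Etale P Q ∧
      Function.Surjective φ ∧ ∀ q, φ q = 0 → ((1 : A) ⊗ₜ[P] q) = 0 := by
  obtain ⟨S⟩ := Algebra.IsStandardEtale.nonempty_standardEtalePresentation (R := A) (S := B)
  have hl : ∀ p : A[X], ∃ q : P[X], q.map (algebraMap P A) = p := Polynomial.map_surjective _ hs
  obtain ⟨f, hf, -, hm⟩ := lifts_and_natDegree_eq_and_monic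
    ((mem_lifts (f := algebraMap P A) S.f).2 (hl _)) S.monic_f
  obtain ⟨g, hg⟩ := hl S.g
  let T : StandardEtalePair P := ⟨f, hm, derivative f * g, g, 0, 1, by ring⟩
  have hT : T.HasMap S.x := by
    refine ⟨?_, ?_⟩
    · change aeval S.x f = 0
      rw [← aeval_map_algebraMap A, hf]; exact S.hasMap.1
    · change IsUnit (aeval S.x (derivative f * g))
      rw [map_mul, ← aeval_map_algebraMap A, ← aeval_map_algebraMap A _ g, hg, ← derivative_map, hf]
      exact S.hasMap.isUnit_derivative_f.mul S.hasMap.2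
  let ι : T.Ring →ₐ[P] A ⊗[P] T.Ring := Algebra.TensorProduct.includeRight
  have hS : S.P.HasMap (ι T.X) := by
    have h1 : T.HasMap (ι T.X) := T.hasMap_X.map ι
    refine ⟨?_, ?_⟩
    · rw [← hf, aeval_map_algebraMap]; exact h1.1
    · rw [← hg, aeval_map_algebraMap]
      have h2 : IsUnit (aeval (ι T.X) (derivative f * g)) := h1.2
      rw [map_mul] at h2
      exact isUnit_of_mul_isUnit_right h2
  have hφ : Function.Surjective (T.lift S.x hT) := fun y => by
    obtain ⟨p, n, e⟩ := S.exists_mul_aeval_x_g_pow_eq_aeval_x y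
    obtain ⟨p, rfl⟩ := hl p
    have h2 : IsUnit (aeval T.X (derivative f * g)) := T.hasMap_X.2
    rw [map_mul] at h2
    obtain ⟨v, hv⟩ := isUnit_of_mul_isUnit_right h2
    refine ⟨aeval T.X p * (↑v⁻¹ : T.Ring) ^ n, ?_⟩
    have h3 : ∀ r : P[X], T.lift S.x hT (aeval T.X r) = aeval S.x (r.map (algebraMap P A)) := fun r => by
      rw [← aeval_algHom_apply, T.lift_X, aeval_map_algebraMap]
    have h4 : (aeval S.x S.g) * T.lift S.x hT (↑v⁻¹) = 1 := by
      rw [← hg, ← h3, ← hv, ← map_mul, Units.mul_inv, map_one]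
    rw [map_mul, h3, ← e, map_pow, mul_assoc, ← mul_pow, h4, one_pow, mul_one]
  refine ⟨T.Ring, inferInstance, inferInstance, T.lift S.x hT, inferInstance, hφ, fun q hq => ?_⟩
  let χ : B →ₐ[A] A ⊗[P] T.Ring := (S.P.lift _ hS).comp S.equivRing.toAlgHom
  have hχ : (χ.restrictScalars P).comp (T.lift S.x hT) = ι := by
    apply T.hom_ext
    simp [χ]
  change ι q = 0
  rw [← hχ, AlgHom.comp_apply, hq, map_zero]

open TensorProduct in
theorem std_h1 {k A B : Type u} [CommRing k] [CommRing A] [CommRing B] [Algebra k A] [Algebra A B]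
    [Algebra k B] [IsScalarTower k A B] [Algebra.IsStandardEtale A B] :
    Nonempty (B ⊗[A] Algebra.H1Cotangent k A ≃ₗ[B] Algebra.H1Cotangent k B) := by
  let E : Algebra.Extension k A := (Algebra.Generators.self k A).toExtension
  let : Algebra E.Ring B := ((algebraMap A B).comp (algebraMap E.Ring A)).toAlgebra
  have : IsScalarTower E.Ring A B := .of_algebraMap_eq' rfl
  have : IsScalarTower k E.Ring B := .of_algebraMap_eq fun x => by
    rw [IsScalarTower.algebraMap_apply E.Ring A B, ← IsScalarTower.algebraMap_apply k E.Ring A,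
      ← IsScalarTower.algebraMap_apply]
  obtain ⟨Q, _, _, φ, hQ, hs, hk⟩ := exists_etale_lift (B := B) E.algebraMap_surjective
  let : Algebra k Q := ((algebraMap E.Ring Q).comp (algebraMap k E.Ring)).toAlgebra
  have : IsScalarTower k E.Ring Q := .of_algebraMap_eq' rfl
  let Q' : Algebra.Extension k B := .ofSurjective (φ.restrictScalars k) hs
  let h : E.Hom Q' :=
    { toRingHom := algebraMap E.Ring Q
      toRingHom_algebraMap := fun x => (IsScalarTower.algebraMap_apply k E.Ring Q _).symm
      algebraMap_toRingHom := fun x => φ.commutes x }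
  have : Algebra.FormallySmooth k E.Ring := (inferInstance : Algebra.FormallySmooth k (MvPolynomial A k))
  have : Algebra.FormallySmooth k Q'.Ring := .comp k E.Ring Q
  have : Module.Flat A B := Algebra.Smooth.flat A B
  let : Algebra E.Ring Q'.Ring := (inferInstance : Algebra E.Ring Q)
  have hfl : Module.Flat E.Ring Q'.Ring := (Algebra.Smooth.flat _ _ : Module.Flat E.Ring Q)
  refine ⟨Algebra.Extension.tensorH1CotangentOfFormallyEtale h rfl
    (RingHom.formallyEtale_algebraMap.mpr (inferInstance : Algebra.FormallyEtale E.Ring Q)) ?_ ≪≫ₗ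
      Algebra.Extension.equivH1CotangentOfFormallySmooth _⟩
  let F : E.ker →ₗ[E.Ring] Q'.ker := h.mapKer rfl
  change Function.Bijective (F.liftBaseChange Q'.Ring)
  have hF : ∀ x, ((F.liftBaseChange Q'.Ring x : Q'.ker) : Q'.Ring) =
      (TensorProduct.rid E.Ring Q'.Ring) ((Submodule.subtype E.ker).lTensor Q'.Ring x) := fun x => by
    induction x with
    | zero => simp
    | add x y hx hy => rw [map_add, map_add, map_add, ← hx, ← hy]; rfl
    | tmul a b =>
      rw [LinearMap.liftBaseChange_tmul, LinearMap.lTensor_tmul, TensorProduct.rid_tmul, Algebra.smul_def,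
        mul_comm]
      rfl
  have hex := lTensor_exact Q'.Ring (f := Submodule.subtype E.ker) (g := Algebra.linearMap E.Ring A)
    (fun x => ⟨fun hx => ⟨⟨x, hx⟩, rfl⟩, by rintro ⟨y, rfl⟩; exact y.2⟩) E.algebraMap_surjective
  refine ⟨fun x y hxy => ?_, fun y => ?_⟩
  · apply Module.Flat.lTensor_preserves_injective_linearMap (M := Q'.Ring) _ (Submodule.subtype_injective E.ker)
    apply (TensorProduct.rid E.Ring Q'.Ring).injective
    rw [← hF, ← hF, hxy]
  · have hy : φ y.1 = 0 := y.2
    obtain ⟨x, hx⟩ := (hex (y.1 ⊗ₜ[E.Ring] 1)).1 (by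
      rw [LinearMap.lTensor_tmul, Algebra.linearMap_apply, map_one]
      exact (TensorProduct.comm_tmul E.Ring A Q _ _).symm.trans
        ((congrArg (TensorProduct.comm E.Ring A Q) (hk _ hy)).trans (map_zero _)))
    refine ⟨x, Subtype.ext ?_⟩
    rw [hF, hx, TensorProduct.rid_tmul, one_smul]

open TensorProduct in
theorem smooth_descend {k A B Ap Bq : Type u} [CommRing k] [CommRing A] [CommRing B] [CommRing Ap] [CommRing Bq]
    [Algebra k A] [Algebra A B] [Algebra k B] [IsScalarTower k A B] [Algebra k Ap] [Algebra A Ap] [Algebra k Bq]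
    [Algebra B Bq] [Algebra A Bq] [Algebra Ap Bq] [IsScalarTower k A Ap] [IsScalarTower A B Bq]
    [IsScalarTower A Ap Bq] [IsScalarTower k Ap Bq] [Algebra.Etale A B] (p : Ideal A) [p.IsPrime]
    (q : Ideal B) [q.IsPrime] [IsLocalization.AtPrime Ap p] [IsLocalization.AtPrime Bq q]
    [Module.FaithfullyFlat Ap Bq] [IsLocalRing Ap] [IsNoetherianRing Ap] [Algebra.EssFiniteType k Ap]
    [Algebra.FormallySmooth k Bq] : Algebra.FormallySmooth k Ap := by
  have hAB : Algebra.FormallyEtale A Bq := by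
    have : Algebra.FormallyEtale B Bq := .of_isLocalization q.primeCompl
    exact .comp A B Bq
  have hApB : Algebra.FormallyEtale Ap Bq := by
    have : Algebra.FormallyEtale A Ap := .of_isLocalization p.primeCompl
    exact .of_restrictScalars (R := A)
  have : Algebra.IsEtaleAt A q := by
    have : Algebra.FormallyEtale B (Localization.AtPrime q) := .of_isLocalization q.primeCompl
    exact Algebra.FormallyEtale.comp A B (Localization.AtPrime q)
  obtain ⟨g, hg, hstd⟩ := Algebra.IsEtaleAt.exists_isStandardEtale (R := A) q
  let B' := Localization.Away g
  have hgu : IsUnit (algebraMap B Bq g) := IsLocalization.map_units Bq (⟨g, hg⟩ : q.primeCompl)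
  let : Algebra B' Bq := (IsLocalization.Away.lift (S := B') g hgu).toAlgebra
  have : IsScalarTower B B' Bq := .of_algebraMap_eq fun x => (IsLocalization.Away.lift_eq g hgu x).symm
  have : IsScalarTower A B' Bq := .of_algebraMap_eq fun x => by
    rw [IsScalarTower.algebraMap_apply A B B', ← IsScalarTower.algebraMap_apply B B' Bq,
      ← IsScalarTower.algebraMap_apply]
  have : IsScalarTower k B Bq := .of_algebraMap_eq fun x => by
    rw [IsScalarTower.algebraMap_apply k A B, ← IsScalarTower.algebraMap_apply A B Bq,
      IsScalarTower.algebraMap_apply A Ap Bq, ← IsScalarTower.algebraMap_apply k A Ap,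
      ← IsScalarTower.algebraMap_apply]
  have : IsScalarTower k B' Bq := .of_algebraMap_eq fun x => by
    rw [IsScalarTower.algebraMap_apply k B B', ← IsScalarTower.algebraMap_apply B B' Bq,
      ← IsScalarTower.algebraMap_apply]
  have : IsScalarTower k A B' := .of_algebraMap_eq fun x => by
    rw [IsScalarTower.algebraMap_apply A B B', ← IsScalarTower.algebraMap_apply k A B,
      ← IsScalarTower.algebraMap_apply]
  have : IsLocalization (q.primeCompl.map (algebraMap B B')) Bq :=
    IsLocalization.isLocalization_of_submonoid_le B' Bq (Submonoid.powers g) q.primeCompl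
      ((Submonoid.powers_le).2 hg)
  obtain ⟨e1⟩ := std_h1 (k := k) (A := A) (B := B')
  have e2 := Algebra.tensorH1CotangentOfIsLocalization k (S := B') Bq (q.primeCompl.map (algebraMap B B'))
  have e3 := Algebra.tensorH1CotangentOfIsLocalization k (S := A) Ap p.primeCompl
  have e4 := e1.baseChange B' Bq _ _
  have e5 := e3.baseChange Ap Bq _ _
  have h1 : Subsingleton (Bq ⊗[A] Algebra.H1Cotangent k A) :=
    ((AlgebraTensorModule.cancelBaseChange A B' Bq Bq (Algebra.H1Cotangent k A)).symm.toEquiv.trans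
      (e4.toEquiv.trans e2.toEquiv)).subsingleton
  have h2 : Subsingleton (Bq ⊗[Ap] Algebra.H1Cotangent k Ap) :=
    (e5.symm.toEquiv.trans
      (AlgebraTensorModule.cancelBaseChange A Ap Bq Bq (Algebra.H1Cotangent k A)).toEquiv).subsingleton
  have h3 := Module.FaithfullyFlat.lTensor_reflects_triviality Ap Bq (Algebra.H1Cotangent k Ap)
  have e6 := KaehlerDifferential.tensorKaehlerEquivOfFormallyEtale k Ap Bq
  have : Module.Flat Bq (Bq ⊗[Ap] Ω[Ap⁄k]) := Module.Flat.of_linearEquiv e6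
  have : Module.Flat Ap (Ω[Ap⁄k]) := .of_flat_tensorProduct _ _ Bq
  have : Module.FinitePresentation Ap (Ω[Ap⁄k]) := Module.finitePresentation_of_finite _ _
  have := Module.free_of_flat_of_isLocalRing (R := Ap) (P := Ω[Ap⁄k])
  exact ⟨inferInstance, h3⟩

theorem ChartAt.formallySmooth {D C : Type u} [CommRing D] [CommRing C] [Algebra D C] {n l : ℕ} {b : D} {xc : Fin n → C}
    (h : ChartAt D C n l b xc) (hu : (l = 0 ∧ b = 1) ∨ ∃ j : Fin n, (j : ℕ) < l ∧ ∀ i : Fin n, (i : ℕ) < l → i ≠ j →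
      IsUnit (xc i)) : Algebra.FormallySmooth D C := by
  classical
  obtain ⟨B, _, _, _, P, _, hE, hL, hd, hx⟩ := h
  let _ : Algebra (stdRing D n l b) C := ((algebraMap B C).comp (algebraMap (stdRing D n l b) B)).toAlgebra
  have : IsScalarTower (stdRing D n l b) B C := .of_algebraMap_eq' rfl
  have : IsScalarTower D (stdRing D n l b) C :=
    IsScalarTower.of_algebraMap_eq (R := D) (S := stdRing D n l b) (A := C) fun d => (hd d).symm
  have : Algebra.FormallySmooth B C := .of_isLocalization P.primeCompl
  have : Algebra.FormallySmooth (stdRing D n l b) C := .comp _ B C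
  refine Algebra.FormallySmooth.of_comp_surjective fun E _ _ I hI φ => ?_
  have hxc : ∀ i, algebraMap (stdRing D n l b) C (stdCoord D n l b i) = xc i := hx
  have hnil : IsNilpotent I := ⟨2, hI⟩
  have hpr : (∏ i : Fin n, if (i : ℕ) < l then xc i else 1) = algebraMap D C b := by
    have h0 : (Ideal.Quotient.mk (Ideal.span {(∏ i : Fin n, if (i : ℕ) < l then MvPolynomial.X i else 1) -
        MvPolynomial.C b}) ((∏ i : Fin n, if (i : ℕ) < l then MvPolynomial.X i else 1) - MvPolynomial.C b) :
          stdRing D n l b) = 0 := Ideal.Quotient.eq_zero_iff_mem.2 (Ideal.mem_span_singleton_self _)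
    have h1 := congrArg (algebraMap (stdRing D n l b) C) h0
    rw [map_sub, map_sub, map_zero, sub_eq_zero, map_prod, map_prod] at h1
    refine Eq.trans (Finset.prod_congr rfl fun i _ => ?_) (h1.trans (hd b))
    split_ifs
    · exact (hxc i).symm
    · rw [map_one, map_one]
  choose y hy using fun i => Ideal.Quotient.mk_surjective (φ (xc i))
  obtain ⟨y', hy', hp⟩ : ∃ y' : Fin n → E, (∀ i, Ideal.Quotient.mk I (y' i) = φ (xc i)) ∧
      (∏ i : Fin n, if (i : ℕ) < l then y' i else 1) = algebraMap D E b := by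
    rcases hu with ⟨rfl, rfl⟩ | ⟨j, hj, hu⟩
    · exact ⟨y, hy, by simp⟩
    · let q := ∏ i ∈ Finset.univ.erase j, if (i : ℕ) < l then y i else 1
      have hq : Ideal.Quotient.mk I q = φ (∏ i ∈ Finset.univ.erase j, if (i : ℕ) < l then xc i else 1) := by
        rw [map_prod, map_prod]
        refine Finset.prod_congr rfl fun i _ => ?_
        split_ifs
        · exact hy i
        · rw [map_one, map_one]
      have hqu : IsUnit q := by
        rw [← hnil.isUnit_quotient_mk_iff, hq]
        refine IsUnit.map _ (IsUnit.prod_iff.2 fun i hi => ?_)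
        split_ifs with h
        · exact hu i h (Finset.ne_of_mem_erase hi)
        · exact isUnit_one
      obtain ⟨v, hv⟩ := hqu
      refine ⟨Function.update y j (algebraMap D E b * ↑v⁻¹), fun i => ?_, ?_⟩
      · by_cases hij : i = j
        · subst hij
          rw [Function.update_self]
          have hvu : IsUnit (Ideal.Quotient.mk I q) := by rw [← hv]; exact v.isUnit.map _
          refine hvu.mul_right_cancel ?_
          rw [← map_mul, mul_assoc, ← hv, Units.inv_mul, mul_one, hv, hq, ← map_mul]
          have : xc i * (∏ k ∈ Finset.univ.erase i, if (k : ℕ) < l then xc k else 1) = algebraMap D C b := by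
            rw [← hpr, ← Finset.mul_prod_erase _ _ (Finset.mem_univ i), if_pos hj]
          rw [this, AlgHom.commutes]
          rfl
        · rw [Function.update_of_ne hij]; exact hy i
      · rw [← Finset.mul_prod_erase _ _ (Finset.mem_univ j), if_pos hj, Function.update_self]
        have : (∏ i ∈ Finset.univ.erase j, if (i : ℕ) < l then Function.update y j (algebraMap D E b * ↑v⁻¹) i else 1) =
            q := Finset.prod_congr rfl fun i hi => by rw [Function.update_of_ne (Finset.ne_of_mem_erase hi)]
        rw [this, ← hv, mul_assoc, Units.inv_mul, mul_one]
  let θ : stdRing D n l b →ₐ[D] E := Ideal.Quotient.liftₐ _ (MvPolynomial.aeval y') fun a ha => by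
    have hle : Ideal.span {(∏ i : Fin n, if (i : ℕ) < l then MvPolynomial.X i else 1) - MvPolynomial.C b} ≤
        RingHom.ker (MvPolynomial.aeval (R := D) y').toRingHom := by
      rw [Ideal.span_singleton_le_iff_mem, RingHom.mem_ker]
      change MvPolynomial.aeval y' _ = 0
      rw [map_sub, map_prod, MvPolynomial.aeval_C, ← hp, sub_eq_zero]
      refine Finset.prod_congr rfl fun i _ => ?_
      split_ifs
      · exact MvPolynomial.aeval_X _ _
      · exact map_one _
    exact hle ha
  let _ : Algebra (stdRing D n l b) E := θ.toRingHom.toAlgebra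
  have : IsScalarTower D (stdRing D n l b) E :=
    IsScalarTower.of_algebraMap_eq (R := D) (S := stdRing D n l b) (A := E) fun d => (θ.commutes d).symm
  have hc : (φ.comp (IsScalarTower.toAlgHom D (stdRing D n l b) C)) =
      (Ideal.Quotient.mkₐ D I).comp θ := by
    apply Ideal.Quotient.algHom_ext
    apply MvPolynomial.algHom_ext
    intro i
    change φ (algebraMap (stdRing D n l b) C (stdCoord D n l b i)) = Ideal.Quotient.mk I (MvPolynomial.aeval y' (MvPolynomial.X i))
    rw [hxc, MvPolynomial.aeval_X, hy']
  let φ' : C →ₐ[stdRing D n l b] E ⧸ I := { φ with commutes' := fun r => congrArg (fun F => F r) hc }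
  obtain ⟨g, hg⟩ := Algebra.FormallySmooth.comp_surjective (stdRing D n l b) C I hI φ'
  refine ⟨g.restrictScalars D, AlgHom.ext fun c => ?_⟩
  exact congrArg (fun F => F c) hg

/-- charts with at most one branch are smooth -/
theorem HasChart.smooth {D : CommRingCat.{u}} [IsNoetherianRing D] {Y : Scheme.{u}} {f : Y ⟶ Spec D}
    [LocallyOfFinitePresentation f] {y : Y} [IsNoetherianRing (Stk f y)]
    {n l : ℕ} {b : D} {J : Set (Fin n)} (h : HasChart f y n l b J) (hln : l ≤ n) (hl : 0 < l ∨ b = 1)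
    (hJ : ∀ i ∈ J, ∀ j ∈ J, i = j) : y ∈ f.smoothLocus := by
  obtain ⟨U, gX, x', gT, h1, h2, rfl, h3, h4⟩ := h
  let _ := stkAlg f gX x'
  have := stkAlg_tower f gX x'
  have := stkAlg_ff f gX x'
  have hsm : Algebra.FormallySmooth D (Stk (gX ≫ f) x') := by
    refine (chartAt_stk f gX gT h2 h3 x').formallySmooth ?_
    have hu : ∀ i : Fin n, (i : ℕ) < l → i ∉ J → IsUnit
        (stkHom (D := CommRingCat.of (stdRing D n l b)) gT x' (stdCoord D n l b i)) := fun i hi hiJ =>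
      (stkHom_isUnit (D := CommRingCat.of (stdRing D n l b)) gT x' _).2 fun hm => hiJ ((h4 i).2 ⟨hi, hm⟩)
    by_cases hl0 : l = 0
    · exact .inl ⟨hl0, hl.resolve_left (by omega)⟩
    by_cases hne : J.Nonempty
    · obtain ⟨j, hj⟩ := hne
      exact .inr ⟨j, ((h4 j).1 hj).1, fun i hi hij => hu i hi fun hiJ => hij (hJ i hiJ j hj)⟩
    · exact .inr ⟨⟨0, by omega⟩, by simp; omega, fun i hi _ => hu i hi fun hiJ => hne ⟨i, hiJ⟩⟩
  obtain ⟨V, hV, hyV, -⟩ := exists_affine (gX x') ⊤ (TopologicalSpace.Opens.mem_top _)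
  obtain ⟨V', hV', hyV', hVV⟩ := exists_affine x' (gX ⁻¹ᵁ V) hyV
  have e1 : (gX.appLE V V' hVV).hom.Etale := HasRingHomProperty.appLE @Etale gX inferInstance ⟨V, hV⟩ ⟨V', hV'⟩ hVV
  let _ : Algebra D Γ(Y, V) := ((Scheme.ΓSpecIso D).inv ≫ f.appLE ⊤ V le_top).hom.toAlgebra
  let _ : Algebra Γ(Y, V) Γ(U, V') := (gX.appLE V V' hVV).hom.toAlgebra
  let _ : Algebra D Γ(U, V') := ((algebraMap Γ(Y, V) Γ(U, V')).comp (algebraMap D Γ(Y, V))).toAlgebra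
  have : IsScalarTower D Γ(Y, V) Γ(U, V') := .of_algebraMap_eq' rfl
  let _ : Algebra Γ(Y, V) (Stk f (gX x')) := (Y.presheaf.germ V (gX x') hyV).hom.toAlgebra
  let _ : Algebra Γ(U, V') (Stk (gX ≫ f) x') := (U.presheaf.germ V' x' hyV').hom.toAlgebra
  let _ : Algebra Γ(Y, V) (Stk (gX ≫ f) x') :=
    ((algebraMap Γ(U, V') (Stk (gX ≫ f) x')).comp (algebraMap Γ(Y, V) Γ(U, V'))).toAlgebra
  have : IsScalarTower Γ(Y, V) Γ(U, V') (Stk (gX ≫ f) x') := .of_algebraMap_eq' rfl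
  have : IsScalarTower Γ(Y, V) (Stk f (gX x')) (Stk (gX ≫ f) x') := .of_algebraMap_eq fun a => by
    have : Y.presheaf.germ V (gX x') hyV ≫ gX.stalkMap x' = gX.appLE V V' hVV ≫ U.presheaf.germ V' x' hyV' := by
      rw [Scheme.Hom.germ_stalkMap]
      delta Scheme.Hom.appLE
      rw [Category.assoc, U.presheaf.germ_res]
    exact (congrArg (fun F => F.hom a) this).symm
  have : IsScalarTower D Γ(Y, V) (Stk f (gX x')) := .of_algebraMap_eq fun d => by
    exact (congrArg (fun F => F.hom d) (stkHom_germ f (gX x') V hyV)).symm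
  have : Algebra.Etale Γ(Y, V) Γ(U, V') := e1
  have : IsLocalization.AtPrime (Stk f (gX x')) (hV.primeIdealOf ⟨gX x', hyV⟩).asIdeal :=
    hV.isLocalization_stalk ⟨_, hyV⟩
  have : IsLocalization.AtPrime (Stk (gX ≫ f) x') (hV'.primeIdealOf ⟨x', hyV'⟩).asIdeal :=
    hV'.isLocalization_stalk ⟨_, hyV'⟩
  have hpp := (hV.primeIdealOf ⟨gX x', hyV⟩).2
  have hqq := (hV'.primeIdealOf ⟨x', hyV'⟩).2
  have hft : Algebra.FiniteType D Γ(Y, V) := by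
    have h1 : (f.appLE ⊤ V le_top).hom.FiniteType :=
      HasRingHomProperty.appLE @LocallyOfFiniteType f inferInstance ⟨⊤, isAffineOpen_top _⟩ ⟨V, hV⟩ le_top
    exact RingHom.finiteType_respectsIso.2 _ (Scheme.ΓSpecIso D).symm.commRingCatIsoToRingEquiv h1
  have : Algebra.EssFiniteType Γ(Y, V) (Stk f (gX x')) :=
    Algebra.EssFiniteType.of_isLocalization _ (hV.primeIdealOf ⟨gX x', hyV⟩).asIdeal.primeCompl
  have : Algebra.EssFiniteType D (Stk f (gX x')) := .comp D Γ(Y, V) _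
  have hS : Algebra.FormallySmooth D (Stk f (gX x')) := smooth_descend (A := Γ(Y, V)) (B := Γ(U, V')) (Bq := Stk (gX ≫ f) x')
    (hV.primeIdealOf ⟨gX x', hyV⟩).asIdeal (hV'.primeIdealOf ⟨x', hyV'⟩).asIdeal
  rw [Scheme.Hom.mem_smoothLocus]
  let a : Spec D := f (gX x')
  let _ : Algebra (Stk (𝟙 (Spec D)) a) (Stk f (gX x')) := (f.stalkMap (gX x')).hom.toAlgebra
  have : IsScalarTower D (Stk (𝟙 (Spec D)) a) (Stk f (gX x')) := .of_algebraMap_eq fun d =>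
    (congrArg (fun F => F.hom d) ((stkHom_comp' (𝟙 (Spec D)) f (gX x')).trans
      (stk_congr (Category.comp_id f) (gX x')))).symm
  let _ : Algebra D Γ(Spec D, ⊤) := (Scheme.ΓSpecIso D).inv.hom.toAlgebra
  let _ : Algebra Γ(Spec D, ⊤) (Stk (𝟙 (Spec D)) a) :=
    ((Spec D).presheaf.germ ⊤ a (TopologicalSpace.Opens.mem_top _)).hom.toAlgebra
  have : IsScalarTower D Γ(Spec D, ⊤) (Stk (𝟙 (Spec D)) a) := .of_algebraMap_eq fun d => by
    simp only [stk_algebraMap, stkHom, Scheme.Hom.id_appTop, Category.id_comp]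
    rfl
  have haT : a ∈ (⊤ : (Spec D).Opens) := TopologicalSpace.Opens.mem_top _
  have hap := ((isAffineOpen_top (Spec D)).primeIdealOf ⟨a, haT⟩).2
  have : IsLocalization.AtPrime (Stk (𝟙 (Spec D)) a) ((isAffineOpen_top (Spec D)).primeIdealOf ⟨a, haT⟩).asIdeal :=
    (isAffineOpen_top (Spec D)).isLocalization_stalk ⟨a, haT⟩
  have : Algebra.FormallyUnramified Γ(Spec D, ⊤) (Stk (𝟙 (Spec D)) a) :=
    .of_isLocalization ((isAffineOpen_top (Spec D)).primeIdealOf ⟨a, haT⟩).asIdeal.primeCompl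
  have : Algebra.FormallyUnramified D Γ(Spec D, ⊤) := .of_surjective (Algebra.ofId D Γ(Spec D, ⊤))
    (Scheme.ΓSpecIso D).symm.commRingCatIsoToRingEquiv.surjective
  have : Algebra.FormallyUnramified D (Stk (𝟙 (Spec D)) a) := .comp D Γ(Spec D, ⊤) _
  exact Algebra.FormallySmooth.of_restrictScalars D (Stk (𝟙 (Spec D)) a) (Stk f (gX x'))

theorem smooth_bc {P X Y Z : Scheme.{u}} {p : P ⟶ X} {q : P ⟶ Y} {f : X ⟶ Z} {g : Y ⟶ Z} (h : IsPullback p q f g)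
    (V : X.Opens) (hV : Smooth (V.ι ≫ f)) : Smooth ((p ⁻¹ᵁ V).ι ≫ q) := by
  have h2 := (isPullback_morphismRestrict p V).paste_vert h
  exact MorphismProperty.of_isPullback (P := @Smooth) h2 hV

theorem smoothLocus_smooth {X Y : Scheme.{u}} (f : X ⟶ Y) [LocallyOfFinitePresentation f] :
    Smooth (f.smoothLocus.ι ≫ f) := by
  rw [← Scheme.Hom.smoothLocus_eq_top_iff, ← Scheme.Hom.preimage_smoothLocus_eq]
  ext x
  simp

theorem red_smooth {k : CommRingCat.{u}} [IsDomain k] [IsIntegrallyClosed k] {Z : Scheme.{u}} (g : Z ⟶ Spec k)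
    (V : Z.Opens) (hV : Smooth (V.ι ≫ g)) {C : Set Z} (hC : C = Set.univ) (W : ReducedClosedSubscheme Z C) (w : W.Z)
    (hw : W.ι w ∈ V) : SmoothAtPt (W.ι ≫ g) w := by
  have := W.isClosedImmersion
  have hred : IsReduced V.toScheme := by
    have (x : V.toScheme) : _root_.IsReduced (V.toScheme.presheaf.stalk x) := by
      have := (smooth_stk_normal0 (V.ι ≫ g) hV x).1
      exact inferInstanceAs (_root_.IsReduced (Stk (V.ι ≫ g) x))
    exact isReduced_of_isReduced_stalk _
  have h1 : IsClosedImmersion (W.ι ∣_ V) := inferInstance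
  have h2 : Surjective (W.ι ∣_ V) := by
    have : Surjective W.ι := ⟨fun z => by
      have : z ∈ Set.range W.ι.base := by rw [W.range, hC]; trivial
      exact this⟩
    exact MorphismProperty.of_isPullback (P := @Surjective) (isPullback_morphismRestrict W.ι V).flip this
  have h3 : IsIso (W.ι ∣_ V) := isIso_of_isClosedImmersion_of_surjective _
  refine ⟨W.ι ⁻¹ᵁ V, hw, ?_⟩
  have h4 : (W.ι ⁻¹ᵁ V).ι ≫ W.ι ≫ g = (W.ι ∣_ V) ≫ V.ι ≫ g := by
    rw [← Category.assoc, ← Category.assoc, morphismRestrict_ι]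
  change Smooth _
  rw [h4]
  infer_instance

theorem stratum_gen {R : CommRingCat.{u}} {X : Scheme.{u}} (f : X ⟶ Spec R) [LocallyOfFinitePresentation f]
    (s : Spec R) {T : Set (fiberScheme f s)} (hT : IsStratum (fiberRes f s) 1 T) :
    ∃ ξ ∈ T, (∀ z ∈ T, ξ ⤳ z) ∧ fiberι f s ξ ∉ f.smoothLocus := by
  obtain ⟨Sing, ⟨h0, hS⟩, W, T', hT', rfl⟩ := hT
  have ho : IsOpen {z : W.Z | SmoothAtPt (W.ι ≫ fiberRes f s) z} := by
    rw [isOpen_iff_forall_mem_open]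
    rintro z ⟨U, hz, hU⟩
    exact ⟨U, fun y hy => ⟨U, hy, hU⟩, U.2, hz⟩
  have : QuasiSober {z : W.Z // SmoothAtPt (W.ι ≫ fiberRes f s) z} := ho.isOpenEmbedding_subtypeVal.quasiSober
  obtain ⟨x, hx⟩ := QuasiSober.sober hT'.1 (isClosed_of_mem_irreducibleComponents _ hT')
  have hx' : x ∈ T' := hx.mem
  refine ⟨_, ⟨_, ⟨x, hx', rfl⟩, rfl⟩, ?_, fun hsm => ?_⟩
  · rintro _ ⟨_, ⟨z, hz, rfl⟩, rfl⟩
    exact ((hx.specializes hz).map continuous_subtype_val).map W.ι.continuous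
  · have h1 : W.ι x.1 ∈ Sing 1 := W.range.subset ⟨_, rfl⟩
    obtain ⟨W0, hW0⟩ := hS 0
    obtain ⟨w, hw, hwx⟩ := hW0.subset h1
    refine hw (red_smooth (fiberRes f s) (fiberι f s ⁻¹ᵁ f.smoothLocus)
      (smooth_bc (IsPullback.of_hasPullback _ _) _ (smoothLocus_smooth f)) h0 W0 w ?_)
    change fiberι f s (W0.ι.base w) ∈ f.smoothLocus
    rw [hwx]
    exact hsm

section
variable {D : CommRingCat.{u}} [IsLocalRing D] [IsDomain D] [IsNoetherianRing D] [IsIntegrallyClosed D]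
  {Y : Scheme.{u}} {f : Y ⟶ Spec D}

theorem Fam.lpos (F : Fam f) {y : Y} {n l : ℕ} {b : D} {J : Set (Fin n)} (h : HasChart f y n l b J) :
    0 < l ∨ b = 1 := by
  by_contra hc
  push Not at hc
  obtain ⟨h0, hb⟩ := hc
  obtain rfl : l = 0 := by omega
  exact one_ne_zero (F.nzd y (1 - b) (sub_ne_zero.2 (Ne.symm hb)) 1 (by rw [h.oChart.killed, zero_mul]))

theorem Fam.two (F : Fam f) [LocallyOfFinitePresentation f] {y : Y} {n l : ℕ} {b : D} {J : Set (Fin n)}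
    (h : HasChart f y n l b J) (hln : l ≤ n) (hy : y ∉ f.smoothLocus) : ∃ i ∈ J, ∃ j ∈ J, i ≠ j := by
  by_contra hc
  push Not at hc
  have := F.stk_noeth y
  exact hy (h.smooth hln (F.lpos h) hc)

theorem Fam.cmp (F : Fam f) [LocallyOfFinitePresentation f] {y : Y} (hm : (f y).asIdeal = IsLocalRing.maximalIdeal D)
    {n l n' l' : ℕ} {b b' : D} {J : Set (Fin n)} {J' : Set (Fin n')}
    (h : HasChart f y n l b J) (hln : l ≤ n) (h' : HasChart f y n' l' b' J') (hln' : l' ≤ n')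
    (hy : y ∉ f.smoothLocus) : ∃ e, 0 < e ∧ Associated b' (b ^ e) := by
  obtain ⟨i, hi, j, hj, hij⟩ := F.two h hln hy
  obtain ⟨i', hi', j', hj', hij'⟩ := F.two h' hln' hy
  have hb := F.b_ne_zero h i j hi hj hij
  have hb' := F.b_ne_zero h' i' j' hi' hj' hij'
  have hl := F.lpos h
  obtain ⟨U, gX, x, gT, h1, h2, rfl, h3, h4⟩ := h
  obtain ⟨U', gX', x', gT', h1', h2', hxx, h3', h4'⟩ := h'
  obtain ⟨w, hw, hw'⟩ := Scheme.Pullback.exists_preimage_pullback x x' hxx.symm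
  let p := pullback.fst gX gX'
  let q := pullback.snd gX gX'
  have c1 := chartAt_stk f (p ≫ gX) (p ≫ gT) (inferInstanceAs (Etale (p ≫ gT)))
    (by rw [Category.assoc, h3, Category.assoc]) w
  have c2 := chartAt_stk f (p ≫ gX) (q ≫ gT') (inferInstanceAs (Etale (q ≫ gT')))
    (by rw [Category.assoc, h3', ← Category.assoc, ← pullback.condition, Category.assoc]) w
  have hmx : mExt D (Stk ((p ≫ gX) ≫ f) w) ≤ IsLocalRing.maximalIdeal _ := mExt_le_max w (by
    change (f (gX (p w))).asIdeal = _
    rw [hw, hm])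
  have m1 : ∀ i, i ∈ J → (i : ℕ) < l ∧ stkHom (D := CommRingCat.of (stdRing D n l b)) (p ≫ gT) w (stdCoord D n l b i) ∈
      IsLocalRing.maximalIdeal (Stk ((p ≫ gX) ≫ f) w) := fun i hi => by
    rw [h4] at hi
    refine ⟨hi.1, (stkHom_mem (D := CommRingCat.of (stdRing D n l b)) (p ≫ gT) w _).2 ?_⟩
    change _ ∈ (gT (p w)).asIdeal
    rw [hw]
    exact hi.2
  have m2 : ∀ i, i ∈ J' → (i : ℕ) < l' ∧ stkHom (D := CommRingCat.of (stdRing D n' l' b')) (q ≫ gT') w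
      (stdCoord D n' l' b' i) ∈ IsLocalRing.maximalIdeal (Stk ((p ≫ gX) ≫ f) w) := fun i hi => by
    rw [h4'] at hi
    refine ⟨hi.1, (stkHom_mem (D := CommRingCat.of (stdRing D n' l' b')) (q ≫ gT') w _).2 ?_⟩
    change _ ∈ (gT' (q w)).asIdeal
    rw [hw']
    exact hi.2
  have := c1.noeth
  have := c1.flat hln hl
  classical
  exact lc_compare (c1.localChart hmx ⟨i, m1 i hi⟩) (c2.localChart hmx ⟨i', m2 i' hi'⟩) hb hb' ⟨i, m1 i hi⟩
    ⟨j, m1 j hj⟩ fun h => hij (congrArg Subtype.val h)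

end

theorem assoc_pow_lt {A : Type*} [CommRing A] [IsDomain A] {t x y c : A} (ht : t ≠ 0) (hc : ¬ IsUnit c) {m1 m2 : ℕ}
    (h1 : Associated (t ^ m1) x) (h2 : Associated (t ^ m2) y) (h : Associated (x * c) y) : m1 < m2 := by
  by_contra hle
  have h3 : t ^ m1 * c ∣ t ^ m1 * 1 := by
    rw [mul_one]
    exact (((h1.mul_right c).trans h).trans h2.symm).dvd.trans (pow_dvd_pow t (not_lt.1 hle))
  exact hc (isUnit_of_dvd_one ((mul_dvd_mul_iff_left (pow_ne_zero _ ht)).1 h3))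

theorem fib_gen {R : CommRingCat.{u}} [IsLocalRing R] {X : Scheme.{u}} (f : X ⟶ Spec R) (s : Spec R)
    (hs : s.asIdeal = IsLocalRing.maximalIdeal R) {c : Set (fiberScheme f s)}
    (hc : c ∈ irreducibleComponents (fiberScheme f s)) :
    ∃ x, closure {x} = c ∧ IsGen f (fiberι f s x) ∧ ∀ z ∈ c, fiberι f s x ⤳ fiberι f s z := by
  have hcl := isClosed_of_mem_irreducibleComponents c hc
  obtain ⟨x, hx⟩ := QuasiSober.sober hc.1 hcl
  have hr : ∀ y, y ∈ Set.range (f.fiberι s) ↔ f y = s := fun y => by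
    rw [Scheme.Hom.range_fiberι]; rfl
  have he : Topology.IsEmbedding (fiberι f s) := (f.fiberι s).isEmbedding
  refine ⟨x, hx, ⟨?_, ?_⟩, fun z hz => ?_⟩
  · exact (congrArg PrimeSpectrum.asIdeal ((hr _).1 ⟨x, rfl⟩)).trans hs
  · intro y hy hys
    obtain ⟨y', rfl⟩ := (hr y).2 (PrimeSpectrum.ext (hys.trans hs.symm))
    have h1 : y' ⤳ x := he.isInducing.specializes_iff.1 hy
    have h2 : closure {y'} ⊆ c := hc.2 isIrreducible_singleton.closure (by
      rw [← hx.def]; exact h1.closure_subset)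
    have h3 : x ⤳ y' := hx.specializes (h2 (subset_closure rfl))
    exact congrArg (fiberι f s) (h1.antisymm h3).eq
  · exact (hx.specializes hz).map he.continuous

section
variable {R : CommRingCat.{u}} [IsDomain R] [IsNoetherianRing R] [IsIntegrallyClosed R]
  [HenselianLocalRing R] [IsSepClosed (IsLocalRing.ResidueField R)]
  {X : Scheme.{u}} {f : X ⟶ Spec R} {A : CommRingCat.{u}} [IsDomain A] [IsDiscreteValuationRing A]

theorem exists_gen_over {ψ : R ⟶ A} (F' : Fam (pullback.snd f (Spec.map ψ)))
    (hc : (Spec.map ψ (IsLocalRing.closedPoint A)).asIdeal = IsLocalRing.maximalIdeal R) {η : X} (g : IsGen f η) :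
    ∃ w, IsGen (pullback.snd f (Spec.map ψ)) w ∧ pullback.fst f (Spec.map ψ) w = η := by
  have := F'.noeth
  obtain ⟨z, hz1, hz2⟩ := Scheme.Pullback.exists_preimage_pullback (f := f) (g := Spec.map ψ) η
    (IsLocalRing.closedPoint A) (PrimeSpectrum.ext (g.1.trans hc.symm))
  obtain ⟨w, hw, gw⟩ := exists_isGen (f := pullback.snd f (Spec.map ψ)) z (by rw [hz2]; rfl)
  refine ⟨w, gw, g.2 _ ?_ ?_⟩
  · rw [← hz1]; exact hw.map (pullback.fst f (Spec.map ψ)).continuous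
  · rw [← hc, ← Scheme.Hom.comp_apply, pullback.condition, Scheme.Hom.comp_apply]
    congr 2
    exact PrimeSpectrum.ext gw.1

theorem edge_rel [LocallyOfFinitePresentation f] (F : Fam f) {ψ : R ⟶ A} (F' : Fam (pullback.snd f (Spec.map ψ)))
    (hc : (Spec.map ψ (IsLocalRing.closedPoint A)).asIdeal = IsLocalRing.maximalIdeal R)
    (U : (Spec R).Opens) (hU : Smooth ((f ⁻¹ᵁ U).ι ≫ f)) (hψ : Spec.map ψ ⟨⊥, Ideal.isPrime_bot⟩ ∈ U) {E : X → ℤ}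
    (hE : IsCartierDiv E) (hE0 : ∀ z, f z ∈ U → E z = 0) {ET : ↑(pullback f (Spec.map ψ)) → ℤ}
    (hET : IsDivPullback (pullback.fst f (Spec.map ψ)) E ET) {z : X} (hns : z ∉ f.smoothLocus)
    (hz : (f z).asIdeal = IsLocalRing.maximalIdeal R) {n l : ℕ} {b : R} {J : Set (Fin n)} (hch : HasChart f z n l b J)
    (hln : l ≤ n) {η₁ η₂ : X} (h₁ : η₁ ⤳ z) (h₂ : η₂ ⤳ z) (g₁ : IsGen f η₁) (g₂ : IsGen f η₂) (hne : η₁ ≠ η₂)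
    {w₁ w₂ : ↑(pullback f (Spec.map ψ))} (k₁ : IsGen (pullback.snd f (Spec.map ψ)) w₁)
    (k₂ : IsGen (pullback.snd f (Spec.map ψ)) w₂) (p₁ : pullback.fst f (Spec.map ψ) w₁ = η₁)
    (p₂ : pullback.fst f (Spec.map ψ) w₂ = η₂) :
    ∃ ρ d1 d2, ρ ≠ 0 ∧ d1 ≠ 0 ∧ d2 ≠ 0 ∧ IsVal f E η₁ d1 ρ ∧ IsVal f E η₂ d2 ρ ∧ (ET w₁ = ET w₂ → Associated d1 d2) ∧
      (ET w₁ < ET w₂ → ∃ e, 0 < e ∧ Associated (d1 * b ^ e) d2) := by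
  have := F.proper
  obtain ⟨i, hi, j, hj, hij⟩ := F.two hch hln hns
  have hb := F.b_ne_zero hch i j hi hj hij
  obtain ⟨ρ, d1, d2, hρ, hd1, hd2, v1, v2, e, he⟩ := edge_val F U hU hE hE0 _ hψ hz hch hln hb hj h₁ h₂ g₁ g₂ hne
  obtain ⟨C, _, _, _, _, _, _, x, c1, c2, c3, c4, -⟩ := hch.oChart.oLoc hln (mExt_le_max z hz) j hj
  have hbm : ¬ IsUnit (ψ b) := by
    have := c1.hb
    rw [← hc] at this
    exact this
  obtain ⟨t, ht⟩ := IsDiscreteValuationRing.exists_irreducible A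
  have key : ∀ d : R, d ∉ (Spec.map ψ ⟨⊥, Ideal.isPrime_bot⟩).asIdeal → d ≠ 0 ∧ ∃ m : ℕ, Associated (t ^ m) (ψ d) := by
    intro d hd
    refine ⟨fun h => hd (h ▸ Ideal.zero_mem _), ?_⟩
    obtain ⟨m, hm⟩ := IsDiscreteValuationRing.associated_pow_irreducible (x := ψ d) (fun h => hd h) ht
    exact ⟨m, hm.symm⟩
  obtain ⟨n0, m0, a0⟩ := key ρ hρ
  obtain ⟨n1, m1, a1⟩ := key d1 hd1
  obtain ⟨n2, m2, a2⟩ := key d2 hd2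
  have q1 := (p₁ ▸ v1 : IsVal f E (pullback.fst f (Spec.map ψ) w₁) d1 ρ).pullback F' ψ _ pullback.condition hET k₁ ht a1 a0
  have q2 := (p₂ ▸ v2 : IsVal f E (pullback.fst f (Spec.map ψ) w₂) d2 ρ).pullback F' ψ _ pullback.condition hET k₂ ht a2 a0
  refine ⟨ρ, d1, d2, n0, n1, n2, v1, v2, ?_⟩
  rcases Nat.eq_zero_or_pos e with rfl | he0
  · have h12 : Associated d1 d2 := by simpa using he
    refine ⟨fun _ => h12, fun hlt => ?_⟩
    have h3 := (a1.trans (h12.map ψ.hom)).trans a2.symm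
    have h4 : m1 = m2 := le_antisymm ((pow_dvd_pow_iff ht.ne_zero ht.not_isUnit).1 h3.dvd)
      ((pow_dvd_pow_iff ht.ne_zero ht.not_isUnit).1 h3.symm.dvd)
    omega
  · have hbe : ¬ IsUnit (ψ b ^ e) := by rwa [isUnit_pow_iff he0.ne']
    rcases he with he | he
    · have h3 : Associated (ψ d1 * ψ b ^ e) (ψ d2) := by simpa using he.map ψ.hom
      have h4 := assoc_pow_lt ht.ne_zero hbe a1 a2 h3
      exact ⟨fun h => by omega, fun _ => ⟨e, he0, he⟩⟩
    · have h3 : Associated (ψ d2 * ψ b ^ e) (ψ d1) := by simpa using (he.map ψ.hom).symm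
      have h4 := assoc_pow_lt ht.ne_zero hbe a2 a1 h3
      exact ⟨fun h => by omega, fun h => by omega⟩
end

theorem Fam.lin_const {A : CommRingCat.{u}} [IsDomain A] [IsDiscreteValuationRing A] {Y : Scheme.{u}} {f : Y ⟶ Spec A}
    (F : Fam f) {D D' : Y → ℤ} (h : LinEquivDiv D D') {w w' : Y} (hw : IsGen f w) (hw' : IsGen f w') :
    D w - D' w = D w' - D' w' := by
  have := F.integral
  obtain ⟨t, ht⟩ := IsDiscreteValuationRing.exists_irreducible A
  obtain ⟨h₁, h₂, n₁, n₂, H⟩ := h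
  have dim : ∀ z, IsGen f z → IsDivisorialPt Y z := fun z hz => by
    obtain ⟨i1, i2, -⟩ := F.dvr_gen ht z hz
    exact IsDiscreteValuationRing.ringKrullDim_eq_one (Stk f z)
  have key : ∀ g ∈ nonZeroDivisors Γ(Y, ⊤), ∃ m : ℕ, ∀ z, IsGen f z → germOrd ⊤ g z trivial m := by
    intro g hg
    obtain ⟨i1, i2, -⟩ := F.dvr_gen ht w hw
    obtain ⟨m, hm⟩ := elemOrd_exists (IsDiscreteValuationRing.ringKrullDim_eq_one (Stk f w)) _
      ((gm_nzd f (TopologicalSpace.Opens.mem_top w) g).1 hg)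
    have : Nonempty (⊤ : Y.Opens) := ⟨⟨w, trivial⟩⟩
    exact ⟨m, F.const_ord ht w hw m g (nonZeroDivisors.ne_zero hg) hm⟩
  obtain ⟨m₁, k₁⟩ := key h₁ n₁
  obtain ⟨m₂, k₂⟩ := key h₂ n₂
  rw [H w (dim w hw) _ _ (k₁ w hw) (k₂ w hw), H w' (dim w' hw') _ _ (k₁ w' hw') (k₂ w' hw')]

/-- Cyclic successor. -/
abbrev nx {N : ℕ} (i : Fin N) : Fin N := ⟨((i : ℕ) + 1) % N, Nat.mod_lt _ i.pos⟩

theorem cyc_assoc {R : Type*} [CommRing R] [IsDomain R] {N : ℕ} (d ρ : Fin N → R) (hρ : ∀ i, ρ i ≠ 0) (k : Fin N)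
    (hk : (k : ℕ) + 1 < N)
    (hA : ∀ i, i ≠ k → i ≠ nx k → Associated (d i * ρ (nx i)) (d (nx i) * ρ i)) :
    Associated (d (nx (nx k)) * ρ k) (d k * ρ (nx (nx k))) := by
  have key : ∀ m, m + 2 ≤ N → Associated (d (nx (nx k)) * ρ ⟨(k + 2 + m) % N, Nat.mod_lt _ k.pos⟩)
      (d ⟨(k + 2 + m) % N, Nat.mod_lt _ k.pos⟩ * ρ (nx (nx k))) := by
    intro m
    induction m with
    | zero =>
      intro _
      have : nx (nx k) = ⟨(k + 2 + 0) % N, Nat.mod_lt _ k.pos⟩ := by ext; simp [add_assoc]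
      rw [this]
    | succ m ih =>
      intro hm
      have h1 := ih (by omega)
      set a : Fin N := ⟨(k + 2 + m) % N, Nat.mod_lt _ k.pos⟩ with ha
      have hn : (⟨(k + 2 + (m + 1)) % N, Nat.mod_lt _ k.pos⟩ : Fin N) = nx a := by
        ext; simp [ha, add_assoc]
      rw [hn]
      have hav : (a : ℕ) ≠ k ∧ (a : ℕ) ≠ k + 1 := by
        change (k + 2 + m : ℕ) % N ≠ k ∧ (k + 2 + m : ℕ) % N ≠ k + 1
        rcases lt_or_ge (k + 2 + m : ℕ) N with h | h
        · rw [Nat.mod_eq_of_lt h]; omega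
        · rw [Nat.mod_eq_sub_mod h, Nat.mod_eq_of_lt (by omega)]; omega
      have h2 := hA a (fun h => hav.1 (congrArg Fin.val h)) (fun h => hav.2 (by
        rw [h]; exact Nat.mod_eq_of_lt hk))
      obtain ⟨u, h1⟩ := h1
      obtain ⟨v, h2⟩ := h2
      refine ⟨u * v, mul_right_cancel₀ (hρ a) ?_⟩
      push_cast
      linear_combination (ρ (nx a) * v) * h1 + ρ (nx (nx k)) * h2
  have := key (N - 2) (by omega)
  have h3 : (⟨(k + 2 + (N - 2)) % N, Nat.mod_lt _ k.pos⟩ : Fin N) = k := by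
    ext
    change (k + 2 + (N - 2) : ℕ) % N = k
    rw [show (k + 2 + (N - 2) : ℕ) = k + N by omega, Nat.add_mod_right, Nat.mod_eq_of_lt k.2]
  rwa [h3] at this

theorem comb_assoc {R : Type*} [CommRing R] [IsDomain R] {dk d1 d2 dk' e1 e2 rk r1 r2 r' B B' : R} (hd2 : d2 ≠ 0)
    (hk : rk ≠ 0) (h1 : r1 ≠ 0) (h' : r' ≠ 0) (a1 : Associated (dk * B) dk') (a2 : Associated (dk' * r1) (d1 * rk))
    (a3 : Associated (e1 * B') e2) (a4 : Associated (d1 * r') (e2 * r1)) (a5 : Associated (d2 * r') (e1 * r2))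
    (a6 : Associated (d2 * rk) (dk * r2)) : Associated B B' := by
  obtain ⟨u1, a1⟩ := a1
  obtain ⟨u2, a2⟩ := a2
  obtain ⟨u3, a3⟩ := a3
  obtain ⟨u4, a4⟩ := a4
  obtain ⟨u5, a5⟩ := a5
  obtain ⟨u6, a6⟩ := a6
  refine ⟨u1 * u2 * u4 * u6 * u3⁻¹ * u5⁻¹, ?_⟩
  have h3 : (u3 : R) * (u3⁻¹ : Rˣ) = 1 := u3.mul_inv
  have h5 : (u5 : R) * (u5⁻¹ : Rˣ) = 1 := u5.mul_inv
  apply mul_left_cancel₀ (mul_ne_zero (mul_ne_zero hd2 hk) (mul_ne_zero h1 h'))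
  have : d2 * rk * (r1 * r') * (B * (u1 * u2 * u4 * u6)) = d2 * rk * (r1 * r') * (B' * (u3 * u5)) := by
    subst a1 a3
    linear_combination (B * u1 * u2 * u4 * r1 * r') * a6 + (u4 * r' * r2) * a2 + (r2 * rk) * a4
      - (B' * u3 * r1 * rk) * a5
  push_cast
  linear_combination ((u3⁻¹ : Rˣ) * (u5⁻¹ : Rˣ) : R) * this + d2 * rk * (r1 * r') * B' * ((u5 : R) * (u5⁻¹ : Rˣ)) * h3
    + d2 * rk * (r1 * r') * B' * h5

/-- Two elements are comparable if they have equal positive powers as ideals. -/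
def Cmp {R : Type*} [CommRing R] (x y : R) : Prop :=
  ∃ n m : ℕ, 0 < n ∧ 0 < m ∧ Ideal.span {x} ^ n = Ideal.span {y} ^ m

theorem Cmp.symm {R : Type*} [CommRing R] {x y : R} (h : Cmp x y) : Cmp y x := by
  obtain ⟨n, m, hn, hm, h⟩ := h
  exact ⟨m, n, hm, hn, h.symm⟩

theorem Cmp.trans {R : Type*} [CommRing R] {x y z : R} (h : Cmp x y) (h' : Cmp y z) : Cmp x z := by
  obtain ⟨n, m, hn, hm, h⟩ := h
  obtain ⟨p, q, hp, hq, h'⟩ := h'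
  exact ⟨n * p, q * m, by positivity, by positivity, by rw [pow_mul, h, ← pow_mul, mul_comm, pow_mul, h', pow_mul]⟩

theorem Cmp.of_assoc {R : Type*} [CommRing R] [IsDomain R] {x y : R} {n m : ℕ} (hn : 0 < n) (hm : 0 < m)
    (h : Associated (x ^ n) (y ^ m)) : Cmp x y :=
  ⟨n, m, hn, hm, by
    rw [Ideal.span_singleton_pow, Ideal.span_singleton_pow, Ideal.span_singleton_eq_span_singleton]; exact h⟩

theorem core {R : CommRingCat.{u}} [IsDomain R] [IsNoetherianRing R] [IsIntegrallyClosed R]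
    [HenselianLocalRing R] [IsSepClosed (IsLocalRing.ResidueField R)]
    {X : Scheme.{u}} {f : X ⟶ Spec R} [LocallyOfFinitePresentation f]
    {A : CommRingCat.{u}} [IsDomain A] [IsDiscreteValuationRing A]
    (F : Fam f) {ψ : R ⟶ A} (F' : Fam (pullback.snd f (Spec.map ψ)))
    (hc : (Spec.map ψ (IsLocalRing.closedPoint A)).asIdeal = IsLocalRing.maximalIdeal R)
    (U : (Spec R).Opens) (hU : Smooth ((f ⁻¹ᵁ U).ι ≫ f)) (hψ : Spec.map ψ ⟨⊥, Ideal.isPrime_bot⟩ ∈ U)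
    (s : Spec R) (hs : s.asIdeal = IsLocalRing.maximalIdeal R)
    (c : GraphCycle f s) (i j : Fin c.N) (bi bj : R) (hbi : StratumHasLabel f s (c.T i) bi)
    (hbj : StratumHasLabel f s (c.T j) bj) (hcmp : ¬ Cmp bi bj) :
      ∃ D : ↑(pullback f (Spec.map ψ)) → ℤ, IsCartierDiv D ∧
        (∀ z : ↑(pullback f (Spec.map ψ)),
          (pullback.snd f (Spec.map ψ)).base z = ⟨⊥, Ideal.isPrime_bot⟩ → D z = 0) ∧
        (∀ E : X → ℤ, IsCartierDiv E → (∀ z : X, f.base z ∈ U → E z = 0) →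
          ∀ ET : ↑(pullback f (Spec.map ψ)) → ℤ,
            IsDivPullback (pullback.fst f (Spec.map ψ)) E ET → ¬ LinEquivDiv ET D) := by
  classical
  choose x hx1 hx2 hx3 using fun i => fib_gen f s hs (c.hv i)
  choose ξ hξT hξs hξn using fun i => stratum_gen f s (c.hT i)
  choose n l b J hln _ hch using fun i => F.good (fiberι f s (ξ i))
  choose w hw hpw using fun i => exists_gen_over F' hc (hx2 i)
  have he : Topology.IsEmbedding (fiberι f s) := (f.fiberι s).isEmbedding
  have hy : ∀ z, (f (fiberι f s z)).asIdeal = IsLocalRing.maximalIdeal R := fun z => by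
    have h : f.fiberι s z ∈ f ⁻¹' {s} := by rw [← Scheme.Hom.range_fiberι]; exact ⟨z, rfl⟩
    exact (congrArg PrimeSpectrum.asIdeal h).trans hs
  have hinj : Function.Injective fun i => fiberι f s (x i) := fun i j h =>
    c.v_inj (by rw [← hx1 i, ← hx1 j, he.injective h])
  have hT1 : ∀ i, c.T i ⊆ c.v i := fun i => (show c.v i ∈ _ from by rw [c.incident i]; exact Or.inl rfl :
    c.v i ∈ {a ∈ irreducibleComponents ↑(fiberScheme f s) | c.T i ⊆ a}).2
  have hT2 : ∀ i, c.T i ⊆ c.v (nx i) := fun i => (show c.v (nx i) ∈ _ from by rw [c.incident i]; exact Or.inr rfl :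
    c.v (nx i) ∈ {a ∈ irreducibleComponents ↑(fiberScheme f s) | c.T i ⊆ a}).2
  have s1 : ∀ i, fiberι f s (x i) ⤳ fiberι f s (ξ i) := fun i => hx3 i _ (hT1 i (hξT i))
  have s2 : ∀ i, fiberι f s (x (nx i)) ⤳ fiberι f s (ξ i) := fun i => hx3 _ _ (hT2 i (hξT i))
  have lab : ∀ i b', StratumHasLabel f s (c.T i) b' → Cmp b' (b i) := by
    rintro i b' ⟨z, hz, n', l', hln', V, gX, x', gT, e1, e2, e3, e4, e5⟩
    have h1 : HasChart f (fiberι f s z) n' l' b' {i | (i : ℕ) < l'} :=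
      ⟨V, gX, x', gT, e1, e2, e3, e4, fun i => ⟨fun h => ⟨h, e5 i h⟩, fun h => h.1⟩⟩
    obtain ⟨J', h2⟩ := h1.generalize ((hξs i z hz).map he.continuous)
    obtain ⟨e, he, h3⟩ := F.cmp (hy _) (hch i) (hln i) h2 hln' (hξn i)
    exact Cmp.of_assoc (n := 1) one_pos he (by rwa [pow_one])
  obtain ⟨k, hk, hkc⟩ : ∃ k : Fin c.N, (k : ℕ) + 1 < c.N ∧ ¬ Cmp (b k) (b (nx k)) := by
    by_contra! H
    have h0 : ∀ m (hm : m < c.N), Cmp (b ⟨0, c.hN⟩) (b ⟨m, hm⟩) := by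
      intro m
      induction m with
      | zero => exact fun _ => ⟨1, 1, one_pos, one_pos, rfl⟩
      | succ m ih =>
        intro hm
        have h1 := (ih (by omega)).trans (H ⟨m, by omega⟩ hm)
        rwa [show nx (⟨m, by omega⟩ : Fin c.N) = ⟨m + 1, hm⟩ from Fin.ext (Nat.mod_eq_of_lt hm)] at h1
    exact hcmp (((lab i bi hbi).trans (h0 i i.2).symm).trans ((h0 j j.2).trans (lab j bj hbj).symm))
  have hnx : ∀ i : Fin c.N, i ≠ nx i := fun i h => by
    have h1 : (i : ℕ) = (i + 1) % c.N := congrArg Fin.val h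
    rcases lt_or_ge ((i : ℕ) + 1) c.N with h2 | h2
    · rw [Nat.mod_eq_of_lt h2] at h1; omega
    · rw [show (i : ℕ) + 1 = c.N by omega, Nat.mod_self] at h1; omega
  obtain ⟨L, hL, hLc⟩ := F'.divFun_cartier
  refine ⟨divFun _ (fun z => pullback.fst f (Spec.map ψ) z = fiberι f s (x (nx k))) L, hLc _, ?_, ?_⟩
  · intro z hz
    refine if_neg fun h => IsDiscreteValuationRing.not_a_field A (h.1.1.symm.trans ?_)
    exact congrArg PrimeSpectrum.asIdeal hz
  intro E hE hE0 ET hET hlin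
  have hD : ∀ i, divFun (pullback.snd f (Spec.map ψ)) (fun z => pullback.fst f (Spec.map ψ) z = fiberι f s (x (nx k)))
      L (w i) = if i = nx k then (L : ℤ) else 0 := by
    intro i
    unfold divFun
    congr 1
    exact propext ⟨fun h => hinj ((hpw i).symm.trans h.2), fun h => ⟨hw i, h ▸ hpw i⟩⟩
  have hconst : ∀ i j, _ := fun i j => F'.lin_const hlin (hw i) (hw j)
  simp only [hD] at hconst
  choose ρ d d' r0 d0 _ v1 v2 q1 q2 using fun i => edge_rel F F' hc U hU hψ hE hE0 hET (hξn i) (hy _) (hch i) (hln i)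
    (s1 i) (s2 i) (hx2 _) (hx2 _) (fun h => hnx i (hinj h)) (hw _) (hw _) (hpw _) (hpw _)
  have hcyc := cyc_assoc d ρ r0 k hk (fun i hi hi' => by
    have h1 := hconst i (nx i)
    have hne : nx i ≠ nx k := fun h => hi (by
      have h2 : (i + 1 : ℕ) % c.N = (k + 1) % c.N := congrArg Fin.val h
      rw [Nat.mod_eq_of_lt hk] at h2
      rcases lt_or_ge ((i : ℕ) + 1) c.N with h3 | h3
      · rw [Nat.mod_eq_of_lt h3] at h2; exact Fin.ext (by omega)
      · rw [show (i : ℕ) + 1 = c.N by omega, Nat.mod_self] at h2; omega)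
    rw [if_neg hi', if_neg hne] at h1
    exact ((q1 i (by omega)).mul_right _).trans ((v2 i).uniq F (hx2 _) (v1 (nx i))))
  obtain ⟨ρ', e1, e2, z0, -, -, y1, y2, -, y3⟩ := edge_rel F F' hc U hU hψ hE hE0 hET (hξn (nx k)) (hy _) (hch _)
    (hln _) (s2 (nx k)) (s1 (nx k)) (hx2 _) (hx2 _) (fun h => hnx _ (hinj h).symm) (hw _) (hw _) (hpw _) (hpw _)
  have c1 := hconst k (nx k)
  have c2 := hconst (nx (nx k)) (nx k)
  rw [if_pos rfl, if_neg (hnx k)] at c1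
  rw [if_pos rfl, if_neg (hnx (nx k)).symm] at c2
  obtain ⟨e, he, a1⟩ := q2 k (by omega)
  obtain ⟨e', he', a3⟩ := y3 (by omega)
  exact hkc (Cmp.of_assoc he he' (comb_assoc (d0 _) (r0 k) (r0 (nx k)) z0 a1 ((v2 k).uniq F (hx2 _) (v1 _)) a3
    ((v1 (nx k)).uniq F (hx2 _) y2) ((v1 _).uniq F (hx2 _) y1) hcyc))

theorem regular_props {R : Type u} [CommRing R] [IsLocalRing R] [Infinite (IsLocalRing.ResidueField R)]
    (h : IsRegularLocal R) : IsNoetherianRing R ∧ IsDomain R ∧ IsIntegrallyClosed R := by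
  obtain ⟨hN, hl, S, hS, hd⟩ := h
  have hx : Ideal.span (Set.range fun i : Fin S.card => (S.equivFin.symm i : R)) = IsLocalRing.maximalIdeal R := by
    rw [← hS]
    congr 1
    ext a
    constructor
    · rintro ⟨i, rfl⟩
      exact (S.equivFin.symm i).2
    · intro ha
      exact ⟨S.equivFin ⟨a, ha⟩, by simp⟩
  exact ⟨hN, isDomain_of_regular _ hx hd.symm, isIntegrallyClosed_of_regular _ hx hd.symm⟩

theorem not_aligned_gives_nonextendable_cartier_divisor
    (R : CommRingCat.{u}) (hsh : StrictlyHenselianLocal ↥R) (hreg : IsRegularLocal ↥R)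
    {X : Scheme.{u}} (f : X ⟶ Spec R) (hss : IsSemistable f)
    (U : (Spec R).Opens) (hdense : Dense (U : Set (Spec R)))
    (hsm : IsSmooth (f ∣_ U))
    (s : ↑(Spec R)) (hs : s = closedPt R hsh.toIsLocalRing)
    (hnotaligned : ¬ AlignedOver hsh.toIsLocalRing f) :
    ∀ (A : CommRingCat.{u}) [IsDomain ↥A] [IsDiscreteValuationRing ↥A] (ψ : R ⟶ A),
      (Spec.map ψ).base (closedPt A inferInstance) = s →
      (Spec.map ψ).base ⟨⊥, Ideal.bot_prime⟩ ∈ U →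
      ∃ D : ↑(pullback f (Spec.map ψ)) → ℤ,
        IsCartierDiv D ∧
        -- `D` is trivial over the generic point of `T`
        (∀ z : ↑(pullback f (Spec.map ψ)),
          (pullback.snd f (Spec.map ψ)).base z = ⟨⊥, Ideal.bot_prime⟩ → D z = 0) ∧
        -- no Cartier divisor `E` on `X`, trivial over `U`, pulls back to (a divisor
        -- linearly equivalent to) `D`
        (∀ E : X → ℤ, IsCartierDiv E → (∀ z : X, f.base z ∈ U → E z = 0) →
          ∀ ET : ↑(pullback f (Spec.map ψ)) → ℤ,
            IsDivPullback (pullback.fst f (Spec.map ψ)) E ET →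
            ¬ LinEquivDiv ET D) := by
  intro A _ _ ψ hc hψ
  subst hs
  have := hsh.henselian
  have : IsSepClosed (IsLocalRing.ResidueField R) := hsh.sepClosedResidue
  have : Infinite (IsLocalRing.ResidueField R) := infinite_of_sepClosed _
  obtain ⟨_, _, _⟩ := regular_props hreg
  obtain ⟨hp, hconn, hcd⟩ := hss
  have hfp : LocallyOfFinitePresentation f := inferInstance
  have hU : Smooth ((f ⁻¹ᵁ U).ι ≫ f) := by
    have := hsm
    rw [← morphismRestrict_ι]
    exact MorphismProperty.comp_mem (W := @Smooth) _ _ hsm inferInstance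
  have hbot : ∀ p : Spec R, p.asIdeal = ⊥ → p ∈ U := by
    intro p hpb
    obtain ⟨q, hq⟩ := hdense.nonempty
    refine Specializes.mem_open ((PrimeSpectrum.le_iff_specializes (R := R) p q).1 ?_) U.2 hq
    change p.asIdeal ≤ _
    rw [hpb]
    exact bot_le
  have F : Fam f := ⟨hp, hconn, fun z hz => chart_base f z hz (hcd z).some, f ⁻¹ᵁ U, hU, fun y hy => hbot _ hy⟩
  have hcm : (Spec.map ψ (IsLocalRing.closedPoint A)).asIdeal = IsLocalRing.maximalIdeal R :=
    congrArg PrimeSpectrum.asIdeal hc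
  have F' : Fam (pullback.snd f (Spec.map ψ)) := by
    refine ⟨inferInstance, geomConn_bc hconn _, fun z hz => ?_, _,
      smooth_bc (IsPullback.of_hasPullback f (Spec.map ψ)) (f ⁻¹ᵁ U) hU, fun y hy => ?_⟩
    · have h1 : f (pullback.fst f (Spec.map ψ) z) = Spec.map ψ (IsLocalRing.closedPoint A) := by
        rw [← Scheme.Hom.comp_apply, pullback.condition, Scheme.Hom.comp_apply]
        congr 1
        exact PrimeSpectrum.ext hz
      obtain ⟨n, l, b, J, hln, h⟩ := F.charts _ ((congrArg PrimeSpectrum.asIdeal h1).trans hcm)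
      exact ⟨n, l, ψ b, J, hln, h.bc ψ z⟩
    · have h1 : f (pullback.fst f (Spec.map ψ) y) = Spec.map ψ ⟨⊥, Ideal.isPrime_bot⟩ := by
        rw [← Scheme.Hom.comp_apply, pullback.condition, Scheme.Hom.comp_apply]
        congr 1
        exact PrimeSpectrum.ext hy
      change f (pullback.fst f (Spec.map ψ) y) ∈ U
      rw [h1]
      exact hψ
  unfold AlignedOver at hnotaligned
  push Not at hnotaligned
  obtain ⟨c, i, j, bi, bj, hbi, hbj, H⟩ := hnotaligned
  exact core F F' hcm U hU hψ _ rfl c i j bi bj hbi hbj (fun ⟨n, m, hn, hm, h⟩ => H n m hn hm h)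

end NeronSemistable
end
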